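/- Assume (H1): N₁ ≠ N₂, and (H2): either τ = 1, or, whenever N_i > N_k ({i,k} = {1,2}), all multiplicities m_{j,i} with 1 ≤ j ≤ d_i lie in [0,1]. If u_ε is a sequence of stable solutions of (E_ε) with ε → 0, then u_ε → 0 almost everywhere in Ω∖Z as ε → 0. -/

import Mathlib

open MeasureTheory Real Filter Set Metric Topology

noncomputable section

/-- The Euclidean plane `ℝ²`. -/
abbrev Pl := EuclideanSpace ℝ (Fin 2)

/-- The unit lattice `ℤ² ⊆ ℝ²`; the flat 2-torus `Ω` is its quotient, which we model by
working with doubly periodic functions on the plane. -/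
def unitLattice : Set Pl :=
  {v | ∃ a b : ℤ, v = (a : ℝ) • EuclideanSpace.single 0 (1:ℝ) +
      (b : ℝ) • EuclideanSpace.single 1 (1:ℝ)}

/-- A fundamental domain for the torus `Ω` (of total area `|Ω| = 1`). -/
def fund : Set Pl := {x | x 0 ∈ Ico (0:ℝ) 1 ∧ x 1 ∈ Ico (0:ℝ) 1}

/-- A doubly periodic function on the plane, i.e. a function on the torus `Ω`. -/
def Periodic2 (u : Pl → ℝ) : Prop := ∀ x : Pl, ∀ v ∈ unitLattice, u (x + v) = u x

/-- Partial derivative in the `i`-th coordinate direction. -/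
def pd (u : Pl → ℝ) (i : Fin 2) : Pl → ℝ :=
  fun x => lineDeriv ℝ u x (EuclideanSpace.single i (1:ℝ))

/-- The Laplacian `Δu`. -/
def lap (u : Pl → ℝ) (x : Pl) : ℝ := pd (pd u 0) 0 x + pd (pd u 1) 1 x

/-- `|∇u|²`. -/
def gradSq (u : Pl → ℝ) (x : Pl) : ℝ := (pd u 0 x) ^ 2 + (pd u 1 x) ^ 2

/-- The nonlinearity `f_τ(t) = e^t (1 − e^t) / (τ + e^t)³`. -/
def fτ (τ t : ℝ) : ℝ := exp t * (1 - exp t) / (τ + exp t) ^ 3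

/-- `f_τ'(t) = e^t (τ − 2(τ+1) e^t + e^{2t}) / (τ + e^t)⁴`. -/
def fτ' (τ t : ℝ) : ℝ := exp t * (τ - 2 * (τ + 1) * exp t + exp (2 * t)) / (τ + exp t) ^ 4

/-- The antiderivative `F_{2,τ}(t) = e^t ((1−τ) e^t + 2τ) / (2τ² (τ+e^t)²)` of `f_τ`. -/
def F2τ (τ t : ℝ) : ℝ := exp t * ((1 - τ) * exp t + 2 * τ) / (2 * τ ^ 2 * (τ + exp t) ^ 2)

/-- `u − 2a ln‖· − p‖` extends smoothly across `p`: this encodes the distributional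
equation `Δu = 4πa δ_p + (smooth)` near `p`. -/
def LogSing (u : Pl → ℝ) (p : Pl) (a : ℝ) : Prop :=
  ∃ r > 0, ∃ v : Pl → ℝ, ContDiffOn ℝ (⊤ : ℕ∞) v (ball p r) ∧
    ∀ x ∈ ball p r, x ≠ p → u x = 2 * a * Real.log ‖x - p‖ + v x

/-- The vortex data: distinct points `p_{j,1}` (`1 ≤ j ≤ d₁`), `p_{j,2}` (`1 ≤ j ≤ d₂`)
of the torus with multiplicities `m_{j,1} ≥ 0`, `m_{j,2} ≥ 0`. -/
structure VortexData where
  d₁ : ℕ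
  d₂ : ℕ
  p₁ : Fin d₁ → Pl
  p₂ : Fin d₂ → Pl
  m₁ : Fin d₁ → ℝ
  m₂ : Fin d₂ → ℝ
  m₁_nonneg : ∀ j, 0 ≤ m₁ j
  m₂_nonneg : ∀ j, 0 ≤ m₂ j
  distinct : ∀ i j : Fin d₁ ⊕ Fin d₂, i ≠ j → ∀ v ∈ unitLattice,
      Sum.elim p₁ p₂ i ≠ Sum.elim p₁ p₂ j + v

namespace VortexData
variable (V : VortexData)

/-- The set `Z₁` of vortex points `p_{j,1}` (viewed in the plane: all lattice translates). -/
def Z1 : Set Pl := {x | ∃ j v, v ∈ unitLattice ∧ x = V.p₁ j + v}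

/-- The set `Z₂` of vortex points `p_{j,2}` (viewed in the plane: all lattice translates). -/
def Z2 : Set Pl := {x | ∃ j v, v ∈ unitLattice ∧ x = V.p₂ j + v}

/-- The full vortex set `Z = Z₁ ∪ Z₂`. -/
def Z : Set Pl := V.Z1 ∪ V.Z2

/-- `N₁ = Σ_j m_{j,1}`. -/
def N1 : ℝ := ∑ j, V.m₁ j

/-- `N₂ = Σ_j m_{j,2}`. -/
def N2 : ℝ := ∑ j, V.m₂ j

end VortexData

/-- `u` is a solution of `(E_ε)`:
`Δu + ε⁻² f_τ(u) = 4π Σ_j m_{j,1} δ_{p_{j,1}} − 4π Σ_j m_{j,2} δ_{p_{j,2}}` on `Ω`,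
formulated classically: `u` is doubly periodic, smooth away from `Z`, solves the PDE
classically off `Z`, and has the prescribed logarithmic singularities at the vortices. -/
structure IsSolution (V : VortexData) (τ ε : ℝ) (u : Pl → ℝ) : Prop where
  periodic : Periodic2 u
  smooth : ContDiffOn ℝ (⊤ : ℕ∞) u (V.Z)ᶜ
  pde : ∀ x ∉ V.Z, lap u x + (ε ^ 2)⁻¹ * fτ τ (u x) = 0
  sing₁ : ∀ j, LogSing u (V.p₁ j) (V.m₁ j)
  sing₂ : ∀ j, LogSing u (V.p₂ j) (-(V.m₂ j))

/-- The quadratic form `∫_Ω |∇φ|² − ε⁻² f_τ'(u) φ²` of the linearized operator at `u`. -/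
def QuadForm (τ ε : ℝ) (u φ : Pl → ℝ) : ℝ :=
  ∫ x in fund, (gradSq φ x - (ε ^ 2)⁻¹ * fτ' τ (u x) * (φ x) ^ 2)

/-- `u` is a stable solution: the first eigenvalue `μ_ε` of the linearized operator is
nonnegative, i.e. the quadratic form is nonnegative on all (smooth, doubly periodic)
test functions. -/
def Stable (τ ε : ℝ) (u : Pl → ℝ) : Prop :=
  ∀ φ : Pl → ℝ, ContDiff ℝ (⊤ : ℕ∞) φ → Periodic2 φ → 0 ≤ QuadForm τ ε u φ

/-- `u` is strictly stable: the first eigenvalue `μ_ε` of the linearized operator is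
strictly positive. -/
def StrictlyStable (τ ε : ℝ) (u : Pl → ℝ) : Prop :=
  ∃ μ > 0, ∀ φ : Pl → ℝ, ContDiff ℝ (⊤ : ℕ∞) φ → Periodic2 φ →
    μ * (∫ x in fund, (φ x) ^ 2) ≤ QuadForm τ ε u φ

set_option linter.unusedSectionVars false

/-- The plane as a product. -/
abbrev E2 := ℝ × ℝ

def D1 (g : E2 → ℝ) (x : E2) : ℝ := fderiv ℝ g x (1, 0)
def D2 (g : E2 → ℝ) (x : E2) : ℝ := fderiv ℝ g x (0, 1)
def lapp (g : E2 → ℝ) (x : E2) : ℝ := D1 (D1 g) x + D2 (D2 g) x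
/-- squared gradient -/
def gsq (g : E2 → ℝ) (x : E2) : ℝ := D1 g x ^ 2 + D2 g x ^ 2

/-- integer translations -/
def lat (k : ℤ × ℤ) : E2 := ((k.1 : ℝ), (k.2 : ℝ))

def Per (h : E2 → ℝ) : Prop := ∀ x, ∀ k : ℤ × ℤ, h (x + lat k) = h x

def cell (c : E2) : Set E2 := Ioc c.1 (c.1 + 1) ×ˢ Ioc c.2 (c.2 + 1)

def QQ : Set E2 := cell 0

def Lsub : AddSubgroup E2 := (AddSubgroup.zmultiples (1:ℝ)).prod (AddSubgroup.zmultiples (1:ℝ))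

lemma mem_Lsub {v : E2} : v ∈ Lsub ↔ ∃ k : ℤ × ℤ, v = lat k := by
  constructor
  · rintro ⟨⟨a, ha⟩, ⟨b, hb⟩⟩
    refine ⟨(a, b), ?_⟩
    ext
    · simpa [lat] using ha.symm
    · simpa [lat] using hb.symm
  · rintro ⟨k, rfl⟩
    exact ⟨⟨k.1, by simp [lat]⟩, ⟨k.2, by simp [lat]⟩⟩

instance : Countable Lsub := by
  have : Function.Surjective (fun k : ℤ × ℤ => (⟨lat k, mem_Lsub.2 ⟨k, rfl⟩⟩ : Lsub)) := by
    rintro ⟨v, hv⟩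
    obtain ⟨k, rfl⟩ := mem_Lsub.1 hv
    exact ⟨k, rfl⟩
  exact this.countable

lemma cell_meas (c : E2) : MeasurableSet (cell c) := measurableSet_Ioc.prod measurableSet_Ioc

lemma cell_fund (c : E2) : IsAddFundamentalDomain Lsub (cell c) volume := by
  refine IsAddFundamentalDomain.mk' (cell_meas c).nullMeasurableSet ?_
  intro x
  obtain ⟨a, ha, ha'⟩ := existsUnique_add_zsmul_mem_Ioc (zero_lt_one' ℝ) x.1 c.1
  obtain ⟨b, hb, hb'⟩ := existsUnique_add_zsmul_mem_Ioc (zero_lt_one' ℝ) x.2 c.2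
  refine ⟨⟨lat (a, b), mem_Lsub.2 ⟨_, rfl⟩⟩, ?_, ?_⟩
  · change (lat (a,b)) + x ∈ cell c
    constructor
    · simpa [lat, add_comm] using ha
    · simpa [lat, add_comm] using hb
  · rintro ⟨v, hv⟩ h
    obtain ⟨k, rfl⟩ := mem_Lsub.1 hv
    have h' : lat k + x ∈ cell c := h
    have h1 := ha' k.1 (by simpa [lat, add_comm] using h'.1)
    have h2 := hb' k.2 (by simpa [lat, add_comm] using h'.2)
    ext <;> simp [lat, h1, h2]

lemma per_vadd {h : E2 → ℝ} (hp : Per h) (g : Lsub) (x : E2) : h (g +ᵥ x) = h x := by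
  obtain ⟨v, hv⟩ := g
  obtain ⟨k, rfl⟩ := mem_Lsub.1 hv
  have := hp x k
  change h (lat k + x) = h x
  rw [add_comm]; exact this

/-- the integral of a periodic function over any cell -/
lemma cell_integral {h : E2 → ℝ} (hp : Per h) (c : E2) :
    ∫ x in cell c, h x = ∫ x in QQ, h x :=
  (cell_fund c).setIntegral_eq (cell_fund 0) (fun g x => per_vadd hp g x)

lemma cell_integrable {h : E2 → ℝ} (hp : Per h) (c : E2) :
    IntegrableOn h (cell c) ↔ IntegrableOn h QQ :=
  (cell_fund c).integrableOn_iff (cell_fund 0) (fun g x => per_vadd hp g x)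

lemma cell_sub_Icc (c : E2) : cell c ⊆ Icc c (c + (1,1)) := by
  rintro x ⟨h1, h2⟩
  exact ⟨⟨h1.1.le, h2.1.le⟩, ⟨h1.2, h2.2⟩⟩

lemma cell_ae (c : E2) : (cell c) =ᵐ[volume] Icc c (c + (1,1)) := by
  have : Icc c (c + (1,1)) = Icc c.1 (c.1+1) ×ˢ Icc c.2 (c.2+1) := by
    rw [← Icc_prod_Icc]
    rfl
  rw [this, cell]
  exact Measure.set_prod_ae_eq Ioc_ae_eq_Icc Ioc_ae_eq_Icc

lemma cell_vol (c : E2) : volume (cell c) = 1 := by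
  rw [cell, Measure.volume_eq_prod, Measure.prod_prod]
  simp

lemma D1_add_lat {h : E2 → ℝ} (hp : Per h) : Per (D1 h) := by
  intro x k
  have : h = fun y => h (y + lat k) := by ext y; exact (hp y k).symm
  unfold D1
  conv_rhs => rw [this]
  rw [fderiv_comp_add_right]

lemma D2_add_lat {h : E2 → ℝ} (hp : Per h) : Per (D2 h) := by
  intro x k
  have : h = fun y => h (y + lat k) := by ext y; exact (hp y k).symm
  unfold D2
  conv_rhs => rw [this]
  rw [fderiv_comp_add_right]

/-- divergence theorem on rectangles -/
lemma rect_div {X Y : E2 → ℝ} {O : Set E2} (hO : IsOpen O) (hX : ContDiffOn ℝ 1 X O)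
    (hY : ContDiffOn ℝ 1 Y O) {a b : E2} (hab : a ≤ b) (hsub : Icc a b ⊆ O) :
    ∫ x in Icc a b, (D1 X x + D2 Y x) =
      (((∫ x in a.1..b.1, Y (x, b.2)) - ∫ x in a.1..b.1, Y (x, a.2)) +
          ∫ y in a.2..b.2, X (b.1, y)) - ∫ y in a.2..b.2, X (a.1, y) := by
  have hio : Ioo a.1 b.1 ×ˢ Ioo a.2 b.2 ⊆ O := by
    rintro x ⟨h1, h2⟩
    exact hsub ⟨⟨h1.1.le, h2.1.le⟩, ⟨h1.2.le, h2.2.le⟩⟩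
  refine integral_divergence_prod_Icc_of_hasFDerivAt_of_le X Y (fderiv ℝ X) (fderiv ℝ Y) a b hab
    (hX.continuousOn.mono hsub) (hY.continuousOn.mono hsub) ?_ ?_ ?_
  · intro x hx
    exact ((hX.differentiableOn (by simp)).differentiableAt (hO.mem_nhds (hio hx))).hasFDerivAt
  · intro x hx
    exact ((hY.differentiableOn (by simp)).differentiableAt (hO.mem_nhds (hio hx))).hasFDerivAt
  · apply ContinuousOn.integrableOn_compact isCompact_Icc
    have h1 := (hX.continuousOn_fderiv_of_isOpen hO (by simp)).mono hsub
    have h2 := (hY.continuousOn_fderiv_of_isOpen hO (by simp)).mono hsub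
    exact (h1.clm_apply continuousOn_const).add (h2.clm_apply continuousOn_const)

lemma torus_div {X Y : E2 → ℝ} (hX : ContDiff ℝ 1 X) (hY : ContDiff ℝ 1 Y)
    (pX : Per X) (pY : Per Y) : ∫ x in QQ, (D1 X x + D2 Y x) = 0 := by
  have h0 : ∫ x in QQ, (D1 X x + D2 Y x) = ∫ x in Icc (0:E2) (0 + (1,1)), (D1 X x + D2 Y x) :=
    setIntegral_congr_set (cell_ae 0)
  rw [h0, rect_div isOpen_univ hX.contDiffOn hY.contDiffOn
    (by constructor <;> simp) (subset_univ _)]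
  have e1 : ∀ x : ℝ, Y (x, (0 + ((1:ℝ),(1:ℝ))).2) = Y (x, (0:E2).2) := by
    intro x
    have := pY (x, 0) (0, 1)
    simpa [lat] using this
  have e2 : ∀ y : ℝ, X ((0 + ((1:ℝ),(1:ℝ))).1, y) = X ((0:E2).1, y) := by
    intro y
    have := pX (0, y) (1, 0)
    simpa [lat] using this
  simp only [e1, e2]
  ring

/-- cylinder coordinates -/
def Cyl (p z : E2) : E2 := (p.1 + exp z.1 * cos z.2, p.2 + exp z.1 * sin z.2)

/-- squared Euclidean length -/
def nsq (x : E2) : ℝ := x.1 ^ 2 + x.2 ^ 2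

lemma nsq_cyl (p z : E2) : nsq (Cyl p z - p) = exp (2 * z.1) := by
  simp only [nsq, Cyl, Prod.fst_sub, Prod.snd_sub]
  have := Real.sin_sq_add_cos_sq z.2
  have h2 : exp (2 * z.1) = exp z.1 ^ 2 := by rw [← Real.exp_nat_mul]; norm_num
  rw [h2]
  linear_combination (exp z.1)^2 * this

lemma Cyl_contDiff (p : E2) {n : WithTop ℕ∞} : ContDiff ℝ n (Cyl p) := by
  unfold Cyl
  fun_prop

def CylD (z : E2) : E2 →L[ℝ] E2 :=
  ((exp z.1 * cos z.2) • ContinuousLinearMap.fst ℝ ℝ ℝ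
      + (-(exp z.1 * sin z.2)) • ContinuousLinearMap.snd ℝ ℝ ℝ).prod
    ((exp z.1 * sin z.2) • ContinuousLinearMap.fst ℝ ℝ ℝ
      + (exp z.1 * cos z.2) • ContinuousLinearMap.snd ℝ ℝ ℝ)

lemma Cyl_hasFDerivAt (p z : E2) : HasFDerivAt (Cyl p) (CylD z) z := by
  unfold Cyl CylD
  have h1 : HasFDerivAt (fun z : E2 => exp z.1) (exp z.1 • ContinuousLinearMap.fst ℝ ℝ ℝ) z :=
    (hasFDerivAt_fst (p := z)).exp
  have h2 : HasFDerivAt (fun z : E2 => cos z.2) (-sin z.2 • ContinuousLinearMap.snd ℝ ℝ ℝ) z :=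
    (hasFDerivAt_snd (p := z)).cos
  have h3 : HasFDerivAt (fun z : E2 => sin z.2) (cos z.2 • ContinuousLinearMap.snd ℝ ℝ ℝ) z :=
    (hasFDerivAt_snd (p := z)).sin
  refine HasFDerivAt.prodMk ?_ ?_
  · refine ((h1.mul h2).const_add p.1).congr_fderiv ?_
    ext <;> simp <;> ring
  · refine ((h1.mul h3).const_add p.2).congr_fderiv ?_
    ext <;> simp <;> ring

lemma CylD_det (z : E2) : (CylD z).det = exp (2 * z.1) := by
  have h2 : exp (2 * z.1) = exp z.1 ^ 2 := by rw [← Real.exp_nat_mul]; norm_num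
  have : CylD z = (Matrix.toLin (.finTwoProd ℝ) (.finTwoProd ℝ)
    !![exp z.1 * cos z.2, -(exp z.1 * sin z.2); exp z.1 * sin z.2, exp z.1 * cos z.2]).toContinuousLinearMap := by
    rw [Matrix.toLin_finTwoProd_toContinuousLinearMap]
    rfl
  rw [this]
  simp only [LinearMap.det_toContinuousLinearMap, LinearMap.det_toLin,
    Matrix.det_fin_two_of, sub_neg_eq_add]
  have := Real.sin_sq_add_cos_sq z.2
  rw [h2]
  linear_combination (exp z.1)^2 * this

def strip : Set E2 := univ ×ˢ Ioo (-π) π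

lemma strip_meas : MeasurableSet strip := MeasurableSet.univ.prod measurableSet_Ioo

lemma Cyl_inj (p : E2) : InjOn (Cyl p) strip := by
  intro z hz w hw h
  have e1 : exp (2 * z.1) = exp (2 * w.1) := by rw [← nsq_cyl p z, ← nsq_cyl p w, h]
  have e2 : z.1 = w.1 := by have := exp_injective e1; linarith
  have hp : polarCoord.symm (exp z.1, z.2) = polarCoord.symm (exp w.1, w.2) := by
    have h1 := congrArg Prod.fst h
    have h2 := congrArg Prod.snd h
    simp only [Cyl, add_right_inj] at h1 h2
    simp only [polarCoord_symm_apply]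
    rw [h1, h2]
  have hz' : ((exp z.1, z.2) : E2) ∈ polarCoord.target := ⟨exp_pos _, hz.2⟩
  have hw' : ((exp w.1, w.2) : E2) ∈ polarCoord.target := ⟨exp_pos _, hw.2⟩
  have := polarCoord.symm.injOn hz' hw' hp
  have h3 := congrArg Prod.snd this
  exact Prod.ext e2 h3

lemma Cyl_image_ae (p : E2) : (Cyl p '' strip : Set E2) =ᵐ[volume] univ := by
  rw [ae_eq_univ]
  have h1 : ((Cyl p '' strip)ᶜ : Set E2) ⊆ (fun x => x + (-p)) ⁻¹' (polarCoord.source)ᶜ := by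
    intro x hx hs
    apply hx
    have h2 := polarCoord.map_source hs
    refine ⟨(Real.log (polarCoord (x + -p)).1, (polarCoord (x + -p)).2), ⟨mem_univ _, h2.2⟩, ?_⟩
    have h3 := polarCoord.left_inv hs
    have h4 : 0 < (polarCoord (x + -p)).1 := h2.1
    rw [polarCoord_symm_apply] at h3
    have h5 := congrArg Prod.fst h3
    have h6 := congrArg Prod.snd h3
    simp only [Prod.fst_add, Prod.snd_add, Prod.fst_neg, Prod.snd_neg] at h5 h6
    simp only [Cyl]
    rw [Real.exp_log h4]
    ext
    · change p.1 + _ = x.1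
      linarith
    · change p.2 + _ = x.2
      linarith
  refine measure_mono_null h1 ?_
  rw [measure_preimage_add_right]
  exact ae_eq_univ.1 polarCoord_source_ae_eq_univ

lemma cyl_integral (p : E2) (g : E2 → ℝ) :
    ∫ x, g x = ∫ z in strip, exp (2 * z.1) * g (Cyl p z) := by
  rw [← setIntegral_univ, ← setIntegral_congr_set (Cyl_image_ae p),
    integral_image_eq_integral_abs_det_fderiv_smul volume strip_meas
      (fun z _ => (Cyl_hasFDerivAt p z).hasFDerivWithinAt) (Cyl_inj p)]
  simp only [CylD_det, abs_of_pos (exp_pos _), smul_eq_mul]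

lemma cyl_integrable (p : E2) (g : E2 → ℝ) :
    Integrable g ↔ IntegrableOn (fun z => exp (2 * z.1) * g (Cyl p z)) strip := by
  rw [← integrableOn_univ, ← integrableOn_congr_set_ae (Cyl_image_ae p),
    integrableOn_image_iff_integrableOn_abs_det_fderiv_smul volume strip_meas
      (fun z _ => (Cyl_hasFDerivAt p z).hasFDerivWithinAt) (Cyl_inj p)]
  simp only [CylD_det, abs_of_pos (exp_pos _), smul_eq_mul]

lemma D1_comp_cyl {g : E2 → ℝ} {p z : E2} (hg : DifferentiableAt ℝ g (Cyl p z)) :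
    D1 (g ∘ Cyl p) z = exp z.1 * cos z.2 * D1 g (Cyl p z) + exp z.1 * sin z.2 * D2 g (Cyl p z) := by
  unfold D1 D2
  rw [(hg.hasFDerivAt.comp z (Cyl_hasFDerivAt p z)).fderiv]
  have : CylD z (1, 0) = (exp z.1 * cos z.2) • ((1:ℝ), (0:ℝ)) + (exp z.1 * sin z.2) • ((0:ℝ), (1:ℝ)) := by
    simp [CylD]
  rw [ContinuousLinearMap.comp_apply, this, map_add, map_smul, map_smul]
  simp

lemma D2_comp_cyl {g : E2 → ℝ} {p z : E2} (hg : DifferentiableAt ℝ g (Cyl p z)) :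
    D2 (g ∘ Cyl p) z = -(exp z.1 * sin z.2) * D1 g (Cyl p z) + exp z.1 * cos z.2 * D2 g (Cyl p z) := by
  unfold D1 D2
  rw [(hg.hasFDerivAt.comp z (Cyl_hasFDerivAt p z)).fderiv]
  have : CylD z (0, 1) = (-(exp z.1 * sin z.2)) • ((1:ℝ), (0:ℝ)) + (exp z.1 * cos z.2) • ((0:ℝ), (1:ℝ)) := by
    simp [CylD]
  rw [ContinuousLinearMap.comp_apply, this, map_add, map_smul, map_smul]
  simp

lemma gsq_comp_cyl {g : E2 → ℝ} {p z : E2} (hg : DifferentiableAt ℝ g (Cyl p z)) :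
    gsq (g ∘ Cyl p) z = exp (2 * z.1) * gsq g (Cyl p z) := by
  have h2 : exp (2 * z.1) = exp z.1 ^ 2 := by rw [← Real.exp_nat_mul]; norm_num
  unfold gsq
  rw [D1_comp_cyl hg, D2_comp_cyl hg, h2]
  have := Real.sin_sq_add_cos_sq z.2
  linear_combination (exp z.1)^2 * (D1 g (Cyl p z) ^ 2 + D2 g (Cyl p z) ^ 2) * this

section
/-- smoothness near a point -/
def SmAt (g : E2 → ℝ) (x : E2) : Prop := ∀ᶠ y in 𝓝 x, ContDiffAt ℝ (⊤ : ℕ∞) g y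

lemma SmAt.cd {g : E2 → ℝ} {x : E2} (h : SmAt g x) : ContDiffAt ℝ (⊤ : ℕ∞) g x :=
  h.self_of_nhds

lemma SmAt.diff {g : E2 → ℝ} {x : E2} (h : SmAt g x) : DifferentiableAt ℝ g x :=
  h.cd.differentiableAt (by simp)

lemma SmAt.cont {g : E2 → ℝ} {x : E2} (h : SmAt g x) : ContinuousAt g x :=
  h.cd.continuousAt

lemma SmAt.ev {g : E2 → ℝ} {x : E2} (h : SmAt g x) : ∀ᶠ y in 𝓝 x, SmAt g y :=
  Filter.Eventually.eventually_nhds h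

lemma SmAt.of_contDiff {g : E2 → ℝ} {x : E2} (h : ContDiff ℝ (⊤ : ℕ∞) g) : SmAt g x :=
  Eventually.of_forall fun _ => h.contDiffAt

lemma SmAt.of_on {g : E2 → ℝ} {x : E2} {O : Set E2} (h : ContDiffOn ℝ (⊤ : ℕ∞) g O)
    (hO : IsOpen O) (hx : x ∈ O) : SmAt g x := by
  filter_upwards [hO.mem_nhds hx] with y hy using h.contDiffAt (hO.mem_nhds hy)

lemma SmAt.congr {g h : E2 → ℝ} {x : E2} (hg : SmAt g x) (e : h =ᶠ[𝓝 x] g) : SmAt h x := by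
  filter_upwards [hg, e.eventuallyEq_nhds] with y h1 h2 using h1.congr_of_eventuallyEq h2

lemma SmAt.fd {g : E2 → ℝ} {x : E2} (h : ContDiffAt ℝ (⊤ : ℕ∞) g x) :
    ContDiffAt ℝ (⊤ : ℕ∞) (fderiv ℝ g) x :=
  h.fderiv_right (by exact le_rfl)

lemma SmAt.D1 {g : E2 → ℝ} {x : E2} (h : SmAt g x) : SmAt (D1 g) x := by
  filter_upwards [h] with y hy using (SmAt.fd hy).clm_apply contDiffAt_const

lemma SmAt.D2 {g : E2 → ℝ} {x : E2} (h : SmAt g x) : SmAt (D2 g) x := by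
  filter_upwards [h] with y hy using (SmAt.fd hy).clm_apply contDiffAt_const

lemma SmAt.add {g h : E2 → ℝ} {x : E2} (hg : SmAt g x) (hh : SmAt h x) :
    SmAt (fun y => g y + h y) x := by
  filter_upwards [hg, hh] with y h1 h2 using h1.add h2

lemma SmAt.sub {g h : E2 → ℝ} {x : E2} (hg : SmAt g x) (hh : SmAt h x) :
    SmAt (fun y => g y - h y) x := by
  filter_upwards [hg, hh] with y h1 h2 using h1.sub h2

lemma SmAt.mul {g h : E2 → ℝ} {x : E2} (hg : SmAt g x) (hh : SmAt h x) :
    SmAt (fun y => g y * h y) x := by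
  filter_upwards [hg, hh] with y h1 h2 using h1.mul h2

lemma SmAt.neg {g : E2 → ℝ} {x : E2} (hg : SmAt g x) : SmAt (fun y => - g y) x := by
  filter_upwards [hg] with y h1 using h1.neg

lemma SmAt.pow {g : E2 → ℝ} {x : E2} (hg : SmAt g x) (n : ℕ) : SmAt (fun y => g y ^ n) x := by
  filter_upwards [hg] with y h1 using h1.pow n

lemma SmAt.const {x : E2} (c : ℝ) : SmAt (fun _ => c) x :=
  Eventually.of_forall fun _ => contDiffAt_const

lemma SmAt.comp {G : ℝ → ℝ} {g : E2 → ℝ} {x : E2} (hG : ContDiff ℝ (⊤ : ℕ∞) G) (hg : SmAt g x) :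
    SmAt (fun y => G (g y)) x := by
  filter_upwards [hg] with y h1 using hG.contDiffAt.comp y h1

lemma SmAt.fst {G : ℝ → ℝ} {x : E2} (hG : ContDiff ℝ (⊤ : ℕ∞) G) :
    SmAt (fun y => G y.1) x :=
  SmAt.of_contDiff (hG.comp contDiff_fst)

lemma SmAt.lapp {g : E2 → ℝ} {x : E2} (h : SmAt g x) : SmAt (lapp g) x :=
  h.D1.D1.add h.D2.D2

lemma D1_congr {g h : E2 → ℝ} {x : E2} (e : g =ᶠ[𝓝 x] h) : D1 g x = D1 h x := by
  unfold D1; rw [e.fderiv_eq]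

lemma D2_congr {g h : E2 → ℝ} {x : E2} (e : g =ᶠ[𝓝 x] h) : D2 g x = D2 h x := by
  unfold D2; rw [e.fderiv_eq]

lemma D1_congr' {g h : E2 → ℝ} {x : E2} (e : g =ᶠ[𝓝 x] h) : D1 g =ᶠ[𝓝 x] D1 h := by
  filter_upwards [e.eventuallyEq_nhds] with y hy using D1_congr hy

lemma D2_congr' {g h : E2 → ℝ} {x : E2} (e : g =ᶠ[𝓝 x] h) : D2 g =ᶠ[𝓝 x] D2 h := by
  filter_upwards [e.eventuallyEq_nhds] with y hy using D2_congr hy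

lemma lapp_congr {g h : E2 → ℝ} {x : E2} (e : g =ᶠ[𝓝 x] h) : lapp g x = lapp h x := by
  unfold lapp; rw [D1_congr (D1_congr' e), D2_congr (D2_congr' e)]

lemma gsq_congr {g h : E2 → ℝ} {x : E2} (e : g =ᶠ[𝓝 x] h) : gsq g x = gsq h x := by
  unfold gsq; rw [D1_congr e, D2_congr e]

variable {g h : E2 → ℝ} {x : E2}

lemma D1_add (hg : DifferentiableAt ℝ g x) (hh : DifferentiableAt ℝ h x) :
    D1 (fun y => g y + h y) x = D1 g x + D1 h x := by
  unfold D1; rw [fderiv_fun_add hg hh]; rfl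
lemma D2_add (hg : DifferentiableAt ℝ g x) (hh : DifferentiableAt ℝ h x) :
    D2 (fun y => g y + h y) x = D2 g x + D2 h x := by
  unfold D2; rw [fderiv_fun_add hg hh]; rfl
lemma D1_sub (hg : DifferentiableAt ℝ g x) (hh : DifferentiableAt ℝ h x) :
    D1 (fun y => g y - h y) x = D1 g x - D1 h x := by
  unfold D1; rw [fderiv_fun_sub hg hh]; rfl
lemma D1_mul (hg : DifferentiableAt ℝ g x) (hh : DifferentiableAt ℝ h x) :
    D1 (fun y => g y * h y) x = D1 g x * h x + g x * D1 h x := by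
  unfold D1; rw [fderiv_fun_mul hg hh]; simp; ring
lemma D2_mul (hg : DifferentiableAt ℝ g x) (hh : DifferentiableAt ℝ h x) :
    D2 (fun y => g y * h y) x = D2 g x * h x + g x * D2 h x := by
  unfold D2; rw [fderiv_fun_mul hg hh]; simp; ring
lemma D1_const (c : ℝ) : D1 (fun _ => c) x = 0 := by
  unfold D1; simp
lemma D2_const (c : ℝ) : D2 (fun _ => c) x = 0 := by
  unfold D2; simp
lemma D1_cmul (c : ℝ) (hg : DifferentiableAt ℝ g x) :
    D1 (fun y => c * g y) x = c * D1 g x := by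
  unfold D1; rw [fderiv_const_mul hg]; rfl
lemma D2_cmul (c : ℝ) (hg : DifferentiableAt ℝ g x) :
    D2 (fun y => c * g y) x = c * D2 g x := by
  unfold D2; rw [fderiv_const_mul hg]; rfl
lemma D1_neg : D1 (fun y => - g y) x = - D1 g x := by
  unfold D1; rw [fderiv_fun_neg]; rfl
lemma D2_neg : D2 (fun y => - g y) x = - D2 g x := by
  unfold D2; rw [fderiv_fun_neg]; rfl
lemma D1_comp {G : ℝ → ℝ} {G' : ℝ} (hG : HasDerivAt G G' (g x)) (hg : DifferentiableAt ℝ g x) :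
    D1 (fun y => G (g y)) x = G' * D1 g x := by
  have h : HasFDerivAt (fun y => G (g y)) (G' • fderiv ℝ g x) x :=
    hG.comp_hasFDerivAt x hg.hasFDerivAt
  unfold D1; rw [h.fderiv]; rfl
lemma D2_comp {G : ℝ → ℝ} {G' : ℝ} (hG : HasDerivAt G G' (g x)) (hg : DifferentiableAt ℝ g x) :
    D2 (fun y => G (g y)) x = G' * D2 g x := by
  have h : HasFDerivAt (fun y => G (g y)) (G' • fderiv ℝ g x) x :=
    hG.comp_hasFDerivAt x hg.hasFDerivAt
  unfold D2; rw [h.fderiv]; rfl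

lemma D1_fst {G : ℝ → ℝ} {G' : ℝ} (hG : HasDerivAt G G' x.1) :
    D1 (fun y : E2 => G y.1) x = G' := by
  have h : HasFDerivAt (fun y : E2 => G y.1) (G' • ContinuousLinearMap.fst ℝ ℝ ℝ) x :=
    hG.comp_hasFDerivAt x hasFDerivAt_fst
  unfold D1; rw [h.fderiv]; simp
lemma D2_fst {G : ℝ → ℝ} {G' : ℝ} (hG : HasDerivAt G G' x.1) :
    D2 (fun y : E2 => G y.1) x = 0 := by
  have h : HasFDerivAt (fun y : E2 => G y.1) (G' • ContinuousLinearMap.fst ℝ ℝ ℝ) x :=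
    hG.comp_hasFDerivAt x hasFDerivAt_fst
  unfold D2; rw [h.fderiv]; simp
lemma D1_snd {G : ℝ → ℝ} {G' : ℝ} (hG : HasDerivAt G G' x.2) :
    D1 (fun y : E2 => G y.2) x = 0 := by
  have h : HasFDerivAt (fun y : E2 => G y.2) (G' • ContinuousLinearMap.snd ℝ ℝ ℝ) x :=
    hG.comp_hasFDerivAt x hasFDerivAt_snd
  unfold D1; rw [h.fderiv]; simp
lemma D2_snd {G : ℝ → ℝ} {G' : ℝ} (hG : HasDerivAt G G' x.2) :
    D2 (fun y : E2 => G y.2) x = G' := by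
  have h : HasFDerivAt (fun y : E2 => G y.2) (G' • ContinuousLinearMap.snd ℝ ℝ ℝ) x :=
    hG.comp_hasFDerivAt x hasFDerivAt_snd
  unfold D2; rw [h.fderiv]; simp

lemma D1D2_comm (hg : SmAt g x) : D1 (D2 g) x = D2 (D1 g) x := by
  have hs : IsSymmSndFDerivAt ℝ g x := hg.cd.isSymmSndFDerivAt (by simp; exact WithTop.coe_le_coe.2 le_top)
  have hd : DifferentiableAt ℝ (fderiv ℝ g) x := (SmAt.fd hg.cd).differentiableAt (by simp)
  have e1 : D1 (D2 g) x = fderiv ℝ (fderiv ℝ g) x (1,0) (0,1) := by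
    unfold D1 D2
    rw [fderiv_clm_apply hd (by fun_prop)]; simp
  have e2 : D2 (D1 g) x = fderiv ℝ (fderiv ℝ g) x (0,1) (1,0) := by
    unfold D1 D2
    rw [fderiv_clm_apply hd (by fun_prop)]; simp
  rw [e1, e2]; exact hs _ _

lemma D1_lapp (hg : SmAt g x) : lapp (D1 g) x = D1 (lapp g) x := by
  have e : D1 (lapp g) x = D1 (D1 (D1 g)) x + D1 (D2 (D2 g)) x :=
    D1_add hg.D1.D1.diff hg.D2.D2.diff
  have e3 : D2 (D1 g) =ᶠ[𝓝 x] D1 (D2 g) := by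
    filter_upwards [hg.ev] with y hy using (D1D2_comm hy).symm
  rw [e, lapp, D1D2_comm hg.D2, D2_congr e3]

lemma lapp_comp {G G' : ℝ → ℝ} {G'' : ℝ} (hg : SmAt g x) (hG : ∀ t, HasDerivAt G (G' t) t)
    (hG' : HasDerivAt G' G'' (g x)) :
    lapp (fun y => G (g y)) x = G' (g x) * lapp g x + G'' * gsq g x := by
  have e1 : D1 (fun y => G (g y)) =ᶠ[𝓝 x] fun y => G' (g y) * D1 g y := by
    filter_upwards [hg.ev] with y hy using D1_comp (hG _) hy.diff
  have e2 : D2 (fun y => G (g y)) =ᶠ[𝓝 x] fun y => G' (g y) * D2 g y := by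
    filter_upwards [hg.ev] with y hy using D2_comp (hG _) hy.diff
  have hd : DifferentiableAt ℝ (fun y => G' (g y)) x :=
    (hG'.comp_hasFDerivAt x hg.diff.hasFDerivAt).differentiableAt
  rw [lapp, D1_congr e1, D2_congr e2, D1_mul hd hg.D1.diff, D2_mul hd hg.D2.diff,
    D1_comp hG' hg.diff, D2_comp hG' hg.diff, lapp, gsq]
  ring

lemma SmAt.cyl {g : E2 → ℝ} {p z : E2} (h : SmAt g (Cyl p z)) : SmAt (g ∘ Cyl p) z := by
  filter_upwards [(Cyl_contDiff p (n := 1)).continuous.continuousAt.eventually h] with w hw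
  exact ContDiffAt.comp w hw (Cyl_contDiff p).contDiffAt

lemma lapp_comp_cyl {g : E2 → ℝ} {p z : E2} (hg : SmAt g (Cyl p z)) :
    lapp (g ∘ Cyl p) z = exp (2 * z.1) * lapp g (Cyl p z) := by
  have hev : ∀ᶠ w in 𝓝 z, SmAt g (Cyl p w) :=
    (Cyl_contDiff p (n := 1)).continuous.continuousAt.eventually hg.ev
  have h2 : exp (2 * z.1) = exp z.1 ^ 2 := by rw [← Real.exp_nat_mul]; norm_num
  set c : E2 → ℝ := fun w => exp w.1 * cos w.2 with hc
  set s : E2 → ℝ := fun w => exp w.1 * sin w.2 with hs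
  have de1 : DifferentiableAt ℝ (fun w : E2 => exp w.1) z := by fun_prop
  have de2 : DifferentiableAt ℝ (fun w : E2 => cos w.2) z := by fun_prop
  have de3 : DifferentiableAt ℝ (fun w : E2 => sin w.2) z := by fun_prop
  have c1 : D1 c z = c z := by
    rw [hc, D1_mul de1 de2, D1_fst (Real.hasDerivAt_exp _), D1_snd (Real.hasDerivAt_cos _)]; ring
  have c2 : D2 c z = - s z := by
    rw [hc, D2_mul de1 de2, D2_fst (Real.hasDerivAt_exp _), D2_snd (Real.hasDerivAt_cos _)]
    simp [hs]
  have s1 : D1 s z = s z := by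
    rw [hs, D1_mul de1 de3, D1_fst (Real.hasDerivAt_exp _), D1_snd (Real.hasDerivAt_sin _)]; ring
  have s2 : D2 s z = c z := by
    rw [hs, D2_mul de1 de3, D2_fst (Real.hasDerivAt_exp _), D2_snd (Real.hasDerivAt_sin _)]
    simp [hc]
  have dc : DifferentiableAt ℝ c z := de1.mul de2
  have ds : DifferentiableAt ℝ s z := de1.mul de3
  have e1 : D1 (g ∘ Cyl p) =ᶠ[𝓝 z]
      fun w => c w * (D1 g ∘ Cyl p) w + s w * (D2 g ∘ Cyl p) w := by
    filter_upwards [hev] with w hw using D1_comp_cyl hw.diff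
  have e2 : D2 (g ∘ Cyl p) =ᶠ[𝓝 z]
      fun w => (- s w) * (D1 g ∘ Cyl p) w + c w * (D2 g ∘ Cyl p) w := by
    filter_upwards [hev] with w hw using D2_comp_cyl hw.diff
  have k1 : DifferentiableAt ℝ (D1 g ∘ Cyl p) z := hg.D1.cyl.diff
  have k2 : DifferentiableAt ℝ (D2 g ∘ Cyl p) z := hg.D2.cyl.diff
  rw [lapp, D1_congr e1, D2_congr e2, D1_add (dc.fun_mul k1) (ds.fun_mul k2),
    D2_add (ds.fun_neg.fun_mul k1) (dc.fun_mul k2), D1_mul dc k1, D1_mul ds k2, D2_mul ds.fun_neg k1,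
    D2_mul dc k2, D2_neg, c1, c2, s1, s2, D1_comp_cyl hg.D1.diff, D1_comp_cyl hg.D2.diff,
    D2_comp_cyl hg.D1.diff, D2_comp_cyl hg.D2.diff, h2, lapp]
  simp only [hc, hs, Function.comp]
  have := Real.sin_sq_add_cos_sq z.2
  linear_combination (exp z.1)^2 * (D1 (D1 g) (Cyl p z) + D2 (D2 g) (Cyl p z)) * this

/-- nearest integers -/
def rnd (p x : E2) : ℤ × ℤ := (-round (x.1 - p.1), -round (x.2 - p.2))

/-- periodization of a function supported near `p` -/
def pz (p : E2) (g : E2 → ℝ) (x : E2) : ℝ := g (x + lat (rnd p x))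

lemma pz_per (p : E2) (g : E2 → ℝ) : Per (pz p g) := by
  intro x k
  unfold pz rnd lat
  congr 1
  have h1 : round (x.1 + k.1 - p.1) = round (x.1 - p.1) + k.1 := by
    rw [← round_add_intCast]; congr 1; ring
  have h2 : round (x.2 + k.2 - p.2) = round (x.2 - p.2) + k.2 := by
    rw [← round_add_intCast]; congr 1; ring
  ext
  · simp [h1]
  · simp [h2]

lemma round_eq_of_abs_lt {t : ℝ} {n : ℤ} (h : |t - n| < 1 / 2) : round t = n := by
  rw [round_eq, Int.floor_eq_iff]
  rw [abs_lt] at h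
  constructor <;> linarith [h.1, h.2]

lemma pz_eq {p : E2} {g : E2 → ℝ} {x : E2} (h1 : |x.1 - p.1| < 1/2) (h2 : |x.2 - p.2| < 1/2) :
    pz p g x = g x := by
  unfold pz rnd lat
  rw [round_eq_of_abs_lt (n := 0) (by simpa using h1),
    round_eq_of_abs_lt (n := 0) (by simpa using h2)]
  congr 1
  ext <;> simp

lemma pz_eq_lat {p : E2} {g : E2 → ℝ} {x : E2} (k : ℤ × ℤ) (h1 : |(x + lat k).1 - p.1| < 1/2)
    (h2 : |(x + lat k).2 - p.2| < 1/2) :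
    pz p g x = g (x + lat k) := by
  rw [← pz_per p g x k, pz_eq h1 h2]

/-- local description of the periodization: near every point it is either zero or a translate -/
lemma pz_local {p : E2} {g : E2 → ℝ} {r : ℝ} (hr : r < 1/2)
    (hg : ∀ x, r < max |x.1 - p.1| |x.2 - p.2| → g x = 0) (x : E2) :
    (pz p g =ᶠ[𝓝 x] fun _ => 0) ∨ ∃ k : ℤ × ℤ, (max |(x + lat k).1 - p.1| |(x + lat k).2 - p.2| < 1/2) ∧
      pz p g =ᶠ[𝓝 x] fun y => g (y + lat k) := by
  set k := rnd p x with hk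
  set d : E2 → ℝ := fun y => max |(y + lat k).1 - p.1| |(y + lat k).2 - p.2| with hd
  have hdc : Continuous d := by
    have : Continuous (fun y : E2 => y + lat k) := by fun_prop
    fun_prop
  have h1 : d x ≤ 1/2 := by
    simp only [hd, hk, rnd, lat]
    apply max_le
    · have := abs_sub_round (x.1 - p.1)
      refine le_trans (le_of_eq ?_) this
      congr 1; simp; ring
    · have := abs_sub_round (x.2 - p.2)
      refine le_trans (le_of_eq ?_) this
      congr 1; simp; ring
  rcases lt_or_ge (d x) (1/2) with h2 | h2
  · right
    refine ⟨k, h2, ?_⟩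
    filter_upwards [hdc.continuousAt.eventually (gt_mem_nhds h2)] with y hy
    exact pz_eq_lat k (lt_of_le_of_lt (le_max_left _ _) hy) (lt_of_le_of_lt (le_max_right _ _) hy)
  · left
    -- distance of coordinates to nearest integer is continuous and > r
    set e : E2 → ℝ := fun y => max |(y.1 - p.1) - round (y.1 - p.1)| |(y.2 - p.2) - round (y.2 - p.2)|
    have hr0 : ∀ t : ℝ, |t - round t| = min (Int.fract t) (1 - Int.fract t) := abs_sub_round_eq_min
    have hx : 1/2 ≤ e x := by
      refine le_trans h2 (le_of_eq ?_)
      simp only [hd, hk, rnd, lat, e]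
      congr 2 <;> (simp; ring)
    have key : ∀ t : ℝ, ∀ᶠ y : ℝ in 𝓝 t, |t - round t| - (1/2 - r)/2 ≤ |y - round y| := by
      intro t
      filter_upwards [Metric.ball_mem_nhds t (show 0 < (1/2 - r)/2 by linarith)] with y hy
      have a1 : |t - round t| ≤ |t - round y| := round_le t (round y)
      have a2 : |t - round y| ≤ |t - y| + |y - round y| := abs_sub_le _ _ _
      rw [Metric.mem_ball, Real.dist_eq, abs_sub_comm] at hy
      linarith
    have k1 := (show ContinuousAt (fun y : E2 => y.1 - p.1) x by fun_prop).eventually (key (x.1 - p.1))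
    have k2 := (show ContinuousAt (fun y : E2 => y.2 - p.2) x by fun_prop).eventually (key (x.2 - p.2))
    filter_upwards [k1, k2] with y hy1 hy2
    unfold pz
    apply hg
    have : e y ≤ max |(y + lat (rnd p y)).1 - p.1| |(y + lat (rnd p y)).2 - p.2| := by
      apply le_of_eq
      simp only [rnd, lat, e]
      congr 2 <;> (simp; ring)
    refine lt_of_lt_of_le ?_ this
    have : e x - (1/2 - r)/2 ≤ e y := by
      simp only [e, sub_le_iff_le_add]
      apply max_le
      · have := le_max_left (|y.1 - p.1 - round (y.1 - p.1)|) (|y.2 - p.2 - round (y.2 - p.2)|)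
        linarith
      · have := le_max_right (|y.1 - p.1 - round (y.1 - p.1)|) (|y.2 - p.2 - round (y.2 - p.2)|)
        linarith
    linarith

lemma pz_smooth {p : E2} {g : E2 → ℝ} {r : ℝ} (hr : r < 1/2)
    (hg : ∀ x, r < max |x.1 - p.1| |x.2 - p.2| → g x = 0) (hs : ContDiff ℝ (⊤ : ℕ∞) g) :
    ContDiff ℝ (⊤ : ℕ∞) (pz p g) := by
  rw [contDiff_iff_contDiffAt]
  intro x
  rcases pz_local hr hg x with h | ⟨k, -, h⟩
  · exact contDiffAt_const.congr_of_eventuallyEq h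
  · refine ContDiffAt.congr_of_eventuallyEq ?_ h
    exact (hs.comp (by fun_prop : ContDiff ℝ (⊤ : ℕ∞) fun y : E2 => y + lat k)).contDiffAt

/-- integral of a periodic function vanishing away from the translates of a small disc -/
lemma per_integral_local {H K : E2 → ℝ} (hH : Per H) (p : E2)
    (h1 : ∀ x, |x.1 - p.1| < 1/2 → |x.2 - p.2| < 1/2 → H x = K x)
    (h2 : ∀ x, (1/2 ≤ |x.1 - p.1| ∨ 1/2 ≤ |x.2 - p.2|) → K x = 0) :
    ∫ x in QQ, H x = ∫ x, K x := by
  rw [← cell_integral hH (p - (1/2,1/2)), setIntegral_congr_set (cell_ae _)]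
  have hI : Icc (p - ((1/2:ℝ),(1/2:ℝ))) (p - (1/2,1/2) + (1,1))
      = Icc (p.1 - 1/2) (p.1 + 1/2) ×ˢ Icc (p.2 - 1/2) (p.2 + 1/2) := by
    rw [← Icc_prod_Icc]
    congr 2 <;> (simp; try norm_num; try ring)
  have hae : (Icc (p - ((1/2:ℝ),(1/2:ℝ))) (p - (1/2,1/2) + (1,1)) : Set E2)
      =ᵐ[volume] (Ioo (p.1 - 1/2) (p.1 + 1/2) ×ˢ Ioo (p.2 - 1/2) (p.2 + 1/2) : Set E2) := by
    rw [hI]; exact Measure.set_prod_ae_eq Ioo_ae_eq_Icc.symm Ioo_ae_eq_Icc.symm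
  rw [setIntegral_congr_set hae]
  have hm : MeasurableSet (Ioo (p.1 - 1/2) (p.1 + 1/2) ×ˢ Ioo (p.2 - 1/2) (p.2 + 1/2) : Set E2) :=
    measurableSet_Ioo.prod measurableSet_Ioo
  rw [setIntegral_congr_fun hm (g := K), setIntegral_eq_integral_of_forall_compl_eq_zero]
  · intro x hx
    apply h2
    by_contra hc
    push Not at hc
    apply hx
    rw [abs_lt, abs_lt] at hc
    exact ⟨⟨by linarith [hc.1.1], by linarith [hc.1.2]⟩, ⟨by linarith [hc.2.1], by linarith [hc.2.2]⟩⟩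
  · intro x hx
    apply h1
    · rw [abs_lt]; exact ⟨by linarith [hx.1.1], by linarith [hx.1.2]⟩
    · rw [abs_lt]; exact ⟨by linarith [hx.2.1], by linarith [hx.2.2]⟩
end

lemma hasDerivAt_slice1 {v : E2 → ℝ} (hv : ContDiff ℝ 1 v) (y t : ℝ) :
    HasDerivAt (fun t => v (t, y)) (D1 v (t, y)) t := by
  have h := ((hv.differentiable (by simp)) (t, y)).hasFDerivAt
  have h2 : HasDerivAt (fun t : ℝ => ((t, y) : E2)) ((1:ℝ), (0:ℝ)) t :=
    (hasDerivAt_id t).prodMk (hasDerivAt_const t y)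
  exact h.comp_hasDerivAt t h2

lemma hasDerivAt_slice2 {v : E2 → ℝ} (hv : ContDiff ℝ 1 v) (x t : ℝ) :
    HasDerivAt (fun t => v (x, t)) (D2 v (x, t)) t := by
  have h := ((hv.differentiable (by simp)) (x, t)).hasFDerivAt
  have h2 : HasDerivAt (fun t : ℝ => ((x, t) : E2)) ((0:ℝ), (1:ℝ)) t :=
    (hasDerivAt_const t x).prodMk (hasDerivAt_id t)
  exact h.comp_hasDerivAt t h2

lemma D1_cont {v : E2 → ℝ} (hv : ContDiff ℝ 1 v) : Continuous (D1 v) :=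
  (hv.continuous_fderiv (by simp)).clm_apply continuous_const
lemma D2_cont {v : E2 → ℝ} (hv : ContDiff ℝ 1 v) : Continuous (D2 v) :=
  (hv.continuous_fderiv (by simp)).clm_apply continuous_const

lemma osc1d {w w' : ℝ → ℝ} (hw : ∀ t, HasDerivAt w (w' t) t) (hc : Continuous w') {a b x y : ℝ}
    (hx : x ∈ Icc a b) (hy : y ∈ Icc a b) : |w x - w y| ≤ ∫ t in Icc a b, |w' t| := by
  have e : ∫ t in y..x, w' t = w x - w y :=
    intervalIntegral.integral_eq_sub_of_hasDerivAt (fun t _ => hw t) (hc.intervalIntegrable _ _)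
  rw [← e, ← Real.norm_eq_abs]
  refine (intervalIntegral.norm_integral_le_integral_norm_uIoc (f := w')).trans ?_
  apply setIntegral_mono_set
  · exact (hc.abs.integrableOn_Icc)
  · exact Eventually.of_forall fun t => abs_nonneg _
  · apply HasSubset.Subset.eventuallyLE
    intro t ht
    rw [uIoc_eq_union] at ht
    rcases ht with h | h
    · exact ⟨hy.1.trans h.1.le, h.2.trans hx.2⟩
    · exact ⟨hx.1.trans h.1.le, h.2.trans hy.2⟩

lemma rect_fubini {f : E2 → ℝ} (hf : Continuous f) (a b : E2) :
    ∫ z in Icc a b, f z = ∫ x in Icc a.1 b.1, ∫ y in Icc a.2 b.2, f (x, y) := by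
  have h : (Icc a b : Set E2) = Icc a.1 b.1 ×ˢ Icc a.2 b.2 := by rw [Icc_prod_Icc]
  rw [h, Measure.volume_eq_prod, setIntegral_prod]
  rw [← Measure.volume_eq_prod, ← h]
  exact hf.continuousOn.integrableOn_compact isCompact_Icc

lemma rect_fubini' {f : E2 → ℝ} (hf : Continuous f) (a b : E2) :
    ∫ z in Icc a b, f z = ∫ y in Icc a.2 b.2, ∫ x in Icc a.1 b.1, f (x, y) := by
  rw [rect_fubini hf]
  apply integral_integral_swap
  have h : (Icc a b : Set E2) = Icc a.1 b.1 ×ˢ Icc a.2 b.2 := by rw [Icc_prod_Icc]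
  have h2 := hf.continuousOn.integrableOn_compact (μ := volume) (isCompact_Icc (a := a) (b := b))
  rw [h, IntegrableOn, Measure.volume_eq_prod, ← Measure.prod_restrict] at h2
  exact h2

lemma cont_param {f : E2 → ℝ} (hf : Continuous f) (a b : ℝ) :
    Continuous (fun x => ∫ y in Icc a b, f (x, y)) := by
  apply continuous_parametric_integral_of_continuous (by simpa [Function.uncurry] using! hf) isCompact_Icc

lemma cont_param' {f : E2 → ℝ} (hf : Continuous f) (a b : ℝ) :
    Continuous (fun y => ∫ x in Icc a b, f (x, y)) :=
  cont_param (f := fun z => f (z.2, z.1)) (hf.comp continuous_swap) a b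

/-- average over a rectangle -/
def ravg (v : E2 → ℝ) (a b : E2) : ℝ :=
  ((b.1 - a.1) * (b.2 - a.2))⁻¹ * ∫ z in Icc a b, v z

lemma vol_rect {a b : E2} (h1 : a.1 < b.1) (h2 : a.2 < b.2) :
    volume.real (Icc a b : Set E2) = (b.1 - a.1) * (b.2 - a.2) := by
  have h : (Icc a b : Set E2) = Icc a.1 b.1 ×ˢ Icc a.2 b.2 := by rw [Icc_prod_Icc]
  rw [h, Measure.volume_eq_prod, measureReal_prod_prod]
  simp [h1.le, h2.le]

lemma rect_sobolev {v : E2 → ℝ} (hv : ContDiff ℝ 1 v) {a b : E2} (h1 : a.1 < b.1) (h2 : a.2 < b.2) :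
    ∫ z in Icc a b, (v z - ravg v a b) ^ 2 ≤
      (1 + (b.2 - a.2) / (b.1 - a.1)) * (1 + (b.1 - a.1) / (b.2 - a.2)) *
       (∫ z in Icc a b, (|D1 v z| + |D2 v z|)) ^ 2 := by
  set L1 := b.1 - a.1 with hL1
  set L2 := b.2 - a.2 with hL2
  have p1 : 0 < L1 := by linarith
  have p2 : 0 < L2 := by linarith
  have c1 := (D1_cont hv).abs
  have c2 := (D2_cont hv).abs
  have hvc := hv.continuous
  set A : ℝ → ℝ := fun y => ∫ x in Icc a.1 b.1, |D1 v (x, y)| with hA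
  set B : ℝ → ℝ := fun x => ∫ y in Icc a.2 b.2, |D2 v (x, y)| with hB
  have cA : Continuous A := cont_param' c1 _ _
  have cB : Continuous B := cont_param c2 _ _
  have A0 : ∀ y, 0 ≤ A y := fun y => integral_nonneg fun _ => abs_nonneg _
  have B0 : ∀ y, 0 ≤ B y := fun y => integral_nonneg fun _ => abs_nonneg _
  set E := ∫ z in Icc a b, (|D1 v z| + |D2 v z|) with hE
  have iR : ∀ f : E2 → ℝ, Continuous f → IntegrableOn f (Icc a b) :=
    fun f hf => hf.continuousOn.integrableOn_compact isCompact_Icc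
  have iI : ∀ (f : ℝ → ℝ) (s t : ℝ), Continuous f → IntegrableOn f (Icc s t) :=
    fun f s t hf => hf.continuousOn.integrableOn_compact isCompact_Icc
  have hEE : E = (∫ y in Icc a.2 b.2, A y) + ∫ x in Icc a.1 b.1, B x := by
    rw [hE, integral_add (iR _ c1) (iR _ c2), rect_fubini' c1, rect_fubini c2]
  have iA0 : 0 ≤ ∫ y in Icc a.2 b.2, A y := integral_nonneg A0
  have iB0 : 0 ≤ ∫ x in Icc a.1 b.1, B x := integral_nonneg B0
  set k := ravg v a b with hk
  have vol : volume.real (Icc a b : Set E2) = L1 * L2 := vol_rect h1 h2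
  have gen : ∀ z ∈ Icc a b, ∀ K : E2 → ℝ, Continuous K →
      (∀ w ∈ Icc a b, |v z - v w| ≤ K w) → L1 * L2 * |v z - k| ≤ ∫ w in Icc a b, K w := by
    intro z hz K hK hb
    have e : L1 * L2 * (v z - k) = ∫ w in Icc a b, (v z - v w) := by
      rw [integral_sub (iR _ continuous_const) (iR _ hvc), setIntegral_const, vol, hk, ravg,
        smul_eq_mul, ← hL1, ← hL2]
      field_simp
    have : L1 * L2 * |v z - k| = |L1 * L2 * (v z - k)| := by
      rw [abs_mul, abs_of_pos (mul_pos p1 p2)]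
    rw [this, e]
    refine (abs_integral_le_integral_abs).trans ?_
    exact setIntegral_mono_on (iR _ (by fun_prop)) (iR _ hK) measurableSet_Icc hb
  have osc1 : ∀ x x' y, x ∈ Icc a.1 b.1 → x' ∈ Icc a.1 b.1 → |v (x, y) - v (x', y)| ≤ A y := by
    intro x x' y hx hx'
    exact osc1d (hasDerivAt_slice1 hv y) ((D1_cont hv).comp (by fun_prop)) hx hx'
  have osc2 : ∀ x y y', y ∈ Icc a.2 b.2 → y' ∈ Icc a.2 b.2 → |v (x, y) - v (x, y')| ≤ B x := by
    intro x y y' hx hx'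
    exact osc1d (hasDerivAt_slice2 hv x) ((D2_cont hv).comp (by fun_prop)) hx hx'
  have sp : ∀ {z : E2}, z ∈ Icc a b → z.1 ∈ Icc a.1 b.1 ∧ z.2 ∈ Icc a.2 b.2 :=
    fun hz => ⟨⟨hz.1.1, hz.2.1⟩, ⟨hz.1.2, hz.2.2⟩⟩
  have b1 : ∀ z ∈ Icc a b, |v z - k| ≤ A z.2 + E / L1 := by
    intro z hz
    have := gen z hz (fun w => A z.2 + B w.1) (by fun_prop) (by
      intro w hw
      have t1 := osc1 z.1 w.1 z.2 (sp hz).1 (sp hw).1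
      have t2 := osc2 w.1 z.2 w.2 (sp hz).2 (sp hw).2
      calc |v z - v w| ≤ |v z - v (w.1, z.2)| + |v (w.1, z.2) - v w| := abs_sub_le _ _ _
        _ ≤ _ := add_le_add t1 t2)
    have e2 : ∫ w in Icc a b, (A z.2 + B w.1) = L1 * L2 * A z.2 + L2 * ∫ x in Icc a.1 b.1, B x := by
      rw [integral_add (iR _ continuous_const) (iR _ (by fun_prop)), setIntegral_const, vol,
        rect_fubini (by fun_prop)]
      simp only [setIntegral_const, smul_eq_mul]
      rw [integral_const_mul]
      simp [h2.le, hL2]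
    rw [e2] at this
    have h3 : L1 * L2 * |v z - k| ≤ L1 * L2 * (A z.2 + E / L1) := by
      refine this.trans ?_
      have : L1 * L2 * (A z.2 + E / L1) = L1 * L2 * A z.2 + L2 * E := by field_simp
      rw [this, hEE]
      nlinarith
    exact le_of_mul_le_mul_left h3 (mul_pos p1 p2)
  have b2 : ∀ z ∈ Icc a b, |v z - k| ≤ B z.1 + E / L2 := by
    intro z hz
    have := gen z hz (fun w => B z.1 + A w.2) (by fun_prop) (by
      intro w hw
      have t1 := osc2 z.1 z.2 w.2 (sp hz).2 (sp hw).2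
      have t2 := osc1 z.1 w.1 w.2 (sp hz).1 (sp hw).1
      calc |v z - v w| ≤ |v z - v (z.1, w.2)| + |v (z.1, w.2) - v w| := abs_sub_le _ _ _
        _ ≤ _ := add_le_add t1 t2)
    have e2 : ∫ w in Icc a b, (B z.1 + A w.2) = L1 * L2 * B z.1 + L1 * ∫ x in Icc a.2 b.2, A x := by
      rw [integral_add (iR _ continuous_const) (iR _ (by fun_prop)), setIntegral_const, vol,
        rect_fubini' (by fun_prop)]
      simp only [setIntegral_const, smul_eq_mul]
      rw [integral_const_mul]
      simp [h1.le, hL1]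
    rw [e2] at this
    have h3 : L1 * L2 * |v z - k| ≤ L1 * L2 * (B z.1 + E / L2) := by
      refine this.trans ?_
      have : L1 * L2 * (B z.1 + E / L2) = L1 * L2 * B z.1 + L1 * E := by field_simp
      rw [this, hEE]
      nlinarith
    exact le_of_mul_le_mul_left h3 (mul_pos p1 p2)
  have E0 : 0 ≤ E := by rw [hEE]; positivity
  have step : ∫ z in Icc a b, (v z - k) ^ 2 ≤
      ∫ z in Icc a b, (A z.2 + E / L1) * (B z.1 + E / L2) := by
    refine setIntegral_mono_on (iR _ (by fun_prop)) (iR _ (by fun_prop)) measurableSet_Icc ?_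
    intro z hz
    rw [← sq_abs, sq]
    exact mul_le_mul (b1 z hz) (b2 z hz) (abs_nonneg _) ((abs_nonneg _).trans (b1 z hz))
  refine step.trans ?_
  rw [rect_fubini (by fun_prop)]
  have e3 : ∀ x : ℝ, ∫ y in Icc a.2 b.2, (A y + E / L1) * (B x + E / L2)
      = ((∫ y in Icc a.2 b.2, A y) + L2 * (E / L1)) * (B x + E / L2) := by
    intro x
    rw [integral_mul_const, integral_add (iI _ _ _ cA) (iI _ _ _ continuous_const),
      setIntegral_const]
    simp [h2.le, hL2]
  simp only [e3]
  rw [integral_const_mul, integral_add (iI _ _ _ cB) (iI _ _ _ continuous_const), setIntegral_const]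
  have : (volume.real (Icc a.1 b.1)) • (E / L2) = L1 * (E / L2) := by simp [h1.le, hL1]
  rw [this]
  have q1 : (∫ y in Icc a.2 b.2, A y) + L2 * (E / L1) ≤ (1 + L2 / L1) * E := by
    have : (1 + L2 / L1) * E = E + L2 * (E / L1) := by ring
    rw [this]; linarith
  have q2 : (∫ y in Icc a.1 b.1, B y) + L1 * (E / L2) ≤ (1 + L1 / L2) * E := by
    have : (1 + L1 / L2) * E = E + L1 * (E / L2) := by ring
    rw [this]; linarith
  calc _ ≤ ((1 + L2 / L1) * E) * ((1 + L1 / L2) * E) := by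
        apply mul_le_mul q1 q2 (by positivity) (by positivity)
    _ = _ := by ring

lemma cs_int {α : Type*} [MeasurableSpace α] {μ : Measure α} {f g : α → ℝ}
    (hf : Integrable (fun x => f x ^ 2) μ) (hg : Integrable (fun x => g x ^ 2) μ)
    (hfg : Integrable (fun x => f x * g x) μ) :
    (∫ x, f x * g x ∂μ) ^ 2 ≤ (∫ x, f x ^ 2 ∂μ) * ∫ x, g x ^ 2 ∂μ := by
  have h : ∀ t : ℝ, 0 ≤ (∫ x, g x ^ 2 ∂μ) * (t * t) + (-2 * ∫ x, f x * g x ∂μ) * t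
      + ∫ x, f x ^ 2 ∂μ := by
    intro t
    have e : ∫ x, (f x - t * g x) ^ 2 ∂μ = (∫ x, g x ^ 2 ∂μ) * (t * t)
        + (-2 * ∫ x, f x * g x ∂μ) * t + ∫ x, f x ^ 2 ∂μ := by
      have : (fun x => (f x - t * g x) ^ 2)
          = fun x => (g x ^ 2 * (t * t) + (f x * g x) * (-2 * t)) + f x ^ 2 := by
        ext x; ring
      have i1 : Integrable (fun x => g x ^ 2 * (t * t) + (f x * g x) * (-2 * t)) μ :=
        (hg.mul_const _).add (hfg.mul_const _)
      rw [this, integral_add i1 hf,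
        integral_add (hg.mul_const _) (hfg.mul_const _), integral_mul_const, integral_mul_const]
      ring
    rw [← e]
    exact integral_nonneg fun x => sq_nonneg _
  have := discrim_le_zero h
  unfold discrim at this
  nlinarith

/-- Sobolev constant of a rectangle -/
def Csob (a b : E2) : ℝ :=
  (1 + (b.2 - a.2) / (b.1 - a.1)) * (1 + (b.1 - a.1) / (b.2 - a.2))

lemma Csob_pos {a b : E2} (h1 : a.1 < b.1) (h2 : a.2 < b.2) : 0 < Csob a b := by
  have p1 : 0 < b.1 - a.1 := by linarith
  have p2 : 0 < b.2 - a.2 := by linarith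
  unfold Csob; positivity

/-- weighted Cauchy–Schwarz for gradients -/
lemma grad_cs {v : E2 → ℝ} (hv : ContDiff ℝ 1 v) {a b : E2} {L : ℝ} (hL : 0 < L) (k : ℝ)
    {S : Set E2} (hS : MeasurableSet S) (hz : ∀ z ∉ S, D1 v z = 0 ∧ D2 v z = 0) :
    (∫ z in Icc a b, (|D1 v z| + |D2 v z|)) ^ 2 ≤
      2 * (∫ z in Icc a b, L / (L ^ 2 + (v z - k) ^ 2) * gsq v z) *
        ∫ z in Icc a b, S.indicator (fun z => L + (v z - k) ^ 2 / L) z := by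
  have c1 := D1_cont hv
  have c2 := D2_cont hv
  have cv := hv.continuous
  have pos : ∀ z, 0 < L ^ 2 + (v z - k) ^ 2 := fun z => by positivity
  set f : E2 → ℝ := fun z => √(L / (L ^ 2 + (v z - k) ^ 2)) * (|D1 v z| + |D2 v z|) with hf
  set g : E2 → ℝ := S.indicator (fun z => √(L + (v z - k) ^ 2 / L)) with hg
  have cf : Continuous f := by
    apply Continuous.mul
    · apply Continuous.sqrt
      apply Continuous.div continuous_const (by fun_prop) (fun z => (pos z).ne')
    · fun_prop
  have cg0 : Continuous (fun z => √(L + (v z - k) ^ 2 / L)) := by fun_prop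
  have iR : ∀ f : E2 → ℝ, Continuous f → IntegrableOn f (Icc a b) :=
    fun f hf => hf.continuousOn.integrableOn_compact isCompact_Icc
  have prod : ∀ z, f z * g z = |D1 v z| + |D2 v z| := by
    intro z
    by_cases h : z ∈ S
    · simp only [hf, hg, indicator_of_mem h]
      rw [mul_right_comm, ← Real.sqrt_mul (by have := pos z; positivity)]
      have : L / (L ^ 2 + (v z - k) ^ 2) * (L + (v z - k) ^ 2 / L) = 1 := by
        have := (pos z).ne'
        field_simp
      rw [this]; simp
    · simp [hf, hg, indicator_of_notMem h, (hz z h).1, (hz z h).2]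
  have gsq' : (fun z => g z ^ 2) = S.indicator (fun z => L + (v z - k) ^ 2 / L) := by
    ext z
    by_cases h : z ∈ S
    · simp only [hg, indicator_of_mem h]
      rw [Real.sq_sqrt (by positivity)]
    · simp [hg, indicator_of_notMem h]
  have ig2 : IntegrableOn (fun z => g z ^ 2) (Icc a b) := by
    rw [gsq']
    exact (iR _ (by fun_prop)).indicator hS
  have h := cs_int (μ := volume.restrict (Icc a b)) (iR _ (cf.pow 2)) ig2
    (by simp only [prod]; exact iR _ (by fun_prop))
  simp only [prod] at h
  refine h.trans ?_
  rw [gsq']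
  apply mul_le_mul_of_nonneg_right
  · rw [← integral_const_mul]
    refine setIntegral_mono_on (iR _ (cf.pow 2)) (iR _ ?_) measurableSet_Icc ?_
    · apply continuous_const.mul
      apply Continuous.mul
      · apply Continuous.div continuous_const (by fun_prop) (fun z => (pos z).ne')
      · unfold gsq; fun_prop
    · intro z _
      simp only [hf, mul_pow]
      have hp := pos z
      rw [Real.sq_sqrt (by positivity)]
      have : (|D1 v z| + |D2 v z|) ^ 2 ≤ 2 * gsq v z := by
        unfold gsq
        have := sq_nonneg (|D1 v z| - |D2 v z|)
        have e1 := sq_abs (D1 v z)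
        have e2 := sq_abs (D2 v z)
        nlinarith
      have hp2 : 0 ≤ L / (L ^ 2 + (v z - k) ^ 2) := by positivity
      nlinarith [mul_le_mul_of_nonneg_left this hp2]
  · apply integral_nonneg
    intro z
    apply indicator_nonneg
    intro z _
    positivity

/-- BMO type estimate on a rectangle -/
lemma rect_bmo {v : E2 → ℝ} (hv : ContDiff ℝ 1 v) {a b : E2} (h1 : a.1 < b.1) (h2 : a.2 < b.2)
    {K L : ℝ} (hK : 0 < K) (hL : L = 4 * Csob a b * K)
    (hE : ∫ z in Icc a b, L / (L ^ 2 + (v z - ravg v a b) ^ 2) * gsq v z ≤ K) :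
    ∫ z in Icc a b, (v z - ravg v a b) ^ 2 ≤
      16 * Csob a b ^ 2 * K ^ 2 * ((b.1 - a.1) * (b.2 - a.2)) := by
  have hC := Csob_pos h1 h2
  have L0 : 0 < L := by rw [hL]; positivity
  have s := rect_sobolev hv h1 h2
  have t := grad_cs hv (a := a) (b := b) L0 (ravg v a b) MeasurableSet.univ (by simp)
  rw [indicator_univ] at t
  set k := ravg v a b
  have cv := hv.continuous
  have iR : ∀ f : E2 → ℝ, Continuous f → IntegrableOn f (Icc a b) :=
    fun f hf => hf.continuousOn.integrableOn_compact isCompact_Icc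
  rw [integral_add (iR _ continuous_const) (iR _ (by fun_prop)), setIntegral_const,
    vol_rect h1 h2, integral_div, smul_eq_mul] at t
  set I := ∫ z in Icc a b, (v z - k) ^ 2
  set W := (b.1 - a.1) * (b.2 - a.2)
  have I0 : 0 ≤ I := integral_nonneg fun _ => sq_nonneg _
  have W0 : 0 < W := mul_pos (by linarith) (by linarith)
  have h3 : I ≤ Csob a b * (2 * K * (W * L + I / L)) := by
    refine s.trans ?_
    apply mul_le_mul_of_nonneg_left _ hC.le
    refine t.trans ?_
    apply mul_le_mul_of_nonneg_right _ (by positivity)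
    linarith
  have h4 : Csob a b * (2 * K * (W * L + I / L)) = 8 * Csob a b ^ 2 * K ^ 2 * W + I / 2 := by
    rw [hL]; field_simp; ring
  rw [h4] at h3
  linarith

/-- smooth truncations -/
lemma exists_trunc (M : ℝ) (hM : 0 < M) : ∃ T T' : ℝ → ℝ, ContDiff ℝ (⊤ : ℕ∞) T ∧
    (∀ t, HasDerivAt T (T' t) t) ∧ (∀ t, 0 ≤ T' t) ∧ (∀ t, T' t ≤ 1) ∧
    (∀ t, |t| ≤ M → T t = t) ∧ (∀ t, M + 1 ≤ t → T t = T (M+1)) ∧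
    (∀ t, t ≤ -(M+1) → T t = T (-(M+1))) := by
  set χ : ContDiffBump (0:ℝ) := ⟨M, M+1, hM, by linarith⟩ with hχ
  have cχ : Continuous χ := χ.continuous
  have hd : ∀ t, HasDerivAt (fun t => ∫ s in (0:ℝ)..t, χ s) (χ t) t := fun t =>
    intervalIntegral.integral_hasDerivAt_right (cχ.intervalIntegrable _ _)
      cχ.stronglyMeasurable.stronglyMeasurableAtFilter cχ.continuousAt
  have hout : ∀ s, M + 1 ≤ |s| → χ s = 0 := by
    intro s hs
    apply χ.zero_of_le_dist
    rw [Real.dist_eq, sub_zero]; exact hs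
  refine ⟨fun t => ∫ s in (0:ℝ)..t, χ s, χ, ?_, hd, fun t => χ.nonneg, fun t => χ.le_one, ?_, ?_, ?_⟩
  · rw [contDiff_infty_iff_deriv]
    refine ⟨fun t => (hd t).differentiableAt, ?_⟩
    have : deriv (fun t => ∫ s in (0:ℝ)..t, χ s) = χ := by ext t; exact (hd t).deriv
    rw [this]
    exact χ.contDiff
  · intro t ht
    have : ∫ s in (0:ℝ)..t, χ s = ∫ s in (0:ℝ)..t, (1:ℝ) := by
      apply intervalIntegral.integral_congr
      intro s hs
      apply χ.one_of_mem_closedBall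
      rw [mem_closedBall, Real.dist_eq, sub_zero]
      have := Set.abs_sub_left_of_mem_uIcc hs
      simp only [sub_zero] at this
      exact this.trans ht
    simp only [this]; simp
  · intro t ht
    have h0 : ∫ s in (M+1)..t, χ s = 0 := by
      rw [intervalIntegral.integral_congr (g := fun _ => 0)]
      · simp
      · intro s hs
        rw [uIcc_of_le ht] at hs
        exact hout s (hs.1.trans (le_abs_self s))
    have := intervalIntegral.integral_add_adjacent_intervals
      (cχ.intervalIntegrable (μ := volume) 0 (M+1)) (cχ.intervalIntegrable (M+1) t)
    simp only []
    linarith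
  · intro t ht
    have h0 : ∫ s in (-(M+1))..t, χ s = 0 := by
      rw [intervalIntegral.integral_congr (g := fun _ => 0)]
      · simp
      · intro s hs
        rw [uIcc_of_ge ht] at hs
        exact hout s (by rw [le_abs]; right; linarith [hs.2])
    have := intervalIntegral.integral_add_adjacent_intervals
      (cχ.intervalIntegrable (μ := volume) 0 (-(M+1))) (cχ.intervalIntegrable (-(M+1)) t)
    simp only []
    linarith

/-! f facts -/
def mn (t : ℝ) : ℝ := min (exp t) 1

lemma mn_nonneg (t : ℝ) : 0 ≤ mn t := le_min (exp_pos t).le zero_le_one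
lemma mn_pos (t : ℝ) : 0 < mn t := lt_min (exp_pos t) zero_lt_one
lemma mn_le_one (t : ℝ) : mn t ≤ 1 := min_le_right _ _
lemma mn_le_exp (t : ℝ) : mn t ≤ exp t := min_le_left _ _
lemma mn_cont : Continuous mn := by unfold mn; fun_prop
lemma mn_of_le {t : ℝ} (h : t ≤ 0) : mn t = exp t := min_eq_left (exp_le_one_iff.2 h)

lemma frac_le_mn (t : ℝ) : exp t / (1 + exp t) ≤ mn t := by
  have h := exp_pos t
  refine le_min ?_ ?_
  · rw [div_le_iff₀ (by positivity)]; nlinarith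
  · rw [div_le_iff₀ (by positivity)]; nlinarith

lemma f_hasDeriv {τ : ℝ} (hτ : 0 < τ) (t : ℝ) : HasDerivAt (fτ τ) (fτ' τ t) t := by
  have h := exp_pos t
  have e := Real.hasDerivAt_exp t
  have h1 := (e.mul ((hasDerivAt_const t (1:ℝ)).sub e)).div (((hasDerivAt_const t τ).add e).pow 3)
    (by simp; positivity)
  unfold fτ
  refine h1.congr_deriv ?_
  unfold fτ'
  have : exp (2*t) = exp t ^ 2 := by rw [← exp_nat_mul]; norm_num
  rw [this]
  simp
  field_simp
  ring

lemma F_hasDeriv {τ : ℝ} (hτ : 0 < τ) (t : ℝ) : HasDerivAt (F2τ τ) (fτ τ t) t := by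
  have h := exp_pos t
  have e := Real.hasDerivAt_exp t
  have h1 := (e.mul ((e.const_mul (1-τ)).add_const (2*τ))).div
    ((((hasDerivAt_const t τ).add e).pow 2).const_mul (2*τ^2)) (ne_of_gt (show 0 < 2*τ^2*(τ+exp t)^2 by positivity))
  unfold F2τ
  refine h1.congr_deriv ?_
  unfold fτ
  simp
  field_simp
  ring

lemma f_smooth {τ : ℝ} (hτ : 0 < τ) : ContDiff ℝ (⊤ : ℕ∞) (fτ τ) := by
  unfold fτ
  apply ContDiff.div (by fun_prop) (by fun_prop)
  intro x; have := exp_pos x; positivity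

lemma f'_smooth {τ : ℝ} (hτ : 0 < τ) : ContDiff ℝ (⊤ : ℕ∞) (fτ' τ) := by
  unfold fτ'
  apply ContDiff.div (by fun_prop) (by fun_prop)
  intro x; have := exp_pos x; positivity

lemma F_smooth {τ : ℝ} (hτ : 0 < τ) : ContDiff ℝ (⊤ : ℕ∞) (F2τ τ) := by
  unfold F2τ
  apply ContDiff.div (by fun_prop) (by fun_prop)
  intro x; have := exp_pos x; positivity

lemma f_bounds {τ : ℝ} (hτ : 0 < τ) : ∃ C : ℝ, 1 ≤ C ∧ ∀ t, |fτ τ t| ≤ C * mn t ∧ |fτ' τ t| ≤ C * mn t ∧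
    |F2τ τ t| ≤ C * mn t := by
  set m := min τ 1 with hm
  have m0 : 0 < m := lt_min hτ one_pos
  have m1 : m ≤ 1 := min_le_right _ _
  have m2 : m ≤ τ := min_le_left _ _
  set C1 := (m^3)⁻¹
  set C2 := (2*(τ+1))*(m^4)⁻¹
  set C3 := (2*(τ+1))*(2*τ^2*m^2)⁻¹
  have c1 : 0 < C1 := by positivity
  have c2 : 0 < C2 := by positivity
  have c3 : 0 < C3 := by positivity
  refine ⟨1 + C1 + C2 + C3, by linarith, fun t => ?_⟩
  have hx := exp_pos t
  have key := frac_le_mn t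
  set x := exp t
  have hmx : m * (1+x) ≤ τ + x := by nlinarith
  have p1 : 0 < m * (1+x) := by positivity
  have hmn := mn_nonneg t
  have red : ∀ A D, 0 ≤ D → |A| ≤ D * (x / (1+x)) → D ≤ 1 + C1 + C2 + C3 →
      |A| ≤ (1 + C1 + C2 + C3) * mn t := by
    intro A D hD h h2
    exact h.trans (mul_le_mul h2 key (by positivity) (by linarith))
  refine ⟨red _ C1 c1.le ?_ (by linarith), red _ C2 c2.le ?_ (by linarith), red _ C3 c3.le ?_ (by linarith)⟩
  · unfold fτ
    rw [abs_div, abs_mul, abs_of_pos hx, abs_of_pos (by positivity : 0 < (τ + x)^3)]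
    have a1 : |1 - x| ≤ 1 + x := by rw [abs_le]; constructor <;> linarith
    have a2 : (m*(1+x))^3 ≤ (τ+x)^3 := pow_le_pow_left₀ p1.le hmx 3
    calc x * |1-x| / (τ+x)^3 ≤ x * (1+x) / (m*(1+x))^3 := by gcongr
      _ = C1 * (x/(1+x)) * (1/(1+x)) := by simp only [C1]; field_simp
      _ ≤ C1 * (x/(1+x)) * 1 := by
          gcongr
          rw [div_le_one (by positivity)]; linarith
      _ = _ := by ring
  · unfold fτ'
    have e2 : exp (2*t) = x^2 := by simp only [x]; rw [← exp_nat_mul]; norm_num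
    rw [e2, abs_div, abs_mul, abs_of_pos hx, abs_of_pos (by positivity : 0 < (τ + x)^4)]
    have a1 : |τ - 2*(τ+1)*x + x^2| ≤ 2*(τ+1)*(1+x)^2 := by
      rw [abs_le]; constructor <;> nlinarith [mul_pos hτ hx, sq_nonneg x, mul_pos hτ (pow_pos hx 2)]
    have a2 : (m*(1+x))^4 ≤ (τ+x)^4 := pow_le_pow_left₀ p1.le hmx 4
    calc x * |τ - 2*(τ+1)*x + x^2| / (τ+x)^4 ≤ x * (2*(τ+1)*(1+x)^2) / (m*(1+x))^4 := by gcongr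
      _ = C2 * (x/(1+x)) * (1/(1+x)) := by simp only [C2]; field_simp
      _ ≤ C2 * (x/(1+x)) * 1 := by
          gcongr
          rw [div_le_one (by positivity)]; linarith
      _ = _ := by ring
  · unfold F2τ
    rw [abs_div, abs_mul, abs_of_pos hx, abs_of_pos (by positivity : 0 < 2*τ^2*(τ + x)^2)]
    have a1 : |(1-τ)*x + 2*τ| ≤ 2*(τ+1)*(1+x) := by
      rw [abs_le]; constructor <;> nlinarith [mul_pos hτ hx]
    have a2 : (m*(1+x))^2 ≤ (τ+x)^2 := pow_le_pow_left₀ p1.le hmx 2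
    calc x * |(1-τ)*x + 2*τ| / (2*τ^2*(τ+x)^2) ≤ x * (2*(τ+1)*(1+x)) / (2*τ^2*(m*(1+x))^2) := by
          gcongr
      _ = C3 * (x/(1+x)) := by simp only [C3]; field_simp

/-- F controls min(e^t,1), and f, for e^t ≤ 1+1/τ -/
lemma F_lower {τ : ℝ} (hτ : 0 < τ) : ∃ c : ℝ, 0 < c ∧ ∀ t, exp t ≤ 1 + 1/τ → c * mn t ≤ F2τ τ t ∧ fτ τ t ≤ 2 * F2τ τ t := by
  refine ⟨τ / (2 * τ^2 * (τ + (1 + 1/τ))^2), by positivity, fun t ht => ?_⟩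
  have hx := exp_pos t
  have h2 := mn_le_exp t
  set x := exp t
  have hq : τ * x ≤ τ + 1 := by
    have := mul_le_mul_of_nonneg_left ht hτ.le
    have e : τ * (1 + 1/τ) = τ + 1 := by field_simp
    linarith
  have hnum : τ ≤ (1-τ)*x + 2*τ := by
    rcases le_or_gt τ 1 with h | h
    · nlinarith
    · nlinarith
  constructor
  · unfold F2τ
    calc _ ≤ τ / (2 * τ^2 * (τ + (1 + 1/τ))^2) * x := by gcongr
      _ = x * τ / (2 * τ^2 * (τ + (1 + 1/τ))^2) := by ring
      _ ≤ x * ((1-τ)*x + 2*τ) / (2 * τ^2 * (τ + x)^2) := by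
        gcongr
        · have := mul_nonneg hx.le (hτ.le.trans hnum); linarith

  · unfold fτ F2τ
    rw [← sub_nonneg]
    have : 2 * (x * ((1 - τ) * x + 2 * τ) / (2 * τ ^ 2 * (τ + x) ^ 2)) - x * (1 - x) / (τ + x) ^ 3
       = x * (τ^2 + 3*τ*x + (1-τ)*x^2) / (τ^2 * (τ+x)^3) := by field_simp; ring
    rw [this]
    apply div_nonneg _ (by positivity)
    apply mul_nonneg hx.le
    rcases le_or_gt τ 1 with h | h
    · have := mul_nonneg (sub_nonneg.2 h) (sq_nonneg x); positivity
    · nlinarith [mul_pos hτ hx, mul_nonneg hx.le (sub_nonneg.2 hq)]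

lemma f_neg_inf {τ : ℝ} (hτ : 0 < τ) : ∃ K : ℝ, 1 ≤ K ∧ ∃ c : ℝ, 0 < c ∧ ∀ t, t ≤ -K →
    fτ τ t ≤ 2 * fτ' τ t ∧ c * mn t ≤ fτ τ t := by
  refine ⟨max 1 (- log (τ/(8*(τ+1)))), le_max_left _ _, (1/2)/(τ+1)^3, by positivity, fun t ht => ?_⟩
  have hK1 : t ≤ -1 := ht.trans (neg_le_neg (le_max_left _ _))
  have hK : t ≤ log (τ/(8*(τ+1))) := by
    have := ht.trans (neg_le_neg (le_max_right _ _)); simpa using this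
  have hx := exp_pos t
  have h1 : exp t ≤ τ/(8*(τ+1)) := by
    have := exp_le_exp.2 hK
    rwa [exp_log (by positivity)] at this
  have h2 := mn_le_exp t
  have e2 : exp (2*t) = exp t^2 := by rw [← exp_nat_mul]; norm_num
  unfold fτ fτ'
  rw [e2]
  set x := exp t
  have h3 : 8*(τ+1)*x ≤ τ := by rw [le_div_iff₀ (by positivity)] at h1; linarith
  have h4 : x ≤ 1/2 := by nlinarith [mul_pos hτ hx]
  constructor
  · rw [← sub_nonneg]
    have : 2 * (x * (τ - 2 * (τ + 1) * x + x ^ 2) / (τ + x) ^ 4) - x * (1 - x) / (τ + x) ^ 3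
      = x * (τ - (3*τ+5) * x + 3 * x^2) / (τ+x)^4 := by field_simp; ring
    rw [this]
    have : 0 ≤ τ - (3*τ+5) * x + 3 * x^2 := by nlinarith [mul_pos hτ hx, sq_nonneg x]
    positivity
  · calc _ ≤ (1/2)/(τ+1)^3 * x := by gcongr
      _ = x * (1/2) / (τ+1)^3 := by ring
      _ ≤ x * (1-x)/(τ+x)^3 := by
        have : 0 ≤ 1 - x := by linarith
        gcongr <;> linarith

lemma abs_f_le_F_one (t : ℝ) : |fτ 1 t| ≤ F2τ 1 t := by
  have hx := exp_pos t
  unfold fτ F2τ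
  set x := exp t
  rw [abs_div, abs_mul, abs_of_pos hx, abs_of_pos (by positivity : 0 < (1 + x)^3)]
  have a1 : |1 - x| ≤ 1 + x := by rw [abs_le]; constructor <;> linarith
  calc x * |1-x| / (1+x)^3 ≤ x * (1+x) / (1+x)^3 := by gcongr
    _ = _ := by field_simp; ring

lemma f_sign_neg {τ : ℝ} (hτ : 0 < τ) {t : ℝ} (h : t ≤ 0) : 0 ≤ fτ τ t := by
  have hx := exp_pos t
  have := exp_le_one_iff.2 h
  unfold fτ
  have : 0 ≤ 1 - exp t := by linarith
  positivity

lemma f_sign_pos {τ : ℝ} (hτ : 0 < τ) {t : ℝ} (h : 0 ≤ t) : fτ τ t ≤ 0 := by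
  have hx := exp_pos t
  have := one_le_exp h
  unfold fτ
  apply div_nonpos_of_nonpos_of_nonneg _ (by positivity)
  apply mul_nonpos_of_nonneg_of_nonpos hx.le (by linarith)

/-! symmetry -/
lemma f_symm {τ : ℝ} (hτ : 0 < τ) (t : ℝ) : fτ τ (-t) = -(τ^3)⁻¹ * fτ τ⁻¹ t := by
  unfold fτ
  have hx := exp_pos t
  rw [exp_neg]
  field_simp
  ring

lemma f'_symm {τ : ℝ} (hτ : 0 < τ) (t : ℝ) : fτ' τ (-t) = (τ^3)⁻¹ * fτ' τ⁻¹ t := by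
  unfold fτ'
  have hx := exp_pos t
  have e2 : exp (2*t) = exp t^2 := by rw [← exp_nat_mul]; norm_num
  have e3 : exp (2*(-t)) = (exp t^2)⁻¹ := by rw [mul_neg, exp_neg, e2]
  rw [e3, e2, exp_neg]
  field_simp
  ring

lemma Cyl_lim_aux (p z : E2) : |(Cyl p z).1 - p.1| ≤ exp z.1 ∧ |(Cyl p z).2 - p.2| ≤ exp z.1 := by
  have h := exp_pos z.1
  simp only [Cyl, add_sub_cancel_left, abs_mul, abs_of_pos h]
  exact ⟨mul_le_of_le_one_right h.le (abs_cos_le_one _), mul_le_of_le_one_right h.le (abs_sin_le_one _)⟩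

/-- a property near p holds at Cyl p z for z.1 very negative -/
lemma cyl_ev {p : E2} {Q : E2 → Prop} (h : ∀ᶠ x in 𝓝 p, Q x) :
    ∃ s0 : ℝ, ∀ z : E2, z.1 ≤ s0 → Q (Cyl p z) := by
  obtain ⟨r, r0, hr⟩ := Metric.eventually_nhds_iff.1 h
  refine ⟨log (r/2), fun z hz => hr ?_⟩
  have h1 : exp z.1 ≤ r/2 := by
    have := exp_le_exp.2 hz
    rwa [exp_log (by positivity)] at this
  have := Cyl_lim_aux p z
  rw [Prod.dist_eq, max_lt_iff, Real.dist_eq, Real.dist_eq]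
  constructor <;> linarith [this.1, this.2]

lemma Cyl_ne (p z : E2) : Cyl p z ≠ p := by
  intro h
  have := nsq_cyl p z
  rw [h] at this
  simp [nsq] at this
  exact (exp_pos _).ne this

lemma smAt_contAt_D {v : E2 → ℝ} {p : E2} (h : SmAt v p) :
    ∃ C, 0 ≤ C ∧ ∀ᶠ x in 𝓝 p, |D1 v x| ≤ C ∧ |D2 v x| ≤ C ∧ |v x| ≤ C := by
  have h1 := h.D1.cont
  have h2 := h.D2.cont
  have h3 := h.cont
  refine ⟨max (|D1 v p| + 1) (max (|D2 v p| + 1) (|v p| + 1)), by positivity, ?_⟩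
  filter_upwards [h1.abs.eventually_lt continuousAt_const (lt_add_one _),
    h2.abs.eventually_lt continuousAt_const (lt_add_one _),
    h3.abs.eventually_lt continuousAt_const (lt_add_one _)] with x a b c
  exact ⟨a.le.trans (le_max_left _ _), b.le.trans ((le_max_left _ _).trans (le_max_right _ _)),
    c.le.trans ((le_max_right _ _).trans (le_max_right _ _))⟩

lemma cyl_small {v : E2 → ℝ} {p : E2} (h : SmAt v p) : ∃ C s0, 0 ≤ C ∧ ∀ z : E2, z.1 ≤ s0 →
    |D1 (v ∘ Cyl p) z| ≤ C * exp z.1 ∧ |D2 (v ∘ Cyl p) z| ≤ C * exp z.1 ∧ |v (Cyl p z)| ≤ C := by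
  obtain ⟨C, C0, hC⟩ := (smAt_contAt_D h)
  obtain ⟨s0, hs⟩ := cyl_ev (hC.and h.ev)
  refine ⟨2*C, s0, by positivity, fun z hz => ?_⟩
  obtain ⟨⟨b1, b2, b3⟩, hsm⟩ := hs z hz
  have he := exp_pos z.1
  rw [D1_comp_cyl hsm.diff, D2_comp_cyl hsm.diff]
  have c1 := abs_cos_le_one z.2
  have c2 := abs_sin_le_one z.2
  refine ⟨?_, ?_, by linarith⟩
  · refine (abs_add_le _ _).trans ?_
    rw [abs_mul, abs_mul, abs_mul, abs_mul, abs_of_pos he]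
    have := mul_le_mul c1 b1 (abs_nonneg _) zero_le_one
    have := mul_le_mul c2 b2 (abs_nonneg _) zero_le_one
    nlinarith
  · refine (abs_add_le _ _).trans ?_
    rw [abs_mul, abs_mul, abs_neg, abs_mul, abs_mul, abs_of_pos he]
    have := mul_le_mul c2 b1 (abs_nonneg _) zero_le_one
    have := mul_le_mul c1 b2 (abs_nonneg _) zero_le_one
    nlinarith

/-- boxes exhausting the strip -/
def box (s0 s1 : ℝ) : Set E2 := Icc (s0, -π) (s1, π)

lemma box_ae (s0 s1 : ℝ) : (box s0 s1 : Set E2) =ᵐ[volume] (Icc s0 s1 ×ˢ Ioo (-π) π : Set E2) := by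
  have : box s0 s1 = Icc s0 s1 ×ˢ Icc (-π) π := by
    unfold box; rw [Icc_prod_eq]
  rw [this]
  exact (Measure.set_prod_ae_eq (ae_eq_refl _) Ioo_ae_eq_Icc).symm

lemma strip_integrable {h : E2 → ℝ} (hc : Continuous h) {s1 : ℝ} (h0 : ∀ z, s1 ≤ z.1 → h z = 0)
    (hb : ∃ C s0, ∀ z : E2, z.1 ≤ s0 → |h z| ≤ C * exp z.1) : IntegrableOn h strip := by
  obtain ⟨C, s0, hb⟩ := hb
  have hsub : strip ⊆ (Iic s0 ×ˢ Ioo (-π) π) ∪ (box s0 s1 ∪ (Ici s1 ×ˢ Ioo (-π) π)) := by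
    intro z hz
    obtain ⟨-, hz⟩ := hz
    rcases le_or_gt z.1 s0 with h | h
    · exact Or.inl ⟨h, hz⟩
    · rcases le_or_gt z.1 s1 with h' | h'
      · refine Or.inr (Or.inl ⟨?_, ?_⟩)
        · exact ⟨h.le, hz.1.le⟩
        · exact ⟨h', hz.2.le⟩
      · exact Or.inr (Or.inr ⟨h'.le, hz⟩)
  refine IntegrableOn.mono_set ?_ hsub
  refine IntegrableOn.union ?_ (IntegrableOn.union ?_ ?_)
  · have i1 : IntegrableOn (fun s : ℝ => exp s) (Iic s0) := integrableOn_exp_Iic s0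
    have i2 : IntegrableOn (fun _ : ℝ => C) (Ioo (-π) π) := by
      apply integrableOn_const <;> simp
    have i3 : IntegrableOn (fun z : E2 => exp z.1 * C) (Iic s0 ×ˢ Ioo (-π) π) := by
      unfold IntegrableOn
      rw [Measure.volume_eq_prod, ← Measure.prod_restrict]
      exact Integrable.mul_prod i1 i2
    refine Integrable.mono' i3 hc.aestronglyMeasurable.restrict ?_
    rw [ae_restrict_iff' (measurableSet_Iic.prod measurableSet_Ioo)]
    refine Eventually.of_forall fun z hz => ?_
    rw [Real.norm_eq_abs]
    have := hb z hz.1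
    linarith
  · exact hc.continuousOn.integrableOn_compact isCompact_Icc
  · refine IntegrableOn.congr_fun (f := fun _ => 0) integrableOn_zero ?_ (measurableSet_Ici.prod measurableSet_Ioo)
    intro z hz
    exact (h0 z hz.1).symm

lemma cyl_div {X Y : E2 → ℝ} {O : Set E2} (hO : IsOpen O) (hX : ContDiffOn ℝ 1 X O)
    (hY : ContDiffOn ℝ 1 Y O) {s0 s1 : ℝ} (h : s0 ≤ s1) (hsub : box s0 s1 ⊆ O)
    (hper : ∀ s ∈ Icc s0 s1, Y (s, π) = Y (s, -π)) :
    ∫ z in box s0 s1, (D1 X z + D2 Y z) =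
      (∫ θ in (-π)..π, X (s1, θ)) - ∫ θ in (-π)..π, X (s0, θ) := by
  have hpi := pi_pos
  have := rect_div hO hX hY (a := (s0, -π)) (b := (s1, π)) ⟨h, by simp; linarith⟩ hsub
  unfold box
  rw [this]
  have e : ∫ x in s0..s1, Y (x, π) = ∫ x in s0..s1, Y (x, -π) := by
    apply intervalIntegral.integral_congr
    intro s hs
    rw [uIcc_of_le h] at hs
    exact hper s hs
  simp only
  rw [e]; ring

lemma cyl_div_lim {X Y : E2 → ℝ} {s1 c : ℝ} (hX : ∀ z, SmAt X z) (hY : ∀ z, SmAt Y z)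
    (hper : ∀ s, Y (s, π) = Y (s, -π)) (h0 : ∀ z : E2, s1 ≤ z.1 → X z = 0)
    (lim : ∀ e > 0, ∃ s0 : ℝ, ∀ z : E2, z.1 ≤ s0 → |X z - c| ≤ e)
    (int : IntegrableOn (fun z => D1 X z + D2 Y z) strip) :
    ∫ z in strip, (D1 X z + D2 Y z) = -(2 * π * c) := by
  have hpi := pi_pos
  have cX : ContDiff ℝ (⊤ : ℕ∞) X := contDiff_iff_contDiffAt.2 fun z => (hX z).cd
  have cY : ContDiff ℝ (⊤ : ℕ∞) Y := contDiff_iff_contDiffAt.2 fun z => (hY z).cd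
  have ex : (strip : Set E2) = ⋃ n : ℕ, (Icc (-(n:ℝ)) n ×ˢ Ioo (-π) π) := by
    ext z
    simp only [strip, mem_prod, mem_univ, true_and, mem_iUnion]
    constructor
    · intro h
      obtain ⟨n, hn⟩ := exists_nat_ge |z.1|
      exact ⟨n, abs_le.1 hn, h⟩
    · rintro ⟨n, -, h⟩; exact h
  have t1 : Tendsto (fun n : ℕ => ∫ z in (Icc (-(n:ℝ)) n ×ˢ Ioo (-π) π), (D1 X z + D2 Y z)) atTop
      (𝓝 (∫ z in strip, (D1 X z + D2 Y z))) := by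
    rw [ex]
    apply tendsto_setIntegral_of_monotone
    · intro n; exact measurableSet_Icc.prod measurableSet_Ioo
    · intro n m hnm
      refine Set.prod_mono ?_ le_rfl
      have : (n:ℝ) ≤ m := by exact_mod_cast hnm
      exact Icc_subset_Icc (by linarith) this
    · rw [← ex]; exact int
  refine tendsto_nhds_unique t1 ?_
  rw [Metric.tendsto_atTop]
  intro e he
  obtain ⟨s0, hs0⟩ := lim (e / (4*π)) (by positivity)
  obtain ⟨n0, hn0⟩ := exists_nat_ge (max |s0| |s1|)
  refine ⟨n0, fun n hn => ?_⟩
  have hn' : (n0:ℝ) ≤ n := by exact_mod_cast hn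
  have b1 : -(n:ℝ) ≤ s0 := by
    have := (le_max_left _ _).trans hn0; have := neg_abs_le s0; linarith
  have b2 : s1 ≤ n := by
    have := (le_max_right _ _).trans hn0; have := le_abs_self s1; linarith
  rw [← setIntegral_congr_set (box_ae _ _), cyl_div isOpen_univ (cX.of_le (by simp)).contDiffOn
    (cY.of_le (by simp)).contDiffOn (by have := n.cast_nonneg (α := ℝ); linarith) (subset_univ _)
    (fun s _ => hper s)]
  have e1 : ∫ θ in (-π)..π, X (n, θ) = 0 := by
    rw [intervalIntegral.integral_congr (g := fun _ => 0)]
    · simp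
    · intro θ _; exact h0 _ b2
  rw [e1]
  have e2 : ∫ θ in (-π)..π, c = 2 * π * c := by
    rw [intervalIntegral.integral_const, smul_eq_mul]; ring
  have ci : Continuous fun θ => X (-(n:ℝ), θ) := cX.continuous.comp (by fun_prop)
  rw [← e2, Real.dist_eq]
  have : (0 - ∫ θ in (-π)..π, X (-(n:ℝ), θ)) - -(∫ θ in (-π)..π, c)
     = - ∫ θ in (-π)..π, (X (-(n:ℝ), θ) - c) := by
    rw [intervalIntegral.integral_sub (ci.intervalIntegrable _ _) (by simp)]; ring
  rw [this, abs_neg]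
  have := intervalIntegral.norm_integral_le_of_norm_le_const (a := -π) (b := π)
    (f := fun θ => X (-(n:ℝ), θ) - c) (C := e/(4*π)) (fun θ _ => hs0 _ b1)
  rw [Real.norm_eq_abs] at this
  refine this.trans_lt ?_
  rw [show π - -π = 2*π by ring, abs_of_pos (by positivity)]
  have : e / (4*π) * (2*π) = e/2 := by field_simp; norm_num
  linarith

/-! radial functions -/
def rad (p : E2) (c : ℝ) (χ : ℝ → ℝ) (x : E2) : ℝ :=
  if x = p then c else χ (log (nsq (x - p)) / 2)

lemma rad_cyl (p z : E2) (c : ℝ) (χ : ℝ → ℝ) : rad p c χ (Cyl p z) = χ z.1 := by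
  unfold rad
  rw [if_neg (Cyl_ne p z), nsq_cyl, log_exp]
  congr 1; ring

lemma nsq_pos {x : E2} (h : x ≠ 0) : 0 < nsq x := by
  unfold nsq
  rcases eq_or_ne x.1 0 with h1 | h1
  · have : x.2 ≠ 0 := fun h2 => h (Prod.ext h1 h2)
    positivity
  · positivity

lemma nsq_nonneg (x : E2) : 0 ≤ nsq x := by unfold nsq; positivity

lemma nsq_cont : Continuous nsq := by unfold nsq; fun_prop
lemma nsq_smooth : ContDiff ℝ (⊤ : ℕ∞) nsq := by unfold nsq; fun_prop

/-- near p, 0<nsq small means log small -/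
lemma rad_near (p : E2) {c s0 : ℝ} {χ : ℝ → ℝ} (hc : ∀ s ≤ s0, χ s = c) {x : E2}
    (hx : nsq (x - p) ≤ exp (2*s0)) : rad p c χ x = c := by
  unfold rad
  split_ifs with h
  · rfl
  · apply hc
    have := log_le_log (nsq_pos (sub_ne_zero.2 h)) hx
    rw [log_exp] at this
    linarith

lemma log_smAt {p x : E2} (h : x ≠ p) : SmAt (fun x => log (nsq (x - p))) x := by
  have : ContDiffOn ℝ (⊤ : ℕ∞) (fun x => log (nsq (x - p))) {p}ᶜ := by
    apply ContDiffOn.log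
    · exact (nsq_smooth.comp (contDiff_id.sub contDiff_const)).contDiffOn
    · intro y hy
      exact (nsq_pos (sub_ne_zero.2 hy)).ne'
  exact SmAt.of_on this isOpen_compl_singleton h

lemma rad_ne {p x : E2} (c : ℝ) (χ : ℝ → ℝ) (h : x ≠ p) :
    rad p c χ =ᶠ[𝓝 x] fun y => χ (2⁻¹ * log (nsq (y - p))) := by
  filter_upwards [isOpen_compl_singleton.mem_nhds h] with y hy
  unfold rad
  rw [if_neg (show ¬ y = p from hy)]; congr 1; ring

lemma rad_smAt {p : E2} {c s0 : ℝ} {χ : ℝ → ℝ} (hχ : ContDiff ℝ (⊤ : ℕ∞) χ)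
    (hc : ∀ s ≤ s0, χ s = c) (x : E2) : SmAt (rad p c χ) x := by
  rcases eq_or_ne x p with h | h
  · subst h
    refine (SmAt.const c).congr ?_
    have : ∀ᶠ y in 𝓝 x, nsq (y - x) < exp (2*s0) := by
      apply (nsq_cont.comp (continuous_id.sub continuous_const)).continuousAt.eventually_lt
        continuousAt_const
      simp [nsq]; positivity
    filter_upwards [this] with y hy
    exact rad_near x hc hy.le
  · exact (SmAt.comp hχ ((SmAt.const 2⁻¹).mul (log_smAt h))).congr (rad_ne c χ h)

lemma rad_contDiff {p : E2} {c s0 : ℝ} {χ : ℝ → ℝ} (hχ : ContDiff ℝ (⊤ : ℕ∞) χ)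
    (hc : ∀ s ≤ s0, χ s = c) : ContDiff ℝ (⊤ : ℕ∞) (rad p c χ) :=
  contDiff_iff_contDiffAt.2 fun z => (rad_smAt hχ hc z).cd

lemma rad_zero {p : E2} {c s1 : ℝ} {χ : ℝ → ℝ} (h1 : ∀ s, s1 ≤ s → χ s = 0) {x : E2}
    (hx : exp (2*s1) ≤ nsq (x - p)) : rad p c χ x = 0 := by
  have h : x ≠ p := by
    rintro rfl
    simp [nsq] at hx
    exact absurd hx (not_le.2 (exp_pos _))
  unfold rad
  rw [if_neg h]
  apply h1
  have := log_le_log (exp_pos _) hx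
  rw [log_exp] at this
  linarith

structure Loc (τ lam : ℝ) (u : E2 → ℝ) (p : E2) (a S : ℝ) : Prop where
  sm : ∀ z : E2, z.1 < S → SmAt u (Cyl p z)
  pde : ∀ z : E2, z.1 < S → lapp u (Cyl p z) = -(lam * fτ τ (u (Cyl p z)))
  sing : ∃ v : E2 → ℝ, SmAt v p ∧ ∀ᶠ x in 𝓝[≠] p, u x = a * log (nsq (x - p)) + v x

structure Cut (χ χ' : ℝ → ℝ) (s0 s1 : ℝ) : Prop where
  smooth : ContDiff ℝ (⊤ : ℕ∞) χ
  deriv : ∀ s, HasDerivAt χ (χ' s) s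
  one : ∀ s ≤ s0, χ s = 1
  zero : ∀ s, s1 ≤ s → χ s = 0
  nonneg : ∀ s, 0 ≤ χ s
  le_one : ∀ s, χ s ≤ 1

lemma Cut.lt {χ χ' : ℝ → ℝ} {s0 s1 : ℝ} (h : Cut χ χ' s0 s1) : s0 < s1 := by
  by_contra hc
  have := h.one s0 le_rfl
  rw [h.zero s0 (not_lt.1 hc)] at this
  exact zero_ne_one this

lemma Cut.eq_deriv {χ χ' : ℝ → ℝ} {s0 s1 : ℝ} (h : Cut χ χ' s0 s1) : χ' = _root_.deriv χ := by
  ext s; exact (h.deriv s).deriv.symm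

lemma Cut.cont {χ χ' : ℝ → ℝ} {s0 s1 : ℝ} (h : Cut χ χ' s0 s1) : Continuous χ' := by
  rw [h.eq_deriv]
  exact (h.smooth.continuous_deriv (by simp))

lemma Cut.d0 {χ χ' : ℝ → ℝ} {s0 s1 : ℝ} (h : Cut χ χ' s0 s1) {s : ℝ} (hs : s ≤ s0) : χ' s = 0 := by
  have hcl : IsClosed {s | χ' s = 0} := isClosed_eq h.cont continuous_const
  have hsub : Iio s0 ⊆ {s | χ' s = 0} := by
    intro t ht
    have : χ =ᶠ[𝓝 t] fun _ => 1 := by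
      filter_upwards [isOpen_Iio.mem_nhds ht] with y hy
      exact h.one y (le_of_lt hy)
    have := this.deriv_eq
    simp only [deriv_const] at this
    show χ' t = 0
    rw [h.eq_deriv, this]
  have := hcl.closure_subset_iff.2 hsub
  rw [closure_Iio] at this
  exact this hs

lemma Cut.d1 {χ χ' : ℝ → ℝ} {s0 s1 : ℝ} (h : Cut χ χ' s0 s1) {s : ℝ} (hs : s1 ≤ s) : χ' s = 0 := by
  have hcl : IsClosed {s | χ' s = 0} := isClosed_eq h.cont continuous_const
  have hsub : Ioi s1 ⊆ {s | χ' s = 0} := by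
    intro t ht
    have : χ =ᶠ[𝓝 t] fun _ => 0 := by
      filter_upwards [isOpen_Ioi.mem_nhds ht] with y hy
      exact h.zero y (le_of_lt hy)
    have := this.deriv_eq
    simp only [deriv_const] at this
    show χ' t = 0
    rw [h.eq_deriv, this]
  have := hcl.closure_subset_iff.2 hsub
  rw [closure_Ioi] at this
  exact this hs

/-- square of a cutoff is a cutoff -/
lemma Cut.sq {χ χ' : ℝ → ℝ} {s0 s1 : ℝ} (h : Cut χ χ' s0 s1) :
    Cut (fun s => χ s ^ 2) (fun s => 2 * χ s * χ' s) s0 s1 where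
  smooth := h.smooth.pow 2
  deriv s := by simpa using (h.deriv s).fun_pow 2
  one s hs := by simp [h.one s hs]
  zero s hs := by simp [h.zero s hs]
  nonneg s := by positivity
  le_one s := pow_le_one₀ (h.nonneg s) (h.le_one s)

lemma cut_smAt {χ : ℝ → ℝ} {s1 S : ℝ} (hχ : ContDiff ℝ (⊤ : ℕ∞) χ) (h0 : ∀ s, s1 ≤ s → χ s = 0)
    (hS : s1 < S) {g : E2 → ℝ} (hg : ∀ z : E2, z.1 < S → SmAt g z) (z : E2) :
    SmAt (fun z => χ z.1 * g z) z := by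
  rcases lt_or_ge z.1 S with h | h
  · exact (SmAt.fst hχ).mul (hg z h)
  · refine (SmAt.const 0).congr ?_
    have : ∀ᶠ y : E2 in 𝓝 z, s1 < y.1 :=
      continuousAt_const.eventually_lt continuous_fst.continuousAt (by simpa using lt_of_lt_of_le hS h)
    filter_upwards [this] with y hy
    rw [h0 _ hy.le, zero_mul]

lemma cut_D_zero {χ : ℝ → ℝ} {s1 : ℝ} (h0 : ∀ s, s1 ≤ s → χ s = 0) {g : E2 → ℝ} {z : E2}
    (hz : s1 < z.1) : D1 (fun z => χ z.1 * g z) z = 0 ∧ D2 (fun z => χ z.1 * g z) z = 0 := by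
  have e : (fun z : E2 => χ z.1 * g z) =ᶠ[𝓝 z] fun _ => 0 := by
    have : ∀ᶠ y : E2 in 𝓝 z, s1 < y.1 :=
      continuousAt_const.eventually_lt continuous_fst.continuousAt (by simpa using hz)
    filter_upwards [this] with y hy
    rw [h0 _ hy.le, zero_mul]
  rw [D1_congr e, D2_congr e, D1_const, D2_const]
  exact ⟨rfl, rfl⟩

/-! theta periodicity -/
def TPer (h : E2 → ℝ) : Prop := ∀ z : E2, h (z + (0, 2*π)) = h z

lemma TPer.D1 {h : E2 → ℝ} (hp : TPer h) : TPer (D1 h) := by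
  intro z
  have : (fun y => h (y + (0, 2*π))) = h := funext hp
  unfold _root_.D1
  rw [← fderiv_comp_add_right, this]

lemma TPer.D2 {h : E2 → ℝ} (hp : TPer h) : TPer (D2 h) := by
  intro z
  have : (fun y => h (y + (0, 2*π))) = h := funext hp
  unfold _root_.D2
  rw [← fderiv_comp_add_right, this]

lemma TPer.pi {h : E2 → ℝ} (hp : TPer h) (s : ℝ) : h (s, π) = h (s, -π) := by
  have := hp (s, -π)
  rw [← this]; congr 1; ext <;> simp; ring

lemma tper_cyl (u : E2 → ℝ) (p : E2) : TPer (u ∘ Cyl p) := by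
  intro z
  simp [Cyl]

section
variable {τ lam : ℝ} {u : E2 → ℝ} {p : E2} {a S : ℝ}

lemma Loc.U_sm (h : Loc τ lam u p a S) {z : E2} (hz : z.1 < S) : SmAt (u ∘ Cyl p) z := (h.sm z hz).cyl

lemma Loc.U_pde (h : Loc τ lam u p a S) {z : E2} (hz : z.1 < S) :
    lapp (u ∘ Cyl p) z = -(lam * exp (2*z.1) * fτ τ ((u ∘ Cyl p) z)) := by
  rw [lapp_comp_cyl (h.sm z hz), h.pde z hz]
  simp only [Function.comp]; ring

lemma Loc.as (h : Loc τ lam u p a S) : ∃ C s0, 0 ≤ C ∧ ∀ z : E2, z.1 ≤ s0 →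
    |D1 (u ∘ Cyl p) z - 2*a| ≤ C * exp z.1 ∧ |D2 (u ∘ Cyl p) z| ≤ C * exp z.1 ∧
    |D1 (D1 (u ∘ Cyl p)) z| ≤ C * exp z.1 ∧ |D2 (D1 (u ∘ Cyl p)) z| ≤ C * exp z.1 ∧
    |u (Cyl p z) - 2*a*z.1| ≤ C := by
  obtain ⟨v, hv, he⟩ := h.sing
  set v1 : E2 → ℝ := fun x => (x.1 - p.1) * D1 v x + (x.2 - p.2) * D2 v x with hv1
  have sm1 : SmAt v1 p := by
    have c1 : SmAt (fun x : E2 => x.1 - p.1) p := SmAt.of_contDiff (by fun_prop)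
    have c2 : SmAt (fun x : E2 => x.2 - p.2) p := SmAt.of_contDiff (by fun_prop)
    exact (c1.mul hv.D1).add (c2.mul hv.D2)
  obtain ⟨C1, s1, C10, h1⟩ := cyl_small hv
  obtain ⟨C2, s2, C20, h2⟩ := cyl_small sm1
  rw [eventually_nhdsWithin_iff] at he
  obtain ⟨s3, h3⟩ := cyl_ev (he.and hv.ev)
  have eqU : ∀ z : E2, z.1 ≤ s3 → u (Cyl p z) = 2*a*z.1 + v (Cyl p z) := by
    intro z hz
    rw [(h3 z hz).1 (Cyl_ne p z), nsq_cyl, log_exp]; ring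
  have ev3 : ∀ z : E2, z.1 < s3 → ∀ᶠ y : E2 in 𝓝 z, y.1 < s3 := fun z hz =>
    continuous_fst.continuousAt.eventually_lt continuousAt_const hz
  have dl : ∀ z : E2, HasDerivAt (fun s : ℝ => 2*a*s) (2*a) z.1 := fun z => by
    simpa using (hasDerivAt_id z.1).const_mul (2*a)
  have dfst : ∀ z : E2, DifferentiableAt ℝ (fun y : E2 => 2*a*y.1) z := fun z => by fun_prop
  have eU : ∀ z : E2, z.1 < s3 → D1 (u ∘ Cyl p) z = 2*a + D1 (v ∘ Cyl p) z ∧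
      D2 (u ∘ Cyl p) z = D2 (v ∘ Cyl p) z := by
    intro z hz
    have e : (u ∘ Cyl p) =ᶠ[𝓝 z] fun y => 2*a*y.1 + (v ∘ Cyl p) y := by
      filter_upwards [ev3 z hz] with y hy
      exact eqU y hy.le
    have dv : DifferentiableAt ℝ (v ∘ Cyl p) z := (h3 z hz.le).2.cyl.diff
    rw [D1_congr e, D2_congr e, D1_add (dfst z) dv, D2_add (dfst z) dv,
      D1_fst (G := fun s => 2*a*s) (dl z), D2_fst (G := fun s => 2*a*s) (dl z)]
    exact ⟨rfl, by ring⟩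
  have eV : ∀ z : E2, z.1 < s3 → D1 (u ∘ Cyl p) =ᶠ[𝓝 z] fun y => 2*a + (v1 ∘ Cyl p) y := by
    intro z hz
    filter_upwards [ev3 z hz] with y hy
    rw [(eU y hy).1, D1_comp_cyl (h3 y hy.le).2.diff]
    simp only [Function.comp, hv1, Cyl]
    ring
  refine ⟨C1 + C2, min (min s1 s2) (s3 - 1), by positivity, fun z hz => ?_⟩
  have z1 : z.1 ≤ s1 := hz.trans ((min_le_left _ _).trans (min_le_left _ _))
  have z2 : z.1 ≤ s2 := hz.trans ((min_le_left _ _).trans (min_le_right _ _))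
  have z3 : z.1 < s3 := by have := hz.trans (min_le_right _ _); linarith
  have he := exp_pos z.1
  obtain ⟨b1, b2, b3⟩ := h1 z z1
  obtain ⟨c1, c2, c3⟩ := h2 z z2
  have q1 : 0 ≤ C1 * exp z.1 := by positivity
  have q2 : 0 ≤ C2 * exp z.1 := by positivity
  by_cases hv1d : DifferentiableAt ℝ (v1 ∘ Cyl p) z
  · rw [(eU z z3).1, (eU z z3).2, D1_congr (eV z z3), D2_congr (eV z z3),
      D1_add (differentiableAt_const _) hv1d, D2_add (differentiableAt_const _) hv1d, D1_const, D2_const,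
      eqU z z3.le]
    refine ⟨?_, by linarith, ?_, ?_, ?_⟩
    · rw [add_sub_cancel_left]; linarith
    · rw [zero_add]; linarith
    · rw [zero_add]; linarith
    · rw [add_sub_cancel_left]; linarith
  · exfalso; apply hv1d
    have := (h3 z z3.le).2
    have c1 : SmAt (fun x : E2 => x.1 - p.1) (Cyl p z) := SmAt.of_contDiff (by fun_prop)
    have c2 : SmAt (fun x : E2 => x.2 - p.2) (Cyl p z) := SmAt.of_contDiff (by fun_prop)
    have q : SmAt v1 (Cyl p z) := (c1.mul this.D1).add (c2.mul this.D2)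
    exact q.cyl.diff

end

lemma cyl_ident {g1 g2 k : E2 → ℝ} {S c s0 s1 : ℝ} {χ χ' : ℝ → ℝ} (hχ : Cut χ χ' s0 s1) (hS : s1 < S)
    (h1 : ∀ z : E2, z.1 < S → SmAt g1 z) (h2 : ∀ z : E2, z.1 < S → SmAt g2 z) (hp : TPer g2)
    (hdiv : ∀ z : E2, z.1 < S → D1 g1 z + D2 g2 z = k z)
    (has : ∃ C t0, ∀ z : E2, z.1 ≤ t0 → |g1 z - c| ≤ C * exp z.1 ∧ |k z| ≤ C * exp z.1) :
    IntegrableOn (fun z => χ' z.1 * g1 z + χ z.1 * k z) strip ∧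
    ∫ z in strip, (χ' z.1 * g1 z + χ z.1 * k z) = -(2 * π * c) := by
  obtain ⟨C, t0, has⟩ := has
  have sX := cut_smAt hχ.smooth hχ.zero hS h1
  have sY := cut_smAt hχ.smooth hχ.zero hS h2
  have eq : (fun z : E2 => χ' z.1 * g1 z + χ z.1 * k z)
      = fun z => D1 (fun z => χ z.1 * g1 z) z + D2 (fun z => χ z.1 * g2 z) z := by
    ext z
    rcases lt_or_ge z.1 S with h | h
    · have dχ : DifferentiableAt ℝ (fun y : E2 => χ y.1) z := (SmAt.fst hχ.smooth).diff
      rw [D1_mul dχ (h1 z h).diff, D2_mul dχ (h2 z h).diff, D1_fst (hχ.deriv _), D2_fst (hχ.deriv _),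
        ← hdiv z h]
      ring
    · have hz : s1 < z.1 := lt_of_lt_of_le hS h
      rw [(cut_D_zero hχ.zero hz).1, (cut_D_zero hχ.zero hz).2, hχ.d1 hz.le, hχ.zero _ hz.le]
      ring
  have cont : Continuous (fun z : E2 => χ' z.1 * g1 z + χ z.1 * k z) := by
    rw [eq]
    apply Continuous.add
    · exact continuous_iff_continuousAt.2 fun z => (sX z).D1.cont
    · exact continuous_iff_continuousAt.2 fun z => (sY z).D2.cont
  have int : IntegrableOn (fun z => χ' z.1 * g1 z + χ z.1 * k z) strip := by
    refine strip_integrable cont (s1 := s1) ?_ ⟨C, min t0 s0, fun z hz => ?_⟩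
    · intro z hz
      rw [hχ.d1 hz, hχ.zero _ hz]; ring
    · have z1 := hz.trans (min_le_left _ _)
      have z2 := hz.trans (min_le_right _ _)
      rw [hχ.d0 z2, hχ.one _ z2]
      simpa using (has z z1).2
  refine ⟨int, ?_⟩
  simp only [eq] at int ⊢
  refine cyl_div_lim sX sY (s1 := s1) ?_ ?_ ?_ int
  · intro s; simp only [hp.pi s]
  · intro z hz; rw [hχ.zero _ hz, zero_mul]
  · intro e he
    have : Tendsto (fun s : ℝ => C * exp s) atBot (𝓝 (C * 0)) := tendsto_exp_atBot.const_mul C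
    rw [mul_zero] at this
    obtain ⟨t1, ht1⟩ := eventually_atBot.1 (this.eventually (gt_mem_nhds he))
    refine ⟨min (min t0 s0) t1, fun z hz => ?_⟩
    have z1 := hz.trans ((min_le_left _ _).trans (min_le_left _ _))
    have z2 := hz.trans ((min_le_left _ _).trans (min_le_right _ _))
    have z3 := hz.trans (min_le_right _ _)
    rw [hχ.one _ z2, one_mul]
    exact (has z z1).1.trans (ht1 _ z3).le

lemma exp2_le {s : ℝ} (h : s ≤ 0) : exp (2*s) ≤ exp s := exp_le_exp.2 (by linarith)

section
variable {τ lam : ℝ} {u : E2 → ℝ} {p : E2} {a S : ℝ} {χ χ' : ℝ → ℝ} {s0 s1 : ℝ}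

lemma Loc.flux (hτ : 0 < τ) (h : Loc τ lam u p a S) (hχ : Cut χ χ' s0 s1) (hS : s1 < S) :
    IntegrableOn (fun z => χ' z.1 * D1 (u ∘ Cyl p) z + χ z.1 * (-(lam * exp (2*z.1) * fτ τ (u (Cyl p z))))) strip ∧
    ∫ z in strip, (χ' z.1 * D1 (u ∘ Cyl p) z + χ z.1 * (-(lam * exp (2*z.1) * fτ τ (u (Cyl p z)))))
      = -(2 * π * (2*a)) := by
  obtain ⟨Cf, -, hCf⟩ := f_bounds hτ
  obtain ⟨C, t0, C0, has⟩ := h.as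
  refine cyl_ident hχ hS (g2 := D2 (u ∘ Cyl p)) (fun z hz => (h.U_sm hz).D1) (fun z hz => (h.U_sm hz).D2)
    (tper_cyl u p).D2 (fun z hz => h.U_pde hz) ⟨C + |lam| * Cf, min t0 0, fun z hz => ?_⟩
  have z1 := hz.trans (min_le_left _ _)
  have z2 := hz.trans (min_le_right _ _)
  have hf := (hCf (u (Cyl p z))).1
  have hm := mn_le_one (u (Cyl p z))
  have hm0 := mn_nonneg (u (Cyl p z))
  have he := exp_pos z.1
  have he2 := exp_pos (2*z.1)
  have hCf0 : 0 ≤ Cf := by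
    by_contra hc
    have := abs_nonneg (fτ τ 0)
    have := (hCf 0).1
    nlinarith [mn_pos 0]
  constructor
  · have := (has z z1).1
    have : 0 ≤ |lam| * Cf * exp z.1 := by positivity
    linarith
  · rw [abs_neg, abs_mul, abs_mul, abs_of_pos he2]
    have q : |fτ τ (u (Cyl p z))| ≤ Cf := by nlinarith
    calc |lam| * exp (2*z.1) * |fτ τ (u (Cyl p z))| ≤ |lam| * exp z.1 * Cf := by
          gcongr; linarith
      _ ≤ _ := by nlinarith [mul_nonneg C0 he.le]

lemma Loc.poho (hτ : 0 < τ) (h : Loc τ lam u p a S) (hχ : Cut χ χ' s0 s1) (hS : s1 < S) :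
    IntegrableOn (fun z => χ' z.1 * ((D1 (u ∘ Cyl p) z ^ 2 - D2 (u ∘ Cyl p) z ^ 2) * 2⁻¹
        + lam * (exp (2*z.1) * F2τ τ (u (Cyl p z))))
      + χ z.1 * (2 * lam * exp (2*z.1) * F2τ τ (u (Cyl p z)))) strip ∧
    ∫ z in strip, (χ' z.1 * ((D1 (u ∘ Cyl p) z ^ 2 - D2 (u ∘ Cyl p) z ^ 2) * 2⁻¹
        + lam * (exp (2*z.1) * F2τ τ (u (Cyl p z))))
      + χ z.1 * (2 * lam * exp (2*z.1) * F2τ τ (u (Cyl p z)))) = -(2 * π * (2*a^2)) := by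
  obtain ⟨Cf, hCf1, hCf⟩ := f_bounds hτ
  obtain ⟨C, t0, C0, has⟩ := h.as
  have sE : ∀ z : E2, SmAt (fun z : E2 => exp (2*z.1)) z := fun z => SmAt.of_contDiff (by fun_prop)
  refine cyl_ident hχ hS (g2 := fun z => D1 (u ∘ Cyl p) z * D2 (u ∘ Cyl p) z) ?_ ?_ ?_ ?_
    ⟨C * (C + 4 * |a| + 1) + C * C + 3 * |lam| * Cf, min t0 0, fun z hz => ?_⟩
  · intro z hz
    have U := h.U_sm hz
    exact (((U.D1.pow 2).sub (U.D2.pow 2)).mul (SmAt.const _)).add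
      ((SmAt.const _).mul ((sE z).mul (SmAt.comp (F_smooth hτ) U)))
  · intro z hz
    have U := h.U_sm hz
    exact U.D1.mul U.D2
  · intro z
    simp only [(tper_cyl u p).D1 z, (tper_cyl u p).D2 z]
  · intro z hz
    have U := h.U_sm hz
    have hp := h.U_pde hz
    have comm := D1D2_comm U
    have F1 : D1 (fun z => F2τ τ (u (Cyl p z))) z = fτ τ ((u ∘ Cyl p) z) * D1 (u ∘ Cyl p) z :=
      D1_comp (g := u ∘ Cyl p) (F_hasDeriv hτ _) U.diff
    have E1 : D1 (fun z : E2 => exp (2*z.1)) z = 2 * exp (2*z.1) := by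
      have : HasDerivAt (fun s => exp (2*s)) (2 * exp (2*z.1)) z.1 := by
        have := ((hasDerivAt_id z.1).const_mul 2).exp; simpa [mul_comm] using this
      exact D1_fst (G := fun s => exp (2*s)) this
    have dF : DifferentiableAt ℝ (fun z => F2τ τ (u (Cyl p z))) z := (SmAt.comp (F_smooth hτ) U).diff
    have a1 : D1 (fun z => (D1 (u ∘ Cyl p) z ^ 2 - D2 (u ∘ Cyl p) z ^ 2) * 2⁻¹
        + lam * (exp (2*z.1) * F2τ τ (u (Cyl p z)))) z
        = (D1 (u ∘ Cyl p) z * D1 (D1 (u ∘ Cyl p)) z - D2 (u ∘ Cyl p) z * D1 (D2 (u ∘ Cyl p)) z)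
         + lam * (2 * exp (2*z.1) * F2τ τ (u (Cyl p z))
            + exp (2*z.1) * (fτ τ ((u ∘ Cyl p) z) * D1 (u ∘ Cyl p) z)) := by
      rw [D1_add, D1_mul, D1_sub, D1_const, D1_cmul, D1_mul (sE z).diff dF, F1, E1]
      · have p1 : D1 (fun y => D1 (u ∘ Cyl p) y ^ 2) z = 2 * D1 (u ∘ Cyl p) z * D1 (D1 (u ∘ Cyl p)) z := by
          have := D1_comp (G := fun t => t^2) (by simpa using hasDerivAt_pow 2 (D1 (u ∘ Cyl p) z)) U.D1.diff
          simpa using this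
        have p2 : D1 (fun y => D2 (u ∘ Cyl p) y ^ 2) z = 2 * D2 (u ∘ Cyl p) z * D1 (D2 (u ∘ Cyl p)) z := by
          have := D1_comp (G := fun t => t^2) (by simpa using hasDerivAt_pow 2 (D2 (u ∘ Cyl p) z)) U.D2.diff
          simpa using this
        rw [p1, p2]; simp only [Function.comp]; ring
      · exact ((sE z).mul (SmAt.comp (F_smooth hτ) U)).diff
      · exact (U.D1.pow 2).diff
      · exact (U.D2.pow 2).diff
      · exact ((U.D1.pow 2).sub (U.D2.pow 2)).diff
      · exact differentiableAt_const _
      · exact (((U.D1.pow 2).sub (U.D2.pow 2)).mul (SmAt.const _)).diff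
      · exact ((SmAt.const _).mul ((sE z).mul (SmAt.comp (F_smooth hτ) U))).diff
    rw [a1, D2_mul U.D1.diff U.D2.diff]
    unfold lapp at hp
    have hp' : D2 (D2 (u ∘ Cyl p)) z = -(lam * exp (2*z.1) * fτ τ ((u ∘ Cyl p) z)) - D1 (D1 (u ∘ Cyl p)) z := by
      linarith
    rw [hp', comm]
    simp only [Function.comp]; ring
  · have z1 := hz.trans (min_le_left _ _)
    have z2 := hz.trans (min_le_right _ _)
    obtain ⟨b1, b2, -⟩ := has z z1
    have hF := (hCf (u (Cyl p z))).2.2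
    have hm := mn_le_one (u (Cyl p z))
    have hm0 := mn_nonneg (u (Cyl p z))
    have he := exp_pos z.1
    have he1 : exp z.1 ≤ 1 := exp_le_one_iff.2 z2
    have he2 := exp_pos (2*z.1)
    have q : |F2τ τ (u (Cyl p z))| ≤ Cf := by nlinarith
    have r : |lam * (exp (2*z.1) * F2τ τ (u (Cyl p z)))| ≤ |lam| * Cf * exp z.1 := by
      rw [abs_mul, abs_mul, abs_of_pos he2]
      calc |lam| * (exp (2*z.1) * |F2τ τ (u (Cyl p z))|) ≤ |lam| * (exp z.1 * Cf) := by
            gcongr; linarith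
        _ = _ := by ring
    have r0 : 0 ≤ |lam| * Cf * exp z.1 := (abs_nonneg _).trans r
    have x1 : |D1 (u ∘ Cyl p) z ^ 2 - 4*a^2| ≤ C * exp z.1 * (C + 4 * |a|) := by
      rw [show D1 (u ∘ Cyl p) z ^ 2 - 4*a^2 = (D1 (u ∘ Cyl p) z - 2*a) * ((D1 (u ∘ Cyl p) z - 2*a) + 4*a) by ring,
        abs_mul]
      apply mul_le_mul b1 _ (abs_nonneg _) (by positivity)
      refine (abs_add_le _ _).trans ?_
      rw [abs_mul, abs_of_pos (by norm_num : (0:ℝ) < 4)]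
      nlinarith
    have x2 : D2 (u ∘ Cyl p) z ^ 2 ≤ C * exp z.1 * C := by
      rw [← sq_abs, sq]
      apply mul_le_mul b2 _ (abs_nonneg _) (by positivity)
      nlinarith
    have y1 : 0 ≤ C * exp z.1 * (C + 4 * |a|) := by positivity
    have y2 : 0 ≤ C * exp z.1 * C := by positivity
    have y3 : 0 ≤ C * exp z.1 := by positivity
    constructor
    · rw [abs_le] at *
      constructor <;> nlinarith [sq_nonneg (D2 (u ∘ Cyl p) z)]
    · rw [show 2 * lam * exp (2*z.1) * F2τ τ (u (Cyl p z)) = 2 * (lam * (exp (2*z.1) * F2τ τ (u (Cyl p z)))) by ring,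
        abs_mul, abs_of_pos (by norm_num : (0:ℝ) < 2)]
      nlinarith
lemma Loc.vtest (hτ : 0 < τ) (h : Loc τ lam u p a S) (hχ : Cut χ χ' s0 s1) (hS : s1 < S) :
    IntegrableOn (fun z => χ' z.1 * (D1 (u ∘ Cyl p) z * D1 (D1 (u ∘ Cyl p)) z
        + 2 * lam * (exp (2*z.1) * F2τ τ (u (Cyl p z))))
      + χ z.1 * (gsq (D1 (u ∘ Cyl p)) z - lam * exp (2*z.1) * fτ' τ (u (Cyl p z)) * D1 (u ∘ Cyl p) z ^ 2
        + 4 * lam * (exp (2*z.1) * F2τ τ (u (Cyl p z))))) strip ∧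
    ∫ z in strip, (χ' z.1 * (D1 (u ∘ Cyl p) z * D1 (D1 (u ∘ Cyl p)) z
        + 2 * lam * (exp (2*z.1) * F2τ τ (u (Cyl p z))))
      + χ z.1 * (gsq (D1 (u ∘ Cyl p)) z - lam * exp (2*z.1) * fτ' τ (u (Cyl p z)) * D1 (u ∘ Cyl p) z ^ 2
        + 4 * lam * (exp (2*z.1) * F2τ τ (u (Cyl p z))))) = 0 := by
  obtain ⟨Cf, hCf1, hCf⟩ := f_bounds hτ
  obtain ⟨C, t0, C0, has⟩ := h.as
  have sE : ∀ z : E2, SmAt (fun z : E2 => exp (2*z.1)) z := fun z => SmAt.of_contDiff (by fun_prop)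
  have main := cyl_ident (c := 0) hχ hS (g1 := fun z => D1 (u ∘ Cyl p) z * D1 (D1 (u ∘ Cyl p)) z
        + 2 * lam * (exp (2*z.1) * F2τ τ (u (Cyl p z))))
      (g2 := fun z => D1 (u ∘ Cyl p) z * D2 (D1 (u ∘ Cyl p)) z)
      (k := fun z => gsq (D1 (u ∘ Cyl p)) z - lam * exp (2*z.1) * fτ' τ (u (Cyl p z)) * D1 (u ∘ Cyl p) z ^ 2
        + 4 * lam * (exp (2*z.1) * F2τ τ (u (Cyl p z)))) ?_ ?_ ?_ ?_
    ⟨(C + 2 * |a|) * C + 2 * C^2 + |lam| * Cf * (C + 2*|a|)^2 + 4 * |lam| * Cf, min t0 0, fun z hz => ?_⟩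
  · simpa using main
  · intro z hz
    have U := h.U_sm hz
    exact (U.D1.mul U.D1.D1).add
      ((SmAt.const _).mul ((sE z).mul (SmAt.comp (F_smooth hτ) U)))
  · intro z hz
    have U := h.U_sm hz
    exact U.D1.mul U.D1.D2
  · intro z
    simp only [(tper_cyl u p).D1 z, (tper_cyl u p).D1.D2 z]
  · intro z hz
    have U := h.U_sm hz
    have F1 : D1 (fun z => F2τ τ (u (Cyl p z))) z = fτ τ (u (Cyl p z)) * D1 (u ∘ Cyl p) z :=
      D1_comp (g := u ∘ Cyl p) (F_hasDeriv hτ _) U.diff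
    have f1 : D1 (fun z => fτ τ (u (Cyl p z))) z = fτ' τ (u (Cyl p z)) * D1 (u ∘ Cyl p) z :=
      D1_comp (g := u ∘ Cyl p) (f_hasDeriv hτ _) U.diff
    have E1 : D1 (fun z : E2 => exp (2*z.1)) z = 2 * exp (2*z.1) := by
      have : HasDerivAt (fun s => exp (2*s)) (2 * exp (2*z.1)) z.1 := by
        have := ((hasDerivAt_id z.1).const_mul 2).exp; simpa [mul_comm] using this
      exact D1_fst (G := fun s => exp (2*s)) this
    have sF : SmAt (fun z => F2τ τ (u (Cyl p z))) z := SmAt.comp (F_smooth hτ) U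
    have sf : SmAt (fun z => fτ τ (u (Cyl p z))) z := SmAt.comp (f_smooth hτ) U
    have hV : lapp (D1 (u ∘ Cyl p)) z = -lam * (2 * exp (2*z.1) * fτ τ (u (Cyl p z))
        + exp (2*z.1) * (fτ' τ (u (Cyl p z)) * D1 (u ∘ Cyl p) z)) := by
      rw [D1_lapp U]
      have e : lapp (u ∘ Cyl p) =ᶠ[𝓝 z] fun z => -lam * (exp (2*z.1) * fτ τ (u (Cyl p z))) := by
        have : ∀ᶠ y : E2 in 𝓝 z, y.1 < S := continuous_fst.continuousAt.eventually_lt continuousAt_const hz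
        filter_upwards [this] with y hy
        rw [h.U_pde hy]; simp only [Function.comp]; ring
      rw [D1_congr e, D1_cmul _ ((sE z).mul sf).diff, D1_mul (sE z).diff sf.diff, E1, f1]
    rw [D1_add (U.D1.mul U.D1.D1).diff ((SmAt.const _).mul ((sE z).mul sF)).diff,
      D1_mul U.D1.diff U.D1.D1.diff, D1_cmul _ ((sE z).mul sF).diff, D1_mul (sE z).diff sF.diff, E1, F1,
      D2_mul U.D1.diff U.D1.D2.diff]
    unfold lapp at hV
    have hV' : D2 (D2 (D1 (u ∘ Cyl p))) z = -lam * (2 * exp (2*z.1) * fτ τ (u (Cyl p z))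
        + exp (2*z.1) * (fτ' τ (u (Cyl p z)) * D1 (u ∘ Cyl p) z)) - D1 (D1 (D1 (u ∘ Cyl p))) z := by
      linarith
    rw [hV']
    unfold gsq
    ring
  · have z1 := hz.trans (min_le_left _ _)
    have z2 := hz.trans (min_le_right _ _)
    obtain ⟨b1, b2, b3, b4, -⟩ := has z z1
    have hF := (hCf (u (Cyl p z))).2.2
    have hf := (hCf (u (Cyl p z))).2.1
    have hm := mn_le_one (u (Cyl p z))
    have hm0 := mn_nonneg (u (Cyl p z))
    have he := exp_pos z.1
    have he1 : exp z.1 ≤ 1 := exp_le_one_iff.2 z2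
    have he2 := exp_pos (2*z.1)
    have hee := exp2_le z2
    have q : |F2τ τ (u (Cyl p z))| ≤ Cf := by nlinarith
    have q' : |fτ' τ (u (Cyl p z))| ≤ Cf := by nlinarith
    have r : |lam * (exp (2*z.1) * F2τ τ (u (Cyl p z)))| ≤ |lam| * Cf * exp z.1 := by
      rw [abs_mul, abs_mul, abs_of_pos he2]
      calc |lam| * (exp (2*z.1) * |F2τ τ (u (Cyl p z))|) ≤ |lam| * (exp z.1 * Cf) := by
            gcongr
        _ = _ := by ring
    have v1 : |D1 (u ∘ Cyl p) z| ≤ C + 2 * |a| := by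
      have : |2 * a| = 2 * |a| := by rw [abs_mul, abs_of_pos (by norm_num : (0:ℝ) < 2)]
      have := abs_sub_abs_le_abs_sub (D1 (u ∘ Cyl p) z) (2*a)
      nlinarith
    have v2 : |D1 (u ∘ Cyl p) z * D1 (D1 (u ∘ Cyl p)) z| ≤ (C + 2 * |a|) * C * exp z.1 := by
      rw [abs_mul, mul_assoc]
      exact mul_le_mul v1 b3 (abs_nonneg _) (by positivity)
    have v3 : ∀ w : ℝ, |w| ≤ C * exp z.1 → w^2 ≤ C^2 * exp z.1 := by
      intro w hw
      rw [← sq_abs, sq, sq]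
      have := mul_le_mul hw hw (abs_nonneg _) (by positivity)
      nlinarith [mul_nonneg (mul_nonneg C0 C0) he.le]
    have v4 := v3 _ b3
    have v5 := v3 _ b4
    have v6 : |lam * exp (2*z.1) * fτ' τ (u (Cyl p z)) * D1 (u ∘ Cyl p) z ^ 2| ≤
        |lam| * Cf * (C + 2*|a|)^2 * exp z.1 := by
      rw [abs_mul, abs_mul, abs_mul, abs_of_pos he2, abs_pow]
      calc |lam| * exp (2*z.1) * |fτ' τ (u (Cyl p z))| * |D1 (u ∘ Cyl p) z| ^ 2
          ≤ |lam| * exp z.1 * Cf * (C + 2*|a|)^2 := by gcongr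
        _ = _ := by ring
    have w1 : 0 ≤ (C + 2 * |a|) * C * exp z.1 := by positivity
    have w2 : 0 ≤ C^2 * exp z.1 := by positivity
    have w3 : 0 ≤ |lam| * Cf * (C + 2*|a|)^2 * exp z.1 := (abs_nonneg _).trans v6
    have w4 : 0 ≤ |lam| * Cf * exp z.1 := (abs_nonneg _).trans r
    unfold gsq
    have ex : ((C + 2 * |a|) * C + 2 * C^2 + |lam| * Cf * (C + 2*|a|)^2 + 4 * |lam| * Cf) * exp z.1
      = (C + 2 * |a|) * C * exp z.1 + 2 * (C^2 * exp z.1) + |lam| * Cf * (C + 2*|a|)^2 * exp z.1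
        + 4 * (|lam| * Cf * exp z.1) := by ring
    rw [ex, mul_assoc 2 lam, mul_assoc 4 lam]
    have n1 := sq_nonneg (D1 (D1 (u ∘ Cyl p)) z)
    have n2 := sq_nonneg (D2 (D1 (u ∘ Cyl p)) z)
    rw [abs_le] at v6 r v2
    constructor
    · rw [abs_le]
      constructor <;> linarith
    · rw [abs_le]
      constructor <;> linarith
end

def Zs {ι : Type} (P : ι → E2) : Set E2 := {x | ∃ i k, x = P i + lat k}

structure Sol {ι : Type} (P : ι → E2) (a : ι → ℝ) (τ lam : ℝ) (u : E2 → ℝ) : Prop where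
  per : Per u
  sm : ∀ x ∉ Zs P, SmAt u x
  pde : ∀ x ∉ Zs P, lapp u x = -(lam * fτ τ (u x))
  sing : ∀ i, ∃ v : E2 → ℝ, SmAt v (P i) ∧ ∀ᶠ x in 𝓝[≠] (P i), u x = a i * log (nsq (x - P i)) + v x

def StabS (τ lam : ℝ) (u : E2 → ℝ) : Prop :=
  ∀ φ : E2 → ℝ, ContDiff ℝ (⊤ : ℕ∞) φ → Per φ → 0 ≤ ∫ x in QQ, (gsq φ x - lam * fτ' τ (u x) * φ x ^ 2)

/-- separation of the points -/
structure Sepa {ι : Type} (P : ι → E2) (ρ : ℝ) : Prop where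
  pos : 0 < ρ
  small : ρ ≤ 1/16
  sep : ∀ i j k, nsq (P i - (P j + lat k)) < (4*ρ)^2 → i = j ∧ k = 0

lemma lat_add (k l : ℤ × ℤ) : lat (k + l) = lat k + lat l := by
  simp [lat]
lemma lat_neg (k : ℤ × ℤ) : lat (-k) = -lat k := by simp [lat]
lemma lat_zero : lat 0 = 0 := by simp [lat]
lemma lat_inj {k l : ℤ × ℤ} (h : lat k = lat l) : k = l := by
  simp [lat] at h
  exact Prod.ext h.1 h.2

lemma sep_exists {ι : Type} [Finite ι] (P : ι → E2) (h : ∀ i j k, P i = P j + lat k → i = j) :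
    ∃ ρ, Sepa P ρ := by
  have fin : ∀ i j, {k : ℤ × ℤ | nsq (P i - (P j + lat k)) < 1}.Finite := by
    intro i j
    set d := P i - P j
    have : {k : ℤ × ℤ | nsq (P i - (P j + lat k)) < 1} ⊆
        (Icc (⌊d.1⌋ - 1) (⌊d.1⌋ + 2)) ×ˢ (Icc (⌊d.2⌋ - 1) (⌊d.2⌋ + 2)) := by
      intro k hk
      have hk' : (d.1 - k.1)^2 + (d.2 - k.2)^2 < 1 := by
        have : nsq (P i - (P j + lat k)) < 1 := hk
        simp only [nsq, lat, Prod.fst_sub, Prod.snd_sub, Prod.fst_add, Prod.snd_add] at this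
        simp only [d, Prod.fst_sub, Prod.snd_sub]
        convert this using 3 <;> ring
      have b1 : |d.1 - k.1| < 1 := by
        rw [← sq_lt_one_iff_abs_lt_one]; nlinarith [sq_nonneg (d.2 - k.2)]
      have b2 : |d.2 - k.2| < 1 := by
        rw [← sq_lt_one_iff_abs_lt_one]; nlinarith [sq_nonneg (d.1 - k.1)]
      rw [abs_lt] at b1 b2
      have f1 := Int.floor_le d.1
      have f2 := Int.lt_floor_add_one d.1
      have f3 := Int.floor_le d.2
      have f4 := Int.lt_floor_add_one d.2
      refine ⟨⟨?_, ?_⟩, ⟨?_, ?_⟩⟩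
      · have : ((⌊d.1⌋ - 1 : ℤ) : ℝ) < k.1 := by push_cast; linarith
        exact_mod_cast this.le
      · have : (k.1 : ℝ) < ((⌊d.1⌋ + 2 : ℤ) : ℝ) := by push_cast; linarith
        exact_mod_cast this.le
      · have : ((⌊d.2⌋ - 1 : ℤ) : ℝ) < k.2 := by push_cast; linarith
        exact_mod_cast this.le
      · have : (k.2 : ℝ) < ((⌊d.2⌋ + 2 : ℤ) : ℝ) := by push_cast; linarith
        exact_mod_cast this.le
    exact ((finite_Icc _ _).prod (finite_Icc _ _)).subset this
  have key : ∀ᶠ ρ : ℝ in 𝓝[>] 0, ∀ i j, ∀ k ∈ {k : ℤ × ℤ | nsq (P i - (P j + lat k)) < 1},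
      nsq (P i - (P j + lat k)) < (4*ρ)^2 → i = j ∧ k = 0 := by
    rw [eventually_all]; intro i
    rw [eventually_all]; intro j
    rw [eventually_all_finite (fin i j)]
    intro k _
    by_cases hc : i = j ∧ k = 0
    · exact Eventually.of_forall fun _ _ => hc
    · have hne : P i - (P j + lat k) ≠ 0 := by
        intro h0
        have h1 := sub_eq_zero.1 h0
        have hij := h i j k h1
        refine hc ⟨hij, ?_⟩
        rw [hij] at h1
        have : lat k = lat 0 := by rw [lat_zero]; exact (left_eq_add.1 h1)
        exact lat_inj this
      have hpos := nsq_pos hne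
      have t : Tendsto (fun ρ : ℝ => (4*ρ)^2) (𝓝[>] 0) (𝓝 0) := by
        have : Continuous fun ρ : ℝ => (4*ρ)^2 := by fun_prop
        have := this.tendsto 0
        simp only [mul_zero, ne_eq, OfNat.ofNat_ne_zero, not_false_eq_true, zero_pow] at this
        exact this.mono_left nhdsWithin_le_nhds
      filter_upwards [t.eventually (gt_mem_nhds hpos)] with ρ hρ hlt
      exact absurd hlt (not_lt.2 (le_of_lt hρ))
  have k2 : ∀ᶠ ρ : ℝ in 𝓝[>] 0, ρ ∈ Ioc (0:ℝ) (1/16) := Ioc_mem_nhdsGT (by norm_num)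
  obtain ⟨ρ, h1, h2⟩ := (key.and k2).exists
  refine ⟨ρ, h2.1, h2.2, fun i j k hk => h1 i j k ?_ hk⟩
  have h3 := h2.1
  have h4 := h2.2
  show nsq (P i - (P j + lat k)) < 1
  nlinarith

section
variable {ι : Type} {P : ι → E2} {a : ι → ℝ} {τ lam : ℝ} {u : E2 → ℝ} {ρ : ℝ}

lemma Zs_countable [Countable ι] : (Zs P).Countable := by
  have : Zs P = range (fun q : ι × (ℤ × ℤ) => P q.1 + lat q.2) := by
    ext x
    constructor
    · rintro ⟨i, k, rfl⟩; exact ⟨(i, k), rfl⟩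
    · rintro ⟨⟨i, k⟩, rfl⟩; exact ⟨i, k, rfl⟩
  rw [this]; exact countable_range _

lemma Zs_null [Countable ι] : volume (Zs P) = 0 := Zs_countable.measure_zero _

lemma Zs_ae [Countable ι] : ∀ᵐ x : E2, x ∉ Zs P := by
  rw [ae_iff]; simpa using Zs_null (P := P)

lemma Zs_add {x : E2} (k : ℤ × ℤ) : x + lat k ∈ Zs P ↔ x ∈ Zs P := by
  constructor
  · rintro ⟨i, l, h⟩
    refine ⟨i, l - k, ?_⟩
    rw [sub_eq_add_neg, lat_add, lat_neg, ← add_assoc, ← h]; simp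
  · rintro ⟨i, l, rfl⟩
    exact ⟨i, l + k, by rw [lat_add, add_assoc]⟩

lemma P_mem (i : ι) : P i ∈ Zs P := ⟨i, 0, by rw [lat_zero, add_zero]⟩

/-- points near P i are not in Zs -/
lemma Sepa.near (h : Sepa P ρ) {i : ι} {x : E2} (hx : nsq (x - P i) < (4*ρ)^2) (hz : x ∈ Zs P) : x = P i := by
  obtain ⟨j, k, rfl⟩ := hz
  have : nsq (P i - (P j + lat k)) < (4*ρ)^2 := by
    convert hx using 1
    simp only [nsq, Prod.fst_sub, Prod.snd_sub]; ring
  obtain ⟨rfl, rfl⟩ := h.sep i j k this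
  simp [lat_zero]

lemma Sepa.isOpen (h : Sepa P ρ) : IsOpen (Zs P)ᶜ := by
  rw [isOpen_iff_mem_nhds]
  intro x hx
  by_contra hn
  have hcl : ∀ δ > 0, ∃ y ∈ Zs P, nsq (y - x) < δ := by
    intro δ hδ
    by_contra hc
    push Not at hc
    apply hn
    have : ∀ᶠ y in 𝓝 x, nsq (y - x) < δ := by
      apply (nsq_cont.comp (continuous_id.sub continuous_const)).continuousAt.eventually_lt
        continuousAt_const
      simpa [nsq] using hδ
    filter_upwards [this] with y hy hyz
    exact absurd hy (not_lt.2 (hc y hyz))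
  have hp := h.pos
  obtain ⟨y, hy, hyx⟩ := hcl (ρ^2) (by positivity)
  have hxy : 0 < nsq (y - x) := nsq_pos (fun h0 => hx (by rw [← sub_eq_zero.1 h0]; exact hy))
  obtain ⟨y', hy', hyx'⟩ := hcl (min (ρ^2) (nsq (y - x))) (lt_min (by positivity) hxy)
  obtain ⟨i, k, rfl⟩ := hy
  have h1 := hyx'.trans_le (min_le_left _ _)
  have h2 := hyx'.trans_le (min_le_right _ _)
  have : y' + lat (-k) = P i := by
    refine h.near ?_ ((Zs_add _).2 hy')
    simp only [nsq, Prod.fst_sub, Prod.snd_sub, Prod.fst_add, Prod.snd_add, lat_neg, Prod.fst_neg, Prod.snd_neg] at *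
    nlinarith [sq_nonneg ((y'.1 - x.1) + ((P i).1 + (lat k).1 - x.1)), sq_nonneg ((y'.2 - x.2) + ((P i).2 + (lat k).2 - x.2))]
  have e : y' = P i + lat k := by rw [← this, lat_neg]; simp
  rw [e] at h2
  exact lt_irrefl _ h2

lemma Sol.loc (hs : Sol P a τ lam u) (h : Sepa P ρ) (i : ι) : Loc τ lam u (P i) (a i) (log (4*ρ)) := by
  have hp := h.pos
  have key : ∀ z : E2, z.1 < log (4*ρ) → Cyl (P i) z ∉ Zs P := by
    intro z hz hm
    refine Cyl_ne (P i) z (h.near ?_ hm)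
    rw [nsq_cyl, two_mul, exp_add, ← sq]
    have := exp_lt_exp.2 hz
    rw [exp_log (by positivity)] at this
    exact pow_lt_pow_left₀ this (exp_pos _).le (by norm_num)
  exact ⟨fun z hz => hs.sm _ (key z hz), fun z hz => hs.pde _ (key z hz), hs.sing i⟩

/-- regular points -/
lemma Sol.loc_reg (hs : Sol P a τ lam u) {q : E2} {R : ℝ} (hR : 0 < R)
    (hq : ∀ x, nsq (x - q) < R^2 → x ∉ Zs P) : Loc τ lam u q 0 (log R) := by
  have key : ∀ z : E2, z.1 < log R → Cyl q z ∉ Zs P := by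
    intro z hz
    apply hq
    rw [nsq_cyl, two_mul, exp_add, ← sq]
    have := exp_lt_exp.2 hz
    rw [exp_log (by positivity)] at this
    exact pow_lt_pow_left₀ this (exp_pos _).le (by norm_num)
  refine ⟨fun z hz => hs.sm _ (key z hz), fun z hz => hs.pde _ (key z hz), u, hs.sm q (hq q ?_), ?_⟩
  · simp [nsq]; positivity
  · exact Eventually.of_forall fun x => by ring

lemma Sol.aesm [Countable ι] (hs : Sol P a τ lam u) (h : Sepa P ρ) : AEStronglyMeasurable u volume := by
  have c : ContinuousOn u (Zs P)ᶜ := fun x hx => (hs.sm x hx).cont.continuousWithinAt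
  have := c.aestronglyMeasurable (μ := volume) h.isOpen.measurableSet
  rwa [Measure.restrict_eq_self_of_ae_mem] at this
  exact Zs_ae

lemma per_near {w : E2 → ℝ} (hw : Per w) {Q : E2 → ℝ → Prop} (x : E2) (k : ℤ × ℤ)
    (hQ : ∀ᶠ y in 𝓝 x, Q y (w y)) : ∀ᶠ y in 𝓝 (x + lat k), Q (y - lat k) (w y) := by
  have t : Tendsto (fun y => y - lat k) (𝓝 (x + lat k)) (𝓝 x) := by
    have : Continuous fun y : E2 => y - lat k := by fun_prop
    have := this.tendsto (x + lat k)
    simpa using this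
  filter_upwards [t.eventually hQ] with y hy
  have := hw (y - lat k) k
  rw [sub_add_cancel] at this
  rwa [this]

/-- u tends to ∓∞ at singular points -/
lemma Sol.to_inf (hs : Sol P a τ lam u) (i : ι) (M : ℝ) : ∀ᶠ x in 𝓝[≠] (P i),
    (0 < a i → u x < -M) ∧ (a i < 0 → M < u x) := by
  obtain ⟨v, hv, he⟩ := hs.sing i
  have hb : ∀ᶠ x in 𝓝[≠] (P i), |v x - v (P i)| < 1 := by
    apply Filter.Eventually.filter_mono nhdsWithin_le_nhds
    have := (hv.cont.sub (continuousAt_const (y := v (P i)))).abs.eventually_lt (continuousAt_const (y := (1:ℝ)))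
      (by simp)
    exact this
  have t0 : Tendsto (fun x => nsq (x - P i)) (𝓝[≠] (P i)) (𝓝[≠] 0) := by
    rw [tendsto_nhdsWithin_iff]
    constructor
    · have : Continuous fun x => nsq (x - P i) := nsq_cont.comp (by fun_prop)
      have := this.tendsto (P i)
      simp only [sub_self] at this
      rw [show nsq 0 = 0 by simp [nsq]] at this
      exact this.mono_left nhdsWithin_le_nhds
    · filter_upwards [self_mem_nhdsWithin] with x hx
      exact (nsq_pos (sub_ne_zero.2 hx)).ne'
  have t1 := Real.tendsto_log_nhdsNE_zero.comp t0
  rcases lt_trichotomy (a i) 0 with h | h | h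
  · have := (t1.const_mul_atBot_of_neg h).eventually (eventually_gt_atTop (M + 1 + |v (P i)|))
    filter_upwards [he, hb, this] with x h1 h2 h3
    refine ⟨fun h' => absurd h' (by linarith), fun _ => ?_⟩
    simp only [Function.comp] at h3
    rw [h1]
    rw [abs_lt] at h2
    have := neg_abs_le (v (P i))
    linarith
  · exact Eventually.of_forall fun x => ⟨fun h' => by linarith, fun h' => by linarith⟩
  · have := (t1.const_mul_atBot h).eventually (eventually_lt_atBot (-(M + 1 + |v (P i)|)))
    filter_upwards [he, hb, this] with x h1 h2 h3
    refine ⟨fun _ => ?_, fun h' => absurd h' (by linarith)⟩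
    simp only [Function.comp] at h3
    rw [h1]
    rw [abs_lt] at h2
    have := le_abs_self (v (P i))
    linarith
end

structure Adm {ι : Type} (P : ι → E2) (W : E2 → ℝ) : Prop where
  sm : ContDiff ℝ (⊤ : ℕ∞) W
  per : Per W
  loc : ∀ i, ∀ᶠ x in 𝓝 (P i), W x = W (P i)

/-- gradient product -/
def gp (g h : E2 → ℝ) (x : E2) : ℝ := D1 g x * D1 h x + D2 g x * D2 h x

section
variable {ι : Type} {P : ι → E2} {a : ι → ℝ} {τ lam : ℝ} {u : E2 → ℝ} {ρ : ℝ}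

lemma gp_comp_cyl {g h : E2 → ℝ} {p z : E2} (hg : DifferentiableAt ℝ g (Cyl p z))
    (hh : DifferentiableAt ℝ h (Cyl p z)) :
    gp (g ∘ Cyl p) (h ∘ Cyl p) z = exp (2 * z.1) * gp g h (Cyl p z) := by
  unfold gp
  rw [D1_comp_cyl hg, D1_comp_cyl hh, D2_comp_cyl hg, D2_comp_cyl hh, two_mul, exp_add]
  have := sin_sq_add_cos_sq z.2
  have e : sin z.2 ^ 2 = 1 - cos z.2 ^ 2 := by linarith
  ring_nf
  rw [e]; ring

lemma Adm.const (c : ℝ) : Adm P (fun _ => c) :=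
  ⟨contDiff_const, fun _ _ => rfl, fun _ => Eventually.of_forall fun _ => rfl⟩

lemma Adm.add {W X : E2 → ℝ} (hW : Adm P W) (hX : Adm P X) : Adm P (fun x => W x + X x) :=
  ⟨hW.sm.add hX.sm, fun x k => by simp only [hW.per x k, hX.per x k], fun i => by
    filter_upwards [hW.loc i, hX.loc i] with x h1 h2; rw [h1, h2]⟩

lemma Adm.cmul {W : E2 → ℝ} (c : ℝ) (hW : Adm P W) : Adm P (fun x => c * W x) :=
  ⟨contDiff_const.mul hW.sm, fun x k => by simp only [hW.per x k], fun i => by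
    filter_upwards [hW.loc i] with x h1; rw [h1]⟩

lemma Adm.loc' {W : E2 → ℝ} (hW : Adm P W) {x : E2} (hx : x ∈ Zs P) : ∀ᶠ y in 𝓝 x, W y = W x := by
  obtain ⟨i, k, rfl⟩ := hx
  have := per_near hW.per (Q := fun _ c => c = W (P i)) (P i) k (hW.loc i)
  rw [hW.per]; exact this

lemma gp_per {g h : E2 → ℝ} (hg : Per g) (hh : Per h) : Per (gp g h) := fun x k => by
  simp only [gp, D1_add_lat hg x k, D1_add_lat hh x k, D2_add_lat hg x k, D2_add_lat hh x k]

lemma Adm.gp_zero {W : E2 → ℝ} (hW : Adm P W) {x : E2} (hx : x ∈ Zs P) (u : E2 → ℝ) : 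
    ∀ᶠ y in 𝓝 x, gp W u y = 0 := by
  have e : W =ᶠ[𝓝 x] fun _ => W x := hW.loc' hx
  filter_upwards [D1_congr' e, D2_congr' e] with y h1 h2
  rw [gp, h1, h2, D1_const, D2_const]; ring

lemma Adm.gcont {W : E2 → ℝ} (hW : Adm P W) (hs : Sol P a τ lam u) : Continuous (gp W u) := by
  rw [continuous_iff_continuousAt]
  intro x
  by_cases hx : x ∈ Zs P
  · exact (continuousAt_const (y := (0:ℝ))).congr (EventuallyEq.symm (hW.gp_zero hx u))
  · have h1 := (SmAt.of_contDiff (x := x) hW.sm)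
    have h2 := hs.sm x hx
    exact (h1.D1.cont.mul h2.D1.cont).add (h1.D2.cont.mul h2.D2.cont)

lemma cont_int {g : E2 → ℝ} (hg : Continuous g) (c : E2) : IntegrableOn g (cell c) :=
  (hg.continuousOn.integrableOn_compact isCompact_Icc).mono_set (cell_sub_Icc c)

lemma QQ_int {g : E2 → ℝ} (hg : Continuous g) : IntegrableOn g QQ := cont_int hg 0

lemma QQ_fin : IsFiniteMeasure (volume.restrict QQ) := ⟨by
  rw [Measure.restrict_apply_univ]; unfold QQ; rw [cell_vol]; simp⟩

/-- continuous bounded functions of u are integrable -/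
lemma Sol.int_comp [Countable ι] (hs : Sol P a τ lam u) (h : Sepa P ρ) {G : ℝ → ℝ} (hG : Continuous G) {C : ℝ} (hC : ∀ t, |G t| ≤ C)
    {W : E2 → ℝ} (hW : Continuous W) : IntegrableOn (fun x => W x * G (u x)) QQ := by
  have i1 : IntegrableOn W QQ := cont_int hW 0
  have m : AEStronglyMeasurable (fun x => G (u x)) (volume.restrict QQ) :=
    (hG.comp_aestronglyMeasurable (hs.aesm h)).restrict
  exact i1.mul_bdd (c := C) m (Eventually.of_forall fun x => by simpa using hC (u x))

lemma f_bdd (hτ : 0 < τ) : ∃ C, ∀ t, |fτ τ t| ≤ C := by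
  obtain ⟨C, hC, h⟩ := f_bounds hτ
  exact ⟨C, fun t => (h t).1.trans (by nlinarith [mn_le_one t, mn_nonneg t])⟩

lemma f_cont (hτ : 0 < τ) : Continuous (fτ τ) := (f_smooth hτ).continuous

lemma Sol.int_f [Countable ι] (hτ : 0 < τ) (hs : Sol P a τ lam u) (h : Sepa P ρ) {W : E2 → ℝ} (hW : Continuous W) :
    IntegrableOn (fun x => W x * fτ τ (u x)) QQ := by
  obtain ⟨C, hC⟩ := f_bdd hτ
  exact hs.int_comp h (f_cont hτ) hC hW

def IWf (τ lam : ℝ) (u W : E2 → ℝ) : ℝ := (∫ x in QQ, gp W u x) - lam * ∫ x in QQ, W x * fτ τ (u x)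

lemma IW_zero (hs : Sol P a τ lam u) {W : E2 → ℝ} (hW : Adm P W) (h : Sepa P ρ) [Countable ι] (hτ : 0 < τ)
    (h0 : ∀ i, W (P i) = 0) : IWf τ lam u W = 0 := by
  have hz : ∀ x ∈ Zs P, ∀ᶠ y in 𝓝 x, W y = 0 := by
    intro x hx
    have := hW.loc' hx
    obtain ⟨i, k, rfl⟩ := hx
    rwa [hW.per, h0 i] at this
  have smx : ∀ g : E2 → ℝ, (∀ x ∉ Zs P, SmAt g x) → ContDiff ℝ 1 (fun x => W x * g x) := by
    intro g hg
    rw [contDiff_iff_contDiffAt]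
    intro x
    by_cases hx : x ∈ Zs P
    · have : (fun x => W x * g x) =ᶠ[𝓝 x] fun _ => 0 := by
        filter_upwards [hz x hx] with y hy; rw [hy, zero_mul]
      exact contDiffAt_const.congr_of_eventuallyEq this
    · exact ((SmAt.of_contDiff hW.sm).mul (hg x hx)).cd.of_le (by norm_cast)
  have key := torus_div (smx (D1 u) fun x hx => (hs.sm x hx).D1) (smx (D2 u) fun x hx => (hs.sm x hx).D2)
    (fun x k => by simp only [hW.per x k, D1_add_lat hs.per x k]) (fun x k => by simp only [hW.per x k, D2_add_lat hs.per x k])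
  have e : ∀ x, D1 (fun x => W x * D1 u x) x + D2 (fun x => W x * D2 u x) x = gp W u x - lam * (W x * fτ τ (u x)) := by
    intro x
    by_cases hx : x ∈ Zs P
    · have e1 : ∀ g : E2 → ℝ, (fun x => W x * g x) =ᶠ[𝓝 x] fun _ => 0 := by
        intro g
        filter_upwards [hz x hx] with y hy; rw [hy, zero_mul]
      rw [D1_congr (e1 _), D2_congr (e1 _), D1_const, D2_const, (hW.gp_zero hx u).self_of_nhds, (hz x hx).self_of_nhds]
      simp
    · have h1 := (SmAt.of_contDiff (x := x) hW.sm)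
      have h2 := hs.sm x hx
      rw [D1_mul h1.diff h2.D1.diff, D2_mul h1.diff h2.D2.diff]
      have := hs.pde x hx
      unfold lapp at this
      unfold gp
      linear_combination W x * this
  simp only [e] at key
  rw [integral_sub (QQ_int (hW.gcont hs)) ((hs.int_f hτ h hW.sm.continuous).const_mul lam), integral_const_mul] at key
  exact key

lemma cut_exists {s0 s1 : ℝ} (h : s0 < s1) : ∃ χ χ' : ℝ → ℝ, Cut χ χ' s0 s1 := by
  have hd : 0 < s1 - s0 := by linarith
  have hsm : ContDiff ℝ (⊤ : ℕ∞) (fun s : ℝ => Real.smoothTransition ((s1 - s) / (s1 - s0))) :=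
    Real.smoothTransition.contDiff.comp ((contDiff_const.sub contDiff_id).div_const _)
  refine ⟨fun s => Real.smoothTransition ((s1 - s) / (s1 - s0)), deriv _, hsm,
    fun s => ((hsm.differentiable (by norm_num)) s).hasDerivAt, fun s hs => ?_, fun s hs => ?_,
    fun s => Real.smoothTransition.nonneg _, fun s => Real.smoothTransition.le_one _⟩
  · exact Real.smoothTransition.one_of_one_le ((one_le_div hd).2 (by linarith))
  · exact Real.smoothTransition.zero_of_nonpos (div_nonpos_of_nonpos_of_nonneg (by linarith) hd.le)

lemma gp_add {g h v : E2 → ℝ} {x : E2} (hg : DifferentiableAt ℝ g x) (hh : DifferentiableAt ℝ h x) :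
    gp (fun y => g y + h y) v x = gp g v x + gp h v x := by
  unfold gp; rw [D1_add hg hh, D2_add hg hh]; ring
lemma gp_cmul {g v : E2 → ℝ} {x : E2} (c : ℝ) (hg : DifferentiableAt ℝ g x) :
    gp (fun y => c * g y) v x = c * gp g v x := by
  unfold gp; rw [D1_cmul c hg, D2_cmul c hg]; ring

lemma IW_add (hs : Sol P a τ lam u) {W X : E2 → ℝ} (hW : Adm P W) (hX : Adm P X) (h : Sepa P ρ) [Countable ι] (hτ : 0 < τ) (c : ℝ) :
    IWf τ lam u (fun x => W x + c * X x) = IWf τ lam u W + c * IWf τ lam u X := by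
  have dW : ∀ x, DifferentiableAt ℝ W x := fun x => (SmAt.of_contDiff (x := x) hW.sm).diff
  have dX : ∀ x, DifferentiableAt ℝ X x := fun x => (SmAt.of_contDiff (x := x) hX.sm).diff
  unfold IWf
  have e : ∀ x, gp (fun x => W x + c * X x) u x = gp W u x + c * gp X u x := fun x => by
    rw [gp_add (dW x) ((dX x).const_mul c), gp_cmul c (dX x)]
  simp only [e, add_mul, mul_assoc]
  rw [integral_add (QQ_int (hW.gcont hs)) ((QQ_int (hX.gcont hs)).const_mul c),
    integral_add (hs.int_f hτ h hW.sm.continuous) ((hs.int_f hτ h hX.sm.continuous).const_mul c), integral_const_mul,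
    integral_const_mul]
  ring

/-- The radial cutoff periodized -/
lemma nsq_max {y : E2} {r : ℝ} (hr : 0 ≤ r) (h : r < max |y.1| |y.2|) : r^2 < nsq y := by
  unfold nsq
  rcases lt_max_iff.1 h with h | h
  · have := pow_lt_pow_left₀ h hr (n := 2) (by norm_num)
    rw [sq_abs] at this; nlinarith [sq_nonneg y.2]
  · have := pow_lt_pow_left₀ h hr (n := 2) (by norm_num)
    rw [sq_abs] at this; nlinarith [sq_nonneg y.1]

lemma exp_two_log {r : ℝ} (hr : 0 < r) : exp (2 * log r) = r^2 := by
  rw [two_mul, exp_add, exp_log hr, sq]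

/-- basic facts about pz of functions supported in a disc of radius r ≤ 1/4 -/
lemma supp_disc {p : E2} {g : E2 → ℝ} {r : ℝ} (hr : 0 ≤ r) (hg : ∀ x, r^2 ≤ nsq (x - p) → g x = 0) :
    ∀ x, r < max |x.1 - p.1| |x.2 - p.2| → g x = 0 := fun x hx => hg x (nsq_max (y := x - p) hr hx).le

lemma pz_disc {p : E2} {g : E2 → ℝ} {r : ℝ} (hr : 0 ≤ r) (hr' : r < 1/2) (hg : ∀ x, r^2 ≤ nsq (x - p) → g x = 0)
    (x : E2) (h : ∀ k, r^2 ≤ nsq (x + lat k - p)) : pz p g x = 0 := by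
  rcases pz_local hr' (supp_disc hr hg) x with h1 | ⟨k, hk, h1⟩
  · exact h1.self_of_nhds
  · rw [h1.self_of_nhds]; exact hg _ (h k)


lemma pz_ev {p : E2} {g : E2 → ℝ} {x : E2} (h1 : |x.1 - p.1| < 1/2) (h2 : |x.2 - p.2| < 1/2) :
    pz p g =ᶠ[𝓝 x] g := by
  have c1 : ∀ᶠ y : E2 in 𝓝 x, |y.1 - p.1| < 1/2 :=
    ContinuousAt.eventually_lt (by fun_prop) continuousAt_const h1
  have c2 : ∀ᶠ y : E2 in 𝓝 x, |y.2 - p.2| < 1/2 :=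
    ContinuousAt.eventually_lt (by fun_prop) continuousAt_const h2
  filter_upwards [c1, c2] with y h1 h2 using pz_eq h1 h2

lemma ev_zero {p : E2} {g : E2 → ℝ} {r : ℝ} (hg : ∀ x, r ≤ nsq (x - p) → g x = 0) {x : E2}
    (hx : r < nsq (x - p)) : g =ᶠ[𝓝 x] fun _ => 0 := by
  have : ∀ᶠ y in 𝓝 x, r < nsq (y - p) :=
    ContinuousAt.eventually_lt continuousAt_const
      (nsq_cont.comp (continuous_id.sub continuous_const)).continuousAt hx
  filter_upwards [this] with y hy using hg y hy.le

lemma box_nsq {p x : E2} (h : 1/2 ≤ |x.1 - p.1| ∨ 1/2 ≤ |x.2 - p.2|) : 1/4 ≤ nsq (x - p) := by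
  simp only [nsq, Prod.fst_sub, Prod.snd_sub]
  rcases h with h | h
  · have := mul_self_le_mul_self (by norm_num) h
    rw [abs_mul_abs_self] at this; nlinarith [sq_nonneg (x.2 - p.2)]
  · have := mul_self_le_mul_self (by norm_num) h
    rw [abs_mul_abs_self] at this; nlinarith [sq_nonneg (x.1 - p.1)]

lemma gp_ev {g h v : E2 → ℝ} {x : E2} (e : g =ᶠ[𝓝 x] h) : gp g v x = gp h v x := by
  unfold gp; rw [D1_congr e, D2_congr e]
lemma gp_ev_zero {g v : E2 → ℝ} {x : E2} (e : g =ᶠ[𝓝 x] fun _ => 0) : gp g v x = 0 := by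
  rw [gp_ev e, gp, D1_const, D2_const]; ring

lemma IW_eta (hτ : 0 < τ) (hs : Sol P a τ lam u) (h : Sepa P ρ) [Countable ι] (i : ι) {χ χ' : ℝ → ℝ} {s0 s1 : ℝ}
    (hχ : Cut χ χ' s0 s1) (h1 : s1 < log (4*ρ)) (had : Adm P (pz (P i) (rad (P i) 1 χ))) :
    IWf τ lam u (pz (P i) (rad (P i) 1 χ)) = -(4 * π * a i) := by
  have hp := h.pos
  have h2 : exp (2*s1) < 1/4 := by
    have e1 : exp (2*s1) < (4*ρ)^2 := by
      rw [← exp_two_log (by positivity)]; exact exp_lt_exp.2 (by linarith)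
    have := h.small
    nlinarith
  set p := P i
  set r := rad p 1 χ with hr
  set η := pz p r with hη
  have hr0 : ∀ x, exp (2*s1) ≤ nsq (x - p) → r x = 0 := fun x hx => rad_zero hχ.zero hx
  have e0 : IWf τ lam u η = ∫ x in QQ, (gp η u x - lam * (η x * fτ τ (u x))) := by
    rw [integral_sub (QQ_int (had.gcont hs)) ((hs.int_f hτ h had.sm.continuous).const_mul lam), integral_const_mul]
    rfl
  have pη : Per η := pz_per _ _
  rw [e0, per_integral_local (K := fun x => gp r u x - lam * (r x * fτ τ (u x))) _ p, cyl_integral p]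
  · have L := hs.loc h i
    have := (L.flux hτ hχ h1).2
    rw [show -(4 * π * a i) = -(2*π*(2 * a i)) by ring, ← this]
    refine setIntegral_congr_fun strip_meas fun z _ => ?_
    have er : r ∘ Cyl p = fun z => χ z.1 := funext fun z => rad_cyl p z 1 χ
    by_cases hz : z.1 < log (4*ρ)
    · have dr : DifferentiableAt ℝ r (Cyl p z) := (rad_smAt hχ.smooth hχ.one _).diff
      have := gp_comp_cyl dr (L.sm z hz).diff
      rw [mul_sub, ← this, er, gp, D1_fst (hχ.deriv z.1), D2_fst (hχ.deriv z.1), hr, rad_cyl]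
      ring
    · have hz' : s1 < z.1 := by linarith
      have hn : exp (2*s1) < nsq (Cyl p z - p) := by rw [nsq_cyl]; exact exp_lt_exp.2 (by linarith)
      rw [gp_ev_zero (ev_zero hr0 hn), hr0 _ hn.le, hχ.d1 hz'.le, hχ.zero _ hz'.le]; ring
  · intro x b1 b2
    have e := pz_ev (g := r) b1 b2
    rw [gp_ev e, hη, e.self_of_nhds]
  · intro x hx
    have hn := h2.trans_le (box_nsq hx)
    rw [gp_ev_zero (ev_zero hr0 hn), hr0 _ hn.le]; ring
  · intro x k
    simp only [gp_per pη hs.per x k, pη x k, hs.per x k]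

lemma eta_adm (h : Sepa P ρ) (i : ι) {χ χ' : ℝ → ℝ} {s0 s1 : ℝ} (hχ : Cut χ χ' s0 s1) (h1 : s1 < log (4*ρ)) :
    Adm P (pz (P i) (rad (P i) 1 χ)) ∧ pz (P i) (rad (P i) 1 χ) (P i) = 1 ∧
      ∀ j ≠ i, pz (P i) (rad (P i) 1 χ) (P j) = 0 := by
  have hp := h.pos
  have hsm := h.small
  have e1 : exp (2*s1) < (4*ρ)^2 := by
    rw [← exp_two_log (by positivity)]; exact exp_lt_exp.2 (by linarith)
  set p := P i
  set r := rad p 1 χ with hr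
  have hr0 : ∀ x, (4*ρ)^2 ≤ nsq (x - p) → r x = 0 := fun x hx => rad_zero hχ.zero (e1.le.trans hx)
  have hlt : 4*ρ < 1/2 := by linarith
  have near : ∀ᶠ x in 𝓝 p, pz p r x = 1 := by
    have a1 := pz_ev (p := p) (g := r) (x := p) (by simp) (by simp)
    have a2 : ∀ᶠ x in 𝓝 p, nsq (x - p) < exp (2*s0) :=
      ContinuousAt.eventually_lt (nsq_cont.comp (continuous_id.sub continuous_const)).continuousAt
        continuousAt_const (by simp [nsq]; positivity)
    filter_upwards [a1, a2] with x h1 h2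
    rw [h1]; exact rad_near p hχ.one h2.le
  have far : ∀ j ≠ i, ∀ᶠ x in 𝓝 (P j), pz p r x = 0 := by
    intro j hj
    rcases pz_local (p := p) hlt (supp_disc (by positivity) hr0) (P j) with hh | ⟨k, hk, hh⟩
    · exact hh
    · have : exp (2*s1) < nsq (P j + lat k - p) := by
        by_contra hc
        push Not at hc
        have : nsq (P i - (P j + lat k)) < (4*ρ)^2 := by
          have e : nsq (P i - (P j + lat k)) = nsq (P j + lat k - p) := by
            unfold nsq; simp only [Prod.fst_sub, Prod.snd_sub, Prod.fst_add, Prod.snd_add, p]; ring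
          rw [e]; exact hc.trans_lt e1
        exact hj (h.sep i j k this).1.symm
      have z0 := ev_zero (g := r) (fun x hx => rad_zero hχ.zero hx) this
      have t : Tendsto (fun y => y + lat k) (𝓝 (P j)) (𝓝 (P j + lat k)) :=
        (continuous_id.add continuous_const).tendsto _
      filter_upwards [hh, t.eventually z0] with y h1 h2
      rw [h1]; exact h2
  refine ⟨⟨pz_smooth hlt (supp_disc (by positivity) hr0) (rad_contDiff hχ.smooth hχ.one), pz_per _ _, fun j => ?_⟩,
    near.self_of_nhds, fun j hj => (far j hj).self_of_nhds⟩
  by_cases hj : j = i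
  · subst hj
    filter_upwards [near] with x hx; rw [hx]; exact near.self_of_nhds.symm
  · filter_upwards [far j hj] with x hx; rw [hx, (far j hj).self_of_nhds]

lemma Sol.IW [Fintype ι] (hτ : 0 < τ) (hs : Sol P a τ lam u) (h : Sepa P ρ) {W : E2 → ℝ} (hW : Adm P W) :
    (∫ x in QQ, gp W u x) - lam * ∫ x in QQ, W x * fτ τ (u x) = -(4 * π * ∑ i, a i * W (P i)) := by
  classical
  have hp := h.pos
  obtain ⟨χ, χ', hχ⟩ := cut_exists (s0 := log ρ) (s1 := log (2*ρ)) (log_lt_log hp (by linarith))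
  have hl : log (2*ρ) < log (4*ρ) := log_lt_log (by linarith) (by linarith)
  have main : ∀ s : Finset ι, ∀ W : E2 → ℝ, Adm P W → (∀ i ∉ s, W (P i) = 0) →
      IWf τ lam u W = -(4 * π * ∑ i, a i * W (P i)) := by
    intro s
    induction s using Finset.induction_on with
    | empty =>
      intro W hW h0
      have h0' : ∀ i, W (P i) = 0 := fun i => h0 i (by simp)
      rw [IW_zero hs hW h hτ h0']; simp [h0']
    | insert i s his ih =>
      intro W hW h0
      obtain ⟨ad, e1, e2⟩ := eta_adm h i hχ hl
      set η := pz (P i) (rad (P i) 1 χ)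
      have hW' : Adm P (fun x => W x + (-W (P i)) * η x) := hW.add (ad.cmul _)
      have := ih _ hW' (by
        intro j hj
        by_cases hji : j = i
        · subst hji; simp [e1]
        · rw [e2 j hji, h0 j (by simp [hji, hj])]; ring)
      rw [IW_add hs hW ad h hτ, IW_eta hτ hs h i hχ hl ad] at this
      have e3 : ∑ j, a j * (W (P j) + (-W (P i)) * η (P j)) = ∑ j, a j * W (P j) - a i * W (P i) := by
        simp only [mul_add, Finset.sum_add_distrib]
        rw [Finset.sum_eq_single (f := fun j => a j * ((-W (P i)) * η (P j))) i]
        · rw [e1]; ring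
        · intro j _ hj; rw [e2 j hj]; ring
        · simp
      rw [e3] at this
      linarith
  exact main Finset.univ W hW (by simp)

lemma Sol.mass [Fintype ι] (hτ : 0 < τ) (hs : Sol P a τ lam u) (h : Sepa P ρ) :
    lam * ∫ x in QQ, fτ τ (u x) = 4 * π * ∑ i, a i := by
  have := hs.IW hτ h (Adm.const 1)
  simp only [gp, D1_const, D2_const] at this
  simp at this
  linarith

/-- extension of G(u) across the singular points -/
lemma Sol.ext (hs : Sol P a τ lam u) (h : Sepa P ρ) (ha : ∀ i, a i ≠ 0) {G : ℝ → ℝ} (hG : ContDiff ℝ (⊤ : ℕ∞) G)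
    {M gm gP : ℝ} (h1 : ∀ t ≤ -M, G t = gm) (h2 : ∀ t, M ≤ t → G t = gP) :
    ∃ w, Adm P w ∧ (∀ x ∉ Zs P, w x = G (u x)) ∧ ∀ i, (0 < a i → w (P i) = gm) ∧ (a i < 0 → w (P i) = gP) := by
  classical
  set w : E2 → ℝ := fun x => if x ∈ Zs P then (if ∃ i k, x = P i + lat k ∧ 0 < a i then gm else gP) else G (u x) with hw
  have w1 : ∀ x ∉ Zs P, w x = G (u x) := fun x hx => by simp only [hw, if_neg hx]
  have w2 : ∀ i, (0 < a i → w (P i) = gm) ∧ (a i < 0 → w (P i) = gP) := by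
    intro i
    constructor
    · intro hi
      have : ∃ j k, P i = P j + lat k ∧ 0 < a j := ⟨i, 0, by rw [lat_zero, add_zero], hi⟩
      simp only [hw, if_pos (P_mem i), if_pos this]
    · intro hi
      have : ¬ ∃ j k, P i = P j + lat k ∧ 0 < a j := by
        rintro ⟨j, k, he, hj⟩
        have : i = j := (h.sep i j k (by rw [he]; have := h.pos; simp [nsq]; positivity)).1
        subst this; linarith
      simp only [hw, if_pos (P_mem i), if_neg this]
  have per : Per w := by
    intro x k
    have e1 : (∃ i l, x + lat k = P i + lat l ∧ 0 < a i) ↔ (∃ i l, x = P i + lat l ∧ 0 < a i) := by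
      constructor
      · rintro ⟨i, l, he, hi⟩
        exact ⟨i, l - k, by rw [sub_eq_add_neg, lat_add, lat_neg, ← add_assoc, ← he]; simp, hi⟩
      · rintro ⟨i, l, rfl, hi⟩
        exact ⟨i, l + k, by rw [lat_add, add_assoc], hi⟩
    simp only [hw, Zs_add, e1, hs.per x k]
  have loc : ∀ i, ∀ᶠ x in 𝓝 (P i), w x = w (P i) := by
    intro i
    have a1 := hs.to_inf i M
    rw [eventually_nhdsWithin_iff] at a1
    have a2 : ∀ᶠ x in 𝓝 (P i), nsq (x - P i) < (4*ρ)^2 :=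
      ContinuousAt.eventually_lt (nsq_cont.comp (continuous_id.sub continuous_const)).continuousAt
        continuousAt_const (by have := h.pos; simp [nsq]; positivity)
    filter_upwards [a1, a2] with x b1 b2
    by_cases hx : x = P i
    · rw [hx]
    · rw [w1 x fun hz => hx (h.near b2 hz)]
      rcases lt_or_gt_of_ne (ha i) with hi | hi
      · rw [(w2 i).2 hi]; exact h2 _ ((b1 hx).2 hi).le
      · rw [(w2 i).1 hi]; exact h1 _ ((b1 hx).1 hi).le
  refine ⟨w, ⟨?_, per, loc⟩, w1, w2⟩
  rw [contDiff_iff_contDiffAt]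
  intro x
  by_cases hx : x ∈ Zs P
  · obtain ⟨i, k, rfl⟩ := hx
    have := per_near per (Q := fun _ c => c = w (P i)) (P i) k (loc i)
    exact contDiffAt_const.congr_of_eventuallyEq this
  · have : w =ᶠ[𝓝 x] fun y => G (u y) := by
      filter_upwards [h.isOpen.mem_nhds hx] with y hy using w1 y hy
    exact ((SmAt.comp hG (hs.sm x hx)).congr this).cd

/-- energy bound for increasing G -/
lemma Sol.EG [Fintype ι] (hτ : 0 < τ) (hs : Sol P a τ lam u) (h : Sepa P ρ) {G : ℝ → ℝ} (hm : Monotone G)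
    {B : ℝ} (hB : ∀ t, |G t - G 0| ≤ B) {w : E2 → ℝ} (hw : Adm P w) (hwu : ∀ x ∉ Zs P, w x = G (u x)) :
    (∫ x in QQ, gp w u x) + lam * ∫ x in QQ, |fτ τ (u x)| * |G (u x) - G 0| ≤ 4 * π * ((∑ i, |a i|) * B) := by
  have hW : Adm P (fun x => w x + (-G 0)) := hw.add (Adm.const _)
  have := hs.IW hτ h hW
  have e1 : ∀ x, gp (fun x => w x + (-G 0)) u x = gp w u x := by
    intro x
    rw [gp_add (SmAt.of_contDiff (x := x) hw.sm).diff (differentiableAt_const _)]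
    simp [gp, D1_const, D2_const]
  have e2 : ∫ x in QQ, (w x + (-G 0)) * fτ τ (u x) = - ∫ x in QQ, |fτ τ (u x)| * |G (u x) - G 0| := by
    rw [← integral_neg]
    apply integral_congr_ae
    filter_upwards [ae_restrict_of_ae (Zs_ae (P := P))] with x hx
    rw [hwu x hx]
    rcases le_total (u x) 0 with h0 | h0
    · rw [abs_of_nonneg (f_sign_neg hτ h0), abs_of_nonpos (by linarith [hm h0])]; ring
    · rw [abs_of_nonpos (f_sign_pos hτ h0), abs_of_nonneg (by linarith [hm h0])]; ring
  simp only [e1, e2] at this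
  have e3 : -(∑ i, a i * (w (P i) + -G 0)) ≤ (∑ i, |a i|) * B := by
    rw [← Finset.sum_neg_distrib, Finset.sum_mul]
    refine Finset.sum_le_sum fun i _ => ?_
    have b : |w (P i) + -G 0| ≤ B := by
      have hcl : P i ∈ closure (Zs P)ᶜ := by
        have : Dense (Zs P)ᶜ := by
          have := Zs_ae (P := P)
          exact Measure.dense_of_ae this
        exact this (P i)
      have hc : IsClosed {x | |w x + -G 0| ≤ B} :=
        isClosed_le (by have := hw.sm.continuous; fun_prop) continuous_const
      exact (closure_minimal (fun x hx => by
        show |w x + -G 0| ≤ B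
        rw [hwu x hx]; exact hB _) hc) hcl
    calc -(a i * (w (P i) + -G 0)) ≤ |a i * (w (P i) + -G 0)| := neg_le_abs _
      _ = |a i| * |w (P i) + -G 0| := abs_mul _ _
      _ ≤ _ := mul_le_mul_of_nonneg_left b (abs_nonneg _)
  have := pi_pos
  nlinarith

end

def cavg (H : E2 → ℝ) (s : ℝ) : ℝ := ∫ θ in (-π)..π, H (s, θ)

lemma slice1_at {v : E2 → ℝ} {z : E2} (hv : DifferentiableAt ℝ v z) : HasDerivAt (fun t => v (t, z.2)) (D1 v z) z.1 := by
  have h1 : HasDerivAt (fun t : ℝ => ((t, z.2) : E2)) ((1, 0) : E2) z.1 := (hasDerivAt_id _).prodMk (hasDerivAt_const _ _)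
  have h2 : HasFDerivAt v (fderiv ℝ v z) ((fun t : ℝ => ((t, z.2) : E2)) z.1) := hv.hasFDerivAt
  exact h2.comp_hasDerivAt z.1 h1

lemma slice2_at {v : E2 → ℝ} {z : E2} (hv : DifferentiableAt ℝ v z) : HasDerivAt (fun t => v (z.1, t)) (D2 v z) z.2 := by
  have h1 : HasDerivAt (fun t : ℝ => ((z.1, t) : E2)) ((0, 1) : E2) z.2 := (hasDerivAt_const _ _).prodMk (hasDerivAt_id _)
  have h2 : HasFDerivAt v (fderiv ℝ v z) ((fun t : ℝ => ((z.1, t) : E2)) z.2) := hv.hasFDerivAt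
  exact h2.comp_hasDerivAt z.2 h1

lemma slice_cont {H : E2 → ℝ} {s : ℝ} (hH : ∀ z : E2, z.1 = s → ContinuousAt H z) : Continuous fun θ => H (s, θ) := by
  rw [continuous_iff_continuousAt]
  intro θ
  have h1 : ContinuousAt H ((fun θ : ℝ => ((s, θ) : E2)) θ) := hH (s, θ) rfl
  exact ContinuousAt.comp (f := fun θ : ℝ => ((s, θ) : E2)) h1 (by fun_prop)

lemma box_mem {s0 s1 : ℝ} {z : E2} : z ∈ box s0 s1 ↔ (s0 ≤ z.1 ∧ z.1 ≤ s1) ∧ (-π ≤ z.2 ∧ z.2 ≤ π) := by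
  unfold box
  rw [mem_Icc, Prod.le_def, Prod.le_def]
  tauto

lemma box_prod (s0 s1 : ℝ) : box s0 s1 = Icc s0 s1 ×ˢ Icc (-π) π := by
  ext z; rw [box_mem, mem_prod, mem_Icc, mem_Icc]

lemma box_compact (s0 s1 : ℝ) : IsCompact (box s0 s1) := isCompact_Icc
lemma box_meas (s0 s1 : ℝ) : MeasurableSet (box s0 s1) := measurableSet_Icc

lemma cavg_deriv {H : E2 → ℝ} {S s : ℝ} (hH : ∀ z : E2, z.1 < S → SmAt H z) (hs : s < S) :
    HasDerivAt (cavg H) (cavg (D1 H) s) s := by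
  obtain ⟨b, hb1, hb2⟩ := exists_between hs
  have hcont : ContinuousOn (D1 H) (box (s-1) b) := fun z hz =>
    (hH z ((box_mem.1 hz).1.2.trans_lt hb2)).D1.cont.continuousWithinAt
  obtain ⟨C, hC⟩ := (box_compact (s-1) b).exists_bound_of_continuousOn hcont
  have hnb : Ioo (s-1) b ∈ 𝓝 s := Ioo_mem_nhds (by linarith) hb1
  refine (intervalIntegral.hasDerivAt_integral_of_dominated_loc_of_deriv_le (F := fun s θ => H (s, θ)) (F' := fun s θ => D1 H (s, θ))
    (bound := fun _ => C) hnb ?_ ?_ ?_ ?_ ?_ ?_).2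
  · filter_upwards [Iio_mem_nhds hs] with x hx
    exact (slice_cont fun z hz => (hH z (hz ▸ hx)).cont).aestronglyMeasurable
  · exact (slice_cont fun z hz => (hH z (hz ▸ hs)).cont).intervalIntegrable _ _
  · exact (slice_cont fun z hz => (hH z (hz ▸ hs)).D1.cont).aestronglyMeasurable
  · refine Eventually.of_forall fun t ht x hx => hC (x, t) (box_mem.2 ⟨⟨hx.1.le, hx.2.le⟩, ?_⟩)
    rw [uIoc_of_le (by linarith [pi_pos])] at ht
    exact ⟨ht.1.le, ht.2⟩
  · exact intervalIntegrable_const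
  · exact Eventually.of_forall fun t _ x hx => slice1_at (z := (x, t)) (hH (x, t) (hx.2.trans hb2)).diff

lemma cavg_D2 {H : E2 → ℝ} {S s : ℝ} (hH : ∀ z : E2, z.1 < S → SmAt H z) (hs : s < S) (hp : TPer H) :
    cavg (D2 H) s = 0 := by
  unfold cavg
  rw [intervalIntegral.integral_eq_sub_of_hasDerivAt (f := fun θ => H (s, θ))
    (fun θ _ => slice2_at (z := (s, θ)) (hH (s, θ) hs).diff)
    ((slice_cont fun z hz => (hH z (hz ▸ hs)).D2.cont).intervalIntegrable _ _), hp.pi s, sub_self]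

lemma cavg_add {H K : E2 → ℝ} {s : ℝ} (hH : Continuous fun θ => H (s, θ)) (hK : Continuous fun θ => K (s, θ)) :
    cavg (fun z => H z + K z) s = cavg H s + cavg K s :=
  intervalIntegral.integral_add (hH.intervalIntegrable _ _) (hK.intervalIntegrable _ _)

lemma cavg_lapp {H : E2 → ℝ} {S s : ℝ} (hH : ∀ z : E2, z.1 < S → SmAt H z) (hs : s < S) (hp : TPer H) :
    cavg (lapp H) s = cavg (D1 (D1 H)) s := by
  have : cavg (lapp H) s = cavg (D1 (D1 H)) s + cavg (D2 (D2 H)) s := cavg_add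
    (slice_cont fun z hz => (hH z (hz ▸ hs)).D1.D1.cont) (slice_cont fun z hz => (hH z (hz ▸ hs)).D2.D2.cont)
  rw [this, cavg_D2 (fun z hz => (hH z hz).D2) hs hp.D2, add_zero]

lemma cavg_mono {H K : E2 → ℝ} {s : ℝ} (hH : Continuous fun θ => H (s, θ)) (hK : Continuous fun θ => K (s, θ))
    (h : ∀ θ, H (s, θ) ≤ K (s, θ)) : cavg H s ≤ cavg K s :=
  intervalIntegral.integral_mono (by linarith [pi_pos]) (hH.intervalIntegrable _ _) (hK.intervalIntegrable _ _) h

lemma cavg_const (c s : ℝ) : cavg (fun _ => c) s = 2 * π * c := by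
  unfold cavg; rw [intervalIntegral.integral_const, smul_eq_mul]; ring

lemma box_fubini {g : E2 → ℝ} {s0 s1 : ℝ} (h : s0 ≤ s1) (hg : IntegrableOn g (box s0 s1)) :
    ∫ z in box s0 s1, g z = ∫ s in s0..s1, cavg g s ∧ IntervalIntegrable (cavg g) volume s0 s1 := by
  rw [box_prod] at *
  have e : ∀ s, cavg g s = ∫ θ in Icc (-π) π, g (s, θ) := fun s => by
    unfold cavg
    rw [intervalIntegral.integral_of_le (by linarith [pi_pos]), integral_Icc_eq_integral_Ioc]
  have hg' := hg
  rw [IntegrableOn, Measure.volume_eq_prod, ← Measure.prod_restrict] at hg'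
  constructor
  · rw [Measure.volume_eq_prod, setIntegral_prod _ (by rwa [← Measure.volume_eq_prod]), intervalIntegral.integral_of_le h, integral_Icc_eq_integral_Ioc]
    simp only [e]
  · rw [intervalIntegrable_iff_integrableOn_Icc_of_le h]
    have := hg'.integral_prod_left
    simp only [← e] at this
    exact this

/-- monotone with limit at -∞ -/
lemma cavg_lim {H : E2 → ℝ} {c : ℝ} {C s0 : ℝ} (hC : ∀ z : E2, z.1 ≤ s0 → |H z - c| ≤ C * exp z.1)
    (hc : ∀ s ≤ s0, Continuous fun θ => H (s, θ)) : Tendsto (cavg H) atBot (𝓝 (2 * π * c)) := by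
  have hle : ∀ s ≤ s0, |cavg H s - 2 * π * c| ≤ C * exp s * (2 * π) := by
    intro s hs
    have e : cavg H s - 2 * π * c = ∫ θ in (-π)..π, (H (s, θ) - c) := by
      rw [intervalIntegral.integral_sub ((hc s hs).intervalIntegrable _ _) intervalIntegrable_const]
      rw [← cavg_const c s]; rfl
    rw [e]
    have := intervalIntegral.norm_integral_le_of_norm_le_const (a := -π) (b := π) (f := fun θ => H (s, θ) - c) (C := C * exp s)
      (fun θ _ => hC (s, θ) hs)
    rw [show |π - -π| = 2 * π by rw [abs_of_pos (by linarith [pi_pos])]; ring] at this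
    exact this
  rw [tendsto_iff_norm_sub_tendsto_zero]
  refine squeeze_zero' (Eventually.of_forall fun _ => norm_nonneg _) ?_ (g := fun s => C * exp s * (2 * π)) ?_
  · filter_upwards [eventually_le_atBot s0] with s hs using hle s hs
  · have := (tendsto_exp_atBot.const_mul C).mul_const (2*π)
    simpa using this

lemma deriv_mono {A A' : ℝ → ℝ} {S : ℝ} (h : ∀ s < S, HasDerivAt A (A' s) s) (h0 : ∀ s < S, 0 ≤ A' s) {s t : ℝ}
    (hst : s ≤ t) (ht : t < S) : A s ≤ A t := by
  have : MonotoneOn A (Iio S) := by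
    apply monotoneOn_of_deriv_nonneg (convex_Iio S) (fun x hx => (h x hx).continuousAt.continuousWithinAt)
    · intro x hx; rw [interior_Iio] at hx; exact (h x hx).differentiableAt.differentiableWithinAt
    · intro x hx; rw [interior_Iio] at hx; rw [(h x hx).deriv]; exact h0 x hx
  exact this (hst.trans_lt ht) ht hst

lemma le_of_deriv_lim {A A' : ℝ → ℝ} {S L : ℝ} (h : ∀ s < S, HasDerivAt A (A' s) s) (h0 : ∀ s < S, 0 ≤ A' s)
    (hl : Tendsto A atBot (𝓝 L)) {s : ℝ} (hs : s < S) : L ≤ A s :=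
  le_of_tendsto hl (by filter_upwards [eventually_le_atBot s] with t ht using deriv_mono h h0 ht hs)

/-- mean value inequality -/
lemma mean_value {g : E2 → ℝ} {q : E2} {S s0 s1 : ℝ} (h01 : s0 ≤ s1) (h1 : s1 < S) (hq : SmAt g q)
    (hg : ∀ z : E2, z.1 < S → SmAt g (Cyl q z)) (hl : ∀ z : E2, z.1 < S → 0 ≤ lapp g (Cyl q z)) :
    0 ≤ ∫ z in box s0 s1, exp (2*z.1) * (g (Cyl q z) - g q) := by
  set H := g ∘ Cyl q with hH
  have smH : ∀ z : E2, z.1 < S → SmAt H z := fun z hz => (hg z hz).cyl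
  have hp : TPer H := tper_cyl g q
  obtain ⟨C, t0, hC, hb⟩ := cyl_small hq
  have d1 : ∀ s < S, 0 ≤ cavg (D1 H) s := by
    intro s hs
    have lim : Tendsto (cavg (D1 H)) atBot (𝓝 (2 * π * 0)) := by
      refine cavg_lim (C := C) (s0 := min t0 (S-1)) (fun z hz => ?_) fun s hs' => slice_cont fun z hz => (smH z ?_).D1.cont
      · rw [sub_zero]; exact (hb z (hz.trans (min_le_left _ _))).1
      · rw [hz]; linarith [hs'.trans (min_le_right _ _)]
    rw [mul_zero] at lim
    refine le_of_deriv_lim (A' := cavg (D1 (D1 H))) (fun s hs => cavg_deriv (fun z hz => (smH z hz).D1) hs) (fun s hs => ?_) lim hs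
    rw [← cavg_lapp smH hs hp, ← mul_zero (2*π), ← cavg_const 0 s]
    refine cavg_mono continuous_const (slice_cont fun z hz => (smH z (hz ▸ hs)).lapp.cont) fun θ => ?_
    rw [lapp_comp_cyl (hg (s, θ) hs)]
    exact mul_nonneg (exp_pos _).le (hl _ hs)
  have d2 : ∀ s < S, 2 * π * g q ≤ cavg H s := by
    intro s hs
    have h3 : ∃ C t0, ∀ z : E2, z.1 ≤ t0 → |H z - g q| ≤ C * exp z.1 := by
      obtain ⟨K, U, hU, hK⟩ := (hq.cd.of_le (by norm_cast : (1 : WithTop ℕ∞) ≤ (⊤ : ℕ∞))).exists_lipschitzOnWith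
      obtain ⟨t1, ht1⟩ := cyl_ev (p := q) (Q := fun x => x ∈ U) hU
      refine ⟨K, t1, fun z hz => ?_⟩
      have := hK.dist_le_mul _ (ht1 z hz) _ (mem_of_mem_nhds hU)
      rw [Real.dist_eq, Prod.dist_eq, Real.dist_eq, Real.dist_eq] at this
      have b := Cyl_lim_aux q z
      exact this.trans (mul_le_mul_of_nonneg_left (max_le b.1 b.2) K.2)
    obtain ⟨C', t1, hC'⟩ := h3
    have lim : Tendsto (cavg H) atBot (𝓝 (2 * π * g q)) := by
      refine cavg_lim (C := C') (s0 := min t1 (S-1)) (fun z hz => hC' z (hz.trans (min_le_left _ _))) fun s hs' => slice_cont fun z hz => (smH z ?_).cont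
      rw [hz]; linarith [hs'.trans (min_le_right _ _)]
    exact le_of_deriv_lim (fun s hs => cavg_deriv smH hs) d1 lim hs
  have ci : IntegrableOn (fun z : E2 => exp (2*z.1) * (H z - g q)) (box s0 s1) := by
    refine ContinuousOn.integrableOn_compact (box_compact _ _) fun z hz => ContinuousAt.continuousWithinAt ?_
    have := (smH z ((box_mem.1 hz).1.2.trans_lt h1)).cont
    fun_prop
  have := (box_fubini h01 ci).1
  show 0 ≤ ∫ z in box s0 s1, exp (2*z.1) * (H z - g q)
  rw [this]
  refine intervalIntegral.integral_nonneg h01 fun s hs => ?_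
  have hs' : s < S := hs.2.trans_lt h1
  have e : cavg (fun z => exp (2*z.1) * (H z - g q)) s = exp (2*s) * (cavg H s - 2 * π * g q) := by
    unfold cavg
    simp only
    rw [intervalIntegral.integral_const_mul, intervalIntegral.integral_sub
      ((slice_cont fun z hz => (smH z (hz ▸ hs')).cont).intervalIntegrable _ _) intervalIntegrable_const]
    congr 2
    rw [intervalIntegral.integral_const, smul_eq_mul]; ring
  rw [e]
  exact mul_nonneg (exp_pos _).le (by linarith [d2 s hs'])

structure Ctx {ι : Type} (P : ι → E2) (a : ι → ℝ) (τ ρ lam : ℝ) (u : E2 → ℝ) : Prop where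
  hτ : 0 < τ
  sol : Sol P a τ lam u
  sep : Sepa P ρ
  ne : ∀ i, a i ≠ 0
  lam1 : 1 ≤ lam

lemma cyl_le_set {g : E2 → ℝ} (h0 : ∀ x, 0 ≤ g x) (hp : Per g) (hg : IntegrableOn g QQ) (q : E2) {A : Set E2}
    (hA : MeasurableSet A) (hs : A ⊆ strip) (h1 : ∀ z ∈ A, z.1 < log (1/2)) :
    IntegrableOn (fun z => exp (2*z.1) * g (Cyl q z)) A ∧ ∫ z in A, exp (2*z.1) * g (Cyl q z) ≤ ∫ x in QQ, g x := by
  set c : E2 := q - (1/2, 1/2) with hc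
  set g' := (cell c).indicator g with hg'
  have i1 : Integrable g' := by
    rw [hg', integrable_indicator_iff (cell_meas c)]
    exact (cell_integrable hp c).2 hg
  have i2 := (cyl_integrable q g').1 i1
  have e : ∀ z ∈ A, exp (2*z.1) * g (Cyl q z) = exp (2*z.1) * g' (Cyl q z) := by
    intro z hz
    have hlt : exp z.1 < 1/2 := by
      have := exp_lt_exp.2 (h1 z hz)
      rwa [exp_log (by norm_num)] at this
    obtain ⟨b1, b2⟩ := Cyl_lim_aux q z
    have b1' := abs_le.1 b1
    have b2' := abs_le.1 b2
    have : Cyl q z ∈ cell c := by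
      refine ⟨⟨?_, ?_⟩, ⟨?_, ?_⟩⟩ <;> simp only [hc, Prod.fst_sub, Prod.snd_sub] <;> linarith [b1'.1, b1'.2, b2'.1, b2'.2]
    rw [hg', indicator_of_mem this]
  have n : ∀ z, 0 ≤ exp (2*z.1) * g' (Cyl q z) := fun z =>
    mul_nonneg (exp_pos _).le (indicator_nonneg (fun x _ => h0 x) _)
  constructor
  · exact (integrableOn_congr_fun e hA).2 (i2.mono_set hs)
  · rw [setIntegral_congr_fun hA e]
    refine (setIntegral_mono_set i2 (Eventually.of_forall n) (Eventually.of_forall hs)).trans ?_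
    rw [← cyl_integral q g', hg', integral_indicator (cell_meas c), cell_integral hp]

lemma cyl_le_QQ {g : E2 → ℝ} (h0 : ∀ x, 0 ≤ g x) (hp : Per g) (hg : IntegrableOn g QQ) (q : E2) {s0 s1 : ℝ}
    (h1 : s1 < log (1/2)) :
    IntegrableOn (fun z => exp (2*z.1) * g (Cyl q z)) (box s0 s1) ∧
    ∫ z in box s0 s1, exp (2*z.1) * g (Cyl q z) ≤ ∫ x in QQ, g x := by
  have := cyl_le_set h0 hp hg q (A := Icc s0 s1 ×ˢ Ioo (-π) π) (measurableSet_Icc.prod measurableSet_Ioo)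
    (fun z hz => ⟨trivial, hz.2⟩) (fun z hz => hz.1.2.trans_lt h1)
  rw [setIntegral_congr_set (box_ae s0 s1)]
  exact ⟨this.1.congr_set_ae (box_ae s0 s1), this.2⟩

lemma vol_QQ : volume.real QQ = 1 := by
  unfold Measure.real QQ; rw [cell_vol]; simp

lemma gsq_nonneg (g : E2 → ℝ) (x : E2) : 0 ≤ gsq g x := by unfold gsq; positivity

section
variable {ι : Type} [Fintype ι] {P : ι → E2} {a : ι → ℝ} {τ lam ρ : ℝ} {u : E2 → ℝ}

lemma Ctx.pos (c : Ctx P a τ ρ lam u) : 0 < lam := by linarith [c.lam1]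

lemma gsq_cont {w : E2 → ℝ} (hw : ContDiff ℝ (⊤ : ℕ∞) w) : Continuous (gsq w) := by
  have h1 := D1_cont (hw.of_le (by norm_cast : (1 : WithTop ℕ∞) ≤ (⊤ : ℕ∞)))
  have h2 := D2_cont (hw.of_le (by norm_cast : (1 : WithTop ℕ∞) ≤ (⊤ : ℕ∞)))
  unfold gsq; fun_prop

lemma Ctx.arct (c : Ctx P a τ ρ lam u) {T T' : ℝ → ℝ} (hT : ∀ t, HasDerivAt T (T' t) t) (h0 : ∀ t, 0 ≤ T' t)
    (h1 : ∀ t, T' t ≤ 1) {w : E2 → ℝ} (hw : Adm P w) (hwu : ∀ x ∉ Zs P, w x = T (u x)) (k : ℝ) {L : ℝ} (hL : 0 < L) :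
    ∫ x in QQ, L / (L^2 + (w x - k)^2) * gsq w x ≤ 4 * π^2 * ∑ i, |a i| := by
  have hTm : Monotone T := monotone_of_hasDerivAt_nonneg hT h0
  set G : ℝ → ℝ := fun t => arctan ((T t - k) / L)
  have hGm : Monotone G := fun s t hst => arctan_strictMono.monotone
    (div_le_div_of_nonneg_right (by linarith [hTm hst]) hL.le)
  set wG : E2 → ℝ := fun x => arctan ((w x - k) / L)
  have hwG : Adm P wG := by
    refine ⟨?_, fun x v => ?_, fun i => ?_⟩
    · exact contDiff_arctan.comp ((hw.sm.sub contDiff_const).div_const _)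
    · simp only [wG]; rw [hw.per x v]
    · filter_upwards [hw.loc i] with x hx
      simp only [wG, hx]
  have hB : ∀ t, |G t - G 0| ≤ π := by
    intro t
    have a1 := arctan_lt_pi_div_two ((T t - k) / L)
    have a2 := neg_pi_div_two_lt_arctan ((T t - k) / L)
    have a3 := arctan_lt_pi_div_two ((T 0 - k) / L)
    have a4 := neg_pi_div_two_lt_arctan ((T 0 - k) / L)
    simp only [G]
    rw [abs_le]; constructor <;> linarith
  have key := c.sol.EG c.hτ c.sep hGm hB hwG (fun x hx => by simp only [wG, G, hwu x hx])
  have nn : 0 ≤ lam * ∫ x in QQ, |fτ τ (u x)| * |G (u x) - G 0| :=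
    mul_nonneg c.pos.le (integral_nonneg fun x => mul_nonneg (abs_nonneg _) (abs_nonneg _))
  have le : ∫ x in QQ, L / (L^2 + (w x - k)^2) * gsq w x ≤ ∫ x in QQ, gp wG u x := by
    refine setIntegral_mono_ae_restrict ?_ (QQ_int (hwG.gcont c.sol)) ?_
    · apply QQ_int
      have := hw.sm.continuous
      have := gsq_cont hw.sm
      refine Continuous.mul (continuous_const.div (by fun_prop) fun x => ?_) this
      positivity
    · filter_upwards [ae_restrict_of_ae (Zs_ae (P := P))] with x hx
      have hd := (c.sol.sm x hx).diff
      have ew : w =ᶠ[𝓝 x] fun y => T (u y) := by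
        filter_upwards [c.sep.isOpen.mem_nhds hx] with y hy using hwu y hy
      have hwd := (SmAt.of_contDiff (x := x) hw.sm).diff
      have d1 : D1 w x = T' (u x) * D1 u x := by rw [D1_congr ew, D1_comp (hT _) hd]
      have d2 : D2 w x = T' (u x) * D2 u x := by rw [D2_congr ew, D2_comp (hT _) hd]
      have hG : HasDerivAt (fun t => arctan ((t - k) / L)) (L / (L^2 + (w x - k)^2)) (w x) := by
        have := (((hasDerivAt_id (w x)).sub_const k).div_const L).arctan
        convert this using 1
        simp only [id]
        field_simp
        rfl
      have g1 : D1 wG x = L / (L^2 + (w x - k)^2) * D1 w x := D1_comp hG hwd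
      have g2 : D2 wG x = L / (L^2 + (w x - k)^2) * D2 w x := D2_comp hG hwd
      have pos : 0 ≤ L / (L^2 + (w x - k)^2) := by positivity
      have : gp wG u x = L / (L^2 + (w x - k)^2) * (T' (u x) * gsq u x) := by
        unfold gp gsq; rw [g1, g2, d1, d2]; ring
      rw [this]
      refine mul_le_mul_of_nonneg_left ?_ pos
      have : gsq w x = T' (u x) * (T' (u x) * gsq u x) := by unfold gsq; rw [d1, d2]; ring
      rw [this]
      have := mul_nonneg (h0 (u x)) (gsq_nonneg u x)
      nlinarith [h1 (u x)]
  have := pi_pos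
  nlinarith

def Cbmo (N J : ℝ) : ℝ := 16 * Csob (0, -π) (J, π) ^ 2 * (4 * π^2 * N + 1)^2 * (J * (2 * π))

lemma Ctx.bmo (c : Ctx P a τ ρ lam u) {q : E2} {s0 s1 : ℝ} (h01 : s0 < s1) (h1 : s1 < log (1/2))
    (hreg : ∀ z ∈ box s0 s1, Cyl q z ∉ Zs P) :
    ∫ z in box s0 s1, (u (Cyl q z) - ravg (u ∘ Cyl q) (s0, -π) (s1, π))^2 ≤ Cbmo (∑ i, |a i|) (s1 - s0) := by
  have cU : ContinuousOn (u ∘ Cyl q) (box s0 s1) := fun z hz =>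
    ((c.sol.sm _ (hreg z hz)).cyl).cont.continuousWithinAt
  obtain ⟨M0, hM0⟩ := (box_compact s0 s1).exists_bound_of_continuousOn cU
  set M := |M0| + 1
  have hM : 0 < M := by positivity
  obtain ⟨T, T', hTs, hTd, hT0, hT1, hTid, hTp, hTm⟩ := exists_trunc M hM
  obtain ⟨w, hw, hwu, -⟩ := c.sol.ext c.sep c.ne hTs (M := M+1) hTm hTp
  have eq : ∀ z ∈ box s0 s1, w (Cyl q z) = u (Cyl q z) := by
    intro z hz
    rw [hwu _ (hreg z hz)]
    apply hTid
    have := hM0 z hz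
    simp only [Function.comp, norm_eq_abs] at this
    linarith [le_abs_self M0]
  set v := w ∘ Cyl q with hv
  have hvs : ContDiff ℝ 1 v := (hw.sm.of_le (by norm_cast)).comp (Cyl_contDiff q)
  have eavg : ravg (u ∘ Cyl q) (s0, -π) (s1, π) = ravg v (s0, -π) (s1, π) := by
    unfold ravg
    congr 1
    exact setIntegral_congr_fun (box_meas s0 s1) fun z hz => (eq z hz).symm
  have e0 : ∫ z in box s0 s1, (u (Cyl q z) - ravg (u ∘ Cyl q) (s0, -π) (s1, π))^2
      = ∫ z in box s0 s1, (v z - ravg v (s0, -π) (s1, π))^2 := by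
    rw [eavg]
    exact setIntegral_congr_fun (box_meas s0 s1) fun z hz => by
      simp only [hv, Function.comp, eq z hz]
  rw [e0]
  set N := ∑ i, |a i| with hN
  have hN0 : 0 ≤ N := Finset.sum_nonneg fun i _ => abs_nonneg _
  set K := 4 * π^2 * N + 1
  have hK : 0 < K := by positivity
  have p2 : (-π : ℝ) < π := by linarith [pi_pos]
  have hCs : Csob (s0, -π) (s1, π) = Csob (0, -π) (s1 - s0, π) := by unfold Csob; simp
  have hCp := Csob_pos (a := (s0, -π)) (b := (s1, π)) h01 p2
  set L := 4 * Csob (s0, -π) (s1, π) * K with hL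
  have hLp : 0 < L := by positivity
  set k := ravg v (s0, -π) (s1, π)
  have ar := c.arct hTd hT0 hT1 hw hwu k hLp
  have hE : ∫ z in Icc ((s0, -π) : E2) (s1, π), L / (L ^ 2 + (v z - k) ^ 2) * gsq v z ≤ K := by
    have hcont : Continuous fun x => L / (L ^ 2 + (w x - k) ^ 2) * gsq w x := by
      have := hw.sm.continuous
      refine Continuous.mul (continuous_const.div (by fun_prop) fun x => ?_) (gsq_cont hw.sm)
      positivity
    have hper : Per fun x => L / (L ^ 2 + (w x - k) ^ 2) * gsq w x := by
      intro x n
      simp only [gsq]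
      rw [hw.per x n, D1_add_lat hw.per x n, D2_add_lat hw.per x n]
    have := (cyl_le_QQ (g := fun x => L / (L ^ 2 + (w x - k) ^ 2) * gsq w x) (fun x => mul_nonneg (by positivity) (gsq_nonneg _ _))
      hper (QQ_int hcont) q (s0 := s0) h1).2
    have e2 : ∀ z, exp (2*z.1) * (L / (L ^ 2 + (w (Cyl q z) - k) ^ 2) * gsq w (Cyl q z)) = L / (L ^ 2 + (v z - k) ^ 2) * gsq v z := by
      intro z
      rw [hv, gsq_comp_cyl (SmAt.of_contDiff hw.sm).diff]
      simp only [Function.comp]; ring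
    simp only [e2] at this
    have t := this.trans ar
    unfold box at t
    linarith
  have := rect_bmo hvs (a := (s0, -π)) (b := (s1, π)) h01 p2 hK hL hE
  unfold Cbmo
  rw [← hCs]
  have e3 : ((s1, π) : E2).2 - ((s0, -π) : E2).2 = 2 * π := by simp; ring
  rw [e3] at this
  exact this
end

/-- measure of the set where `u ∈ I` on the torus -/
def mu (u : E2 → ℝ) (I : Set ℝ) : ℝ := ∫ x in QQ, I.indicator (fun _ => (1:ℝ)) (u x)

lemma QQ_Icc {g : E2 → ℝ} : ∫ x in QQ, g x = ∫ x in Icc ((0,0) : E2) (1,1), g x := by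
  have := cell_ae (0 : E2)
  have e : Icc (0 : E2) (0 + (1,1)) = Icc ((0,0) : E2) (1,1) := by rw [zero_add]; rfl
  rw [e] at this
  exact setIntegral_congr_set this

lemma cs_nonneg {α : Type*} [MeasurableSpace α] {μ : Measure α} {f g : α → ℝ}
    (hf : Integrable (fun x => f x ^ 2) μ) (hg : Integrable (fun x => g x ^ 2) μ) (hfg : Integrable (fun x => f x * g x) μ)
    {A B : ℝ} (hA : ∫ x, f x ^ 2 ∂μ ≤ A) (hB : ∫ x, g x ^ 2 ∂μ ≤ B) : (∫ x, f x * g x ∂μ) ^ 2 ≤ A * B := by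
  have h0 : 0 ≤ ∫ x, f x ^ 2 ∂μ := integral_nonneg fun x => sq_nonneg _
  have h1 : 0 ≤ ∫ x, g x ^ 2 ∂μ := integral_nonneg fun x => sq_nonneg _
  refine (cs_int hf hg hfg).trans ?_
  exact mul_le_mul hA hB h1 (h0.trans hA)

section
variable {ι : Type} [Fintype ι] {P : ι → E2} {a : ι → ℝ} {τ lam ρ : ℝ} {u : E2 → ℝ}

lemma Ctx.int_b (c : Ctx P a τ ρ lam u) {G : ℝ → ℝ} (hG : Measurable G) {C : ℝ} (hC : ∀ t, |G t| ≤ C) :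
    IntegrableOn (fun x => G (u x)) QQ := by
  have := QQ_fin
  refine Integrable.of_bound (C := C) ?_ (Eventually.of_forall fun x => by rw [norm_eq_abs]; exact hC _)
  have := (c.sol.aesm c.sep).aemeasurable
  exact ((hG.comp_aemeasurable this).aestronglyMeasurable).restrict

lemma Ctx.int_ind (c : Ctx P a τ ρ lam u) {I : Set ℝ} (hI : MeasurableSet I) :
    IntegrableOn (fun x => I.indicator (fun _ => (1:ℝ)) (u x)) QQ :=
  c.int_b (G := I.indicator (fun _ => (1:ℝ))) (measurable_const.indicator hI) (C := 1) fun t => by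
    by_cases h : t ∈ I <;> simp [h]

lemma ind_nonneg (I : Set ℝ) (t : ℝ) : 0 ≤ I.indicator (fun _ => (1:ℝ)) t := indicator_nonneg (fun _ _ => zero_le_one) _

lemma mu_nonneg (u : E2 → ℝ) (I : Set ℝ) : 0 ≤ mu u I := integral_nonneg fun _ => ind_nonneg _ _

lemma Ctx.mu_mono (c : Ctx P a τ ρ lam u) {I J : Set ℝ} (hI : MeasurableSet I) (hJ : MeasurableSet J) (h : I ⊆ J) :
    mu u I ≤ mu u J :=
  integral_mono (c.int_ind hI) (c.int_ind hJ) fun x => indicator_le_indicator_of_subset h (fun _ => zero_le_one) _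

/-- the basic mass estimate -/
lemma Ctx.mass1 (c : Ctx P a τ ρ lam u) :
    lam * ∫ x in QQ, |fτ τ (u x)| * min |u x| 1 ≤ 8 * π * ∑ i, |a i| := by
  obtain ⟨T, T', hTs, hTd, hT0, hT1, hTid, hTp, hTm⟩ := exists_trunc 1 one_pos
  obtain ⟨w, hw, hwu, -⟩ := c.sol.ext c.sep c.ne hTs (M := 2) (by intro t ht; exact hTm t (by linarith)) (by intro t ht; exact hTp t (by linarith))
  have hmono : Monotone T := monotone_of_hasDerivAt_nonneg hTd hT0
  have T0 : T 0 = 0 := hTid 0 (by simp)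
  have Tle : ∀ t, |T t| ≤ 2 := by
    have u1 : T 2 ≤ 2 := by
      have : Antitone fun t => T t - t := antitone_of_hasDerivAt_nonpos (f' := fun t => T' t - 1) (fun t => (hTd t).sub (hasDerivAt_id t)) (fun t => sub_nonpos.2 (hT1 t))
      have := this (show (0:ℝ) ≤ 2 by norm_num)
      simp only [T0] at this; linarith
    have l1 : -2 ≤ T (-2) := by
      have : Antitone fun t => T t - t := antitone_of_hasDerivAt_nonpos (f' := fun t => T' t - 1) (fun t => (hTd t).sub (hasDerivAt_id t)) (fun t => sub_nonpos.2 (hT1 t))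
      have := this (show (-2:ℝ) ≤ 0 by norm_num)
      simp only [T0] at this; linarith
    intro t
    rw [abs_le]
    constructor
    · rcases le_total t (-2) with h | h
      · rw [hTm t (by linarith)]; norm_num; linarith
      · linarith [hmono h]
    · rcases le_total 2 t with h | h
      · rw [hTp t (by linarith)]; norm_num; linarith
      · linarith [hmono h]
  have Tge : ∀ t, min |t| 1 ≤ |T t| := by
    intro t
    rcases le_total |t| 1 with h | h
    · rw [min_eq_left h, hTid t h]
    · rw [min_eq_right h]
      rcases le_total 0 t with h0 | h0
      · rw [abs_of_nonneg h0] at h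
        have := hmono h
        rw [hTid 1 (by simp)] at this
        exact this.trans (le_abs_self _)
      · rw [abs_of_nonpos h0] at h
        have := hmono (show t ≤ -1 by linarith)
        rw [hTid (-1) (by simp)] at this
        exact le_trans (by linarith) (neg_le_abs _)
  have key := c.sol.EG c.hτ c.sep hmono (B := 2) (fun t => by rw [T0, sub_zero]; exact Tle t) hw hwu
  have nn : 0 ≤ ∫ x in QQ, gp w u x := by
    refine setIntegral_nonneg_of_ae_restrict ?_
    filter_upwards [ae_restrict_of_ae (Zs_ae (P := P))] with x hx
    have hd := (c.sol.sm x hx).diff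
    have ew : w =ᶠ[𝓝 x] fun y => T (u y) := by
      filter_upwards [c.sep.isOpen.mem_nhds hx] with y hy using hwu y hy
    have d1 : D1 w x = T' (u x) * D1 u x := by rw [D1_congr ew, D1_comp (hTd _) hd]
    have d2 : D2 w x = T' (u x) * D2 u x := by rw [D2_congr ew, D2_comp (hTd _) hd]
    have : gp w u x = T' (u x) * gsq u x := by unfold gp gsq; rw [d1, d2]; ring
    rw [this]
    exact mul_nonneg (hT0 _) (gsq_nonneg _ _)
  obtain ⟨C, hC⟩ := f_bdd c.hτ
  have cf := f_cont c.hτ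
  have cT := hTs.continuous
  have le : ∫ x in QQ, |fτ τ (u x)| * min |u x| 1 ≤ ∫ x in QQ, |fτ τ (u x)| * |T (u x) - T 0| := by
    refine integral_mono (c.int_b (G := fun t => |fτ τ t| * min |t| 1) (by fun_prop) (C := C) fun t => ?_)
      (c.int_b (G := fun t => |fτ τ t| * |T t - T 0|) (by fun_prop) (C := C * 2) fun t => ?_) fun x => ?_
    · rw [abs_mul, abs_abs, abs_of_nonneg (le_min (abs_nonneg t) zero_le_one : 0 ≤ min |t| 1)]
      calc _ ≤ C * 1 := mul_le_mul (hC t) (min_le_right _ _) (le_min (abs_nonneg _) zero_le_one) ((abs_nonneg _).trans (hC t))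
        _ = C := mul_one _
    · rw [abs_mul, abs_abs, abs_abs, T0, sub_zero]
      exact mul_le_mul (hC t) (Tle t) (abs_nonneg _) ((abs_nonneg _).trans (hC t))
    · simp only [T0, sub_zero]
      exact mul_le_mul_of_nonneg_left (Tge _) (abs_nonneg _)
  have := mul_le_mul_of_nonneg_left le c.pos.le
  linarith

/-- rectangle Sobolev on the torus with small gradient support -/
lemma Ctx.sob (c : Ctx P a τ ρ lam u) {T T' : ℝ → ℝ} (hT : ∀ t, HasDerivAt T (T' t) t) (h0 : ∀ t, 0 ≤ T' t)
    (h1 : ∀ t, T' t ≤ 1) {w : E2 → ℝ} (hw : Adm P w) (hwu : ∀ x ∉ Zs P, w x = T (u x)) (k : ℝ) {L : ℝ} (hL : 0 < L)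
    {S : Set E2} (hS : MeasurableSet S) (hz : ∀ z ∉ S, D1 w z = 0 ∧ D2 w z = 0) :
    ∫ x in QQ, (w x - ravg w (0,0) (1,1))^2 ≤ 32 * π^2 * (∑ i, |a i|) * ∫ x in QQ, S.indicator (fun z => L + (w z - k) ^ 2 / L) x := by
  have hw1 : ContDiff ℝ 1 w := hw.sm.of_le (by norm_cast)
  have s := rect_sobolev hw1 (a := (0,0)) (b := (1,1)) (by norm_num) (by norm_num)
  have g := grad_cs hw1 (a := (0,0)) (b := (1,1)) hL k hS hz
  have ar := c.arct hT h0 h1 hw hwu k hL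
  rw [← QQ_Icc] at s
  rw [← QQ_Icc, ← QQ_Icc, ← QQ_Icc] at g
  rw [← QQ_Icc] at s
  have nn : 0 ≤ ∫ x in QQ, S.indicator (fun z => L + (w z - k) ^ 2 / L) x :=
    integral_nonneg fun x => indicator_nonneg (fun z _ => by positivity) _
  norm_num at s
  have := mul_le_mul_of_nonneg_right ar nn
  linarith

/-- Lemma P -/
lemma Ctx.lemP (c : Ctx P a τ ρ lam u) {T T' : ℝ → ℝ} (hT : ∀ t, HasDerivAt T (T' t) t) (h0 : ∀ t, 0 ≤ T' t)
    (h1 : ∀ t, T' t ≤ 1) {w : E2 → ℝ} (hw : Adm P w) (hwu : ∀ x ∉ Zs P, w x = T (u x)) {I : Set ℝ} (hI : MeasurableSet I)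
    (hTI : ∀ t ∉ I, T t = 0) (hTn : ∀ t, 0 ≤ T t) {σ : ℝ} (hσ : mu u I ≤ σ) (hσ2 : σ ≤ 1/2) :
    ∫ x in QQ, w x ≤ (128 * π^2 * (∑ i, |a i|) + 1) * σ := by
  set N := ∑ i, |a i| with hN
  have hN0 : 0 ≤ N := Finset.sum_nonneg fun i _ => abs_nonneg _
  set L := 128 * π^2 * N + 1 with hL
  have hLp : 0 < L := by positivity
  have hσ0 : 0 ≤ σ := (mu_nonneg u I).trans hσ
  have wc := hw.sm.continuous
  have wn : ∀ x, 0 ≤ w x := by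
    have hd : Dense (Zs P)ᶜ := Measure.dense_of_ae (Zs_ae (P := P))
    intro x
    exact (closure_minimal (fun y hy => by
        show 0 ≤ w y
        rw [hwu y hy]; exact hTn _) (isClosed_le continuous_const wc)) (hd x)
  set S : Set E2 := {x | w x ≠ 0}
  have hS : MeasurableSet S := (isOpen_ne_fun wc continuous_const).measurableSet
  have hz : ∀ z ∉ S, D1 w z = 0 ∧ D2 w z = 0 := by
    intro z hz
    have hz' : w z = 0 := by simpa [S] using hz
    have : IsLocalMin w z := Eventually.of_forall fun y => by rw [hz']; exact wn y
    have := this.fderiv_eq_zero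
    simp [D1, D2, this]
  have s := c.sob hT h0 h1 hw hwu 0 hLp hS hz
  have iw2 : IntegrableOn (fun x => w x ^ 2) QQ := QQ_int (by fun_prop)
  have iw : IntegrableOn w QQ := QQ_int wc
  set X := ∫ x in QQ, w x ^ 2 with hX
  have hX0 : 0 ≤ X := integral_nonneg fun x => sq_nonneg _
  set m := ∫ x in QQ, w x with hm
  have hm0 : 0 ≤ m := integral_nonneg wn
  have ii := c.int_ind hI
  have sI : ∀ᵐ x ∂(volume.restrict QQ), w x = I.indicator (fun _ => (1:ℝ)) (u x) * w x ∧
      S.indicator (fun z => L + (w z - 0) ^ 2 / L) x ≤ L * I.indicator (fun _ => (1:ℝ)) (u x) + w x ^ 2 / L := by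
    filter_upwards [ae_restrict_of_ae (Zs_ae (P := P))] with x hx
    by_cases hxI : u x ∈ I
    · simp only [indicator_of_mem hxI]
      refine ⟨(one_mul _).symm, ?_⟩
      refine (indicator_le_self' (fun z _ => by positivity) x).trans ?_
      simp
    · have : w x = 0 := by rw [hwu x hx, hTI _ hxI]
      refine ⟨by simp [this], ?_⟩
      have hxS : x ∉ S := by simp [S, this]
      rw [indicator_of_notMem hxS, indicator_of_notMem hxI, this]
      simp
  have b1 : ∫ x in QQ, S.indicator (fun z => L + (w z - 0) ^ 2 / L) x ≤ L * σ + X / L := by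
    refine (integral_mono_ae ?_ ((ii.const_mul L).add (iw2.div_const L)) (sI.mono fun x hx => hx.2)).trans ?_
    · exact IntegrableOn.integrable (QQ_int (by fun_prop : Continuous fun z => L + (w z - 0)^2/L)) |>.indicator hS
    · simp only [Pi.add_apply]
      rw [integral_add (ii.const_mul L) (iw2.div_const L), integral_const_mul, integral_div]
      have := mul_le_mul_of_nonneg_left hσ hLp.le
      unfold mu at this
      linarith
  have msq : m ^ 2 ≤ σ * X := by
    have e : m = ∫ x in QQ, I.indicator (fun _ => (1:ℝ)) (u x) * w x := integral_congr_ae (sI.mono fun x hx => hx.1)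
    have sq1 : ∀ x, I.indicator (fun _ => (1:ℝ)) (u x) ^ 2 = I.indicator (fun _ => (1:ℝ)) (u x) := by
      intro x; by_cases h : u x ∈ I <;> simp [h]
    rw [e]
    refine cs_nonneg ?_ iw2 ?_ ?_ le_rfl
    · simp only [sq1]; exact ii
    · exact iw.congr (sI.mono fun x hx => hx.1)
    · simp only [sq1]; exact hσ
  have eav : ravg w (0,0) (1,1) = m := by
    unfold ravg; rw [← QQ_Icc]; norm_num; rfl
  rw [eav] at s
  have e2 : ∫ x in QQ, (w x - m)^2 = X - m^2 := by
    have : ∀ x, (w x - m)^2 = w x ^ 2 - 2 * m * w x + m^2 := fun x => by ring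
    simp only [this]
    have := QQ_fin
    have i3 : IntegrableOn (fun x => 2 * m * w x) QQ := iw.const_mul _
    have i4 : IntegrableOn (fun x => w x ^ 2 - 2 * m * w x) QQ := iw2.sub i3
    rw [integral_add i4 (integrable_const _), integral_sub iw2 i3, integral_const_mul,
      integral_const, measureReal_restrict_apply_univ, vol_QQ, ← hm, ← hX]
    simp; ring
  rw [e2] at s
  have pn : 0 ≤ 32 * π^2 * N := by positivity
  have s2 : X - m^2 ≤ 32 * π^2 * N * (L * σ + X / L) := s.trans (mul_le_mul_of_nonneg_left b1 pn)
  have s3 : 32 * π^2 * N * (X / L) ≤ X / 4 := by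
    rw [mul_div_assoc', div_le_div_iff₀ hLp (by norm_num)]
    nlinarith
  have s4 : X ≤ L^2 * σ := by
    have : m^2 ≤ X / 2 := by nlinarith
    have : X ≤ 128 * π^2 * N * (L * σ) := by nlinarith
    have : 128 * π^2 * N * (L * σ) ≤ L * (L * σ) := mul_le_mul_of_nonneg_right (by linarith) (by positivity)
    nlinarith
  have : m ^ 2 ≤ (L * σ)^2 := by nlinarith
  exact abs_le_of_sq_le_sq' this (by positivity) |>.2
end

lemma f_low {τ : ℝ} (hτ : 0 < τ) : ∃ c : ℝ, 0 < c ∧ (∀ t, |t| ≤ 6 → c * |t| ≤ |fτ τ t|) ∧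
    ∀ t, t ≤ -1 → c * mn t ≤ |fτ τ t| := by
  have p1 : 0 < (τ + exp 6)^3 := by positivity
  have key : ∀ t, |t| ≤ 6 → exp (-6) * |t| ≤ |1 - exp t| := by
    intro t ht
    have e6 : exp (-6) ≤ 1 := by rw [exp_le_one_iff]; norm_num
    obtain ⟨h1, h2⟩ := abs_le.1 ht
    rcases le_total 0 t with h | h
    · rw [abs_of_nonneg h, abs_of_nonpos (by linarith [one_le_exp h])]
      have := add_one_le_exp t
      nlinarith
    · rw [abs_of_nonpos h, abs_of_nonneg (by linarith [exp_le_one_iff.2 h])]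
      have a1 : 1 - exp t = exp t * (exp (-t) - 1) := by
        rw [mul_sub, ← exp_add]; simp
      have a2 := add_one_le_exp (-t)
      have a3 : exp (-6) ≤ exp t := exp_le_exp.2 h1
      rw [a1]
      exact mul_le_mul a3 (by linarith) (by linarith) (exp_pos _).le
  refine ⟨min (exp (-6) * exp (-6) / (τ + exp 6)^3) (1/2 / (τ+1)^3), by positivity, ?_, ?_⟩
  · intro t ht
    have a3 : exp (-6) ≤ exp t := exp_le_exp.2 (abs_le.1 ht).1
    have a4 : exp t ≤ exp 6 := exp_le_exp.2 (abs_le.1 ht).2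
    refine (mul_le_mul_of_nonneg_right (min_le_left _ _) (abs_nonneg t)).trans ?_
    unfold fτ
    rw [abs_div, abs_mul, abs_of_pos (exp_pos t), abs_of_pos (by positivity : 0 < (τ + exp t)^3), div_mul_eq_mul_div]
    refine div_le_div₀ (by positivity) ?_ (by positivity) (by gcongr)
    rw [mul_assoc]
    exact mul_le_mul a3 (key t ht) (by positivity) (exp_pos _).le
  · intro t ht
    rw [mn_of_le (by linarith)]
    refine (mul_le_mul_of_nonneg_right (min_le_right _ _) (exp_pos t).le).trans ?_
    have a1 : exp t ≤ 1/2 := by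
      have : exp t ≤ exp (-1) := exp_le_exp.2 ht
      have h2 : exp (-1) ≤ 1/2 := by
        rw [exp_neg, inv_eq_one_div]
        exact div_le_div_of_nonneg_left (by norm_num) (by norm_num) (by linarith [add_one_le_exp (1:ℝ)])
      linarith
    unfold fτ
    rw [abs_of_nonneg (div_nonneg (mul_nonneg (exp_pos t).le (by linarith)) (by positivity)), div_mul_eq_mul_div]
    refine div_le_div₀ (mul_nonneg (exp_pos t).le (by linarith)) ?_ (by positivity) (by gcongr; linarith)
    nlinarith [exp_pos t]

section
variable {ι : Type} [Fintype ι] {P : ι → E2} {a : ι → ℝ} {τ lam ρ : ℝ} {u : E2 → ℝ}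

lemma Ctx.massG (c : Ctx P a τ ρ lam u) {G : ℝ → ℝ} (hG : Measurable G) {C B : ℝ} (hB0 : 0 ≤ B) (hC : ∀ t, |G t| ≤ C)
    (hB : ∀ t, G t ≤ B * (|fτ τ t| * min |t| 1)) : lam * ∫ x in QQ, G (u x) ≤ B * (8 * π * ∑ i, |a i|) := by
  have m := c.mass1
  obtain ⟨D, hD⟩ := f_bdd c.hτ
  have cf := f_cont c.hτ
  have i1 : IntegrableOn (fun x => |fτ τ (u x)| * min |u x| 1) QQ := by
    refine c.int_b (G := fun t => |fτ τ t| * min |t| 1) (by fun_prop) (C := D) fun t => ?_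
    rw [abs_mul, abs_abs, abs_of_nonneg (le_min (abs_nonneg t) zero_le_one : 0 ≤ min |t| 1)]
    calc _ ≤ D * 1 := mul_le_mul (hD t) (min_le_right _ _) (le_min (abs_nonneg _) zero_le_one) ((abs_nonneg _).trans (hD t))
      _ = D := mul_one _
  have le : ∫ x in QQ, G (u x) ≤ B * ∫ x in QQ, |fτ τ (u x)| * min |u x| 1 := by
    rw [← integral_const_mul]
    exact integral_mono (c.int_b hG hC) (i1.const_mul B) fun x => hB _
  calc _ ≤ lam * (B * ∫ x in QQ, |fτ τ (u x)| * min |u x| 1) := mul_le_mul_of_nonneg_left le c.pos.le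
    _ = B * (lam * ∫ x in QQ, |fτ τ (u x)| * min |u x| 1) := by ring
    _ ≤ _ := mul_le_mul_of_nonneg_left m hB0

lemma ind_abs_le (I : Set ℝ) (t : ℝ) : |I.indicator (fun _ => (1:ℝ)) t| ≤ 1 := by
  by_cases h : t ∈ I <;> simp [h]

end

section
variable {ι : Type} [Fintype ι] (P : ι → E2) (a : ι → ℝ) (τ ρ : ℝ)

lemma tri (hτ : 0 < τ) : ∃ C : ℝ, 0 < C ∧ ∀ lam u, Ctx P a τ ρ lam u →
    lam * mu u (Ici (-1)) ≤ C ∨ lam * mu u (Iic (-5)) ≤ C := by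
  obtain ⟨c0, hc0, hlow, -⟩ := f_low hτ
  set N := ∑ i, |a i| with hN
  have hN0 : 0 ≤ N := Finset.sum_nonneg fun i _ => abs_nonneg _
  refine ⟨32 * π^2 * N * (5 * (c0⁻¹ * (8 * π * N))) + 1, by positivity, ?_⟩
  intro lam u c
  have hI : MeasurableSet (Icc (-5:ℝ) (-1)) := measurableSet_Icc
  have mI : lam * mu u (Icc (-5) (-1)) ≤ c0⁻¹ * (8 * π * N) := by
    refine c.massG (G := (Icc (-5:ℝ) (-1)).indicator (fun _ => (1:ℝ))) (measurable_const.indicator hI) (by positivity)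
      (ind_abs_le _) fun t => ?_
    by_cases ht : t ∈ Icc (-5:ℝ) (-1)
    · rw [indicator_of_mem ht]
      have t1 : 1 ≤ |t| := by rw [abs_of_nonpos (by linarith [ht.2])]; linarith [ht.2]
      have := hlow t (by rw [abs_le]; constructor <;> linarith [ht.1, ht.2])
      rw [min_eq_right t1, mul_one, inv_mul_eq_div, le_div_iff₀ hc0]
      nlinarith
    · rw [indicator_of_notMem ht]; positivity
  obtain ⟨T, T', hTs, hTd, hT0, hT1, hTid, hTp, hTm⟩ := exists_trunc 1 one_pos
  have hmono : Monotone T := monotone_of_hasDerivAt_nonneg hTd hT0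
  have anti : Antitone fun t => T t - t := antitone_of_hasDerivAt_nonpos (f' := fun t => T' t - 1) (fun t => (hTd t).sub (hasDerivAt_id t)) (fun t => sub_nonpos.2 (hT1 t))
  have T1 : T 1 = 1 := hTid 1 (by simp)
  have Tm1 : T (-1) = -1 := hTid (-1) (by simp)
  have Tp2 : 1 ≤ T 2 := by rw [← T1]; exact hmono (by norm_num)
  have Tm2 : T (-2) ≤ -1 := by rw [← Tm1]; exact hmono (by norm_num)
  have Tle : ∀ t, |T t| ≤ 2 := by
    have u1 : T 2 ≤ 2 := by
      have := anti (show (1:ℝ) ≤ 2 by norm_num)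
      simp only [T1] at this; linarith
    have l1 : -2 ≤ T (-2) := by
      have := anti (show (-2:ℝ) ≤ -1 by norm_num)
      simp only [Tm1] at this; linarith
    intro t
    rw [abs_le]
    constructor
    · rcases le_total t (-2) with h | h
      · rw [hTm t (by linarith)]; norm_num; linarith
      · linarith [hmono h]
    · rcases le_total 2 t with h | h
      · rw [hTp t (by linarith)]; norm_num; linarith
      · linarith [hmono h]
  have sh : ∀ t, HasDerivAt (fun t => T (t + 3)) (T' (t + 3)) t := fun t => by
    have := (hTd (t+3)).comp t ((hasDerivAt_id t).add_const 3)
    rw [mul_one] at this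
    exact this
  have Tp : ∀ t, -1 ≤ t → T (t+3) = T 2 := fun t ht => by
    rw [hTp _ (by linarith)]; norm_num
  have Tm : ∀ t, t ≤ -5 → T (t+3) = T (-2) := fun t ht => by
    rw [hTm _ (by linarith)]; norm_num
  obtain ⟨w, hw, hwu, -⟩ := c.sol.ext c.sep c.ne (G := fun t => T (t+3)) (hTs.comp (by fun_prop)) (M := 5)
    (fun t ht => Tm t ht) (fun t ht => Tp t (by linarith))
  set S : Set E2 := {x | D1 w x ≠ 0 ∨ D2 w x ≠ 0} with hSd
  have c1 : Continuous (D1 w) := D1_cont (hw.sm.of_le (by exact_mod_cast le_top))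
  have c2 : Continuous (D2 w) := D2_cont (hw.sm.of_le (by exact_mod_cast le_top))
  have wc := hw.sm.continuous
  have hS : MeasurableSet S := ((isOpen_ne_fun c1 continuous_const).union (isOpen_ne_fun c2 continuous_const)).measurableSet
  have hz : ∀ z ∉ S, D1 w z = 0 ∧ D2 w z = 0 := by
    intro z hz
    simp only [hSd, mem_setOf_eq, not_or, not_not] at hz
    exact hz
  have s := c.sob sh (fun t => hT0 _) (fun t => hT1 _) hw hwu 0 one_pos hS hz
  have ii := c.int_ind hI
  have sI : ∀ᵐ x ∂(volume.restrict QQ),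
      S.indicator (fun z => 1 + (w z - 0) ^ 2 / 1) x ≤ 5 * (Icc (-5:ℝ) (-1)).indicator (fun _ => (1:ℝ)) (u x) := by
    filter_upwards [ae_restrict_of_ae (Zs_ae (P := P))] with x hx
    have cu := (c.sol.sm x hx).cont
    by_cases hxI : u x ∈ Icc (-5:ℝ) (-1)
    · simp only [indicator_of_mem hxI]
      refine (indicator_le_self' (fun z _ => by positivity) x).trans ?_
      have := sq_le_sq' (abs_le.1 (Tle (u x + 3))).1 (abs_le.1 (Tle (u x + 3))).2
      rw [hwu x hx]
      norm_num at this ⊢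
      linarith
    · have hnb : (∃ v, w =ᶠ[𝓝 x] fun _ => v) := by
        simp only [mem_Icc, not_and_or, not_le] at hxI
        rcases hxI with h | h
        · refine ⟨T (-2), ?_⟩
          filter_upwards [c.sep.isOpen.mem_nhds hx, cu.eventually (Iio_mem_nhds h)] with y hy hy2
          rw [hwu y hy, Tm _ (le_of_lt hy2)]
        · refine ⟨T 2, ?_⟩
          filter_upwards [c.sep.isOpen.mem_nhds hx, cu.eventually (Ioi_mem_nhds h)] with y hy hy2
          rw [hwu y hy, Tp _ (le_of_lt hy2)]
      obtain ⟨v, hv⟩ := hnb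
      have hxS : x ∉ S := by
        simp only [hSd, mem_setOf_eq, not_or, not_not]
        rw [D1_congr hv, D2_congr hv]
        exact ⟨D1_const v, D2_const v⟩
      rw [indicator_of_notMem hxS, indicator_of_notMem hxI]
      simp
  have b1 : ∫ x in QQ, S.indicator (fun z => 1 + (w z - 0) ^ 2 / 1) x ≤ 5 * mu u (Icc (-5) (-1)) := by
    unfold mu
    rw [← integral_const_mul]
    refine integral_mono_ae ?_ (ii.const_mul 5) sI
    exact IntegrableOn.integrable (QQ_int (by fun_prop : Continuous fun z => 1 + (w z - 0)^2/1)) |>.indicator hS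
  set m := ravg w (0,0) (1,1)
  set X := ∫ x in QQ, (w x - m)^2 with hX
  have hXb : lam * X ≤ 32 * π^2 * N * (5 * (c0⁻¹ * (8 * π * N))) := by
    have := s.trans (mul_le_mul_of_nonneg_left b1 (by positivity))
    calc lam * X ≤ lam * _ := mul_le_mul_of_nonneg_left this c.pos.le
      _ = 32 * π^2 * N * (5 * (lam * mu u (Icc (-5) (-1)))) := by ring
      _ ≤ _ := by gcongr
  have iX : IntegrableOn (fun x => (w x - m)^2) QQ := QQ_int (by fun_prop)
  have fin : ∀ I : Set ℝ, MeasurableSet I → (∀ t ∈ I, 1 ≤ (T (t+3) - m)^2) → mu u I ≤ X := by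
    intro I hI' h
    unfold mu
    refine integral_mono_ae (c.int_ind hI') iX ?_
    filter_upwards [ae_restrict_of_ae (Zs_ae (P := P))] with x hx
    rw [hwu x hx]
    by_cases hxI : u x ∈ I
    · rw [indicator_of_mem hxI]; exact h _ hxI
    · rw [indicator_of_notMem hxI]; positivity
  rcases le_total m 0 with hm | hm
  · left
    have := fin (Ici (-1)) measurableSet_Ici (fun t ht => by
      rw [Tp t ht]; nlinarith)
    have := mul_le_mul_of_nonneg_left this c.pos.le
    linarith
  · right
    have := fin (Iic (-5)) measurableSet_Iic (fun t ht => by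
      rw [Tm t ht]; nlinarith)
    have := mul_le_mul_of_nonneg_left this c.pos.le
    linarith

lemma numass (hτ : 0 < τ) : ∃ C : ℝ, 0 < C ∧ ∀ lam u, Ctx P a τ ρ lam u →
    lam * ∫ x in QQ, mn (u x) ≤ C + lam * mu u (Ici (-1)) := by
  obtain ⟨c0, hc0, -, hlow⟩ := f_low hτ
  set N := ∑ i, |a i| with hN
  have hN0 : 0 ≤ N := Finset.sum_nonneg fun i _ => abs_nonneg _
  refine ⟨c0⁻¹ * (8 * π * N) + 1, by positivity, ?_⟩
  intro lam u c
  have hI : MeasurableSet (Ici (-1:ℝ)) := measurableSet_Ici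
  have hJ : MeasurableSet (Iio (-1:ℝ)) := measurableSet_Iio
  have bG : ∀ t, |(Iio (-1:ℝ)).indicator mn t| ≤ 1 := fun t => by
    by_cases h : t ∈ Iio (-1:ℝ)
    · rw [indicator_of_mem h, abs_of_nonneg (mn_nonneg t)]; exact mn_le_one t
    · rw [indicator_of_notMem h]; simp
  have mG : Measurable ((Iio (-1:ℝ)).indicator mn) := mn_cont.measurable.indicator hJ
  have := c.massG (G := (Iio (-1:ℝ)).indicator mn) mG (B := c0⁻¹) (by positivity)
    (C := 1) bG fun t => by
      by_cases h : t ∈ Iio (-1:ℝ)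
      · rw [indicator_of_mem h]
        have h' : t < -1 := h
        have t1 : 1 ≤ |t| := by rw [abs_of_nonpos (by linarith)]; linarith
        rw [min_eq_right t1, mul_one, inv_mul_eq_div, le_div_iff₀ hc0, mul_comm]
        exact hlow t h'.le
      · rw [indicator_of_notMem h]; positivity
  have le : ∫ x in QQ, mn (u x) ≤ (∫ x in QQ, (Iio (-1:ℝ)).indicator mn (u x)) + mu u (Ici (-1)) := by
    unfold mu
    rw [← integral_add (c.int_b mG bG) (c.int_ind hI)]
    refine integral_mono (c.int_b mn_cont.measurable (C := 1) fun t => ?_) ((c.int_b mG bG).add (c.int_ind hI)) fun x => ?_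
    · rw [abs_of_nonneg (mn_nonneg t)]; exact mn_le_one t
    · rcases lt_or_ge (u x) (-1) with h | h
      · have h2 : u x ∉ Ici (-1:ℝ) := not_le.2 h
        simp [indicator_of_mem (show u x ∈ Iio (-1:ℝ) from h)]
        exact ind_nonneg _ _
      · simp [indicator_of_mem (show u x ∈ Ici (-1:ℝ) from h)]
        exact (mn_le_one _).trans (by linarith [indicator_nonneg (fun t _ => mn_nonneg t) (u x) (s := Iio (-1:ℝ))])
  have := mul_le_mul_of_nonneg_left le c.pos.le
  linarith
end

def hs (t : ℝ) : ℝ := ∫ s in (0:ℝ)..t, Real.smoothTransition s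

lemma st_cont : Continuous Real.smoothTransition := Real.smoothTransition.continuous

lemma hs_deriv (t : ℝ) : HasDerivAt hs (Real.smoothTransition t) t :=
  intervalIntegral.integral_hasDerivAt_right (st_cont.intervalIntegrable _ _)
      st_cont.stronglyMeasurable.stronglyMeasurableAtFilter st_cont.continuousAt

lemma hs_smooth : ContDiff ℝ (⊤ : ℕ∞) hs := by
  rw [contDiff_infty_iff_deriv]
  refine ⟨fun t => (hs_deriv t).differentiableAt, ?_⟩
  have : deriv hs = Real.smoothTransition := by ext t; exact (hs_deriv t).deriv
  rw [this]
  exact Real.smoothTransition.contDiff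

lemma hs_zero {t : ℝ} (h : t ≤ 0) : hs t = 0 := by
  unfold hs
  rw [intervalIntegral.integral_congr (g := fun _ => 0)]
  · simp
  · intro s hs
    rw [uIcc_of_ge h] at hs
    exact Real.smoothTransition.zero_of_nonpos hs.2

lemma hs_mono : Monotone hs := monotone_of_hasDerivAt_nonneg hs_deriv (fun t => Real.smoothTransition.nonneg t)

lemma hs_nonneg (t : ℝ) : 0 ≤ hs t := by
  rcases le_total t 0 with h | h
  · rw [hs_zero h]
  · rw [← hs_zero le_rfl]; exact hs_mono h

lemma hs_pos {t : ℝ} (h : 0 < t) : 0 < hs t := by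
  unfold hs
  exact intervalIntegral.intervalIntegral_pos_of_pos_on (st_cont.intervalIntegrable _ _)
    (fun x hx => Real.smoothTransition.pos_of_pos hx.1) h

lemma hs_ge (t : ℝ) : t - 1 ≤ hs t := by
  rcases le_total t 1 with h | h
  · linarith [hs_nonneg t]
  · have : Monotone fun t => hs t - Real.smoothTransition 0 * t := by
      refine monotone_of_hasDerivAt_nonneg (f' := fun t => Real.smoothTransition t - Real.smoothTransition 0 * 1) (fun t => (hs_deriv t).sub ((hasDerivAt_id t).const_mul _)) fun t => ?_
      rw [Real.smoothTransition.zero]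
      simpa using Real.smoothTransition.nonneg t
    have e : hs t = hs 1 + ∫ s in (1:ℝ)..t, Real.smoothTransition s :=
      (intervalIntegral.integral_add_adjacent_intervals (st_cont.intervalIntegrable _ _) (st_cont.intervalIntegrable _ _)).symm
    have e2 : ∫ s in (1:ℝ)..t, Real.smoothTransition s = ∫ s in (1:ℝ)..t, (1:ℝ) := by
      apply intervalIntegral.integral_congr
      intro s hs
      rw [uIcc_of_le h] at hs
      exact Real.smoothTransition.one_of_one_le hs.1
    rw [e, e2]
    simp
    exact hs_nonneg 1

/-- mean value: value at the centre against the torus integral -/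
lemma mv_box {g : E2 → ℝ} {q : E2} {S s1 : ℝ} (h1 : s1 < S) (hq : SmAt g q)
    (hg : ∀ z : E2, z.1 < S → SmAt g (Cyl q z)) (hl : ∀ z : E2, z.1 < S → 0 ≤ lapp g (Cyl q z)) (h0 : 0 ≤ g q) :
    g q * exp (2 * s1) ≤ 2 * ∫ z in box (s1-1) s1, exp (2*z.1) * g (Cyl q z) := by
  have m := mean_value (s0 := s1 - 1) (by linarith) h1 hq hg hl
  have ce : Continuous fun z : E2 => exp (2*z.1) := by fun_prop
  have i1 : IntegrableOn (fun z : E2 => exp (2*z.1)) (box (s1-1) s1) := ce.continuousOn.integrableOn_compact (box_compact _ _)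
  have i2 : IntegrableOn (fun z : E2 => exp (2*z.1) * g (Cyl q z)) (box (s1-1) s1) := by
    refine ContinuousOn.integrableOn_compact (box_compact _ _) fun z hz => ?_
    have := (hg z ((box_mem.1 hz).1.2.trans_lt h1)).cyl.cont
    exact (ce.continuousAt.mul this).continuousWithinAt
  have e : ∫ z in box (s1-1) s1, exp (2*z.1) * (g (Cyl q z) - g q) =
      (∫ z in box (s1-1) s1, exp (2*z.1) * g (Cyl q z)) - g q * ∫ z in box (s1-1) s1, exp (2*z.1) := by
    rw [← integral_const_mul, ← integral_sub i2 (i1.const_mul _)]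
    congr 1; ext z; ring
  rw [e] at m
  have low : exp (2*s1) / 2 ≤ ∫ z in box (s1-1) s1, exp (2*z.1) := by
    have : ∫ z in box (s1-1) s1, exp (2*s1 - 2) ≤ ∫ z in box (s1-1) s1, exp (2*z.1) := by
      refine setIntegral_mono_on ?_ i1 (box_meas _ _) fun z hz => ?_
      · exact continuous_const.continuousOn.integrableOn_compact (box_compact _ _)
      · exact exp_le_exp.2 (by linarith [(box_mem.1 hz).1.1])
    refine le_trans ?_ this
    rw [setIntegral_const]
    have v : volume.real (box (s1-1) s1) = 2 * π := by
      unfold box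
      rw [vol_rect (by simp) (by simp; linarith [pi_pos])]
      simp; ring
    rw [v, exp_sub, smul_eq_mul]
    have e2 : exp 2 ≤ 9 := by
      have := exp_one_lt_d9
      have h2 : exp 2 = exp 1 * exp 1 := by rw [← exp_add]; norm_num
      rw [h2]; nlinarith [exp_pos 1]
    rw [mul_div_assoc', div_le_div_iff₀ (by norm_num) (exp_pos _)]
    nlinarith [pi_gt_three, exp_pos (2*s1), mul_pos (exp_pos (2*s1)) pi_pos]
  nlinarith

section
variable {ι : Type} [Fintype ι] {P : ι → E2} {a : ι → ℝ} {τ lam ρ : ℝ} {u : E2 → ℝ}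

/-- the point is not a `+∞` singularity -/
def NotZ2 (P : ι → E2) (a : ι → ℝ) (x : E2) : Prop := ∀ i k, x = P i + lat k → 0 < a i

open Classical in
def hb (P : ι → E2) (u : E2 → ℝ) (t1 : ℝ) (x : E2) : ℝ := if x ∈ Zs P then 0 else hs (u x - t1)

lemma hb_nonneg (t1 : ℝ) (x : E2) : 0 ≤ hb P u t1 x := by
  unfold hb; split_ifs
  · exact le_rfl
  · exact hs_nonneg _

lemma hb_reg {t1 : ℝ} {x : E2} (hx : x ∉ Zs P) : hb P u t1 x = hs (u x - t1) := by
  unfold hb; rw [if_neg hx]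

lemma hb_Z1 (c : Ctx P a τ ρ lam u) {t1 : ℝ} {x : E2} (hx : x ∈ Zs P) (h : NotZ2 P a x) :
    hb P u t1 =ᶠ[𝓝 x] fun _ => 0 := by
  obtain ⟨i, k, rfl⟩ := hx
  have ha := h i k rfl
  have e : ∀ᶠ y in 𝓝 (P i), hb P u t1 y = 0 := by
    have := c.sol.to_inf i (-t1)
    rw [eventually_nhdsWithin_iff] at this
    filter_upwards [this] with y hy
    unfold hb
    split_ifs with h2
    · rfl
    · have hne : y ≠ P i := fun h3 => h2 (h3 ▸ P_mem i)
      have := (hy hne).1 ha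
      exact hs_zero (by linarith)
  have ct : Tendsto (fun y : E2 => y - lat k) (𝓝 (P i + lat k)) (𝓝 (P i)) := by
    have : Continuous fun y : E2 => y - lat k := by fun_prop
    simpa using this.tendsto (P i + lat k)
  filter_upwards [ct.eventually e] with y hy
  rw [← hy]
  have e1 : y ∈ Zs P ↔ (y - lat k ∈ Zs P) := by
    have := Zs_add (P := P) (x := y - lat k) k
    rw [sub_add_cancel] at this
    exact this
  have e2 : u y = u (y - lat k) := by
    have := c.sol.per (y - lat k) k
    rw [sub_add_cancel] at this
    exact this
  unfold hb
  rw [e2]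
  by_cases hy2 : y ∈ Zs P
  · rw [if_pos hy2, if_pos (e1.1 hy2)]
  · rw [if_neg hy2, if_neg (fun h => hy2 (e1.2 h))]

lemma hb_sm (c : Ctx P a τ ρ lam u) {t1 : ℝ} {x : E2} (h : NotZ2 P a x) : SmAt (hb P u t1) x := by
  by_cases hx : x ∈ Zs P
  · exact (SmAt.const 0).congr (hb_Z1 c hx h)
  · have : hb P u t1 =ᶠ[𝓝 x] fun y => hs (u y - t1) := by
      filter_upwards [c.sep.isOpen.mem_nhds hx] with y hy
      exact hb_reg hy
    exact (SmAt.comp hs_smooth ((c.sol.sm x hx).sub (SmAt.const t1))).congr this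

lemma hb_lapp (c : Ctx P a τ ρ lam u) {t1 : ℝ} (ht : 0 ≤ t1) {x : E2} (h : NotZ2 P a x) : 0 ≤ lapp (hb P u t1) x := by
  by_cases hx : x ∈ Zs P
  · rw [lapp_congr (hb_Z1 c hx h)]
    have : lapp (fun _ : E2 => (0:ℝ)) x = 0 := by
      unfold lapp
      have e1 : D1 (fun _ : E2 => (0:ℝ)) = fun _ => 0 := by ext y; exact D1_const 0
      have e2 : D2 (fun _ : E2 => (0:ℝ)) = fun _ => 0 := by ext y; exact D2_const 0
      rw [e1, e2, D1_const, D2_const, add_zero]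
    rw [this]
  · have e : hb P u t1 =ᶠ[𝓝 x] fun y => hs (u y - t1) := by
      filter_upwards [c.sep.isOpen.mem_nhds hx] with y hy
      exact hb_reg hy
    have d2 : DifferentiableAt ℝ Real.smoothTransition (u x - t1) :=
      (Real.smoothTransition.contDiff (n := 1)).differentiable (by norm_num) _
    have sh : ∀ t, HasDerivAt (fun t => hs (t - t1)) (Real.smoothTransition (t - t1)) t := fun t => by
      have := (hs_deriv (t - t1)).comp t ((hasDerivAt_id t).sub_const t1)
      rw [mul_one] at this
      exact this
    have sh2 : HasDerivAt (fun t => Real.smoothTransition (t - t1)) (deriv Real.smoothTransition (u x - t1)) (u x) := by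
      have := d2.hasDerivAt.comp (u x) ((hasDerivAt_id (u x)).sub_const t1)
      rw [mul_one] at this
      exact this
    rw [lapp_congr e, lapp_comp (G := fun t => hs (t - t1)) (c.sol.sm x hx) sh sh2, c.sol.pde x hx]
    have m : 0 ≤ deriv Real.smoothTransition (u x - t1) := Real.smoothTransition.monotone.deriv_nonneg
    have n1 := Real.smoothTransition.nonneg (u x - t1)
    refine add_nonneg ?_ (mul_nonneg m (gsq_nonneg _ _))
    rcases le_total (u x - t1) 0 with h2 | h2
    · rw [Real.smoothTransition.zero_of_nonpos h2]; simp
    · have := f_sign_pos c.hτ (show 0 ≤ u x by linarith)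
      have := mul_nonneg c.pos.le (neg_nonneg.2 this)
      refine mul_nonneg n1 (by linarith)

lemma Ctx.hbox (c : Ctx P a τ ρ lam u) {t1 σ : ℝ} (hσ : mu u (Ici t1) ≤ σ) (hσ2 : σ ≤ 1/2) {q : E2} {s0 s1 : ℝ}
    (h1 : s1 < log (1/2)) (hreg : ∀ z ∈ box s0 s1, NotZ2 P a (Cyl q z)) :
    ∫ z in box s0 s1, exp (2*z.1) * hb P u t1 (Cyl q z) ≤ (128 * π^2 * (∑ i, |a i|) + 1) * σ := by
  have cc : ContinuousOn (fun z => hb P u t1 (Cyl q z)) (box s0 s1) := fun z hz =>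
    (hb_sm c (hreg z hz)).cyl.cont.continuousWithinAt
  obtain ⟨M0, hM0⟩ := (box_compact s0 s1).bddAbove_image cc
  set M := max M0 1
  have hM : 0 < M := lt_max_of_lt_right one_pos
  have hMb : ∀ z ∈ box s0 s1, hb P u t1 (Cyl q z) ≤ M := fun z hz =>
    (hM0 (mem_image_of_mem _ hz)).trans (le_max_left _ _)
  obtain ⟨T, T', hTs, hTd, hT0, hT1, hTid, hTp, hTm⟩ := exists_trunc M hM
  have hmono : Monotone T := monotone_of_hasDerivAt_nonneg hTd hT0
  have T0 : T 0 = 0 := hTid 0 (by simp [hM.le])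
  have Tn : ∀ t, 0 ≤ t → 0 ≤ T t := fun t ht => T0 ▸ hmono ht
  set G : ℝ → ℝ := fun t => T (hs (t - t1)) with hG
  have hGd : ∀ t, HasDerivAt G (T' (hs (t - t1)) * Real.smoothTransition (t - t1)) t := fun t => by
    have := ((hTd (hs (t-t1))).comp t (((hs_deriv (t - t1)).comp t ((hasDerivAt_id t).sub_const t1))))
    rw [mul_one] at this
    exact this
  obtain ⟨w, hw, hwu, hwP⟩ := c.sol.ext c.sep c.ne (G := G) (hTs.comp (hs_smooth.comp (by fun_prop))) (M := |t1| + M + 2) (gm := 0) (gP := T (M+1))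
    (fun t ht => by
      simp only [hG]
      rw [hs_zero (by linarith [neg_abs_le t1]), T0])
    (fun t ht => by
      simp only [hG]
      rw [hTp _ (by linarith [hs_ge (t - t1), le_abs_self t1])])
  have le := c.lemP hGd (fun t => mul_nonneg (hT0 _) (Real.smoothTransition.nonneg _))
    (fun t => mul_le_one₀ (hT1 _) (Real.smoothTransition.nonneg _) (Real.smoothTransition.le_one _)) hw hwu
    (I := Ici t1) measurableSet_Ici (fun t ht => by
      simp only [hG]
      rw [hs_zero (by simp at ht; linarith), T0]) (fun t => Tn _ (hs_nonneg _)) hσ hσ2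
  have wc := hw.sm.continuous
  have wn : ∀ x, 0 ≤ w x := by
    have hd : Dense (Zs P)ᶜ := Measure.dense_of_ae (Zs_ae (P := P))
    intro x
    exact (closure_minimal (fun y hy => by
        show 0 ≤ w y
        rw [hwu y hy]; exact Tn _ (hs_nonneg _)) (isClosed_le continuous_const wc)) (hd x)
  have e : ∫ z in box s0 s1, exp (2*z.1) * hb P u t1 (Cyl q z) = ∫ z in box s0 s1, exp (2*z.1) * w (Cyl q z) := by
    refine setIntegral_congr_fun (box_meas _ _) fun z hz => ?_
    congr 1
    by_cases hx : Cyl q z ∈ Zs P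
    · rw [hb, if_pos hx]
      obtain ⟨i, k, hik⟩ := hx
      have := hreg z hz i k hik
      rw [hik, hw.per, (hwP i).1 this]
    · rw [hwu _ hx]
      have := hMb z hz
      rw [hb_reg hx] at this ⊢
      simp only [hG]
      rw [hTid _ (by rw [abs_of_nonneg (hs_nonneg _)]; exact this)]
  rw [e]
  exact (cyl_le_QQ wn hw.per (QQ_int wc) q h1).2.trans le

/-- upper bound away from `Z₂` -/
lemma Ctx.sup (c : Ctx P a τ ρ lam u) {σ : ℝ} (hσ : mu u (Ici 0) ≤ σ) (hσ2 : σ ≤ 1/2) {q : E2} {r : ℝ} (hr : 0 < r) (hr2 : r ≤ 1/2)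
    (hz : ∀ x, nsq (x - q) < r^2 → NotZ2 P a x) (hq : q ∉ Zs P) :
    hs (u q) * r^2 ≤ 18 * (128 * π^2 * (∑ i, |a i|) + 1) * σ := by
  have hN0 : 0 ≤ ∑ i, |a i| := Finset.sum_nonneg fun i _ => abs_nonneg _
  have hin : ∀ z : E2, z.1 < log r → NotZ2 P a (Cyl q z) := fun z hz' => by
    apply hz
    rw [nsq_cyl, ← exp_two_log hr]
    exact exp_lt_exp.2 (by linarith)
  have hqn : NotZ2 P a q := hz q (by simp [nsq]; positivity)
  have hlog : log r ≤ log (1/2) := log_le_log hr hr2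
  have m := mv_box (g := hb P u 0) (q := q) (S := log r) (s1 := log r - 1) (by linarith) (hb_sm c hqn)
    (fun z hz' => hb_sm c (hin z hz')) (fun z hz' => hb_lapp c le_rfl (hin z hz')) (hb_nonneg _ _)
  have b := c.hbox hσ hσ2 (q := q) (s0 := log r - 1 - 1) (s1 := log r - 1) (by linarith)
    (fun z hz' => hin z (by linarith [(box_mem.1 hz').1.2]))
  rw [hb_reg hq, sub_zero] at m
  have e : exp (2 * (log r - 1)) * 9 ≥ r^2 := by
    rw [mul_sub, exp_sub, exp_two_log hr]
    have e2 : exp 2 ≤ 9 := by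
      have := exp_one_lt_d9
      have h2 : exp 2 = exp 1 * exp 1 := by rw [← exp_add]; norm_num
      rw [h2]; nlinarith [exp_pos 1]
    rw [mul_one, div_mul_eq_mul_div, ge_iff_le, le_div_iff₀ (exp_pos _)]
    nlinarith [sq_nonneg r]
  have := hs_nonneg (u q)
  nlinarith
end

lemma hs_le {t : ℝ} (h : 0 ≤ t) : hs t ≤ t := by
  have anti : Antitone fun t => hs t - t := antitone_of_hasDerivAt_nonpos (f' := fun t => Real.smoothTransition t - 1) (fun t => (hs_deriv t).sub (hasDerivAt_id t)) (fun t => sub_nonpos.2 (Real.smoothTransition.le_one t))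
  have := anti h
  simp only [hs_zero le_rfl] at this
  linarith

section
variable {ι : Type} [Fintype ι] {P : ι → E2} {a : ι → ℝ} {τ lam ρ : ℝ} {u : E2 → ℝ}

lemma Ctx.neg (c : Ctx P a τ ρ lam u) (h : τ^3 ≤ lam) :
    Ctx P (fun i => -a i) τ⁻¹ ρ (lam * (τ^3)⁻¹) (fun x => -u x) := by
  have hτ3 : 0 < τ^3 := pow_pos c.hτ 3
  refine ⟨inv_pos.2 c.hτ, ⟨?_, ?_, ?_, ?_⟩, c.sep, fun i => neg_ne_zero.2 (c.ne i), ?_⟩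
  · intro x k
    simp only [c.sol.per x k]
  · intro x hx
    exact (c.sol.sm x hx).neg
  · intro x hx
    have e1 : D1 (fun y => -u y) = fun y => -D1 u y := by ext y; exact D1_neg
    have e2 : D2 (fun y => -u y) = fun y => -D2 u y := by ext y; exact D2_neg
    have : lapp (fun y => -u y) x = -lapp u x := by
      unfold lapp
      rw [e1, e2, D1_neg, D2_neg]; ring
    rw [this, c.sol.pde x hx]
    have := f_symm c.hτ (-u x)
    rw [neg_neg] at this
    rw [this]; ring
  · intro i
    obtain ⟨v, hv, he⟩ := c.sol.sing i
    refine ⟨fun x => -v x, hv.neg, ?_⟩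
    filter_upwards [he] with x hx
    rw [hx]; ring
  · rw [← div_eq_mul_inv, le_div_iff₀ hτ3]; linarith

lemma StabS.neg (hτ : 0 < τ) (h : StabS τ lam u) : StabS τ⁻¹ (lam * (τ^3)⁻¹) (fun x => -u x) := by
  intro φ h1 h2
  have := h φ h1 h2
  convert this using 3 with x
  have := f'_symm hτ (-u x)
  rw [neg_neg] at this
  rw [this]; ring

lemma mu_neg (t : ℝ) : mu (fun x => -u x) (Ici t) = mu u (Iic (-t)) := by
  unfold mu
  congr 1; ext x
  by_cases h : u x ≤ -t
  · rw [indicator_of_mem (show -u x ∈ Ici t by simp; linarith), indicator_of_mem (show u x ∈ Iic (-t) from h)]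
  · rw [indicator_of_notMem (show -u x ∉ Ici t by simp at h ⊢; linarith), indicator_of_notMem (show u x ∉ Iic (-t) from h)]
end

section
variable {ι : Type} [Fintype ι] (P : ι → E2) (a : ι → ℝ) (τ ρ : ℝ)

/-- upper bound when the set `u ≥ 5` is small -/
lemma caseA_pt {η : ℝ} (hηp : 0 < η) (t : ℝ) : hs t ≤ η + 6 / η^2 * (Icc (-6:ℝ) 6).indicator (fun t => t^2) t
    + 6 * (Ici (5:ℝ)).indicator (fun _ => (1:ℝ)) t + hs (t - 5) := by
  have k1 : 0 ≤ (Icc (-6:ℝ) 6).indicator (fun t => t^2) t := indicator_nonneg (fun _ _ => sq_nonneg _) t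
  have k2 : 0 ≤ (Ici (5:ℝ)).indicator (fun _ => (1:ℝ)) t := ind_nonneg _ t
  have n5 := hs_nonneg (t - 5)
  have p2 : 0 < 6 / η^2 := by positivity
  have p3 := mul_nonneg p2.le k1
  rcases le_total t η with h | h
  · have : hs t ≤ η := by
      rcases le_total t 0 with h0 | h0
      · rw [hs_zero h0]; exact hηp.le
      · exact (hs_le h0).trans h
    linarith
  · have ht := hs_le (hηp.le.trans h)
    rcases le_total t 6 with h6 | h6
    · have e : (Icc (-6:ℝ) 6).indicator (fun t => t^2) t = t^2 := by
        rw [indicator_of_mem]; constructor <;> linarith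
      rw [e]
      have : 6 ≤ 6 / η^2 * t^2 := by
        rw [div_mul_eq_mul_div, le_div_iff₀ (by positivity)]
        nlinarith
      linarith
    · have e : (Ici (5:ℝ)).indicator (fun _ => (1:ℝ)) t = 1 := by
        rw [indicator_of_mem]; simp; linarith
      rw [e]
      have := hs_ge (t - 5)
      linarith

set_option maxHeartbeats 1000000 in
lemma caseA (hτ : 0 < τ) {C1 γ r : ℝ} (hC1 : 0 < C1) (hγ : 0 < γ) (hr : 0 < r) (hr2 : r ≤ 1/2) :
    ∃ Λ : ℝ, ∀ lam u, Ctx P a τ ρ lam u → Λ ≤ lam → lam * mu u (Ici 5) ≤ C1 →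
      ∀ q, (∀ x, nsq (x - q) < r^2 → NotZ2 P a x) → q ∉ Zs P → u q ≤ γ := by
  obtain ⟨c0, hc0, hlow, -⟩ := f_low hτ
  set N := ∑ i, |a i| with hN
  have hN0 : 0 ≤ N := Finset.sum_nonneg fun i _ => abs_nonneg _
  set η := hs γ * r^2 / 40 with hη
  have hγ' := hs_pos hγ
  have hηp : 0 < η := by positivity
  set C2 := 6 / η^2 * (6 * c0⁻¹ * (8 * π * N)) + 6 * C1 + (128 * π^2 * N + 1) * C1 with hC2
  have hC2p : 0 < C2 := by positivity
  refine ⟨max (2 * C1) (C2 / η), ?_⟩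
  intro lam u c hlam hmu q hz hq
  have l1 : 2 * C1 ≤ lam := (le_max_left _ _).trans hlam
  have l2 : C2 / η ≤ lam := (le_max_right _ _).trans hlam
  have lp := c.pos
  have hσ : mu u (Ici 5) ≤ C1 / lam := by rw [le_div_iff₀ lp]; linarith
  have hσ2 : C1 / lam ≤ 1/2 := by rw [div_le_div_iff₀ lp (by norm_num)]; linarith
  have hin : ∀ z : E2, z.1 < log r → NotZ2 P a (Cyl q z) := fun z hz' => by
    apply hz
    rw [nsq_cyl, ← exp_two_log hr]
    exact exp_lt_exp.2 (by linarith)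
  have hqn : NotZ2 P a q := hz q (by simp [nsq]; positivity)
  have hlog : log r ≤ log (1/2) := log_le_log hr hr2
  have m := mv_box (g := hb P u 0) (q := q) (S := log r) (s1 := log r - 1) (by linarith) (hb_sm c hqn)
    (fun z hz' => hb_sm c (hin z hz')) (fun z hz' => hb_lapp c le_rfl (hin z hz')) (hb_nonneg _ _)
  have hbx : ∀ z ∈ box (log r - 1 - 1) (log r - 1), NotZ2 P a (Cyl q z) :=
    fun z hz' => hin z (by linarith [(box_mem.1 hz').1.2])
  have b := c.hbox hσ hσ2 (q := q) (s0 := log r - 1 - 1) (s1 := log r - 1) (by linarith) hbx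
  rw [hb_reg hq, sub_zero] at m
  -- the comparison function
  set K1 : ℝ → ℝ := (Icc (-6:ℝ) 6).indicator (fun t => t^2) with hK1
  set K2 : ℝ → ℝ := (Ici (5:ℝ)).indicator (fun _ => (1:ℝ)) with hK2
  have K1n : ∀ t, 0 ≤ K1 t := fun t => indicator_nonneg (fun _ _ => sq_nonneg _) t
  have K2n : ∀ t, 0 ≤ K2 t := fun t => ind_nonneg _ t
  have K1b : ∀ t, |K1 t| ≤ 36 := fun t => by
    rw [abs_of_nonneg (K1n t), hK1]
    by_cases h : t ∈ Icc (-6:ℝ) 6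
    · rw [indicator_of_mem h]; nlinarith [h.1, h.2]
    · rw [indicator_of_notMem h]; norm_num
  have K1m : Measurable K1 := (by fun_prop : Measurable fun t : ℝ => t^2).indicator measurableSet_Icc
  have i1 := c.int_b K1m K1b
  have i2 := c.int_ind (I := Ici 5) measurableSet_Ici
  have mK1 : lam * ∫ x in QQ, K1 (u x) ≤ 6 * c0⁻¹ * (8 * π * N) := by
    refine c.massG K1m (by positivity) K1b fun t => ?_
    by_cases h : t ∈ Icc (-6:ℝ) 6
    · rw [hK1, indicator_of_mem h]
      have h6 : |t| ≤ 6 := abs_le.2 h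
      have h7 := hlow t h6
      have h8 : |t| ≤ 6 * min |t| 1 := by
        rcases le_total |t| 1 with h' | h'
        · rw [min_eq_left h']; linarith [abs_nonneg t]
        · rw [min_eq_right h']; linarith
      have h9 : |t| ≤ c0⁻¹ * |fτ τ t| := by rw [inv_mul_eq_div, le_div_iff₀ hc0]; linarith
      calc t^2 = |t| * |t| := by rw [← sq, sq_abs]
        _ ≤ (c0⁻¹ * |fτ τ t|) * (6 * min |t| 1) := mul_le_mul h9 h8 (abs_nonneg _) (by positivity)
        _ = _ := by ring
    · rw [hK1, indicator_of_notMem h]; positivity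
  set K : ℝ → ℝ := fun t => η + 6 / η^2 * K1 t + 6 * K2 t with hK
  have QF := QQ_fin
  have iK : IntegrableOn (fun x => K (u x)) QQ :=
    ((integrable_const η).add (i1.const_mul (6/η^2))).add (i2.const_mul 6)
  have Kn : ∀ t, 0 ≤ K t := fun t => by
    have := K1n t; have := K2n t; simp only [hK]; positivity
  have bK := cyl_le_QQ (g := fun x => K (u x)) (fun x => Kn _) (fun x k => by simp only [c.sol.per x k]) iK q
    (s0 := log r - 1 - 1) (s1 := log r - 1) (by linarith)
  have eK : ∫ x in QQ, K (u x) = η + 6/η^2 * (∫ x in QQ, K1 (u x)) + 6 * mu u (Ici 5) := by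
    have j0 : IntegrableOn (fun _ : E2 => η) QQ := integrable_const η
    have j1 : IntegrableOn (fun x => 6/η^2 * K1 (u x)) QQ := i1.const_mul (6/η^2)
    have j2 : IntegrableOn (fun x => 6 * K2 (u x)) QQ := i2.const_mul 6
    have j3 : IntegrableOn (fun x => η + 6/η^2 * K1 (u x)) QQ := j0.add j1
    simp only [hK]
    rw [integral_add j3 j2, integral_add j0 j1, integral_const_mul, integral_const_mul,
      integral_const, measureReal_restrict_apply_univ, vol_QQ, one_smul]
    rfl
  have pt : ∀ x, hb P u 0 x ≤ K (u x) + hb P u 5 x := by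
    intro x
    by_cases hx : x ∈ Zs P
    · rw [hb, hb, if_pos hx, if_pos hx]; linarith [Kn (u x)]
    · rw [hb_reg hx, hb_reg hx, sub_zero]
      exact caseA_pt hηp (u x)
  have ci : ∀ t1, IntegrableOn (fun z => exp (2*z.1) * hb P u t1 (Cyl q z)) (box (log r - 1 - 1) (log r - 1)) := fun t1 => by
    refine ContinuousOn.integrableOn_compact (box_compact _ _) fun z hz => ?_
    have := (hb_sm c (t1 := t1) (hbx z hz)).cyl.cont
    have ce : Continuous fun z : E2 => exp (2*z.1) := by fun_prop
    exact (ce.continuousAt.mul this).continuousWithinAt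
  have tot : ∫ z in box (log r - 1 - 1) (log r - 1), exp (2*z.1) * hb P u 0 (Cyl q z) ≤
      (∫ x in QQ, K (u x)) + (128 * π^2 * N + 1) * (C1 / lam) := by
    refine le_trans ?_ (add_le_add bK.2 b)
    rw [← integral_add bK.1 (ci 5)]
    refine integral_mono (ci 0) (bK.1.add (ci 5)) fun z => ?_
    simp only [Pi.add_apply]
    rw [← mul_add]
    exact mul_le_mul_of_nonneg_left (pt _) (exp_pos _).le
  have tot2 : ∫ z in box (log r - 1 - 1) (log r - 1), exp (2*z.1) * hb P u 0 (Cyl q z) ≤ 2 * η := by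
    refine tot.trans ?_
    rw [eK]
    have a1 : ∫ x in QQ, K1 (u x) ≤ (6 * c0⁻¹ * (8 * π * N)) / lam := by rw [le_div_iff₀ lp]; linarith
    have a2 : C2 / lam ≤ η := by rw [div_le_iff₀ lp]; rw [div_le_iff₀ hηp] at l2; linarith
    have a3 : 6/η^2 * (∫ x in QQ, K1 (u x)) ≤ 6/η^2 * ((6 * c0⁻¹ * (8 * π * N)) / lam) :=
      mul_le_mul_of_nonneg_left a1 (by positivity)
    have a4 : C2 / lam = 6/η^2 * ((6 * c0⁻¹ * (8 * π * N)) / lam) + 6 * (C1/lam) + (128 * π^2 * N + 1) * (C1 / lam) := by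
      rw [hC2]; ring
    linarith
  have e : exp (2 * (log r - 1)) * 9 ≥ r^2 := by
    rw [mul_sub, exp_sub, exp_two_log hr]
    have e2 : exp 2 ≤ 9 := by
      have := exp_one_lt_d9
      have h2 : exp 2 = exp 1 * exp 1 := by rw [← exp_add]; norm_num
      rw [h2]; nlinarith [exp_pos 1]
    rw [mul_one, div_mul_eq_mul_div, ge_iff_le, le_div_iff₀ (exp_pos _)]
    nlinarith [sq_nonneg r]
  by_contra hlt
  push Not at hlt
  have hm := hs_mono hlt.le
  have : hs γ * r^2 ≤ 36 * η := by
    have h1 : hs γ * r^2 ≤ hs (u q) * (exp (2 * (log r - 1)) * 9) :=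
      mul_le_mul hm e (sq_nonneg _) (hs_nonneg _)
    linarith
  rw [hη] at this
  nlinarith [mul_pos hγ' (pow_pos hr 2)]
end

/-! ### Comparing planar and cylindrical integrals -/

lemma box_le_set {g : E2 → ℝ} (y : E2) {Q : Set E2} (hQ : MeasurableSet Q) (g0 : ∀ x ∈ Q, 0 ≤ g x)
    (hg : IntegrableOn g Q) {s0 s1 : ℝ} (hz : ∀ z ∈ box s0 s1, Cyl y z ∈ Q) :
    IntegrableOn (fun z => exp (2*z.1) * g (Cyl y z)) (box s0 s1) ∧
    ∫ z in box s0 s1, exp (2*z.1) * g (Cyl y z) ≤ ∫ x in Q, g x := by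
  have hi := (cyl_integrable y (Q.indicator g)).1 (hg.integrable_indicator hQ)
  have e := cyl_integral y (Q.indicator g)
  rw [integral_indicator hQ] at e
  have sub : (Icc s0 s1 ×ˢ Ioo (-π) π : Set E2) ⊆ strip := fun z hz => ⟨mem_univ _, hz.2⟩
  have sub2 : (Icc s0 s1 ×ˢ Ioo (-π) π : Set E2) ⊆ box s0 s1 := fun z hz =>
    box_mem.2 ⟨hz.1, hz.2.1.le, hz.2.2.le⟩
  have mS : MeasurableSet (Icc s0 s1 ×ˢ Ioo (-π) π : Set E2) := measurableSet_Icc.prod measurableSet_Ioo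
  have eq : EqOn (fun z => exp (2*z.1) * Q.indicator g (Cyl y z)) (fun z => exp (2*z.1) * g (Cyl y z))
      (Icc s0 s1 ×ˢ Ioo (-π) π : Set E2) := fun z h => by
    simp only [indicator_of_mem (hz z (sub2 h))]
  have i1 : IntegrableOn (fun z => exp (2*z.1) * g (Cyl y z)) (Icc s0 s1 ×ˢ Ioo (-π) π : Set E2) :=
    (hi.mono_set sub).congr_fun eq mS
  refine ⟨i1.congr_set_ae (box_ae _ _), ?_⟩
  rw [setIntegral_congr_set (box_ae s0 s1), e, ← setIntegral_congr_fun mS eq]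
  refine setIntegral_mono_set hi (ae_of_all _ fun z => ?_) sub.eventuallyLE
  exact mul_nonneg (exp_pos _).le (indicator_nonneg g0 _)

lemma set_le_box {g : E2 → ℝ} (p : E2) {A : Set E2} (hA : MeasurableSet A) (g0 : ∀ x, 0 ≤ g x)
    {s0 s1 : ℝ} (hz : ∀ x ∈ A, x ≠ p → exp (2*s0) ≤ nsq (x - p) ∧ nsq (x - p) ≤ exp (2*s1))
    (hi : IntegrableOn (fun z => exp (2*z.1) * g (Cyl p z)) (box s0 s1)) :
    ∫ x in A, g x ≤ ∫ z in box s0 s1, exp (2*z.1) * g (Cyl p z) := by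
  have e := cyl_integral p (A.indicator g)
  rw [integral_indicator hA] at e
  have mS : MeasurableSet (Icc s0 s1 ×ˢ Ioo (-π) π : Set E2) := measurableSet_Icc.prod measurableSet_Ioo
  have sub : (Icc s0 s1 ×ˢ Ioo (-π) π : Set E2) ⊆ strip := fun z hz => ⟨mem_univ _, hz.2⟩
  have hi' : IntegrableOn (fun z => exp (2*z.1) * g (Cyl p z)) (Icc s0 s1 ×ˢ Ioo (-π) π : Set E2) :=
    hi.congr_set_ae (box_ae _ _).symm
  rw [e, setIntegral_congr_set (box_ae s0 s1), ← integral_indicator strip_meas, ← integral_indicator mS]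
  refine integral_mono_of_nonneg (ae_of_all _ fun z => indicator_nonneg (fun z _ =>
    mul_nonneg (exp_pos _).le (indicator_nonneg (fun x _ => g0 x) _)) z) (hi'.integrable_indicator mS)
    (ae_of_all _ fun z => ?_)
  by_cases h1 : z ∈ strip
  · simp only [indicator_of_mem h1]
    by_cases h2 : Cyl p z ∈ A
    · rw [indicator_of_mem h2, indicator_of_mem]
      have := hz _ h2 (Cyl_ne p z)
      rw [nsq_cyl, exp_le_exp, exp_le_exp] at this
      exact ⟨⟨by linarith, by linarith⟩, h1.2⟩
    · rw [indicator_of_notMem h2, mul_zero]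
      exact indicator_nonneg (fun z _ => mul_nonneg (exp_pos _).le (g0 _)) z
  · simp only [indicator_of_notMem h1]
    exact indicator_nonneg (fun z _ => mul_nonneg (exp_pos _).le (g0 _)) z

lemma lapp_add {g h : E2 → ℝ} {x : E2} (hg : SmAt g x) (hh : SmAt h x) :
    lapp (fun y => g y + h y) x = lapp g x + lapp h x := by
  have e1 : D1 (fun y => g y + h y) =ᶠ[𝓝 x] fun y => D1 g y + D1 h y := by
    filter_upwards [hg.ev, hh.ev] with y a b using D1_add a.diff b.diff
  have e2 : D2 (fun y => g y + h y) =ᶠ[𝓝 x] fun y => D2 g y + D2 h y := by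
    filter_upwards [hg.ev, hh.ev] with y a b using D2_add a.diff b.diff
  rw [lapp, D1_congr e1, D2_congr e2, D1_add hg.D1.diff hh.D1.diff, D2_add hg.D2.diff hh.D2.diff, lapp, lapp]
  ring

lemma lapp_quad (c : ℝ) (y x : E2) : lapp (fun x => c * nsq (x - y)) x = 4 * c ∧
    SmAt (fun x => c * nsq (x - y)) x := by
  have s : ∀ x, SmAt (fun x => c * nsq (x - y)) x := fun x =>
    SmAt.of_contDiff (contDiff_const.mul (nsq_smooth.comp (contDiff_id.sub contDiff_const)))
  refine ⟨?_, s x⟩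
  have e1 : ∀ x, D1 (fun x => c * nsq (x - y)) x = c * (2 * (x.1 - y.1)) := fun x => by
    have h := slice1_at (s x).diff
    have h2 : HasDerivAt (fun t => c * nsq ((t, x.2) - y)) (c * (2 * (x.1 - y.1))) x.1 := by
      have := ((((hasDerivAt_id x.1).sub_const y.1).pow 2).add_const ((x.2 - y.2)^2)).const_mul c
      simpa [nsq] using this
    exact h.unique h2
  have e2 : ∀ x, D2 (fun x => c * nsq (x - y)) x = c * (2 * (x.2 - y.2)) := fun x => by
    have h := slice2_at (s x).diff
    have h2 : HasDerivAt (fun t => c * nsq ((x.1, t) - y)) (c * (2 * (x.2 - y.2))) x.2 := by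
      have := ((((hasDerivAt_id x.2).sub_const y.2).pow 2).const_add ((x.1 - y.1)^2)).const_mul c
      simpa [nsq] using this
    exact h.unique h2
  have f1 : D1 (fun x => c * nsq (x - y)) = fun x : E2 => (fun t => c * (2 * (t - y.1))) x.1 := funext e1
  have f2 : D2 (fun x => c * nsq (x - y)) = fun x : E2 => (fun t => c * (2 * (t - y.2))) x.2 := funext e2
  have g1 : D1 (fun x : E2 => (fun t => c * (2 * (t - y.1))) x.1) x = c * 2 :=
    D1_fst (G := fun t => c * (2 * (t - y.1)))
      (by simpa using ((((hasDerivAt_id x.1).sub_const y.1).const_mul 2).const_mul c))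
  have g2 : D2 (fun x : E2 => (fun t => c * (2 * (t - y.2))) x.2) x = c * 2 :=
    D2_snd (G := fun t => c * (2 * (t - y.2)))
      (by simpa using ((((hasDerivAt_id x.2).sub_const y.2).const_mul 2).const_mul c))
  rw [lapp, f1, f2, g1, g2]; ring

lemma Cyl_dist (y z : E2) : dist (Cyl y z) y ≤ exp z.1 := by
  have := Cyl_lim_aux y z
  rw [dist_eq_norm, Prod.norm_def]
  exact max_le this.1 this.2

lemma int_exp4 (s : ℝ) (c : ℝ) : ∫ z in box (s-1) s, exp (2*z.1) * (c * exp (2*z.1)) = c * (2 * π * ((exp (4*s) - exp (4*(s-1))) / 4)) := by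
  have hc : Continuous fun z : E2 => exp (2*z.1) * (c * exp (2*z.1)) := by fun_prop
  rw [(box_fubini (by linarith) (hc.continuousOn.integrableOn_compact (box_compact _ _))).1]
  have e : ∀ s, cavg (fun z : E2 => exp (2*z.1) * (c * exp (2*z.1))) s = (2*π*c) * exp (4*s) := fun s => by
    simp only [cavg, intervalIntegral.integral_const, smul_eq_mul]
    rw [show exp (4*s) = exp (2*s) * exp (2*s) by rw [← exp_add]; ring_nf]; ring
  simp only [e]
  rw [intervalIntegral.integral_const_mul, intervalIntegral.integral_comp_mul_left (fun x => exp x) (by norm_num),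
    integral_exp]
  simp; ring

/-- mean value inequality with a quadratic correction -/
lemma mv_quad {g : E2 → ℝ} {y : E2} {r r' c δ : ℝ} (hr : 0 < r) (hr' : r < r') (hc : 0 ≤ c)
    (hg : ∀ x, dist x y < r' → SmAt g x) (hg0 : ∀ x, dist x y < r' → 0 ≤ g x)
    (hl : ∀ x, dist x y < r' → -(4*c) ≤ lapp g x)
    (hm : ∫ z in box (log r - 1) (log r), exp (2*z.1) * g (Cyl y z) ≤ δ) :
    g y * r^2 ≤ 2 * δ + 4 * c * r^4 := by
  have d0 : dist y y < r' := by rw [dist_self]; linarith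
  have dz : ∀ z : E2, z.1 < log r' → dist (Cyl y z) y < r' := fun z hz =>
    (Cyl_dist y z).trans_lt (by rw [← lt_log_iff_exp_lt (hr.trans hr')]; exact hz)
  have m := mv_box (g := fun x => g x + c * nsq (x - y)) (q := y) (S := log r') (s1 := log r)
    (log_lt_log hr hr') ((hg y d0).add (lapp_quad c y y).2) (fun z hz => (hg _ (dz z hz)).add (lapp_quad c y _).2)
    (fun z hz => by
      rw [lapp_add (hg _ (dz z hz)) (lapp_quad c y _).2, (lapp_quad c y _).1]
      linarith [hl _ (dz z hz)]) (by
        have := hg0 y d0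
        have := nsq_nonneg (y - y)
        positivity)
  have z0 : nsq (y - y) = 0 := by simp [nsq]
  simp only [z0, mul_zero, add_zero, nsq_cyl, exp_two_log hr] at m
  refine m.trans ?_
  have hz : ∀ z ∈ box (log r - 1) (log r), z.1 < log r' := fun z hz =>
    (box_mem.1 hz).1.2.trans_lt (log_lt_log hr hr')
  have ce : Continuous fun z : E2 => exp (2*z.1) := by fun_prop
  have i1 : IntegrableOn (fun z => exp (2*z.1) * g (Cyl y z)) (box (log r - 1) (log r)) := by
    refine ContinuousOn.integrableOn_compact (box_compact _ _) fun z h => ?_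
    exact (ce.continuousAt.mul (hg _ (dz z (hz z h))).cyl.cont).continuousWithinAt
  have i2 : IntegrableOn (fun z : E2 => exp (2*z.1) * (c * exp (2*z.1))) (box (log r - 1) (log r)) :=
    (ce.mul (continuous_const.mul ce)).continuousOn.integrableOn_compact (box_compact _ _)
  have e : ∫ z in box (log r - 1) (log r), exp (2*z.1) * (g (Cyl y z) + c * exp (2*z.1)) =
      (∫ z in box (log r - 1) (log r), exp (2*z.1) * g (Cyl y z)) + c * (2 * π * ((exp (4*log r) - exp (4*(log r-1))) / 4)) := by
    rw [← int_exp4, ← integral_add i1 i2]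
    refine integral_congr_ae (ae_of_all _ fun z => ?_)
    simp only; ring
  rw [e]
  have e4 : exp (4*log r) = r^4 := by
    rw [show 4 * log r = 2 * log r + 2 * log r by ring, exp_add, exp_two_log hr]; ring
  have p4 := exp_pos (4*(log r - 1))
  have pi4 := pi_lt_d2
  rw [e4]
  have : c * (2 * π * ((r^4 - exp (4*(log r-1))) / 4)) ≤ 2 * (c * r^4) := by
    have h1 : 2 * π * ((r^4 - exp (4*(log r-1))) / 4) ≤ 2 * π * (r^4 / 4) := by
      apply mul_le_mul_of_nonneg_left _ (by positivity); linarith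
    have h2 : 2 * π * (r^4 / 4) ≤ 2 * r^4 := by nlinarith [pow_pos hr 4]
    have := mul_le_mul_of_nonneg_left (h1.trans h2) hc
    linarith
  linarith

/-- **Lemma S** (small-energy regularity). -/
lemma lemS {V : E2 → ℝ} {x0 : E2} {R C δ : ℝ} (hR : 0 < R) (hC : 0 < C) (hδ : 0 < δ) (hCδ : 200 * C * δ ≤ 1)
    (hV : ∀ x ∈ closedBall x0 R, SmAt V x) (hl : ∀ x ∈ closedBall x0 R, -(C * exp (V x)) ≤ lapp V x)
    (hm : ∫ x in closedBall x0 R, exp (V x) ≤ δ) : R^2 * exp (V x0) ≤ 16 * δ := by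
  have cV : ContinuousOn V (closedBall x0 R) := fun x hx => (hV x hx).cont.continuousWithinAt
  have cE : ContinuousOn (fun x => exp (V x)) (closedBall x0 R) := continuous_exp.comp_continuousOn cV
  have comp : IsCompact (closedBall x0 R) := isCompact_closedBall _ _
  obtain ⟨y, hy, hmax⟩ := comp.exists_isMaxOn (f := fun x => (R - dist x x0)^2 * exp (V x))
    ⟨x0, mem_closedBall_self hR.le⟩ (((continuous_const.sub (continuous_id.dist continuous_const)).pow 2).continuousOn.mul cE)
  have h0 := hmax (mem_closedBall_self hR.le)
  simp only [mem_ofPred_eq, dist_self, sub_zero] at h0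
  refine h0.trans ?_
  set d := R - dist y x0 with hd
  set m := exp (V y) with hmm
  have mp : 0 < m := exp_pos _
  have dn : 0 ≤ d := by rw [hd]; linarith [mem_closedBall.1 hy]
  by_contra hcon
  push Not at hcon
  have dp : 0 < d := by
    rcases dn.eq_or_lt with h | h
    · rw [← h] at hcon; simp at hcon; linarith
    · exact h
  have sub : ∀ x, dist x y < d/2 → x ∈ closedBall x0 R := fun x hx => by
    rw [mem_closedBall]
    have := dist_triangle x y x0
    linarith
  have up : ∀ x, dist x y < d/2 → exp (V x) ≤ 4 * m := fun x hx => by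
    have h1 := hmax (sub x hx)
    simp only [mem_ofPred_eq] at h1
    have h2 : d/2 ≤ R - dist x x0 := by
      have := dist_triangle x y x0
      linarith
    have h3 : (d/2)^2 ≤ (R - dist x x0)^2 := pow_le_pow_left₀ (by linarith) h2 2
    have h4 : (d/2)^2 * exp (V x) ≤ d^2 * m := (mul_le_mul_of_nonneg_right h3 (exp_pos _).le).trans h1
    have h5 : 0 < d^2 := by positivity
    by_contra h6
    push Not at h6
    nlinarith
  set r := sqrt (4*δ/m) with hr
  have r2 : r^2 = 4*δ/m := by rw [hr, sq_sqrt]; positivity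
  have rp : 0 < r := by rw [hr]; apply sqrt_pos.2; positivity
  have mr : m * r^2 = 4*δ := by rw [r2]; field_simp
  have rd : r < d/2 := by
    apply lt_of_pow_lt_pow_left₀ 2 (by linarith)
    rw [r2, div_lt_iff₀ mp]; nlinarith
  have key := mv_quad (g := fun x => exp (V x)) (y := y) (r := r) (r' := d/2) (c := 4*C*m^2) (δ := δ) rp rd
    (by positivity) (fun x hx => SmAt.comp contDiff_exp (hV x (sub x hx))) (fun x _ => (exp_pos _).le)
    (fun x hx => by
      rw [lapp_comp (hV x (sub x hx)) (fun t => hasDerivAt_exp t) (hasDerivAt_exp _)]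
      have h1 := hl x (sub x hx)
      have h2 := up x hx
      have h3 := exp_pos (V x)
      have h4 := mul_nonneg h3.le (gsq_nonneg V x)
      have h5 : exp (V x) * (-(C * exp (V x))) ≤ exp (V x) * lapp V x := mul_le_mul_of_nonneg_left h1 h3.le
      have h6 : exp (V x) * exp (V x) ≤ 4*m*(4*m) := mul_le_mul h2 h2 h3.le (by positivity)
      have h7 := mul_le_mul_of_nonneg_left h6 hC.le
      linarith)
    ((box_le_set y measurableSet_closedBall (fun x _ => (exp_pos _).le) (cE.integrableOn_compact comp)
      (fun z hz => sub _ ((Cyl_dist y z).trans_lt (lt_of_le_of_lt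
        (by rw [← le_log_iff_exp_le rp]; exact (box_mem.1 hz).1.2) rd)))).2.trans hm)
  simp only [← hmm] at key
  have e1 : 4 * (4*C*m^2) * r^4 = 16 * C * (m * r^2)^2 := by ring
  rw [e1, mr] at key
  nlinarith

/-! ### Cutoffs with explicit bounds -/

lemma st_d : ∃ K : ℝ, ∃ w1 w2 : ℝ → ℝ, 0 < K ∧ (∀ t, HasDerivAt Real.smoothTransition (w1 t) t) ∧
    (∀ t, HasDerivAt w1 (w2 t) t) ∧ Continuous w2 ∧ (∀ t, 0 ≤ w1 t) ∧ (∀ t, w1 t ≤ K) ∧ (∀ t, |w2 t| ≤ K) ∧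
    (∀ t, t ≤ 0 → w1 t = 0 ∧ w2 t = 0) ∧ (∀ t, 1 ≤ t → w1 t = 0 ∧ w2 t = 0) := by
  have c2 : ContDiff ℝ 2 Real.smoothTransition := Real.smoothTransition.contDiff (n := 2)
  set w1 := deriv Real.smoothTransition with h1
  set w2 := deriv w1 with h2
  have c1 : ContDiff ℝ 1 w1 := (contDiff_succ_iff_deriv (n := 1)).1 c2 |>.2.2
  have cw2 : Continuous w2 := c1.continuous_deriv le_rfl
  have z1 : ∀ t < 0, w1 t = 0 := fun t ht => by
    have : Real.smoothTransition =ᶠ[𝓝 t] fun _ => 0 := by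
      filter_upwards [Iio_mem_nhds ht] with s hs using Real.smoothTransition.zero_of_nonpos hs.le
    rw [h1, this.deriv_eq, deriv_const]
  have o1 : ∀ t > 1, w1 t = 0 := fun t ht => by
    have : Real.smoothTransition =ᶠ[𝓝 t] fun _ => 1 := by
      filter_upwards [Ioi_mem_nhds ht] with s hs using Real.smoothTransition.one_of_one_le hs.le
    rw [h1, this.deriv_eq, deriv_const]
  have z2 : ∀ t < 0, w2 t = 0 := fun t ht => by
    have : w1 =ᶠ[𝓝 t] fun _ => 0 := by
      filter_upwards [Iio_mem_nhds ht] with s hs using z1 s hs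
    rw [h2, this.deriv_eq, deriv_const]
  have o2 : ∀ t > 1, w2 t = 0 := fun t ht => by
    have : w1 =ᶠ[𝓝 t] fun _ => 0 := by
      filter_upwards [Ioi_mem_nhds ht] with s hs using o1 s hs
    rw [h2, this.deriv_eq, deriv_const]
  have ext0 : ∀ w : ℝ → ℝ, Continuous w → (∀ t < 0, w t = 0) → ∀ t ≤ 0, w t = 0 := fun w cw hw t ht => by
    have : closure (Iio (0:ℝ)) ⊆ {t | w t = 0} :=
      closure_minimal (fun t ht => hw t ht) (isClosed_eq cw continuous_const)
    rw [closure_Iio] at this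
    exact this ht
  have ext1 : ∀ w : ℝ → ℝ, Continuous w → (∀ t > 1, w t = 0) → ∀ t, 1 ≤ t → w t = 0 := fun w cw hw t ht => by
    have : closure (Ioi (1:ℝ)) ⊆ {t | w t = 0} :=
      closure_minimal (fun t ht => hw t ht) (isClosed_eq cw continuous_const)
    rw [closure_Ioi] at this
    exact this ht
  obtain ⟨K1, hK1⟩ := (isCompact_Icc (a := (0:ℝ)) (b := 1)).exists_bound_of_continuousOn c1.continuous.continuousOn
  obtain ⟨K2, hK2⟩ := (isCompact_Icc (a := (0:ℝ)) (b := 1)).exists_bound_of_continuousOn cw2.continuousOn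
  have bd : ∀ w : ℝ → ℝ, (∀ t ≤ 0, w t = 0) → (∀ t, 1 ≤ t → w t = 0) → ∀ K, (∀ t ∈ Icc (0:ℝ) 1, ‖w t‖ ≤ K) → ∀ t, |w t| ≤ |K| := by
    intro w w0 w1 K hK t
    rcases le_total t 0 with h | h
    · rw [w0 t h]; simp
    · rcases le_total 1 t with h' | h'
      · rw [w1 t h']; simp
      · exact (hK t ⟨h, h'⟩).trans (le_abs_self _)
  have b1 := bd w1 (ext0 _ c1.continuous z1) (ext1 _ c1.continuous o1) K1 hK1
  have b2 := bd w2 (ext0 _ cw2 z2) (ext1 _ cw2 o2) K2 hK2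
  refine ⟨|K1| + |K2| + 1, w1, w2, by positivity, fun t => (c2.differentiable (by norm_num) t).hasDerivAt,
    fun t => (c1.differentiable (by norm_num) t).hasDerivAt, cw2, fun t => Real.smoothTransition.monotone.deriv_nonneg,
    fun t => ?_, fun t => ?_, fun t ht => ⟨ext0 _ c1.continuous z1 t ht, ext0 _ cw2 z2 t ht⟩,
    fun t ht => ⟨ext1 _ c1.continuous o1 t ht, ext1 _ cw2 o2 t ht⟩⟩
  · linarith [le_abs_self (w1 t), b1 t, abs_nonneg K2]
  · linarith [b2 t, abs_nonneg K1]

lemma cutJ : ∃ K : ℝ, 0 < K ∧ ∀ s0 J : ℝ, 0 < J → ∃ χ χ' : ℝ → ℝ, Cut χ χ' s0 (s0 + J) ∧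
    (∀ s, χ' s ≤ 0) ∧ ∀ s, -χ' s ≤ K / J := by
  obtain ⟨K, w1, w2, hK, d1, -, -, n1, b1, -, -, -⟩ := st_d
  refine ⟨K, hK, fun s0 J hJ => ⟨fun s => Real.smoothTransition ((s0 + J - s) / J), fun s => w1 ((s0 + J - s)/J) * (-1 / J),
    ⟨?_, fun s => ?_, fun s hs => ?_, fun s hs => ?_, fun s => Real.smoothTransition.nonneg _, fun s => Real.smoothTransition.le_one _⟩,
    fun s => ?_, fun s => ?_⟩⟩
  · exact Real.smoothTransition.contDiff.comp ((contDiff_const.sub contDiff_id).div_const _)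
  · have h := ((hasDerivAt_id s).const_sub (s0 + J)).div_const J
    exact (d1 _).comp s h
  · exact Real.smoothTransition.one_of_one_le ((one_le_div hJ).2 (by linarith))
  · exact Real.smoothTransition.zero_of_nonpos (div_nonpos_of_nonpos_of_nonneg (by linarith) hJ.le)
  · have := n1 ((s0 + J - s)/J)
    beta_reduce
    rw [neg_div, mul_neg]
    have : 0 ≤ w1 ((s0 + J - s)/J) * (1/J) := by positivity
    linarith
  · have := b1 ((s0 + J - s)/J)
    beta_reduce
    rw [neg_div, mul_neg, neg_neg, mul_one_div]
    gcongr

lemma bumpJ : ∃ K : ℝ, 0 < K ∧ ∀ s0 s1 : ℝ, s0 ≤ s1 → ∃ z z1 z2 : ℝ → ℝ, (∀ t, HasDerivAt z (z1 t) t) ∧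
    (∀ t, HasDerivAt z1 (z2 t) t) ∧ Continuous z2 ∧ (∀ t, t ≤ s0 - 1 → z t = 0 ∧ z1 t = 0) ∧
    (∀ t, s1 + 1 ≤ t → z t = 0 ∧ z1 t = 0) ∧ (∀ t, 0 ≤ z t ∧ z t ≤ 1) ∧ (∀ t ∈ Icc s0 s1, z t = 1 ∧ z2 t = 0) ∧
    (∀ t, |z2 t| ≤ K) := by
  obtain ⟨K, w1, w2, hK, d1, d2, c2, n1, b1, b2, e0, e1⟩ := st_d
  refine ⟨2*K, by positivity, fun s0 s1 h => ⟨fun t => Real.smoothTransition (t - (s0 - 1)) + Real.smoothTransition (s1 + 1 - t) - 1,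
    fun t => w1 (t - (s0-1)) - w1 (s1 + 1 - t), fun t => w2 (t - (s0-1)) + w2 (s1 + 1 - t),
    fun t => ?_, fun t => ?_, ?_, fun t ht => ?_, fun t ht => ?_, fun t => ?_, fun t ht => ?_, fun t => ?_⟩⟩
  · have h1 := (d1 (t - (s0-1))).comp t ((hasDerivAt_id t).sub_const (s0-1))
    have h2 := (d1 (s1 + 1 - t)).comp t ((hasDerivAt_id t).const_sub (s1 + 1))
    rw [mul_one] at h1
    rw [mul_neg_one] at h2
    exact (h1.add h2).sub_const 1
  · have h1 := (d2 (t - (s0-1))).comp t ((hasDerivAt_id t).sub_const (s0-1))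
    have h2 := (d2 (s1 + 1 - t)).comp t ((hasDerivAt_id t).const_sub (s1 + 1))
    rw [mul_one] at h1
    rw [mul_neg_one] at h2
    have := h1.sub h2
    rw [sub_neg_eq_add] at this
    exact this
  · fun_prop
  · simp only
    rw [Real.smoothTransition.zero_of_nonpos (by linarith), Real.smoothTransition.one_of_one_le (by linarith),
      (e0 _ (by linarith)).1, (e1 _ (by linarith)).1]
    norm_num
  · simp only
    rw [Real.smoothTransition.one_of_one_le (by linarith), Real.smoothTransition.zero_of_nonpos (by linarith),
      (e1 _ (by linarith)).1, (e0 _ (by linarith)).1]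
    norm_num
  · simp only
    have a1 := Real.smoothTransition.le_one (t - (s0-1))
    have a2 := Real.smoothTransition.le_one (s1 + 1 - t)
    have a3 := Real.smoothTransition.nonneg (t - (s0-1))
    have a4 := Real.smoothTransition.nonneg (s1 + 1 - t)
    refine ⟨?_, by linarith⟩
    rcases le_total t s1 with h' | h'
    · rw [Real.smoothTransition.one_of_one_le (x := s1 + 1 - t) (by linarith)]; linarith
    · rw [Real.smoothTransition.one_of_one_le (x := t - (s0-1)) (by linarith)]; linarith
  · simp only
    rw [Real.smoothTransition.one_of_one_le (by linarith [ht.1]), Real.smoothTransition.one_of_one_le (by linarith [ht.2]),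
      (e1 _ (by linarith [ht.1])).2, (e1 _ (by linarith [ht.2])).2]
    norm_num
  · have := abs_add_le (w2 (t - (s0-1))) (w2 (s1 + 1 - t))
    simp only
    linarith [b2 (t - (s0-1)), b2 (s1+1-t)]

/-- one-dimensional energy inequality -/
lemma ode_energy : ∃ K : ℝ, 0 < K ∧ ∀ (q q1 q2 e : ℝ → ℝ) (s0 s1 S η : ℝ), s0 ≤ s1 → s1 + 1 < S → 0 ≤ η →
    (∀ s < S, HasDerivAt q (q1 s) s) → (∀ s < S, HasDerivAt q1 (q2 s) s) → (∀ s < S, ContinuousAt q2 s) →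
    (∀ s < S, ContinuousAt e s) → (∀ s < S, 0 ≤ e s) → (∀ s < S, 0 ≤ q s) →
    (∀ s ∈ Icc (s0-1) (s1+1), e s - η * (π + q s) ≤ q2 s) →
    ∫ s in s0..s1, e s ≤ K * ((∫ s in (s0-1)..s0, q s) + ∫ s in s1..(s1+1), q s)
      + η * (π * (s1 - s0 + 2) + ∫ s in (s0-1)..(s1+1), q s) := by
  obtain ⟨K, hK, hb⟩ := bumpJ
  refine ⟨K, hK, fun q q1 q2 e s0 s1 S η h01 hS hη hq hq1 cq2 ce e0 qn hin => ?_⟩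
  obtain ⟨z, z1, z2, dz, dz1, cz2, hl, hr, zb, zm, zK⟩ := hb s0 s1 h01
  have cz : Continuous z := continuous_iff_continuousAt.2 fun t => (dz t).continuousAt
  have lt : ∀ {s a b}, b ≤ s1 + 1 → a ≤ b → s ∈ uIcc a b → s < S := fun hb hab hs => by
    rw [uIcc_of_le hab] at hs; linarith [hs.2]
  have ii : ∀ {g : ℝ → ℝ}, (∀ s < S, ContinuousAt g s) → ∀ {a b}, b ≤ s1 + 1 → a ≤ b → IntervalIntegrable g volume a b :=
    fun hg a b hb hab => ContinuousOn.intervalIntegrable fun s hs => (hg s (lt hb hab hs)).continuousWithinAt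
  have cq : ∀ s < S, ContinuousAt q s := fun s hs => (hq s hs).continuousAt
  -- the exact identity
  have ftc : ∫ s in (s0-1)..(s1+1), (z s * q2 s - z2 s * q s) = 0 := by
    have := intervalIntegral.integral_eq_sub_of_hasDerivAt (f := fun s => z s * q1 s - z1 s * q s)
      (f' := fun s => z s * q2 s - z2 s * q s) (a := s0-1) (b := s1+1) (fun s hs => by
        have hs' := lt le_rfl (by linarith) hs
        have := ((dz s).mul (hq1 s hs')).sub ((dz1 s).mul (hq s hs'))
        refine this.congr_deriv ?_
        ring) (ii (fun s hs => (cz.continuousAt.mul (cq2 s hs)).sub (cz2.continuousAt.mul (cq s hs))) le_rfl (by linarith))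
    rw [this, (hl _ le_rfl).1, (hl _ le_rfl).2, (hr _ le_rfl).1, (hr _ le_rfl).2]; ring
  have i1 := ii (g := fun s => z s * q2 s) (fun s hs => cz.continuousAt.mul (cq2 s hs)) (a := s0-1) le_rfl (by linarith)
  have i2 : ∀ {a b}, b ≤ s1 + 1 → a ≤ b → IntervalIntegrable (fun s => z2 s * q s) volume a b := fun hb hab =>
    ii (g := fun s => z2 s * q s) (fun s hs => cz2.continuousAt.mul (cq s hs)) hb hab
  have i3 := ii (g := fun s => z s * e s) (fun s hs => cz.continuousAt.mul (ce s hs)) (a := s0-1) le_rfl (by linarith)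
  have iq : ∀ {a b}, b ≤ s1 + 1 → a ≤ b → IntervalIntegrable q volume a b := fun hb hab => ii cq hb hab
  rw [intervalIntegral.integral_sub i1 (i2 le_rfl (by linarith)), sub_eq_zero] at ftc
  -- the left side
  have L : ∫ s in s0..s1, e s ≤ ∫ s in (s0-1)..(s1+1), z s * e s := by
    have a1 : ∫ s in s0..s1, e s = ∫ s in s0..s1, z s * e s := by
      refine intervalIntegral.integral_congr fun s hs => ?_
      rw [uIcc_of_le h01] at hs
      simp only [(zm s hs).1, one_mul]
    rw [a1, intervalIntegral.integral_of_le h01, intervalIntegral.integral_of_le (by linarith)]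
    rw [intervalIntegrable_iff_integrableOn_Ioc_of_le (by linarith)] at i3
    refine setIntegral_mono_set i3 ?_ (Ioc_subset_Ioc (by linarith) (by linarith)).eventuallyLE
    filter_upwards [ae_restrict_mem measurableSet_Ioc] with s hs
    exact mul_nonneg (zb s).1 (e0 s (by linarith [hs.2]))
  have M : ∫ s in (s0-1)..(s1+1), z s * e s ≤ (∫ s in (s0-1)..(s1+1), z s * q2 s) + ∫ s in (s0-1)..(s1+1), η * (π + q s) := by
    have i4 : IntervalIntegrable (fun s => η * (π + q s)) volume (s0-1) (s1+1) :=
      (intervalIntegrable_const.add (iq le_rfl (by linarith))).const_mul η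
    rw [← intervalIntegral.integral_add i1 i4]
    refine intervalIntegral.integral_mono_on (by linarith) i3 (i1.add i4) fun s hs => ?_
    have h1 := mul_le_mul_of_nonneg_left (hin s hs) (zb s).1
    have h2 : z s * (η * (π + q s)) ≤ η * (π + q s) := by
      have : 0 ≤ η * (π + q s) := mul_nonneg hη (by linarith [pi_pos, qn s (by linarith [hs.2])])
      nlinarith [(zb s).2]
    linarith
  have E : ∫ s in (s0-1)..(s1+1), η * (π + q s) = η * (π * (s1 - s0 + 2) + ∫ s in (s0-1)..(s1+1), q s) := by
    rw [intervalIntegral.integral_const_mul, intervalIntegral.integral_add intervalIntegrable_const (iq le_rfl (by linarith)),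
      intervalIntegral.integral_const, smul_eq_mul]; ring
  have B : ∀ {a b}, b ≤ s1 + 1 → a ≤ b → ∫ s in a..b, z2 s * q s ≤ K * ∫ s in a..b, q s := fun {a b} hb hab => by
    rw [← intervalIntegral.integral_const_mul]
    refine intervalIntegral.integral_mono_on hab (i2 hb hab) ((iq hb hab).const_mul K) fun s hs => ?_
    exact mul_le_mul_of_nonneg_right ((le_abs_self _).trans (zK s)) (qn s (by linarith [hs.2]))
  have R : ∫ s in (s0-1)..(s1+1), z2 s * q s ≤ K * ((∫ s in (s0-1)..s0, q s) + ∫ s in s1..(s1+1), q s) := by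
    rw [← intervalIntegral.integral_add_adjacent_intervals (b := s0) (i2 (by linarith) (by linarith)) (i2 le_rfl (by linarith)),
      ← intervalIntegral.integral_add_adjacent_intervals (a := s0) (b := s1) (i2 (by linarith) h01) (i2 le_rfl (by linarith))]
    have m0 : ∫ s in s0..s1, z2 s * q s = 0 := by
      rw [intervalIntegral.integral_congr (g := fun _ => 0) fun s hs => ?_]
      · simp
      · rw [uIcc_of_le h01] at hs
        simp only [(zm s hs).2, zero_mul]
    rw [m0]
    have := B (a := s0-1) (b := s0) (by linarith) (by linarith)
    have := B (a := s1) (b := s1+1) le_rfl (by linarith)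
    linarith
  linarith

section
variable {ι : Type} [Fintype ι] {P : ι → E2} {a : ι → ℝ} {τ ρ lam : ℝ} {u : E2 → ℝ}

/-- the annulus around `p` -/
def Ann (p : E2) (s0 s1 : ℝ) : Set E2 := {x | exp (2*s0) ≤ nsq (x - p) ∧ nsq (x - p) ≤ exp (2*s1)}

lemma Ann_cyl {p z : E2} {s0 s1 : ℝ} (h0 : s0 ≤ z.1) (h1 : z.1 ≤ s1) : Cyl p z ∈ Ann p s0 s1 := by
  refine ⟨?_, ?_⟩ <;> rw [nsq_cyl] <;> exact exp_le_exp.2 (by linarith)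

lemma Ann_sub {p : E2} {s0 s1 t0 t1 : ℝ} (h0 : t0 ≤ s0) (h1 : s1 ≤ t1) : Ann p s0 s1 ⊆ Ann p t0 t1 := fun x hx =>
  ⟨(exp_le_exp.2 (by linarith)).trans hx.1, hx.2.trans (exp_le_exp.2 (by linarith))⟩

lemma ball_ann {p z x : E2} (hx : x ∈ closedBall (Cyl p z) (exp z.1 / 4)) : x ∈ Ann p (z.1 - 1) (z.1 + 1) := by
  have hE := nsq_cyl p z
  have h2 : exp (2*z.1) = exp z.1 ^ 2 := by rw [← Real.exp_nat_mul]; norm_num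
  rw [mem_closedBall, Prod.dist_eq, max_le_iff, Real.dist_eq, Real.dist_eq, abs_le, abs_le] at hx
  obtain ⟨⟨a1, a2⟩, a3, a4⟩ := hx
  have e0 := exp_pos z.1
  have w1 : (x.1 - (Cyl p z).1)^2 ≤ exp (2*z.1) / 16 := by rw [h2]; nlinarith
  have w2 : (x.2 - (Cyl p z).2)^2 ≤ exp (2*z.1) / 16 := by rw [h2]; nlinarith
  simp only [nsq, Prod.fst_sub, Prod.snd_sub] at hE
  have e3 := Real.exp_one_gt_d9
  have k1 : exp (2*(z.1-1)) * exp 1 ^ 2 = exp (2*z.1) := by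
    rw [← Real.exp_nat_mul, ← exp_add]; congr 1; push_cast; ring
  have k2 : exp (2*(z.1+1)) = exp (2*z.1) * exp 1 ^ 2 := by
    rw [← Real.exp_nat_mul, ← exp_add]; congr 1; push_cast; ring
  have p1 := exp_pos (2*(z.1-1))
  have p2 := exp_pos (2*z.1)
  have q1 : (7:ℝ) ≤ exp 1 ^ 2 := by nlinarith
  simp only [Ann, mem_ofPred_eq, nsq, Prod.fst_sub, Prod.snd_sub]
  constructor
  · nlinarith [sq_nonneg (x.1 - p.1 + (x.1 - (Cyl p z).1)), sq_nonneg (x.2 - p.2 + (x.2 - (Cyl p z).2))]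
  · rw [k2]
    nlinarith [sq_nonneg ((Cyl p z).1 - p.1 - 2 * (x.1 - (Cyl p z).1)), sq_nonneg ((Cyl p z).2 - p.2 - 2*(x.2 - (Cyl p z).2))]

lemma exp_le_mn {t : ℝ} (h : t ≤ 1) : exp t ≤ 3 * mn t := by
  have e3 := Real.exp_one_lt_d9
  unfold mn
  rcases le_total (exp t) 1 with h1 | h1
  · rw [min_eq_left h1]; linarith [exp_pos t]
  · rw [min_eq_right h1]; linarith [exp_le_exp.2 h]

lemma Ctx.cyl_mn (c : Ctx P a τ ρ lam u) (q : E2) {s0 s1 : ℝ} (h1 : s1 < log (1/2)) :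
    IntegrableOn (fun z => exp (2*z.1) * mn (u (Cyl q z))) (box s0 s1) ∧
    ∫ z in box s0 s1, exp (2*z.1) * mn (u (Cyl q z)) ≤ ∫ x in QQ, mn (u x) :=
  cyl_le_QQ (g := fun x => mn (u x)) (fun x => mn_nonneg _) (fun x k => by simp only [c.sol.per x k])
    (c.int_b mn_cont.measurable (C := 1) fun t => by rw [abs_of_nonneg (mn_nonneg _)]; exact mn_le_one _) q h1

lemma Ctx.hpt (c : Ctx P a τ ρ lam u) {C : ℝ} (hC1 : 1 ≤ C) (hC : ∀ t, |fτ τ t| ≤ C * mn t) {p : E2} {s0 s1 δ : ℝ}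
    (h1 : s1 + 1 < log (1/2)) (hreg : ∀ x ∈ Ann p (s0-1) (s1+1), x ∉ Zs P ∧ u x ≤ 1) (hδ : 0 < δ) (hCδ : 600 * C * δ ≤ 1)
    (hm : lam * ∫ z in box (s0-1) (s1+1), exp (2*z.1) * mn (u (Cyl p z)) ≤ δ) (z : E2) (hz0 : s0 ≤ z.1) (hz1 : z.1 ≤ s1) :
    lam * exp (2*z.1) * exp (u (Cyl p z)) ≤ 768 * δ := by
  have hl := c.pos
  have hsub : closedBall (Cyl p z) (exp z.1 / 4) ⊆ Ann p (s0-1) (s1+1) := fun x hx =>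
    Ann_sub (by linarith) (by linarith) (ball_ann hx)
  have hsm : ∀ x ∈ closedBall (Cyl p z) (exp z.1 / 4), SmAt u x := fun x hx => c.sol.sm x (hreg x (hsub hx)).1
  have hex : ∀ x, exp (u x + log lam) = lam * exp (u x) := fun x => by rw [exp_add, exp_log hl, mul_comm]
  have hco : ContinuousOn u (closedBall (Cyl p z) (exp z.1 / 4)) := fun x hx => (hsm x hx).cont.continuousWithinAt
  have hcp := isCompact_closedBall (Cyl p z) (exp z.1 / 4)
  have key := lemS (V := fun x => u x + log lam) (x0 := Cyl p z) (R := exp z.1 / 4) (C := C) (δ := 3 * δ) (by positivity)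
    (by linarith) (by linarith) (by linarith) (fun x hx => (hsm x hx).add (SmAt.const _)) (fun x hx => ?_) ?_
  · rw [hex] at key
    have h2 : exp (2*z.1) = exp z.1 ^ 2 := by rw [← Real.exp_nat_mul]; norm_num
    rw [h2]
    nlinarith
  · rw [lapp_add (hsm x hx) (SmAt.const _)]
    have : lapp (fun _ : E2 => log lam) x = 0 := by
      have e1 : D1 (fun _ : E2 => log lam) = fun _ => 0 := funext fun y => D1_const _
      have e2 : D2 (fun _ : E2 => log lam) = fun _ => 0 := funext fun y => D2_const _
      unfold lapp; rw [e1, e2, D1_const, D2_const]; ring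
    rw [this, c.sol.pde x (hreg x (hsub hx)).1, add_zero]
    simp only [hex]
    have t1 := (le_abs_self _).trans (hC (u x))
    have t2 : C * mn (u x) ≤ C * exp (u x) := mul_le_mul_of_nonneg_left (mn_le_exp _) (by linarith)
    have t3 : lam * fτ τ (u x) ≤ lam * (C * exp (u x)) := mul_le_mul_of_nonneg_left (by linarith) hl.le
    linarith
  · have i1 : IntegrableOn (fun x => exp (u x + log lam)) (closedBall (Cyl p z) (exp z.1 / 4)) :=
      ((hco.add continuousOn_const).rexp).integrableOn_compact hcp
    have i2 : IntegrableOn (fun x => mn (u x)) (closedBall (Cyl p z) (exp z.1 / 4)) :=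
      (mn_cont.comp_continuousOn hco).integrableOn_compact hcp
    have b1 : ∫ x in closedBall (Cyl p z) (exp z.1 / 4), exp (u x + log lam) ≤
        ∫ x in closedBall (Cyl p z) (exp z.1 / 4), 3 * lam * mn (u x) := by
      refine setIntegral_mono_on i1 (i2.const_mul _) measurableSet_closedBall fun x hx => ?_
      rw [hex]
      have := exp_le_mn (hreg x (hsub hx)).2
      nlinarith
    rw [integral_const_mul] at b1
    have b2 := set_le_box (g := fun x => mn (u x)) p (A := closedBall (Cyl p z) (exp z.1 / 4)) measurableSet_closedBall
      (fun x => mn_nonneg _) (s0 := s0 - 1) (s1 := s1 + 1) (fun x hx _ => hsub hx) (c.cyl_mn p h1).1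
    have b3 : lam * ∫ x in closedBall (Cyl p z) (exp z.1 / 4), mn (u x) ≤ δ := (mul_le_mul_of_nonneg_left b2 hl.le).trans hm
    linarith
end

lemma cavg_cmul (H : E2 → ℝ) (c s : ℝ) : cavg (fun z => c * H z) s = c * cavg H s := by
  unfold cavg; exact intervalIntegral.integral_const_mul _ _

/-- angular variance -/
def qv (U : E2 → ℝ) (s : ℝ) : ℝ := 2⁻¹ * cavg (fun z => U z ^ 2) s - cavg U s ^ 2 / (4 * π)

lemma qv_le {U : E2 → ℝ} {s : ℝ} (hU : Continuous fun θ => U (s, θ)) (k : ℝ) :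
    cavg (fun z => (U z - k)^2) s = 2 * qv U s + 2 * π * (k - cavg U s / (2 * π))^2 := by
  have h0 : cavg (fun z => (U z - k)^2) s = cavg (fun z => U z ^ 2 + ((-2*k) * U z + k^2)) s := by
    unfold cavg; congr 1; ext θ; ring
  rw [h0, cavg_add (hU.pow 2) ((hU.const_mul _).add continuous_const), cavg_add (hU.const_mul _) continuous_const, cavg_cmul, cavg_const]
  unfold qv
  field_simp
  ring

lemma qv_nonneg {U : E2 → ℝ} {s : ℝ} (hU : Continuous fun θ => U (s, θ)) : 0 ≤ qv U s := by
  have h := qv_le hU (cavg U s / (2 * π))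
  have h1 : cavg (fun _ => 0) s ≤ cavg (fun z => (U z - cavg U s / (2 * π))^2) s :=
    cavg_mono continuous_const ((hU.sub continuous_const).pow 2) fun θ => sq_nonneg _
  rw [cavg_const] at h1
  rw [sub_self] at h
  nlinarith

lemma qv_ineq {U : E2 → ℝ} {s η : ℝ} (hη : 0 ≤ η) (hU : ∀ z : E2, z.1 = s → SmAt U z) (hl : ∀ θ, |lapp U (s, θ)| ≤ η) :
    cavg (fun z => D2 U z ^ 2) s - η * (π + qv U s) ≤
      2⁻¹ * cavg (lapp fun z => U z ^ 2) s - (cavg (D1 U) s ^ 2 + cavg U s * cavg (lapp U) s) / (2 * π) := by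
  have cU : Continuous fun θ => U (s, θ) := slice_cont fun z hz => (hU z hz).cont
  have c1 : Continuous fun θ => D1 U (s, θ) := slice_cont fun z hz => (hU z hz).D1.cont
  have c2 : Continuous fun θ => D2 U (s, θ) := slice_cont fun z hz => (hU z hz).D2.cont
  have cl : Continuous fun θ => lapp U (s, θ) := slice_cont fun z hz => (hU z hz).lapp.cont
  have cq : Continuous fun θ => lapp (fun z => U z ^ 2) (s, θ) := slice_cont fun z hz => ((hU z hz).pow 2).lapp.cont
  set m := cavg U s / (2*π) with hm
  set n := cavg (D1 U) s / (2*π) with hn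
  have hlq : ∀ θ, lapp (fun z => U z ^ 2) (s, θ) = 2 * U (s, θ) * lapp U (s, θ) + 2 * gsq U (s, θ) := fun θ => by
    have := lapp_comp (g := U) (x := (s, θ)) (G := fun t => t^2) (G' := fun t => 2 * t) (G'' := 2) (hU _ rfl)
      (fun t => by simpa using hasDerivAt_pow 2 t) (by simpa using (hasDerivAt_id (U (s,θ))).const_mul 2)
    exact this
  have cm0 : Continuous fun θ => (-(η/2)) * (U (s,θ) - m)^2 := ((cU.sub continuous_const).pow 2).const_mul _
  have cm : Continuous fun θ => (-(η/2)) * (U (s,θ) - m)^2 + -(η/2) := cm0.add continuous_const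
  have key : cavg (fun z => D2 U z ^ 2 + ((-(η/2)) * (U z - m)^2 + -(η/2))) s ≤
      cavg (fun z => 2⁻¹ * lapp (fun z => U z ^ 2) z + ((-m) * lapp U z + ((-2*n) * D1 U z + n^2))) s := by
    refine cavg_mono ((c2.pow 2).add cm) (by fun_prop) fun θ => ?_
    rw [hlq]
    have := abs_le.1 (hl θ)
    unfold gsq
    have t : -(η * (2⁻¹ * (U (s,θ) - m)^2 + 2⁻¹)) ≤ (U (s,θ) - m) * lapp U (s,θ) := by
      have h1 : |U (s,θ) - m| ≤ 2⁻¹ * (U (s,θ) - m)^2 + 2⁻¹ := by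
        rw [← sq_abs]; nlinarith [sq_nonneg (|U (s,θ) - m| - 1)]
      have h2 : |(U (s,θ) - m) * lapp U (s,θ)| ≤ (2⁻¹ * (U (s,θ) - m)^2 + 2⁻¹) * η := by
        rw [abs_mul]; exact mul_le_mul h1 (hl θ) (abs_nonneg _) (by positivity)
      linarith [neg_abs_le ((U (s,θ) - m) * lapp U (s,θ))]
    nlinarith [sq_nonneg (D1 U (s,θ) - n)]
  rw [cavg_add (c2.pow 2) cm, cavg_add cm0 continuous_const, cavg_const, cavg_cmul, qv_le cU,
    cavg_add (by fun_prop) (by fun_prop), cavg_add (by fun_prop) (by fun_prop), cavg_add (by fun_prop) (by fun_prop),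
    cavg_const, cavg_cmul, cavg_cmul, cavg_cmul, sub_self] at key
  have e1 : cavg U s * cavg (lapp U) s / (2*π) = m * cavg (lapp U) s := by rw [hm]; ring
  have e2 : cavg (D1 U) s ^ 2 / (2*π) = 2 * n * cavg (D1 U) s - 2 * π * n^2 := by rw [hn]; field_simp; ring
  rw [add_div, e1, e2]
  linarith

lemma Cbmo_nonneg {N J : ℝ} (hJ : 0 ≤ J) : 0 ≤ Cbmo N J := by
  unfold Cbmo; positivity

section
variable {ι : Type} [Fintype ι] {P : ι → E2} {a : ι → ℝ} {τ ρ lam : ℝ} {u : E2 → ℝ}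

lemma Ctx.qv_int (c : Ctx P a τ ρ lam u) {p : E2} {a' S : ℝ} (hL : Loc τ lam u p a' S) {s0 s1 : ℝ} (h01 : s0 < s1) (hS : s1 < S)
    (h1 : s1 < log (1/2)) (hreg : ∀ z ∈ box s0 s1, Cyl p z ∉ Zs P) :
    ∫ s in s0..s1, qv (u ∘ Cyl p) s ≤ 2⁻¹ * Cbmo (∑ i, |a i|) (s1 - s0) := by
  have hb := c.bmo h01 h1 hreg
  set k := ravg (u ∘ Cyl p) (s0, -π) (s1, π)
  have hsm : ∀ z : E2, z.1 < S → SmAt (u ∘ Cyl p) z := fun z hz => hL.U_sm hz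
  have hi : IntegrableOn (fun z => ((u ∘ Cyl p) z - k)^2) (box s0 s1) := by
    refine ContinuousOn.integrableOn_compact (box_compact _ _) fun z hz => ?_
    exact (((hsm z (by linarith [(box_mem.1 hz).1.2])).sub (SmAt.const k)).pow 2).cont.continuousWithinAt
  have hf := box_fubini h01.le hi
  have cs : ∀ s < S, Continuous fun θ => (u ∘ Cyl p) (s, θ) := fun s hs => slice_cont fun z hz => (hsm z (by rw [hz]; exact hs)).cont
  have hq : ContinuousOn (qv (u ∘ Cyl p)) (uIcc s0 s1) := by
    intro s hs
    rw [uIcc_of_le h01.le] at hs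
    have hsS : s < S := by linarith [hs.2]
    have t1 := (cavg_deriv hsm hsS).continuousAt
    have t2 := (cavg_deriv (fun z hz => (hsm z hz).pow 2) hsS).continuousAt
    exact ((t2.const_mul _).sub ((t1.pow 2).div_const _)).continuousWithinAt
  have : ∫ s in s0..s1, qv (u ∘ Cyl p) s ≤ ∫ s in s0..s1, 2⁻¹ * cavg (fun z => ((u ∘ Cyl p) z - k)^2) s := by
    refine intervalIntegral.integral_mono_on h01.le hq.intervalIntegrable (hf.2.const_mul _) fun s hs => ?_
    have := qv_le (cs s (by linarith [hs.2])) k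
    have h3 : 0 ≤ 2 * π * (k - cavg (u ∘ Cyl p) s / (2*π))^2 := by positivity
    linarith
  rw [intervalIntegral.integral_const_mul, ← hf.1] at this
  refine this.trans (mul_le_mul_of_nonneg_left hb (by norm_num))

set_option maxHeartbeats 1000000 in
lemma block (P : ι → E2) (a : ι → ℝ) (τ ρ : ℝ) : ∃ C0 : ℝ, 0 < C0 ∧ ∀ J : ℝ, 0 < J → ∃ η : ℝ, 0 < η ∧ ∀ lam u, Ctx P a τ ρ lam u →
    ∀ p a' S s0, Loc τ lam u p a' S → s0 + J + 1 < S → s0 + J + 1 < log (1/2) →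
    (∀ z ∈ box (s0-1) (s0+J+1), Cyl p z ∉ Zs P) →
    (∀ z : E2, s0 - 1 ≤ z.1 → z.1 ≤ s0 + J + 1 → |lapp (u ∘ Cyl p) z| ≤ η) →
    ∫ z in box s0 (s0+J), D2 (u ∘ Cyl p) z ^ 2 ≤ C0 := by
  obtain ⟨K, hK, hode⟩ := ode_energy
  set N := ∑ i, |a i|
  have c1 : 0 ≤ Cbmo N 1 := Cbmo_nonneg (by norm_num)
  refine ⟨K * Cbmo N 1 + 1, by positivity, fun J hJ => ?_⟩
  have c2 : 0 ≤ Cbmo N (J+2) := Cbmo_nonneg (by linarith)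
  refine ⟨(π * (J + 2) + Cbmo N (J+2))⁻¹, by positivity, fun lam u c p a' S s0 hL hS h1 hreg hl => ?_⟩
  set η := (π * (J + 2) + Cbmo N (J+2))⁻¹ with hη
  have η0 : 0 < η := by positivity
  set U := u ∘ Cyl p with hU
  have hsm : ∀ z : E2, z.1 < S → SmAt U z := fun z hz => hL.U_sm hz
  have tU : TPer U := tper_cyl u p
  have tq : TPer fun z => U z ^ 2 := fun z => by simp only [tU z]
  have hsq : ∀ z : E2, z.1 < S → SmAt (fun z => U z ^ 2) z := fun z hz => (hsm z hz).pow 2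
  have cs : ∀ s < S, Continuous fun θ => U (s, θ) := fun s hs => slice_cont fun z hz => (hsm z (by rw [hz]; exact hs)).cont
  have he : ∀ z : E2, z.1 < S → SmAt (fun z => D2 U z ^ 2) z := fun z hz => (hsm z hz).D2.pow 2
  have reg : ∀ {t0 t1 : ℝ}, s0 - 1 ≤ t0 → t1 ≤ s0 + J + 1 → ∀ z ∈ box t0 t1, Cyl p z ∉ Zs P := fun h0 h1 z hz => by
    have := box_mem.1 hz
    exact hreg z (box_mem.2 ⟨⟨by linarith, by linarith⟩, this.2⟩)
  have key := hode (qv U) (fun s => 2⁻¹ * cavg (D1 fun z => U z ^ 2) s - cavg U s * cavg (D1 U) s / (2*π))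
    (fun s => 2⁻¹ * cavg (lapp fun z => U z ^ 2) s - (cavg (D1 U) s ^ 2 + cavg U s * cavg (lapp U) s) / (2*π))
    (cavg fun z => D2 U z ^ 2) s0 (s0 + J) S η (by linarith) hS η0.le (fun s hs => ?_) (fun s hs => ?_) (fun s hs => ?_)
    (fun s hs => (cavg_deriv he hs).continuousAt) (fun s hs => ?_) (fun s hs => qv_nonneg (cs s hs)) (fun s hs => ?_)
  · have hi : IntegrableOn (fun z => D2 U z ^ 2) (box s0 (s0 + J)) := by
      refine ContinuousOn.integrableOn_compact (box_compact _ _) fun z hz => ?_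
      exact (he z (by linarith [(box_mem.1 hz).1.2])).cont.continuousWithinAt
    rw [(box_fubini (by linarith) hi).1]
    refine key.trans ?_
    have q1 := c.qv_int hL (s0 := s0 - 1) (s1 := s0) (by linarith) (by linarith) (by linarith) (reg le_rfl (by linarith))
    have q2 := c.qv_int hL (s0 := s0 + J) (s1 := s0 + J + 1) (by linarith) (by linarith) (by linarith) (reg (by linarith) le_rfl)
    have q3 := c.qv_int hL (s0 := s0 - 1) (s1 := s0 + J + 1) (by linarith) (by linarith) (by linarith) (reg le_rfl le_rfl)
    rw [show s0 - (s0 - 1) = 1 by ring] at q1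
    rw [show s0 + J + 1 - (s0 + J) = 1 by ring] at q2
    rw [show s0 + J + 1 - (s0 - 1) = J + 2 by ring] at q3
    have b1 := mul_le_mul_of_nonneg_left (add_le_add q1 q2) hK.le
    have b2 : η * (π * (s0 + J - s0 + 2) + ∫ s in (s0-1)..(s0+J+1), qv U s) ≤ η * (π * (J + 2) + Cbmo N (J+2)) := by
      refine mul_le_mul_of_nonneg_left ?_ η0.le
      have : s0 + J - s0 + 2 = J + 2 := by ring
      rw [this]; linarith
    rw [hη, inv_mul_cancel₀ (by positivity), ← hη] at b2
    linarith
  · have t1 := cavg_deriv hsm hs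
    have t2 := cavg_deriv hsq hs
    have := (t2.const_mul 2⁻¹).sub ((t1.pow 2).div_const (4*π))
    refine this.congr_deriv ?_
    simp only [Nat.cast_ofNat, Nat.add_one_sub_one, pow_one]
    field_simp; ring
  · have t1 := cavg_deriv hsm hs
    have t2 := cavg_deriv (fun z hz => (hsm z hz).D1) hs
    have t3 := cavg_deriv (fun z hz => (hsq z hz).D1) hs
    rw [← cavg_lapp hsm hs tU] at t2
    rw [← cavg_lapp hsq hs tq] at t3
    have := (t3.const_mul 2⁻¹).sub ((t1.mul t2).div_const (2*π))
    refine this.congr_deriv ?_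
    ring
  · have t1 := (cavg_deriv hsm hs).continuousAt
    have t2 := (cavg_deriv (fun z hz => (hsm z hz).D1) hs).continuousAt
    have t3 := (cavg_deriv (fun z hz => (hsm z hz).lapp) hs).continuousAt
    have t4 := (cavg_deriv (fun z hz => (hsq z hz).lapp) hs).continuousAt
    exact (t4.const_mul _).sub (((t2.pow 2).add (t1.mul t3)).div_const _)
  · have := cavg_mono (H := fun _ => 0) (K := fun z => D2 U z ^ 2) (s := s) continuous_const
      (slice_cont fun z hz => (he z (by rw [hz]; exact hs)).cont) fun θ => sq_nonneg _
    rw [cavg_const] at this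
    linarith
  · refine qv_ineq η0.le (fun z hz => hsm z (by rw [hz]; linarith [hs.2])) fun θ => hl _ ?_ ?_
    · exact hs.1
    · exact hs.2
end

lemma cyl_surj {p x : E2} (h : x ≠ p) : ∃ z, Cyl p z = x := by
  set w : ℂ := ⟨x.1 - p.1, x.2 - p.2⟩ with hw
  have hw0 : w ≠ 0 := by
    intro h0
    apply h
    have h1 := congrArg Complex.re h0
    have h2 := congrArg Complex.im h0
    simp only [hw, Complex.zero_re, Complex.zero_im] at h1 h2
    exact Prod.ext (by linarith) (by linarith)
  have e1 : ‖w‖ * cos w.arg = x.1 - p.1 := Complex.norm_mul_cos_arg w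
  have e2 : ‖w‖ * sin w.arg = x.2 - p.2 := Complex.norm_mul_sin_arg w
  have e0 := exp_log (norm_pos_iff.2 hw0)
  refine ⟨(log ‖w‖, w.arg), Prod.ext ?_ ?_⟩
  · show p.1 + exp (log ‖w‖) * cos w.arg = x.1
    rw [e0, e1]; ring
  · show p.2 + exp (log ‖w‖) * sin w.arg = x.2
    rw [e0, e2]; ring

/-- Euler field applied to g -/
def eul (p : E2) (g : E2 → ℝ) (x : E2) : ℝ := (x.1 - p.1) * D1 g x + (x.2 - p.2) * D2 g x

lemma eul_cyl {p z : E2} {g : E2 → ℝ} (h : DifferentiableAt ℝ g (Cyl p z)) : eul p g (Cyl p z) = D1 (g ∘ Cyl p) z := by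
  rw [D1_comp_cyl h, eul]
  simp [Cyl]

lemma eul_sm {p x : E2} {g : E2 → ℝ} (h : SmAt g x) : SmAt (eul p g) x := by
  have a1 : SmAt (fun y : E2 => y.1 - p.1) x := SmAt.of_contDiff (by fun_prop)
  have a2 : SmAt (fun y : E2 => y.2 - p.2) x := SmAt.of_contDiff (by fun_prop)
  exact (a1.mul h.D1).add (a2.mul h.D2)

open Classical in
def eux (p : E2) (a : ℝ) (u : E2 → ℝ) (x : E2) : ℝ := if x = p then 2 * a else eul p u x

section
variable {ι : Type} [Fintype ι] {P : ι → E2} {a : ι → ℝ} {τ ρ lam : ℝ} {u : E2 → ℝ}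

lemma ne_ev {p x : E2} (h : x ≠ p) : ∀ᶠ y in 𝓝 x, y ≠ p := isOpen_ne.mem_nhds h

lemma Loc.eux_sm {p : E2} {a' S : ℝ} (hL : Loc τ lam u p a' S) : SmAt (eux p a' u) p := by
  obtain ⟨v, hv, hu⟩ := hL.sing
  have hx : SmAt (fun x => 2 * a' + eul p v x) p := (SmAt.const _).add (eul_sm hv)
  refine hx.congr ?_
  rw [eventually_nhdsWithin_iff] at hu
  filter_upwards [eventually_eventually_nhds.2 hu, hv.ev] with x hx hvx
  by_cases h : x = p
  · subst h; simp [eux, eul]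
  · rw [eux, if_neg h]
    obtain ⟨z, rfl⟩ := cyl_surj h
    have e1 : ∀ᶠ y in 𝓝 (Cyl p z), u y = a' * log (nsq (y - p)) + v y := by
      filter_upwards [hx, ne_ev h] with y h1 h2 using h1 h2
    have su : SmAt u (Cyl p z) := (((SmAt.const a').mul (log_smAt h)).add hvx).congr e1
    have e2 : (u ∘ Cyl p) =ᶠ[𝓝 z] fun z => 2 * a' * z.1 + (v ∘ Cyl p) z := by
      filter_upwards [((Cyl_contDiff (n := 1) p).continuous.tendsto z).eventually e1] with y hy
      simp only [Function.comp, hy, nsq_cyl, log_exp]; ring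
    rw [eul_cyl su.diff, eul_cyl hvx.diff, D1_congr e2, D1_add (by fun_prop) hvx.cyl.diff,
      D1_fst (G := fun t => 2 * a' * t) (by simpa using (hasDerivAt_id z.1).const_mul (2*a'))]

lemma strip_int {g : E2 → ℝ} {χ : ℝ → ℝ} {s1 S : ℝ} (hχ : Continuous χ) (h0 : ∀ s, s1 ≤ s → χ s = 0) (hS : s1 < S)
    (hg : ∀ z : E2, z.1 < S → ContinuousAt g z) (hb : ∃ C s0, ∀ z : E2, z.1 ≤ s0 → |χ z.1 * g z| ≤ C * exp z.1) :
    IntegrableOn (fun z => χ z.1 * g z) strip := by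
  refine strip_integrable (s1 := s1) ?_ (fun z hz => by simp only [h0 _ hz, zero_mul]) hb
  refine continuous_iff_continuousAt.2 fun z => ?_
  rcases lt_or_ge z.1 S with h | h
  · exact (hχ.continuousAt.comp continuous_fst.continuousAt).mul (hg z h)
  · have : (fun z : E2 => χ z.1 * g z) =ᶠ[𝓝 z] fun _ => 0 := by
      have : ∀ᶠ y : E2 in 𝓝 z, s1 < y.1 := (isOpen_lt continuous_const continuous_fst).mem_nhds (by simp; linarith)
      filter_upwards [this] with y hy
      rw [h0 _ hy.le, zero_mul]
    exact this.continuousAt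

set_option maxHeartbeats 1000000 in
lemma Ctx.stab_cyl (c : Ctx P a τ ρ lam u) (hst : StabS τ lam u) {p : E2} {a' S s0 s1 : ℝ} (hL : Loc τ lam u p a' S)
    {χ χ' : ℝ → ℝ} (hχ : Cut χ χ' s0 s1) (hS : s1 < S) (h1 : s1 < log (1/2)) :
    0 ≤ ∫ z in strip, (gsq (fun z => χ z.1 * D1 (u ∘ Cyl p) z) z -
      lam * (exp (2*z.1) * fτ' τ (u (Cyl p z))) * (χ z.1 * D1 (u ∘ Cyl p) z)^2) := by
  have h2 : exp (2*s1) < 1/4 := by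
    have e1 := exp_lt_exp.2 (show 2 * s1 < 2 * log (1/2) by linarith)
    rw [exp_two_log (by norm_num)] at e1; linarith
  set g : E2 → ℝ := fun x => rad p 1 χ x * eux p a' u x with hg
  have hg0 : ∀ x, exp (2*s1) ≤ nsq (x - p) → g x = 0 := fun x hx => by
    simp only [hg]; rw [rad_zero hχ.zero hx, zero_mul]
  have gsm : ∀ x, SmAt g x := by
    intro x
    by_cases hx : x = p
    · subst hx; exact (rad_smAt hχ.smooth hχ.one x).mul hL.eux_sm
    · obtain ⟨z, rfl⟩ := cyl_surj hx
      by_cases hz : z.1 < S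
      · have : SmAt (eux p a' u) (Cyl p z) := (eul_sm (p := p) (hL.sm z hz)).congr (by
          filter_upwards [ne_ev hx] with y hy
          rw [eux, if_neg hy])
        exact (rad_smAt hχ.smooth hχ.one _).mul this
      · have hn : exp (2*s1) < nsq (Cyl p z - p) := by rw [nsq_cyl]; exact exp_lt_exp.2 (by linarith)
        exact (SmAt.const 0).congr (ev_zero hg0 hn)
  have gcd : ContDiff ℝ (⊤ : ℕ∞) g := contDiff_iff_contDiffAt.2 fun x => (gsm x).cd
  have gcyl : g ∘ Cyl p = fun z => χ z.1 * D1 (u ∘ Cyl p) z := by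
    funext z
    simp only [Function.comp, hg]
    rw [rad_cyl, eux, if_neg (Cyl_ne p z)]
    by_cases hz : z.1 < S
    · rw [eul_cyl (hL.sm z hz).diff]
    · rw [hχ.zero _ (by linarith), zero_mul, zero_mul]
  have hsup := supp_disc (p := p) (g := g) (exp_pos s1).le (fun x hx => hg0 x (by
    rw [← Real.exp_nat_mul] at hx; exact_mod_cast hx))
  have hr2 : exp s1 < 1/2 := by
    have := exp_lt_exp.2 h1
    rwa [exp_log (by norm_num)] at this
  have hφ := hst (pz p g) (pz_smooth hr2 hsup gcd) (pz_per _ _)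
  have pφ : Per (pz p g) := pz_per _ _
  rw [per_integral_local (K := fun x => gsq g x - lam * fτ' τ (u x) * g x ^ 2) _ p, cyl_integral p] at hφ
  · refine hφ.trans_eq (setIntegral_congr_fun strip_meas fun z _ => ?_)
    have := gsq_comp_cyl (gsm (Cyl p z)).diff
    rw [gcyl] at this
    rw [this, show g (Cyl p z) = (g ∘ Cyl p) z from rfl, gcyl]
    ring
  · intro x b1 b2
    have e := pz_ev (g := g) b1 b2
    rw [gsq_congr e, e.self_of_nhds]
  · intro x hx
    have hn := h2.trans_le (box_nsq hx)
    have e := ev_zero hg0 hn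
    rw [gsq_congr e, hg0 _ hn.le]
    unfold gsq
    rw [D1_const, D2_const]; ring
  · intro x k
    simp only [gsq, D1_add_lat pφ x k, D2_add_lat pφ x k, pφ x k, c.sol.per x k]

lemma Loc.intG {p : E2} {a' S s1 : ℝ} (hL : Loc τ lam u p a' S) {χ : ℝ → ℝ} (hχ : Continuous χ) (h0 : ∀ s, s1 ≤ s → χ s = 0)
    {B : ℝ} (hB : ∀ s, |χ s| ≤ B) (hS : s1 < S) {G : ℝ → ℝ} (hG : Continuous G) {C : ℝ} (hC : ∀ t, |G t| ≤ C) :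
    IntegrableOn (fun z => χ z.1 * (lam * (exp (2*z.1) * G (u (Cyl p z))))) strip := by
  refine strip_int hχ h0 hS (fun z hz => ?_) ⟨B * (|lam| * C), 0, fun z hz => ?_⟩
  · have h1 : ContinuousAt (fun z => u (Cyl p z)) z := (hL.U_sm hz).cont
    have h2 : ContinuousAt (fun z => G (u (Cyl p z))) z := hG.continuousAt.comp h1
    have h3 : ContinuousAt (fun z : E2 => exp (2*z.1)) z := by fun_prop
    exact (h3.mul h2).const_mul lam
  · have b0 : 0 ≤ B := (abs_nonneg _).trans (hB 0)
    have c0 : 0 ≤ C := (abs_nonneg _).trans (hC 0)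
    rw [abs_mul, abs_mul, abs_mul, abs_of_pos (exp_pos _)]
    have e := exp2_le hz
    calc |χ z.1| * (|lam| * (exp (2*z.1) * |G (u (Cyl p z))|)) ≤ B * (|lam| * (exp z.1 * C)) := by
          gcongr
          · exact hB _
          · exact hC _
      _ = _ := by ring

/-- integrability of compactly supported integrands on the strip -/
lemma strip_int0 {g : E2 → ℝ} {ω : ℝ → ℝ} {s0 s1 S : ℝ} (hω : Continuous ω) (h0 : ∀ s ≤ s0, ω s = 0) (h1 : ∀ s, s1 ≤ s → ω s = 0)
    (hS : s1 < S) (hg : ∀ z : E2, z.1 < S → ContinuousAt g z) : IntegrableOn (fun z => ω z.1 * g z) strip :=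
  strip_int hω h1 hS hg ⟨0, s0, fun z hz => by rw [h0 _ hz]; simp⟩

lemma int_lin4 {μ : Measure E2} {h g1 g2 g3 g4 : E2 → ℝ} (i1 : Integrable g1 μ) (i2 : Integrable g2 μ) (i3 : Integrable g3 μ)
    (i4 : Integrable g4 μ) (c1 c2 c3 c4 : ℝ) (e : ∀ z, h z = c1 * g1 z + c2 * g2 z + (c3 * g3 z + c4 * g4 z)) :
    ∫ z, h z ∂μ = c1 * (∫ z, g1 z ∂μ) + c2 * (∫ z, g2 z ∂μ) + (c3 * (∫ z, g3 z ∂μ) + c4 * ∫ z, g4 z ∂μ) := by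
  have a1 : Integrable (fun z => c1 * g1 z + c2 * g2 z) μ := (i1.const_mul c1).add (i2.const_mul c2)
  have a2 : Integrable (fun z => c3 * g3 z + c4 * g4 z) μ := (i3.const_mul c3).add (i4.const_mul c4)
  simp only [e]
  rw [integral_add a1 a2, integral_add (i1.const_mul c1) (i2.const_mul c2), integral_add (i3.const_mul c3) (i4.const_mul c4)]
  simp only [integral_const_mul]

lemma Ctx.crude (c : Ctx P a τ ρ lam u) {p : E2} {a' S s1 : ℝ} (hL : Loc τ lam u p a' S) {χ : ℝ → ℝ} (hχ : Continuous χ)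
    (h0 : ∀ s, s1 ≤ s → χ s = 0) {B : ℝ} (hB : ∀ s, |χ s| ≤ B) (hS : s1 < S) (h1 : s1 < log (1/2))
    {G : ℝ → ℝ} (hG : Continuous G) {C : ℝ} (hC : ∀ t, |G t| ≤ C * mn t) {Cν : ℝ} (hν : lam * ∫ x in QQ, mn (u x) ≤ Cν) :
    |∫ z in strip, χ z.1 * (lam * (exp (2*z.1) * G (u (Cyl p z))))| ≤ B * (C * Cν) := by
  have b0 : 0 ≤ B := (abs_nonneg _).trans (hB 0)
  have c0 : 0 ≤ C := by
    have := (abs_nonneg _).trans (hC 0)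
    exact nonneg_of_mul_nonneg_left this (mn_pos 0)
  have hC' : ∀ t, |G t| ≤ C := fun t => (hC t).trans (by nlinarith [mn_le_one t])
  have hi := hL.intG hχ h0 hB hS hG hC'
  set A : Set E2 := strip ∩ {z | z.1 < s1} with hA
  have mA : MeasurableSet A := strip_meas.inter (measurableSet_lt measurable_fst measurable_const)
  have key := cyl_le_set (g := fun x => mn (u x)) (fun x => mn_nonneg _) (fun x k => by simp only [c.sol.per x k])
    (c.int_b mn_cont.measurable (C := 1) fun t => by rw [abs_of_nonneg (mn_nonneg _)]; exact mn_le_one _) p mA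
    inter_subset_left (fun z hz => lt_trans hz.2 h1)
  rw [setIntegral_eq_of_subset_of_forall_sdiff_eq_zero strip_meas inter_subset_left
    (show ∀ z ∈ strip \ A, χ z.1 * (lam * (exp (2*z.1) * G (u (Cyl p z)))) = 0 from fun z hz => by
      rw [h0 z.1 (not_lt.1 fun h => hz.2 ⟨hz.1, h⟩), zero_mul])]
  have lp := c.pos
  calc |∫ z in A, χ z.1 * (lam * (exp (2*z.1) * G (u (Cyl p z))))|
      ≤ ∫ z in A, |χ z.1 * (lam * (exp (2*z.1) * G (u (Cyl p z))))| := abs_integral_le_integral_abs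
    _ ≤ ∫ z in A, (B * lam * C) * (exp (2*z.1) * mn (u (Cyl p z))) := by
        refine setIntegral_mono_on (hi.mono_set inter_subset_left).abs (key.1.const_mul _) mA fun z _ => ?_
        rw [abs_mul, abs_mul, abs_mul, abs_of_pos lp, abs_of_pos (exp_pos _)]
        calc |χ z.1| * (lam * (exp (2*z.1) * |G (u (Cyl p z))|)) ≤ B * (lam * (exp (2*z.1) * (C * mn (u (Cyl p z))))) := by
              gcongr
              · exact hB _
              · exact hC _
          _ = _ := by ring
    _ = (B * C) * (lam * ∫ z in A, exp (2*z.1) * mn (u (Cyl p z))) := by rw [integral_const_mul]; ring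
    _ ≤ (B * C) * Cν := by
        gcongr
        exact (mul_le_mul_of_nonneg_left key.2 lp.le).trans hν
    _ = _ := by ring

lemma cut_mass {χ χ' : ℝ → ℝ} {s0 s1 : ℝ} (hχ : Cut χ χ' s0 s1) : ∫ z in strip, -χ' z.1 = 2 * π := by
  have := (cyl_ident (g1 := fun _ => 1) (g2 := fun _ => 0) (k := fun _ => 0) (c := 1) hχ (lt_add_one s1)
    (fun _ _ => SmAt.const 1) (fun _ _ => SmAt.const 0) (fun _ => rfl) (fun z _ => by rw [D1_const, D2_const]; ring)
    ⟨0, 0, fun z _ => by simp⟩).2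
  simp only [mul_one, mul_zero, add_zero] at this
  rw [integral_neg, this]; ring

lemma box_strip {g : E2 → ℝ} {s0 s1 k : ℝ} {ω : ℝ → ℝ} (hi : IntegrableOn (fun z => ω z.1 * g z) strip) (h0 : ∀ s ≤ s0, ω s = 0)
    (h1 : ∀ s, s1 ≤ s → ω s = 0) (hk : ∀ s, ω s ≤ k) (hg0 : ∀ z, 0 ≤ g z)
    (hg : IntegrableOn g (box s0 s1)) : ∫ z in strip, ω z.1 * g z ≤ k * ∫ z in box s0 s1, g z := by
  have hsub : (Icc s0 s1 ×ˢ Ioo (-π) π : Set E2) ⊆ strip := prod_mono (subset_univ _) subset_rfl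
  rw [setIntegral_eq_of_subset_of_forall_sdiff_eq_zero strip_meas hsub (fun z hz => ?_), ← integral_const_mul, setIntegral_congr_set (box_ae s0 s1)]
  · refine setIntegral_mono_on (hi.mono_set hsub) (Integrable.const_mul ?_ _) (measurableSet_Icc.prod measurableSet_Ioo) fun z _ =>
      mul_le_mul_of_nonneg_right (hk _) (hg0 _)
    exact hg.congr_set_ae (box_ae s0 s1).symm
  · rcases le_total z.1 s0 with h | h
    · rw [h0 _ h, zero_mul]
    rcases le_total s1 z.1 with h' | h'
    · rw [h1 _ h', zero_mul]
    exact absurd ⟨⟨h, h'⟩, hz.1.2⟩ hz.2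

set_option maxHeartbeats 1000000 in
lemma Ctx.vt_poho (c : Ctx P a τ ρ lam u) {C : ℝ} (hC : ∀ t, |F2τ τ t| ≤ C * mn t) {p : E2} {a' S s0 s1 : ℝ} (hL : Loc τ lam u p a' S)
    {χ χ' : ℝ → ℝ} (hχ : Cut χ χ' s0 s1) (hS : s1 < S) (h1 : s1 < log (1/2)) {k : ℝ} (hd : ∀ s, χ' s ≤ 0) (hk : ∀ s, -χ' s ≤ k)
    {C0 Cν : ℝ} (hC0 : ∫ z in box s0 s1, D2 (u ∘ Cyl p) z ^ 2 ≤ C0) (hν : lam * ∫ x in QQ, mn (u x) ≤ Cν) :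
    IntegrableOn (fun z => -χ' z.1 * D1 (u ∘ Cyl p) z ^ 2) strip ∧
    ∫ z in strip, -χ' z.1 * D1 (u ∘ Cyl p) z ^ 2 ≤ 8 * π * a'^2 + k * C0 + 2 * (k * (C * Cν)) +
      4 * ∫ z in strip, χ z.1 * (lam * (exp (2*z.1) * F2τ τ (u (Cyl p z)))) := by
  have FC := (F_smooth c.hτ).continuous
  have hk0 : 0 ≤ k := by have := hd 0; have := hk 0; linarith
  have c0 : 0 ≤ C := nonneg_of_mul_nonneg_left ((abs_nonneg _).trans (hC 0)) (mn_pos 0)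
  have hC' : ∀ t, |F2τ τ t| ≤ C := fun t => (hC t).trans (by nlinarith [mn_le_one t])
  have cD1 : ∀ z : E2, z.1 < S → ContinuousAt (fun z => D1 (u ∘ Cyl p) z ^ 2) z := fun z hz => ((hL.U_sm hz).D1.pow 2).cont
  have cD2 : ∀ z : E2, z.1 < S → ContinuousAt (fun z => D2 (u ∘ Cyl p) z ^ 2) z := fun z hz => ((hL.U_sm hz).D2.pow 2).cont
  have i1 : IntegrableOn (fun z => -χ' z.1 * D1 (u ∘ Cyl p) z ^ 2) strip :=
    strip_int0 (s0 := s0) (ω := fun s => -χ' s) hχ.cont.neg (fun s hs => by simp [hχ.d0 hs]) (fun s hs => by simp [hχ.d1 hs]) hS cD1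
  have i2 : IntegrableOn (fun z => -χ' z.1 * D2 (u ∘ Cyl p) z ^ 2) strip :=
    strip_int0 (s0 := s0) (ω := fun s => -χ' s) hχ.cont.neg (fun s hs => by simp [hχ.d0 hs]) (fun s hs => by simp [hχ.d1 hs]) hS cD2
  have ab : ∀ s, |χ' s| ≤ k := fun s => by rw [abs_of_nonpos (hd s)]; exact hk s
  have ab1 : ∀ s, |χ s| ≤ 1 := fun s => by rw [abs_of_nonneg (hχ.nonneg s)]; exact hχ.le_one s
  have i3 := hL.intG hχ.cont (fun s hs => hχ.d1 hs) ab hS FC hC'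
  have i4 := hL.intG hχ.smooth.continuous hχ.zero ab1 hS FC hC'
  have b3 := c.crude hL hχ.cont (fun s hs => hχ.d1 hs) ab hS h1 FC hC hν
  have b2 := box_strip (s0 := s0) (s1 := s1) (ω := fun s => -χ' s) i2 (fun s hs => by simp [hχ.d0 hs]) (fun s hs => by simp [hχ.d1 hs]) hk
    (fun z => sq_nonneg _) (ContinuousOn.integrableOn_compact (box_compact _ _) fun z hz =>
      (cD2 z ((box_mem.1 hz).1.2.trans_lt hS)).continuousWithinAt)
  have ph := (hL.poho c.hτ hχ hS).2
  have e : ∫ z in strip, (χ' z.1 * ((D1 (u ∘ Cyl p) z ^ 2 - D2 (u ∘ Cyl p) z ^ 2) * 2⁻¹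
        + lam * (exp (2*z.1) * F2τ τ (u (Cyl p z))))
      + χ z.1 * (2 * lam * exp (2*z.1) * F2τ τ (u (Cyl p z))))
      = (-(2⁻¹) * (∫ z in strip, -χ' z.1 * D1 (u ∘ Cyl p) z ^ 2) + 2⁻¹ * ∫ z in strip, -χ' z.1 * D2 (u ∘ Cyl p) z ^ 2)
        + ((∫ z in strip, χ' z.1 * (lam * (exp (2*z.1) * F2τ τ (u (Cyl p z)))))
        + 2 * ∫ z in strip, χ z.1 * (lam * (exp (2*z.1) * F2τ τ (u (Cyl p z))))) := by
    rw [int_lin4 i1 i2 i3 i4 (-(2⁻¹)) 2⁻¹ 1 2 (fun z => by ring), one_mul]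
  rw [e] at ph
  refine ⟨i1, ?_⟩
  have b4 := mul_le_mul_of_nonneg_left hC0 hk0
  have b5 := (abs_le.1 b3).2
  linarith

set_option maxHeartbeats 2000000 in
lemma Ctx.vt_core (c : Ctx P a τ ρ lam u) (hst : StabS τ lam u) {C : ℝ} (hC : ∀ t, |fτ τ t| ≤ C * mn t ∧ |fτ' τ t| ≤ C * mn t ∧ |F2τ τ t| ≤ C * mn t)
    {p : E2} {a' S s0 s1 : ℝ} (hL : Loc τ lam u p a' S)
    {χ χ' : ℝ → ℝ} (hχ : Cut χ χ' s0 s1) (hS : s1 < S) (h1 : s1 < log (1/2)) {k : ℝ} (hk1 : k ≤ 1) (hd : ∀ s, χ' s ≤ 0) (hk : ∀ s, -χ' s ≤ k)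
    {C0 Cν : ℝ} (hC0 : ∫ z in box s0 s1, D2 (u ∘ Cyl p) z ^ 2 ≤ C0) (hC00 : 0 ≤ C0) (hν : lam * ∫ x in QQ, mn (u x) ≤ Cν) :
    (∫ z in strip, χ z.1 ^ 2 * (lam * (exp (2*z.1) * F2τ τ (u (Cyl p z)))) ≤ k * (8 * π * a'^2 + C0 + 6 * (C * Cν))) ∧
    ((∫ z in strip, χ z.1 ^ 2 * (lam * (exp (2*z.1) * fτ τ (u (Cyl p z)))))^2
      - 8 * π * a' * (∫ z in strip, χ z.1 ^ 2 * (lam * (exp (2*z.1) * fτ τ (u (Cyl p z)))))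
      ≤ 12 * π * (k * (8 * π * a'^2 + C0 + 6 * (C * Cν)))) ∧
    ∫ z in strip, χ' z.1 ^ 2 ≤ 2 * π * k := by
  have FC := (F_smooth c.hτ).continuous
  have fC := (f_smooth c.hτ).continuous
  have hk0 : 0 ≤ k := by have := hd 0; have := hk 0; linarith
  have c0 : 0 ≤ C := nonneg_of_mul_nonneg_left ((abs_nonneg _).trans (hC 0).1) (mn_pos 0)
  have n0 : 0 ≤ Cν := le_trans (mul_nonneg c.pos.le (integral_nonneg fun _ => mn_nonneg _)) hν
  have hw : 0 ≤ C * Cν := mul_nonneg c0 n0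
  have hC' : ∀ t, |F2τ τ t| ≤ C := fun t => (hC t).2.2.trans (by nlinarith [mn_le_one t])
  have hCf : ∀ t, |fτ τ t| ≤ C := fun t => (hC t).1.trans (by nlinarith [mn_le_one t])
  have cD1 : ∀ z : E2, z.1 < S → ContinuousAt (fun z => D1 (u ∘ Cyl p) z) z := fun z hz => ((hL.U_sm hz).D1).cont
  have z0 : ∀ s ≤ s0, χ' s = 0 := fun s hs => hχ.d0 hs
  have z1 : ∀ s, s1 ≤ s → χ' s = 0 := fun s hs => hχ.d1 hs
  obtain ⟨iX, hX⟩ := c.vt_poho (fun t => (hC t).2.2) hL hχ hS h1 hd hk hC0 hν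
  have ab : ∀ s, |χ s| ≤ 1 := fun s => by rw [abs_of_nonneg (hχ.nonneg s)]; exact hχ.le_one s
  have cr := (abs_le.1 (c.crude hL hχ.smooth.continuous hχ.zero ab hS h1 FC (fun t => (hC t).2.2) hν)).2
  set M := 8 * π * a'^2 + C0 + 6 * (C * Cν) with hM
  set X := ∫ z in strip, -χ' z.1 * D1 (u ∘ Cyl p) z ^ 2 with hXd
  have hXM : X ≤ M := by nlinarith [mul_le_mul_of_nonneg_right hk1 hC00, mul_le_mul_of_nonneg_right hk1 hw]
  set Φ := ∫ z in strip, χ z.1 ^ 2 * (lam * (exp (2*z.1) * F2τ τ (u (Cyl p z)))) with hΦ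
  have sq1 : ∀ s, |χ s ^ 2| ≤ 1 := fun s => by rw [abs_pow]; exact pow_le_one₀ (abs_nonneg _) (ab s)
  have i4 := hL.intG hχ.sq.smooth.continuous hχ.sq.zero sq1 hS FC hC'
  have pab : ∀ s, |χ s * χ' s| ≤ k := fun s => by
    rw [abs_mul, abs_of_nonpos (hd s)]
    nlinarith [ab s, abs_nonneg (χ s), hk s, hd s]
  have cont2 : Continuous fun s => χ s * χ' s := hχ.smooth.continuous.mul hχ.cont
  have i5 := hL.intG cont2 (fun s hs => by rw [z1 s hs, mul_zero]) pab hS FC hC'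
  have b5 := c.crude hL cont2 (fun s hs => by rw [z1 s hs, mul_zero]) pab hS h1 FC (fun t => (hC t).2.2) hν
  have iS : IntegrableOn (fun z => χ' z.1 ^ 2 * D1 (u ∘ Cyl p) z ^ 2) strip :=
    strip_int0 (s0 := s0) (ω := fun s => χ' s ^ 2) (hχ.cont.pow 2) (fun s hs => by simp [z0 s hs]) (fun s hs => by simp [z1 s hs]) hS
      (fun z hz => (cD1 z hz).pow 2)
  have hS2 : ∫ z in strip, χ' z.1 ^ 2 * D1 (u ∘ Cyl p) z ^ 2 ≤ k * X := by
    rw [hXd, ← integral_const_mul]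
    refine integral_mono iS (iX.const_mul _) fun z => ?_
    have h2 := sq_nonneg (D1 (u ∘ Cyl p) z)
    have := mul_nonneg (mul_nonneg (neg_nonneg.2 (hd z.1)) (sub_nonneg.2 (hk z.1))) h2
    simp only
    linarith [this]
  have P1 : Φ ≤ k * M := by
    have vt := hL.vtest c.hτ hχ.sq hS
    have st := c.stab_cyl hst hL hχ hS h1
    have e : ∫ z in strip, (gsq (fun z => χ z.1 * D1 (u ∘ Cyl p) z) z - lam * (exp (2*z.1) * fτ' τ (u (Cyl p z))) * (χ z.1 * D1 (u ∘ Cyl p) z)^2)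
      = (0 + ∫ z in strip, χ' z.1 ^ 2 * D1 (u ∘ Cyl p) z ^ 2) + (-4) * ((∫ z in strip, (χ z.1 * χ' z.1) * (lam * (exp (2*z.1) * F2τ τ (u (Cyl p z))))) + Φ) := by
      rw [int_lin4 vt.1 iS i5 i4 1 1 (-4) (-4) (fun z => ?_), vt.2, ← hΦ]
      · ring
      by_cases hz : z.1 < S
      · have d0 : DifferentiableAt ℝ (fun z : E2 => χ z.1) z := (SmAt.fst (x := z) hχ.smooth).diff
        have d1 := (hL.U_sm hz).D1.diff
        have g1 := D1_mul d0 d1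
        have g2 := D2_mul d0 d1
        rw [D1_fst (hχ.deriv z.1)] at g1
        rw [D2_fst (hχ.deriv z.1)] at g2
        simp only [gsq] at g1 g2 ⊢
        rw [g1, g2]
        ring
      · have hz1 : s1 < z.1 := hS.trans_le (not_lt.1 hz)
        have := cut_D_zero hχ.zero (g := D1 (u ∘ Cyl p)) hz1
        simp only [gsq]
        rw [this.1, this.2, hχ.zero _ hz1.le, z1 _ hz1.le]
        ring
    rw [e] at st
    have b6 := (abs_le.1 b5).1
    have : k * X ≤ k * (8 * π * a'^2 + C0 + 6 * (C * Cν)) := mul_le_mul_of_nonneg_left (hXM.trans_eq hM) hk0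
    rw [hM]
    have h3 : 0 ≤ k * (8 * π * a'^2) := by positivity
    have h4 : 0 ≤ k * C0 := by positivity
    have h5 : 0 ≤ k * (C * Cν) := by positivity
    linarith
  refine ⟨P1, ?_, ?_⟩
  · have hd2 : ∀ s, 2 * χ s * χ' s ≤ 0 := fun s => by nlinarith [mul_nonneg (hχ.nonneg s) (neg_nonneg.2 (hd s))]
    have hk2 : ∀ s, -(2 * χ s * χ' s) ≤ 2 * k := fun s => by
      have := (abs_le.1 (pab s)).1; linarith
    obtain ⟨iY, hY⟩ := c.vt_poho (fun t => (hC t).2.2) hL hχ.sq hS h1 hd2 hk2 hC0 hν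
    have fl := (hL.flux c.hτ hχ.sq hS).2
    have i6 := hL.intG hχ.sq.smooth.continuous hχ.sq.zero sq1 hS fC hCf
    have i7 : IntegrableOn (fun z => -(2 * χ z.1 * χ' z.1) * D1 (u ∘ Cyl p) z) strip :=
      strip_int0 (s0 := s0) (ω := fun s => -(2 * χ s * χ' s)) (hχ.sq.cont.neg) (fun s hs => by simp [z0 s hs]) (fun s hs => by simp [z1 s hs]) hS cD1
    have i8 : IntegrableOn (fun z : E2 => -(2 * χ z.1 * χ' z.1)) strip := by
      simpa using strip_int0 (s0 := s0) (ω := fun s => -(2 * χ s * χ' s)) (g := fun _ => 1) (hχ.sq.cont.neg) (fun s hs => by simp [z0 s hs])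
        (fun s hs => by simp [z1 s hs]) hS (fun _ _ => continuousAt_const)
    have m8 := cut_mass hχ.sq
    set H := ∫ z in strip, χ z.1 ^ 2 * (lam * (exp (2*z.1) * fτ τ (u (Cyl p z)))) with hH
    set Y := ∫ z in strip, -(2 * χ z.1 * χ' z.1) * D1 (u ∘ Cyl p) z ^ 2 with hYd
    set X1 := ∫ z in strip, -(2 * χ z.1 * χ' z.1) * D1 (u ∘ Cyl p) z with hX1
    have e1 : X1 + H = 4 * π * a' := by
      have : ∫ z in strip, (2 * χ z.1 * χ' z.1 * D1 (u ∘ Cyl p) z + χ z.1 ^ 2 * (-(lam * exp (2*z.1) * fτ τ (u (Cyl p z))))) = (-1) * (X1 + H) := by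
        rw [hX1, hH, ← integral_add i7 i6, ← integral_const_mul]
        refine integral_congr_ae (Eventually.of_forall fun z => ?_)
        simp only
        ring
      rw [this] at fl
      linarith
    have e2 : 0 ≤ Y - 2 * (X1 / (2 * π)) * X1 + (X1 / (2 * π))^2 * (2 * π) := by
      rw [← m8, hYd]
      have : ∀ t : ℝ, (∫ z in strip, -(2 * χ z.1 * χ' z.1) * D1 (u ∘ Cyl p) z ^ 2) - 2 * t * X1 + t^2 * ∫ z in strip, -(2 * χ z.1 * χ' z.1)
         = ∫ z in strip, -(2 * χ z.1 * χ' z.1) * (D1 (u ∘ Cyl p) z - t)^2 := by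
        intro t
        have h4 := int_lin4 (h := fun z => -(2 * χ z.1 * χ' z.1) * (D1 (u ∘ Cyl p) z - t)^2) iY i7 i8 i8 1 (-(2*t)) (t^2) 0 (fun z => by ring)
        rw [h4, ← hX1]
        ring
      rw [this]
      exact integral_nonneg fun z => mul_nonneg (neg_nonneg.2 (hd2 _)) (sq_nonneg _)
    have e3 : X1^2 ≤ 2 * π * Y := by
      have pp := pi_pos
      have : Y - 2 * (X1 / (2 * π)) * X1 + (X1 / (2 * π))^2 * (2 * π) = (2 * π * Y - X1^2) / (2 * π) := by field_simp; ring
      rw [this] at e2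
      have := (div_nonneg_iff.1 e2).resolve_right (fun h => by linarith [h.2])
      linarith [this.1]
    have e4 : Y ≤ 8 * π * a'^2 + 6 * (k * M) := by
      have : 2 * (k * C0) + 4 * (k * (C * Cν)) ≤ 2 * (k * M) := by
        rw [hM]
        have h3 : 0 ≤ k * (8 * π * a'^2) := by positivity
        have h5 : 0 ≤ k * (C * Cν) := by positivity
        linarith
      linarith
    have e5 : X1 = 4 * π * a' - H := by linarith
    rw [e5] at e3
    nlinarith [mul_le_mul_of_nonneg_left e4 (by positivity : 0 ≤ 2 * π)]
  · have m1 := cut_mass hχ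
    have i8 : IntegrableOn (fun z : E2 => -χ' z.1) strip := by
      simpa using strip_int0 (s0 := s0) (ω := fun s => -χ' s) (g := fun _ => 1) (hχ.cont.neg) (fun s hs => by simp [z0 s hs])
        (fun s hs => by simp [z1 s hs]) hS (fun _ _ => continuousAt_const)
    have i9 : IntegrableOn (fun z : E2 => χ' z.1 ^ 2) strip := by
      simpa using strip_int0 (s0 := s0) (ω := fun s => χ' s ^ 2) (g := fun _ => 1) (hχ.cont.pow 2) (fun s hs => by simp [z0 s hs])
        (fun s hs => by simp [z1 s hs]) hS (fun _ _ => continuousAt_const)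
    rw [mul_comm, ← m1, ← integral_const_mul]
    refine integral_mono i9 (i8.const_mul _) fun z => ?_
    have := mul_nonneg (neg_nonneg.2 (hd z.1)) (sub_nonneg.2 (hk z.1))
    simp only
    linarith [this]

lemma Ctx.pig (c : Ctx P a τ ρ lam u) {Cν δ L A : ℝ} (hL : 0 < L) {n : ℕ} (hn : Cν < n * δ)
    (hν : lam * ∫ x in QQ, mn (u x) ≤ Cν) (p : E2) (hB : A + n * L < log (1/2)) :
    ∃ b : ℝ, A ≤ b ∧ b + L ≤ A + n * L ∧ lam * ∫ z in box b (b + L), exp (2*z.1) * mn (u (Cyl p z)) ≤ δ := by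
  by_contra! hc
  set g : E2 → ℝ := fun z => exp (2*z.1) * mn (u (Cyl p z))
  have key : ∀ i < n, δ ≤ lam * ∫ s in (A + (i:ℝ) * L)..(A + ((i+1:ℕ):ℝ) * L), cavg g s := by
    intro i hi
    have hi' : ((i:ℝ) + 1) ≤ n := by exact_mod_cast hi
    have e : A + ((i+1:ℕ):ℝ) * L = (A + i * L) + L := by push_cast; ring
    have l2 : (A + i * L) + L ≤ A + n * L := by nlinarith
    have h1 := hc (A + i * L) (by nlinarith [mul_nonneg (Nat.cast_nonneg (α := ℝ) i) hL.le]) l2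
    rw [(box_fubini (by linarith) (c.cyl_mn p (by linarith)).1).1] at h1
    rw [e]
    exact h1.le
  have hs := intervalIntegral.sum_integral_adjacent_intervals (f := cavg g) (μ := volume) (a := fun i : ℕ => A + (i:ℝ) * L) (n := n) (by
    intro i hi
    have hi' : ((i:ℝ) + 1) ≤ n := by exact_mod_cast hi
    have e : A + ((i+1:ℕ):ℝ) * L = (A + i * L) + L := by push_cast; ring
    have l2 : (A + i * L) + L ≤ A + n * L := by nlinarith
    simp only [e]
    exact (box_fubini (by linarith) (c.cyl_mn p (by linarith)).1).2)
  simp only [Nat.cast_zero, zero_mul, add_zero] at hs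
  have h0 : A ≤ A + n * L := by have := mul_nonneg (Nat.cast_nonneg (α := ℝ) n) hL.le; linarith
  have hm := c.cyl_mn p (s0 := A) hB
  rw [(box_fubini h0 hm.1).1, ← hs] at hm
  have h3 : (n:ℝ) * δ ≤ lam * ∑ i ∈ Finset.range n, ∫ s in (A + (i:ℝ) * L)..(A + ((i+1:ℕ):ℝ) * L), cavg g s := by
    rw [Finset.mul_sum]
    calc (n:ℝ) * δ = ∑ i ∈ Finset.range n, δ := by simp
      _ ≤ _ := Finset.sum_le_sum fun i hi => key i (Finset.mem_range.1 hi)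
  have := mul_le_mul_of_nonneg_left hm.2 c.pos.le
  linarith

set_option maxHeartbeats 1000000 in
lemma VT (P : ι → E2) (a : ι → ℝ) (ρ : ℝ) (hτ : 0 < τ) {Cν η N' : ℝ} (hη : 0 < η) (hCν : 0 ≤ Cν) :
    ∃ M : ℝ, 0 < M ∧ ∀ lam u, Ctx P a τ ρ lam u → StabS τ lam u → lam * ∫ x in QQ, mn (u x) ≤ Cν →
    ∀ p a' S A B, Loc τ lam u p a' S → |a'| ≤ N' → A + M ≤ B → B < S → B < log (1/2) →
    (∀ x ∈ Ann p A B, x ∉ Zs P ∧ u x ≤ 1) →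
    ∃ χ χ' : ℝ → ℝ, ∃ s0 s1, Cut χ χ' s0 s1 ∧ A ≤ s0 ∧ s1 ≤ B ∧ (∀ s, χ' s ≤ 0) ∧
      (∫ z in strip, χ z.1 ^ 2 * (lam * (exp (2*z.1) * F2τ τ (u (Cyl p z)))) ≤ η) ∧
      (a' ≤ 0 → ∫ z in strip, χ z.1 ^ 2 * (lam * (exp (2*z.1) * fτ τ (u (Cyl p z)))) ≤ η) ∧
      ∫ z in strip, χ' z.1 ^ 2 ≤ η := by
  obtain ⟨C, hC1, hC⟩ := f_bounds hτ
  obtain ⟨K, hK, hcut⟩ := cutJ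
  obtain ⟨C0, hC0, hbl⟩ := block P a τ ρ
  have C0' : 0 < C := by linarith
  set M0 := 8 * π * N'^2 + C0 + 6 * (C * Cν) with hM0
  have M0p : 0 < M0 := by positivity
  set R := 1 + M0 / η + 12 * π * M0 / η^2 + 2 * π / η with hR
  have pp := pi_pos
  have r1 : 0 ≤ M0 / η := by positivity
  have r2 : 0 ≤ 12 * π * M0 / η^2 := by positivity
  have r3 : 0 ≤ 2 * π / η := by positivity
  have Rp : 0 < R := by linarith
  set J := K * R with hJ
  have Jp : 0 < J := by positivity
  have kJ : K / J = 1 / R := by rw [hJ]; field_simp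
  have q0 : 1 / R ≤ 1 := by rw [div_le_one Rp]; linarith
  have q1 : 1 / R * M0 ≤ η := by
    rw [one_div_mul_eq_div, div_le_iff₀ Rp]; rw [← div_le_iff₀' hη]; linarith
  have q2 : 12 * π * (1 / R * M0) ≤ η^2 := by
    have : 12 * π * (1 / R * M0) = 12 * π * M0 / R := by ring
    rw [this, div_le_iff₀ Rp, ← div_le_iff₀' (by positivity)]; linarith
  have q3 : 2 * π * (1 / R) ≤ η := by
    rw [mul_one_div, div_le_iff₀ Rp, ← div_le_iff₀' hη]; linarith
  obtain ⟨ηb, hηb, hblock⟩ := hbl J Jp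
  set δ := min (1 / (600 * C)) (ηb / (768 * C)) with hδ
  have δp : 0 < δ := by rw [hδ]; positivity
  obtain ⟨n, hn⟩ := exists_nat_gt (Cν / δ)
  have hn' : Cν < n * δ := by rwa [div_lt_iff₀ δp] at hn
  have np : (0:ℝ) < n := lt_of_le_of_lt (by positivity) hn
  refine ⟨n * (J + 4), by positivity, ?_⟩
  intro lam u c hst hν p a' S A B hL ha' hAB hBS hB hreg
  obtain ⟨b, hb0, hb1, hb⟩ := c.pig (L := J + 4) (by linarith) hn' hν p (A := A) (by linarith)
  have hp := c.hpt hC1 (fun t => (hC t).1) (p := p) (s0 := b + 1) (s1 := b + J + 3) (δ := δ) (by linarith)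
    (fun x hx => hreg x (Ann_sub (by linarith) (by linarith) hx)) δp
    (by have : δ ≤ 1 / (600 * C) := min_le_left _ _
        rw [le_div_iff₀ (by positivity)] at this; linarith)
    (by have e1 : b + 1 - 1 = b := by ring
        have e2 : b + J + 3 + 1 = b + (J + 4) := by ring
        rw [e1, e2]; exact hb)
  obtain ⟨χ, χ', hχ, hd, hk⟩ := hcut (b + 2) J Jp
  rw [kJ] at hk
  have hD := hblock lam u c p a' S (b + 2) hL (by linarith) (by linarith)
    (fun z hz => (hreg _ (Ann_cyl (by have := (box_mem.1 hz).1.1; linarith) (by have := (box_mem.1 hz).1.2; linarith))).1) (by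
      intro z h0 h1
      rw [hL.U_pde (by linarith), abs_neg, abs_mul, abs_of_nonneg (by have := c.pos; positivity)]
      have h3 := hp z (by linarith) (by linarith)
      have h4 : lam * exp (2*z.1) * |fτ τ ((u ∘ Cyl p) z)| ≤ lam * exp (2*z.1) * (C * exp (u (Cyl p z))) :=
        mul_le_mul_of_nonneg_left ((hC _).1.trans (mul_le_mul_of_nonneg_left (mn_le_exp _) C0'.le)) (by have := c.pos; positivity)
      have h5 : δ ≤ ηb / (768 * C) := min_le_right _ _
      rw [le_div_iff₀ (by positivity)] at h5
      nlinarith [mul_le_mul_of_nonneg_left h3 C0'.le])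
  obtain ⟨v1, v2, v3⟩ := c.vt_core hst hC hL hχ (by linarith) (by linarith) q0 hd hk hD hC0.le hν
  have hMM : 1 / R * (8 * π * a'^2 + C0 + 6 * (C * Cν)) ≤ 1 / R * M0 := by
    refine mul_le_mul_of_nonneg_left ?_ (by positivity)
    have : a'^2 ≤ N'^2 := by rw [← sq_abs a']; exact pow_le_pow_left₀ (abs_nonneg _) ha' 2
    rw [hM0]
    nlinarith
  refine ⟨χ, χ', b + 2, b + 2 + J, hχ, by linarith, by linarith, hd, v1.trans (hMM.trans q1), ?_, v3.trans q3⟩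
  intro ha
  by_contra! hh
  set H := ∫ z in strip, χ z.1 ^ 2 * (lam * (exp (2*z.1) * fτ τ (u (Cyl p z))))
  have h1 : 12 * π * (1 / R * (8 * π * a'^2 + C0 + 6 * (C * Cν))) ≤ η^2 := (mul_le_mul_of_nonneg_left hMM (by positivity)).trans q2
  have h2 : 0 ≤ -(8 * π * a' * H) := by
    have : 0 ≤ π * (-a') * H := mul_nonneg (mul_nonneg pp.le (by linarith)) (by linarith)
    linarith
  nlinarith

lemma nsq_add {x y : E2} {r s : ℝ} (hr : 0 ≤ r) (hs : 0 ≤ s) (hx : nsq x ≤ r^2) (hy : nsq y ≤ s^2) :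
    nsq (x + y) ≤ nsq x + nsq y + 2 * r * s := by
  have h : x.1 * y.1 + x.2 * y.2 ≤ r * s := by
    refine abs_le_of_sq_le_sq' (?_ : _ ≤ _) (mul_nonneg hr hs) |>.2
    have h1 : (x.1 * y.1 + x.2 * y.2)^2 ≤ nsq x * nsq y := by
      unfold nsq; nlinarith [sq_nonneg (x.1 * y.2 - x.2 * y.1)]
    have h2 : nsq x * nsq y ≤ r^2 * s^2 := mul_le_mul hx hy (nsq_nonneg _) (by positivity)
    rw [mul_pow]; linarith
  unfold nsq
  simp only [Prod.fst_add, Prod.snd_add]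
  nlinarith

/-- all singular points are at distance at least `r` from `q` -/
def Far (P : ι → E2) (r : ℝ) (q : E2) : Prop := ∀ x ∈ Zs P, r^2 ≤ nsq (x - q)

lemma Far.sub {r s : ℝ} {q x : E2} (h : Far P r q) (h0 : 0 ≤ s) (hs : s ≤ r) (hx : nsq (x - q) ≤ s^2) : Far P (r - s) x := by
  intro z hz
  by_contra! hc
  have := nsq_add (sub_nonneg.2 hs) h0 hc.le hx
  rw [sub_add_sub_cancel] at this
  have := h z hz
  nlinarith

lemma Far.not {r : ℝ} {q : E2} (h : Far P r q) (hr : 0 < r) : q ∉ Zs P := fun hq => by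
  have := h q hq
  rw [sub_self] at this
  have h0 : nsq 0 = 0 := by simp [nsq]
  rw [h0] at this
  nlinarith [sq_pos_of_pos hr]

lemma nsq_symm (x y : E2) : nsq (x - y) = nsq (y - x) := by
  unfold nsq; simp only [Prod.fst_sub, Prod.snd_sub]; ring

lemma Far.mono {r s : ℝ} {q : E2} (h : Far P r q) (hs : 0 ≤ s) (h1 : s ≤ r) : Far P s q :=
  fun x hx => (pow_le_pow_left₀ hs h1 2).trans (h x hx)

lemma Far.ball {r : ℝ} {q : E2} (h : Far P r q) (x : E2) (hx : nsq (x - q) < r^2) : x ∉ Zs P :=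
  fun hz => absurd (h x hz) (not_le.2 hx)

def Csup (a : ι → ℝ) : ℝ := 18 * (128 * π^2 * (∑ i, |a i|) + 1)
lemma Csup_nonneg (a : ι → ℝ) : 0 ≤ Csup a := by
  have : 0 ≤ ∑ i, |a i| := Finset.sum_nonneg fun _ _ => abs_nonneg _
  unfold Csup; positivity

lemma Ctx.supF (c : Ctx P a τ ρ lam u) {C1 γ r : ℝ} (hB : lam * mu u (Ici (-1)) ≤ C1) (hl : 2 * C1 ≤ lam)
    (hr : 0 < r) (hr2 : r ≤ 1/2) {q : E2} (hz : ∀ x, nsq (x - q) < r^2 → NotZ2 P a x) (hq : q ∉ Zs P)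
    (hγ : Csup a * C1 < lam * r^2 * hs γ) : u q ≤ γ := by
  by_contra! hc
  have lp := c.pos
  have h0 : mu u (Ici 0) ≤ C1 / lam := by
    rw [le_div_iff₀ lp, mul_comm]
    exact (mul_le_mul_of_nonneg_left (c.mu_mono measurableSet_Ici measurableSet_Ici (Ici_subset_Ici.2 (by norm_num))) lp.le).trans hB
  have h1 := c.sup h0 (by rw [div_le_iff₀ lp]; linarith) hr hr2 hz hq
  have h2 : hs γ * r^2 ≤ hs (u q) * r^2 := mul_le_mul_of_nonneg_right (hs_mono hc.le) (by positivity)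
  have h3 : hs γ * r^2 ≤ Csup a * (C1 / lam) := h2.trans h1
  rw [← mul_div_assoc, le_div_iff₀ lp] at h3
  linarith

/-- an admissible level below which `F` is comparable to `mn` -/
def γ0 (τ : ℝ) : ℝ := min 1 (log (1 + 1/τ))
lemma γ0_pos (hτ : 0 < τ) : 0 < γ0 τ := lt_min one_pos (log_pos (by have : 0 < 1/τ := by positivity
                                                                    linarith))
lemma γ0_exp (hτ : 0 < τ) {t : ℝ} (h : t ≤ γ0 τ) : exp t ≤ 1 + 1/τ := by
  have h1 := h.trans (min_le_right _ _)
  rwa [← exp_le_exp, exp_log (by positivity)] at h1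

set_option maxHeartbeats 1000000 in
lemma noCore (P : ι → E2) (a : ι → ℝ) (ρ : ℝ) (hτ : 0 < τ) {C1 : ℝ} (hC1 : 0 < C1) (K : ℝ) :
    ∃ M : ℝ, 0 < M ∧ ∀ lam u, Ctx P a τ ρ lam u → StabS τ lam u → lam * mu u (Ici (-1)) ≤ C1 → M ≤ lam →
    ∀ q r, 0 < r → r ≤ 1/2 → M ≤ lam * r^2 → Far P r q → u q ≤ -K := by
  obtain ⟨Cm, hCm, hnu⟩ := numass P a τ ρ hτ
  obtain ⟨C, hCone, hC⟩ := f_bounds hτ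
  obtain ⟨c0, hc0, hF⟩ := F_lower hτ
  have Cp : 0 < C := by linarith
  have eK := exp_pos (-K)
  obtain ⟨κ, hκ, hκ1, hκ2⟩ : ∃ κ : ℝ, 0 < κ ∧ κ ≤ 1 ∧ 4 * C * κ^2 ≤ exp (-K) / 2 := by
    refine ⟨min 1 (exp (-K) / (8 * C)), by positivity, min_le_left _ _, ?_⟩
    set κ := min 1 (exp (-K) / (8 * C))
    have h0 : 0 < κ := by positivity
    have h1 : κ ≤ 1 := min_le_left _ _
    have h2 : κ ≤ exp (-K) / (8 * C) := min_le_right _ _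
    rw [le_div_iff₀ (by positivity)] at h2
    nlinarith [mul_le_mul_of_nonneg_left h1 h0.le]
  set η := exp (-K) / 2 * κ^2 * c0 / 6 with hη
  have ηp : 0 < η := by positivity
  obtain ⟨M, hM, hVT⟩ := VT P a ρ hτ (N' := 0) ηp (by linarith : 0 ≤ Cm + C1)
  have hg0 := γ0_pos hτ
  set M1 := Csup a * C1 * 4 / hs (γ0 τ) with hM1
  have M1n : 0 ≤ M1 := by have := Csup_nonneg a; have := hs_pos hg0; positivity
  refine ⟨exp (2 * (M + 2)) + M1 + 2 * C1 + 64, by positivity, ?_⟩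
  intro lam u c hst hB hlam q r hr hr2 hMr hfar
  have e1 := exp_pos (2 * (M + 2))
  have lp := c.pos
  have hν : lam * ∫ x in QQ, mn (u x) ≤ Cm + C1 := (hnu lam u c).trans (by linarith)
  -- sup bound on the half ball
  have sup : ∀ x, nsq (x - q) ≤ (r/2)^2 → x ∉ Zs P ∧ u x ≤ γ0 τ := by
    intro x hx
    have hf : Far P (r/2) x := by
      have := hfar.sub (by linarith) (by linarith : r/2 ≤ r) hx
      rwa [show r - r/2 = r/2 by ring] at this
    have hx0 := hf.not (by linarith)
    refine ⟨hx0, c.supF hB (by linarith) (r := r/2) (by linarith) (by linarith) (fun y hy i k e => (hf.ball y hy ⟨i, k, e⟩).elim) hx0 ?_⟩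
    have hp := hs_pos hg0
    have : M1 < lam * r^2 := by linarith
    rw [hM1, div_lt_iff₀ hp] at this
    nlinarith
  set ε := (sqrt lam)⁻¹ with hε
  have εp : 0 < ε := by positivity
  have lε : lam * ε^2 = 1 := by rw [hε, inv_pow, sq_sqrt lp.le]; exact mul_inv_cancel₀ lp.ne'
  have er : exp (M + 2) * ε ≤ r := by
    refine abs_le_of_sq_le_sq' ?_ hr.le |>.2
    rw [mul_pow, ← exp_nat_mul]
    push_cast
    have h1 : exp (2 * (M + 2)) * (lam * ε^2) ≤ lam * r^2 := by rw [lε]; linarith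
    exact le_of_mul_le_mul_left (by linarith) lp
  have l1 : M + 2 + log ε ≤ log r := by
    rw [← log_exp (M+2), ← log_mul (exp_pos _).ne' εp.ne']
    exact log_le_log (by positivity) er
  have l2 : log r ≤ log (1/2) := log_le_log hr hr2
  have r64 : 8 * ε ≤ r := by
    refine abs_le_of_sq_le_sq' ?_ hr.le |>.2
    have h1 : 64 * (lam * ε^2) ≤ lam * r^2 := by rw [lε]; linarith
    exact le_of_mul_le_mul_left (by linarith) lp
  have hL := c.sol.loc_reg hr hfar.ball
  have eB : exp (log r - 1) ≤ r / 2 := by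
    rw [exp_sub, exp_log hr]
    exact div_le_div_of_nonneg_left hr.le (by norm_num) (by have := add_one_le_exp (1:ℝ); linarith)
  have small : ∀ z : E2, z.1 ≤ log r - 1 → nsq (Cyl q z - q) ≤ (r/2)^2 := by
    intro z hz
    rw [nsq_cyl, two_mul, exp_add, ← sq]
    exact pow_le_pow_left₀ (exp_pos _).le ((exp_le_exp.2 hz).trans eB) 2
  obtain ⟨χ, χ', s0, s1, hχ, hs0, hs1, -, hv1, -, -⟩ := hVT lam u c hst hν q 0 (log r) (log ε) (log r - 1) hL (by simp) (by linarith) (by linarith) (by linarith) (by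
    intro x hx
    have h3 : nsq (x - q) ≤ (r/2)^2 := hx.2.trans (by
      rw [two_mul, exp_add, ← sq]; exact pow_le_pow_left₀ (exp_pos _).le eB 2)
    exact ⟨(sup x h3).1, (sup x h3).2.trans (min_le_left _ _)⟩)
  -- mass of the core
  set t := log (κ * ε) with ht
  have ht0 : t ≤ log ε := log_le_log (by positivity) (mul_le_of_le_one_left εp.le hκ1)
  have hmass : ∫ z in box (t - 1) t, exp (2*z.1) * exp (u (Cyl q z)) ≤ 3 * (η / c0) / lam := by
    have i1 := hL.intG (χ := fun s => χ s ^ 2) (hχ.sq.smooth.continuous) hχ.sq.zero (B := 1)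
      (fun s => by rw [abs_of_nonneg (sq_nonneg _)]; exact pow_le_one₀ (hχ.nonneg s) (hχ.le_one s)) (by linarith) (F_smooth hτ).continuous (C := C)
      (fun t => (hC t).2.2.trans (mul_le_of_le_one_right Cp.le (mn_le_one _)))
    have i2 : IntegrableOn (fun z : E2 => exp (2*z.1) * exp (u (Cyl q z))) (box (t-1) t) :=
      ContinuousOn.integrableOn_compact (box_compact _ _) fun z hz => by
        have hz1 := (box_mem.1 hz).1.2
        have := (hL.U_sm (z := z) (by linarith)).cont
        exact ((continuous_exp.comp (continuous_const.mul continuous_fst)).continuousAt.mul (continuous_exp.continuousAt.comp this)).continuousWithinAt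
    have Fn : ∀ z : E2, z.1 ≤ log r - 1 → c0 * mn (u (Cyl q z)) ≤ F2τ τ (u (Cyl q z)) := fun z hz =>
      (hF _ (γ0_exp hτ (sup _ (small z hz)).2)).1
    have step : ∫ z in box (t-1) t, (c0 * lam / 3) * (exp (2*z.1) * exp (u (Cyl q z))) ≤ ∫ z in strip, χ z.1 ^ 2 * (lam * (exp (2*z.1) * F2τ τ (u (Cyl q z)))) := by
      have nn : ∀ z : E2, 0 ≤ χ z.1 ^ 2 * (lam * (exp (2*z.1) * F2τ τ (u (Cyl q z)))) := by
        intro z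
        by_cases hz : z.1 ≤ log r - 1
        · have := mul_nonneg hc0.le (mn_nonneg (u (Cyl q z))) |>.trans (Fn z hz)
          positivity
        · rw [hχ.zero z.1 (by linarith)]; simp
      have bs : (box (t-1) t : Set E2) ≤ᵐ[volume] strip := by
        refine (box_ae (t-1) t).le.trans (LE.le.eventuallyLE ?_)
        exact prod_mono (subset_univ _) subset_rfl
      refine le_trans ?_ (setIntegral_mono_set i1 (Eventually.of_forall nn) bs)
      refine setIntegral_mono_on (i2.const_mul _) (i1.mono_set_ae bs) (box_meas _ _) fun z hz => ?_
      have hz1 := (box_mem.1 hz).1.2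
      have h4 := Fn z (by linarith)
      have h5 := exp_le_mn ((sup _ (small z (by linarith))).2.trans (min_le_left _ _))
      rw [hχ.one z.1 (by linarith)]
      have h6 : c0 * exp (u (Cyl q z)) ≤ 3 * F2τ τ (u (Cyl q z)) := by linarith [mul_le_mul_of_nonneg_left h5 hc0.le]
      have h7 := mul_le_mul_of_nonneg_left h6 (by positivity : 0 ≤ lam * exp (2*z.1))
      linarith
    rw [integral_const_mul] at step
    rw [le_div_iff₀ lp]
    have h8 : c0 * lam / 3 * ∫ z in box (t-1) t, exp (2*z.1) * exp (u (Cyl q z)) ≤ η := step.trans hv1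
    have : 3 * (η / c0) = 3 * η / c0 := by ring
    rw [this, le_div_iff₀ hc0]
    linarith
  have near : ∀ x, dist x q < 2 * (κ * ε) → nsq (x - q) ≤ (r/2)^2 := by
    intro x hx
    rw [Prod.dist_eq, max_lt_iff, Real.dist_eq, Real.dist_eq] at hx
    have h1 := sq_lt_sq' (by linarith [abs_lt.1 hx.1]) (abs_lt.1 hx.1).2
    have h2 := sq_lt_sq' (by linarith [abs_lt.1 hx.2]) (abs_lt.1 hx.2).2
    have h3 : κ * ε ≤ ε := mul_le_of_le_one_left εp.le hκ1
    have h4 : (4 * (κ * ε))^2 ≤ (r/2)^2 := pow_le_pow_left₀ (by positivity) (by linarith) 2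
    unfold nsq
    simp only [Prod.fst_sub, Prod.snd_sub]
    linarith [sq_nonneg (κ * ε)]
  have hmv := mv_quad (g := fun x => exp (u x)) (y := q) (r := κ * ε) (r' := 2 * (κ * ε)) (c := C * lam) (by positivity)
    (by linarith [mul_pos hκ εp]) (by positivity) (fun x hx => SmAt.comp contDiff_exp (c.sol.sm x (sup x (near x hx)).1)) (fun x _ => (exp_pos _).le) (by
      intro x hx
      obtain ⟨hx0, hx1⟩ := sup x (near x hx)
      rw [lapp_comp (G := exp) (G' := exp) (c.sol.sm x hx0) (fun t => hasDerivAt_exp t) (hasDerivAt_exp _), c.sol.pde x hx0]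
      have h1 := mul_nonneg (exp_pos (u x)).le (gsq_nonneg u x)
      have h2 := exp_le_mn (hx1.trans (min_le_left _ _))
      have h3 := (le_abs_self _).trans (hC (u x)).1
      have h4 : exp (u x) ≤ 3 := h2.trans (by linarith [mn_le_one (u x)])
      have h5 : fτ τ (u x) ≤ C := h3.trans (mul_le_of_le_one_right Cp.le (mn_le_one _))
      have h6 : exp (u x) * fτ τ (u x) ≤ 4 * C := by
        linarith [mul_le_mul_of_nonneg_left h5 (exp_pos (u x)).le, mul_le_mul_of_nonneg_right h4 Cp.le]
      have h7 := mul_le_mul_of_nonneg_left h6 lp.le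
      linarith) hmass
  have hfin : exp (u q) ≤ exp (-K) := by
    have h1 : exp (u q) * (κ * ε)^2 ≤ (exp (-K)) * (κ * ε)^2 := by
      refine hmv.trans ?_
      have e3 : 3 * (η / c0) / lam = exp (-K) / 4 * κ^2 * ε^2 := by
        have : ε^2 = 1 / lam := by rw [eq_div_iff lp.ne']; linarith
        rw [this, hη]; field_simp; ring
      have e4 : 4 * (C * lam) * (κ * ε)^4 = 4 * C * κ^2 * (κ * ε)^2 * (lam * ε^2) := by ring
      rw [e3, e4, lε]
      have := mul_le_mul_of_nonneg_right hκ2 (sq_nonneg (κ * ε))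
      linarith
    exact le_of_mul_le_mul_right h1 (by positivity)
  exact exp_le_exp.1 hfin

lemma Far.of_near (h : Sepa P ρ) {i : ι} {x : E2} {r : ℝ} (hr : 0 ≤ r) (h1 : r ≤ ρ) (h2 : r^2 ≤ nsq (x - P i))
    (h3 : nsq (x - P i) ≤ ρ^2) : Far P r x := by
  intro w hw
  by_contra! hc
  have hp := h.pos
  have e : nsq ((w - x) + (x - P i)) ≤ _ := nsq_add hr hp.le hc.le h3
  rw [sub_add_sub_cancel] at e
  have e3 : r^2 ≤ ρ^2 := by gcongr
  have e4 : r * ρ ≤ ρ * ρ := by gcongr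
  have := h.near (x := w) (i := i) (by nlinarith) hw
  rw [this, nsq_symm] at hc
  linarith

/-- periodized radial cutoff around `P i` -/
def et (P : ι → E2) (χ : ℝ → ℝ) (i : ι) : E2 → ℝ := pz (P i) (rad (P i) 1 χ)

lemma exp_sq (s : ℝ) : exp s ^ 2 = exp (2*s) := by rw [← Real.exp_nat_mul]; norm_num

lemma et_split (h : Sepa P ρ) {x : E2} (hx : x ∉ Zs P) :
    (Far P ρ x ∧ ∀ χ χ' : ℝ → ℝ, ∀ s0 s1, Cut χ χ' s0 s1 → s1 ≤ log ρ → ∀ i, et P χ i x = 0) ∨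
    ∃ i z, z.1 < log ρ ∧ (∃ k, x + lat k = Cyl (P i) z) ∧ (∀ s ≤ log ρ, s ≤ z.1 → Far P (exp s) x) ∧
      ∀ χ χ' : ℝ → ℝ, ∀ s0 s1, Cut χ χ' s0 s1 → s1 ≤ log ρ → et P χ i x = χ z.1 ∧ ∀ j, j ≠ i → et P χ j x = 0 := by
  have hp := h.pos
  have hsm := h.small
  have hz0 : ∀ χ χ' : ℝ → ℝ, ∀ s0 s1, Cut χ χ' s0 s1 → s1 ≤ log ρ → ∀ i, (∀ k, ρ^2 ≤ nsq (x + lat k - P i)) →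
      et P χ i x = 0 := by
    intro χ χ' s0 s1 hχ h1 i hk
    refine pz_disc hp.le (by linarith) (fun y hy => rad_zero hχ.zero (le_trans ?_ hy)) x hk
    rw [← exp_two_log hp]; exact exp_le_exp.2 (by linarith)
  have hfar : ∀ k r, Far P r (x + lat k) → Far P r x := by
    intro k r hF w hw
    have := hF (w + lat k) ((Zs_add k).2 hw)
    rwa [add_sub_add_right_eq_sub] at this
  by_cases hF : ∃ i k, nsq (x + lat k - P i) < ρ^2
  · right
    obtain ⟨i, k, hik⟩ := hF
    have hne : x + lat k ≠ P i := fun e => hx ((Zs_add k).1 (e ▸ P_mem i))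
    obtain ⟨z, hz⟩ := cyl_surj hne
    have hzn : nsq (x + lat k - P i) = exp (2*z.1) := by rw [← hz, nsq_cyl]
    have hzl : z.1 < log ρ := by
      rw [hzn, ← exp_two_log hp] at hik
      linarith [exp_lt_exp.1 hik]
    refine ⟨i, z, hzl, ⟨k, hz.symm⟩, fun s hs hsz => hfar k _ ?_, fun χ χ' s0 s1 hχ h1 => ⟨?_, fun j hj => ?_⟩⟩
    · refine Far.of_near h (i := i) (exp_pos _).le ?_ ?_ hik.le
      · rw [← exp_log hp]; exact exp_le_exp.2 hs
      · rw [hzn, exp_sq]; exact exp_le_exp.2 (by linarith)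
    · have hb : ∀ t, t^2 ≤ nsq (x + lat k - P i) → |t| < 1/2 := fun t ht => by
        refine abs_lt_of_sq_lt_sq (by nlinarith) (by norm_num)
      rw [et, pz_eq_lat k (hb _ (le_add_of_nonneg_right (sq_nonneg _)))
        (hb _ (le_add_of_nonneg_left (sq_nonneg _))), ← hz, rad_cyl]
    · refine hz0 χ χ' s0 s1 hχ h1 j fun l => ?_
      by_contra! hc
      have e : nsq ((x + lat k - P i) + (P j - (x + lat l))) ≤ _ :=
        nsq_add hp.le hp.le hik.le (by rw [nsq_symm]; exact hc.le)
      rw [nsq_symm (P j)] at e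
      have e2 : nsq ((x + lat k - P i) + (P j - (x + lat l))) < (4*ρ)^2 := by nlinarith
      rw [show (x + lat k - P i) + (P j - (x + lat l)) = P j - (P i + (lat l - lat k)) by abel,
        show lat l - lat k = lat (l - k) by rw [sub_eq_add_neg l, lat_add, lat_neg]; abel] at e2
      exact hj (h.sep _ _ _ e2).1
  · left
    push Not at hF
    refine ⟨?_, fun χ χ' s0 s1 hχ h1 i => hz0 χ χ' s0 s1 hχ h1 i (hF i)⟩
    rintro w ⟨i, k, rfl⟩
    have := hF i (-k)
    rw [nsq_symm]
    rwa [lat_neg, show x + -lat k - P i = x - (P i + lat k) by abel] at this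

lemma et_int (c : Ctx P a τ ρ lam u) {χ χ' : ℝ → ℝ} {s0 s1 : ℝ} (hχ : Cut χ χ' s0 s1) (h1 : s1 ≤ log ρ) (i : ι)
    (G : ℝ → ℝ) : lam * ∫ x in QQ, et P χ i x * G (u x) =
      ∫ z in strip, χ z.1 * (lam * (exp (2*z.1) * G (u (Cyl (P i) z)))) := by
  have hp := c.sep.pos
  have h2 : exp (2*s1) < 1/4 := by
    have e1 : exp (2*s1) ≤ ρ^2 := by
      rw [← exp_two_log hp]; exact exp_le_exp.2 (by linarith)
    have := c.sep.small
    nlinarith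
  rw [per_integral_local (K := fun x => rad (P i) 1 χ x * G (u x)) _ (P i), cyl_integral (P i), ← integral_const_mul]
  · refine setIntegral_congr_fun strip_meas fun z _ => ?_
    simp only [rad_cyl]; ring
  · intro x b1 b2
    rw [et, pz_eq b1 b2]
  · intro x hx
    rw [rad_zero hχ.zero (h2.le.trans (box_nsq hx)), zero_mul]
  · intro x k
    simp only [et, pz_per (P i) _ x k, c.sol.per x k]

lemma gsq_per {g : E2 → ℝ} (hg : Per g) : Per (gsq g) := fun x k => by
  simp only [gsq, D1_add_lat hg x k, D2_add_lat hg x k]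

lemma et_gsq (h : Sepa P ρ) {χ χ' : ℝ → ℝ} {s0 s1 : ℝ} (hχ : Cut χ χ' s0 s1) (h1 : s1 ≤ log ρ) (i : ι) :
    ∫ x in QQ, gsq (et P χ i) x = ∫ z in strip, χ' z.1 ^ 2 := by
  have hp := h.pos
  have h2 : exp (2*s1) < 1/4 := by
    have e1 : exp (2*s1) ≤ ρ^2 := by
      rw [← exp_two_log hp]; exact exp_le_exp.2 (by linarith)
    have := h.small
    nlinarith
  have hr0 : ∀ x, exp (2*s1) ≤ nsq (x - P i) → rad (P i) 1 χ x = 0 := fun x hx => rad_zero hχ.zero hx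
  rw [et, per_integral_local (K := gsq (rad (P i) 1 χ)) (gsq_per (pz_per _ _)) (P i), cyl_integral (P i)]
  · refine setIntegral_congr_fun strip_meas fun z _ => ?_
    rw [← gsq_comp_cyl (rad_smAt hχ.smooth hχ.one _).diff,
      show rad (P i) 1 χ ∘ Cyl (P i) = fun z => χ z.1 from funext fun z => rad_cyl (P i) z 1 χ, gsq,
      D1_fst (hχ.deriv z.1), D2_fst (hχ.deriv z.1)]
    ring
  · intro x b1 b2
    exact gsq_congr (pz_ev b1 b2)
  · intro x hx
    rw [gsq_congr (ev_zero hr0 (h2.trans_le (box_nsq hx))), gsq, D1_const, D2_const]; ring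

/-- the outer test function -/
def off (P : ι → E2) (χ : ι → ℝ → ℝ) (x : E2) : ℝ := 1 - ∑ i, et P (χ i) i x

lemma log_lt4 (h : Sepa P ρ) : log ρ < log (4*ρ) := log_lt_log h.pos (by linarith [h.pos])

lemma off_stab (c : Ctx P a τ ρ lam u) (hst : StabS τ lam u) {χ χ' : ι → ℝ → ℝ} {s0 s1 : ι → ℝ}
    (hχ : ∀ i, Cut (χ i) (χ' i) (s0 i) (s1 i)) (h1 : ∀ i, s1 i ≤ log ρ) {η : ℝ}
    (hη : ∀ i, ∫ z in strip, χ' i z.1 ^ 2 ≤ η) :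
    (IntegrableOn (fun x => off P χ x ^ 2 * fτ' τ (u x)) QQ) ∧
    lam * ∫ x in QQ, off P χ x ^ 2 * fτ' τ (u x) ≤ Fintype.card ι * (Fintype.card ι * η) := by
  have ad : ∀ i, Adm P (et P (χ i) i) := fun i => (eta_adm c.sep i (hχ i) ((h1 i).trans_lt (log_lt4 c.sep))).1
  have osm : ContDiff ℝ (⊤ : ℕ∞) (off P χ) := contDiff_const.sub (ContDiff.sum fun i _ => (ad i).sm)
  have oper : Per (off P χ) := fun x k => by simp only [off, (ad _).per x k]
  obtain ⟨C, -, hC⟩ := f_bounds c.hτ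
  have hi : IntegrableOn (fun x => off P χ x ^ 2 * fτ' τ (u x)) QQ := c.sol.int_comp c.sep (f'_smooth c.hτ).continuous (C := |C|) (fun t => ((hC t).2.1.trans
    (mul_le_mul (le_abs_self C) (mn_le_one t) (mn_nonneg t) (abs_nonneg C))).trans_eq (mul_one _)) (osm.continuous.pow 2)
  refine ⟨hi, ?_⟩
  have hs := hst _ osm oper
  have e1 : ∀ x, gsq (off P χ) x - lam * fτ' τ (u x) * off P χ x ^ 2 =
      gsq (off P χ) x - lam * (off P χ x ^ 2 * fτ' τ (u x)) := fun x => by ring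
  simp only [e1] at hs
  rw [integral_sub (QQ_int (gsq_cont osm)) (hi.const_mul lam), integral_const_mul] at hs
  have gi : ∀ i, IntegrableOn (gsq (et P (χ i) i)) QQ := fun i => QQ_int (gsq_cont (ad i).sm)
  have hD : ∀ v x, fderiv ℝ (off P χ) x v = -∑ i, fderiv ℝ (et P (χ i) i) x v := by
    intro v x
    have hd : ∀ i ∈ Finset.univ, DifferentiableAt ℝ (et P (χ i) i) x := fun i _ => (SmAt.of_contDiff (ad i).sm).diff
    have e : off P χ = fun x => 1 - ∑ i, et P (χ i) i x := rfl
    rw [e, fderiv_const_sub, fderiv_fun_sum hd]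
    simp
  have e2 : ∫ x in QQ, gsq (off P χ) x ≤ ∫ x in QQ, Fintype.card ι * ∑ i, gsq (et P (χ i) i) x := by
    refine integral_mono (QQ_int (gsq_cont osm)) ((integrable_finsetSum _ fun i _ => gi i).const_mul _) fun x => ?_
    have q : ∀ v, (fderiv ℝ (off P χ) x v)^2 ≤ Fintype.card ι * ∑ i, (fderiv ℝ (et P (χ i) i) x v)^2 := fun v => by
      rw [hD, neg_sq]
      exact sq_sum_le_card_mul_sum_sq
    simp only [gsq, D1, D2, Finset.sum_add_distrib, mul_add]
    exact add_le_add (q _) (q _)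
  rw [integral_const_mul, integral_finsetSum _ fun i _ => gi i] at e2
  have e3 : ∑ i, ∫ x in QQ, gsq (et P (χ i) i) x ≤ ∑ _i : ι, η := Finset.sum_le_sum fun i _ => by
    rw [et_gsq c.sep (hχ i) (h1 i)]; exact hη i
  rw [Finset.sum_const, nsmul_eq_mul, Finset.card_univ] at e3
  have := mul_le_mul_of_nonneg_left e3 (Nat.cast_nonneg (α := ℝ) (Fintype.card ι))
  linarith

lemma glue (c : Ctx P a τ ρ lam u) (hst : StabS τ lam u) {χ χ' ζ ζ' : ι → ℝ → ℝ} {s0 s1 t0 t1 : ι → ℝ}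
    (hχ : ∀ i, Cut (χ i) (χ' i) (s0 i) (s1 i)) (h1 : ∀ i, s1 i ≤ log ρ) (hζ : ∀ i, Cut (ζ i) (ζ' i) (t0 i) (t1 i))
    (h2 : ∀ i, t1 i ≤ log ρ) {η η' e C : ℝ} (he : 0 ≤ e) (hη : ∀ i, ∫ z in strip, χ' i z.1 ^ 2 ≤ η)
    {H : ι → ℝ → ℝ} {G : ℝ → ℝ} (hH : ∀ i, Continuous (H i)) (hHC : ∀ i t, |H i t| ≤ C)
    (hG : Continuous G) (hGC : ∀ t, |G t| ≤ C)
    (hη' : ∀ i, ∫ z in strip, ζ i z.1 ^ 2 * (lam * (exp (2*z.1) * H i (u (Cyl (P i) z)))) ≤ η')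
    (hpt : ∀ x ∉ Zs P, G (u x) ≤ e * (off P χ x ^ 2 * fτ' τ (u x)) + ∑ i, et P (fun s => ζ i s ^ 2) i x * H i (u x)) :
    lam * ∫ x in QQ, G (u x) ≤ e * (Fintype.card ι * (Fintype.card ι * η)) + Fintype.card ι * η' := by
  obtain ⟨i1, e1⟩ := off_stab c hst hχ h1 hη
  have i2 : ∀ i, IntegrableOn (fun x => et P (fun s => ζ i s ^ 2) i x * H i (u x)) QQ := fun i =>
    c.sol.int_comp c.sep (hH i) (hHC i) (eta_adm c.sep i (hζ i).sq ((h2 i).trans_lt (log_lt4 c.sep))).1.sm.continuous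
  have e2 : ∫ x in QQ, G (u x) ≤ ∫ x in QQ, (e * (off P χ x ^ 2 * fτ' τ (u x)) +
      ∑ i, et P (fun s => ζ i s ^ 2) i x * H i (u x)) := by
    refine integral_mono_ae (c.int_b hG.measurable hGC) ((i1.const_mul e).add (integrable_finsetSum _ fun i _ => i2 i)) ?_
    exact ae_restrict_of_ae (Zs_ae.mono hpt)
  rw [integral_add (i1.const_mul e) (integrable_finsetSum _ fun i _ => i2 i), integral_const_mul,
    integral_finsetSum _ fun i _ => i2 i] at e2
  have e3 : ∑ i, lam * ∫ x in QQ, et P (fun s => ζ i s ^ 2) i x * H i (u x) ≤ ∑ _i : ι, η' :=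
    Finset.sum_le_sum fun i _ => by rw [et_int c (hζ i).sq (h2 i)]; exact hη' i
  rw [Finset.sum_const, nsmul_eq_mul, Finset.card_univ, ← Finset.mul_sum] at e3
  have e4 := mul_le_mul_of_nonneg_left e2 c.pos.le
  have e5 := mul_le_mul_of_nonneg_left e1 he
  linarith


/-- scale at which `lam * r^2 = M` -/
def sA (M lam : ℝ) : ℝ := (log M - log lam) / 2

lemma sA_exp {M lam : ℝ} (hM : 0 < M) (hl : 0 < lam) : lam * exp (sA M lam) ^ 2 = M := by
  rw [exp_sq, sA, mul_div_cancel₀ _ two_ne_zero, exp_sub, exp_log hM, exp_log hl, mul_div_cancel₀ _ hl.ne']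

lemma sA_le {M t : ℝ} (hM : 0 < M) (hl : M * exp (-(2*t)) ≤ lam) : sA M lam ≤ t := by
  have := log_le_log (by positivity) hl
  rw [log_mul hM.ne' (exp_pos _).ne', log_exp] at this
  unfold sA; linarith

lemma logρ_lt (h : Sepa P ρ) : log ρ < log (1/2) := log_lt_log h.pos (by linarith [h.small])

lemma near_le (c : Ctx P a τ ρ lam u) {C1 : ℝ} (hB : lam * mu u (Ici (-1)) ≤ C1) (hl : 2 * C1 ≤ lam)
    (hγ : Csup a * C1 < lam * ρ^2 * hs (γ0 τ)) {i : ι} (hi : 0 < a i) {z : E2} (hz : z.1 < log ρ) :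
    u (Cyl (P i) z) ≤ γ0 τ := by
  have hp := c.sep.pos
  have hn : nsq (Cyl (P i) z - P i) ≤ ρ^2 := by
    rw [nsq_cyl, ← exp_two_log hp]; exact exp_le_exp.2 (by linarith)
  have hnear : ∀ x, nsq (x - Cyl (P i) z) < ρ^2 → x ∈ Zs P → x = P i := by
    intro x hx hxz
    have e : nsq ((x - Cyl (P i) z) + (Cyl (P i) z - P i)) ≤ _ := nsq_add hp.le hp.le hx.le hn
    rw [sub_add_sub_cancel] at e
    exact c.sep.near (by nlinarith) hxz
  refine c.supF hB hl hp (by linarith [c.sep.small]) (fun x hx j k hjk => ?_) (fun hm => Cyl_ne _ _ (hnear _ ?_ hm)) hγ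
  · have e := hnear x hx ⟨j, k, hjk⟩
    have : i = j := (c.sep.sep i j k (by
      rw [← e, ← hjk, sub_self]; simp only [nsq, Prod.fst_zero, Prod.snd_zero]; nlinarith)).1
    exact this ▸ hi
  · rw [sub_self]; simp only [nsq, Prod.fst_zero, Prod.snd_zero]; nlinarith

set_option maxHeartbeats 1000000 in
lemma thmB12 (P : ι → E2) (a : ι → ℝ) (ρ : ℝ) (hτ : 0 < τ) {C1 : ℝ} (hC1 : 0 < C1)
    (hc : 0 < ∑ i, a i ∨ (τ = 1 ∧ ∑ i, a i < 0)) : ∃ Λ : ℝ, ∀ lam u, Ctx P a τ ρ lam u → StabS τ lam u → Λ ≤ lam →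
      ¬ lam * mu u (Ici (-1)) ≤ C1 := by
  obtain ⟨Cb, hCb, hb⟩ := numass P a τ ρ hτ
  set n : ℝ := (Fintype.card ι : ℝ) with hn
  have hn0 : 0 ≤ n := Nat.cast_nonneg _
  set σ : ℝ := |∑ i, a i| with hσ
  have hσ0 : 0 < σ := abs_pos.2 (by rcases hc with h | h; exacts [h.ne', h.2.ne])
  have hd : 0 < n * n + n + 1 := by positivity
  set η : ℝ := σ / (n * n + n + 1) with hη
  have hη0 : 0 < η := by positivity
  have hησ : (n * n + n) * η + η = σ := by rw [hη]; field_simp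
  obtain ⟨M1, hM1, VT1⟩ := VT P a ρ hτ (N' := ∑ i, |a i|) hη0 (add_pos hCb hC1).le
  obtain ⟨K, hK1, cK, hcK, hK⟩ := f_neg_inf hτ
  obtain ⟨M2, hM2, NC⟩ := noCore P a ρ hτ hC1 K
  obtain ⟨C, hC1', hC⟩ := f_bounds hτ
  obtain ⟨cF, hcF, hF⟩ := F_lower hτ
  have hγ0 := hs_pos (γ0_pos hτ)
  refine ⟨max (max M2 (2 * C1)) (max ((Csup a * C1 + 1) / (ρ^2 * hs (γ0 τ))) (M2 * exp (-(2*(log ρ - 2*M1))))),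
    fun lam u c hst hl hB => ?_⟩
  have hp := c.sep.pos
  have hl1 := (le_max_left _ _).trans ((le_max_left _ _).trans hl)
  have hl2 := (le_max_right _ _).trans ((le_max_left _ _).trans hl)
  have hl3 := (le_max_left _ _).trans ((le_max_right _ _).trans hl)
  have hA := sA_le hM2 ((le_max_right _ _).trans ((le_max_right _ _).trans hl))
  have hγ : Csup a * C1 < lam * ρ^2 * hs (γ0 τ) := by
    rw [div_le_iff₀ (by positivity), ← mul_assoc] at hl3; linarith
  have hν : lam * ∫ x in QQ, mn (u x) ≤ Cb + C1 := (hb lam u c).trans (by linarith)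
  have hAM := sA_exp hM2 c.pos
  set A := sA M2 lam
  have hAρ : A ≤ log ρ := by linarith
  have hAρ' : exp A ≤ ρ := by rw [← exp_log hp]; exact exp_le_exp.2 hAρ
  have hFar : ∀ x, Far P (exp A) x → u x ≤ -K := fun x hx =>
    NC lam u c hst hB hl1 x (exp A) (exp_pos _) (by linarith [c.sep.small]) hAM.ge hx
  have hann : ∀ i x, x ∈ Ann (P i) A (log ρ) → x ∉ Zs P ∧ u x ≤ 1 := by
    rintro i x ⟨h1, h2⟩
    have hf : Far P (exp A) x := Far.of_near c.sep (exp_pos _).le hAρ' (by rwa [exp_sq]) (by rwa [exp_two_log hp] at h2)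
    exact ⟨hf.not (exp_pos _), by linarith [hFar x hf]⟩
  have hai : ∀ i, |a i| ≤ ∑ i, |a i| := fun i => Finset.single_le_sum (f := fun i => |a i|) (fun j _ => abs_nonneg _) (Finset.mem_univ i)
  have hloc := fun i => c.sol.loc c.sep i
  have hl4 := log_lt4 c.sep
  have hlh := logρ_lt c.sep
  choose χ χ' s0 s1 hχ hs0 hs1 hX1 hX2 hX3 hχη using fun i => VT1 lam u c hst hν (P i) (a i) (log (4*ρ)) A (A + M1) (hloc i)
    (hai i) le_rfl (by linarith) (by linarith) (fun x hx => hann i x (Ann_sub le_rfl (by linarith) hx))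
  choose ζ ζ' t0 t1 hζ ht0 ht1 hX4 hζF hζf hX5 using fun i => VT1 lam u c hst hν (P i) (a i) (log (4*ρ)) (A + M1) (log ρ) (hloc i)
    (hai i) (by linarith) (by linarith) (by linarith) (fun x hx => hann i x (Ann_sub (by linarith) le_rfl hx))
  have hs1' : ∀ i, s1 i ≤ log ρ := fun i => by linarith [hs1 i]
  have hbd : ∀ t, |fτ τ t| ≤ 2 * C ∧ |2 * F2τ τ t| ≤ 2 * C := fun t => by
    have h1 := mul_le_mul_of_nonneg_left (mn_le_one t) (by linarith : (0:ℝ) ≤ C)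
    have h2 := hC t
    rw [abs_mul, abs_two]
    constructor <;> linarith
  have hmass := c.sol.mass hτ c.sep
  have hπ := pi_gt_three
  have hf0 : ∀ x, u x ≤ -K → 0 ≤ fτ τ (u x) := fun x hx => f_sign_neg hτ (by linarith)
  -- values of the cutoffs at a near point
  have hval : ∀ x, ∀ i, ∀ z : E2, (∀ χ χ' : ℝ → ℝ, ∀ s0 s1, Cut χ χ' s0 s1 → s1 ≤ log ρ → et P χ i x = χ z.1 ∧
      ∀ j, j ≠ i → et P χ j x = 0) → off P χ x = 1 - χ i z.1 ∧ ∀ H : ι → ℝ → ℝ,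
      ∑ j, et P (fun s => ζ j s ^ 2) j x * H j (u x) = ζ i z.1 ^ 2 * H i (u x) := by
    intro x i z hv
    constructor
    · rw [off, Finset.sum_eq_single i (fun j _ hj => (hv _ _ _ _ (hχ j) (hs1' j)).2 j hj) (by simp),
        (hv _ _ _ _ (hχ i) (hs1' i)).1]
    · intro H
      rw [Finset.sum_eq_single i (fun j _ hj => by rw [(hv _ _ _ _ (hζ j).sq (ht1 j)).2 j hj, zero_mul]) (by simp),
        (hv _ _ _ _ (hζ i).sq (ht1 i)).1]
  rcases hc with hc | ⟨rfl, hc⟩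
  · have hσe : σ = ∑ i, a i := abs_of_pos hc
    have key := glue c hst hχ hs1' hζ ht1 (e := 2) (by norm_num) hχη (G := fτ τ) (C := 2 * C) (η' := 2 * η)
      (H := fun i => if a i < 0 then fτ τ else fun t => 2 * F2τ τ t)
      (fun i => by
        split_ifs
        exacts [f_cont hτ, (F_smooth hτ).continuous.const_mul 2])
      (fun i t => by split_ifs; exacts [(hbd t).1, (hbd t).2]) (f_cont hτ) (fun t => (hbd t).1)
      (fun i => by
        split_ifs with hi
        · exact (hζf i hi.le).trans (by linarith)
        · have e : ∀ z : E2, ζ i z.1 ^ 2 * (lam * (exp (2*z.1) * (2 * F2τ τ (u (Cyl (P i) z))))) =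
              2 * (ζ i z.1 ^ 2 * (lam * (exp (2*z.1) * F2τ τ (u (Cyl (P i) z))))) := fun z => by ring
          simp only [e]
          rw [integral_const_mul]; linarith [hζF i])
      (fun x hx => by
        rcases et_split c.sep hx with ⟨hF1, h0⟩ | ⟨i, z, hz, ⟨k, hk⟩, hfar, hv⟩
        · have hu := hFar x (hF1.mono (exp_pos _).le hAρ')
          have e : off P χ x = 1 := by
            rw [off, Finset.sum_eq_zero fun i _ => h0 _ _ _ _ (hχ i) (hs1' i) i, sub_zero]
          rw [Finset.sum_eq_zero fun i _ => by rw [h0 _ _ _ _ (hζ i).sq (ht1 i) i, zero_mul], e]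
          linarith [(hK _ hu).1]
        · obtain ⟨v1, v2⟩ := hval x i z hv
          rw [v1, v2]
          set Hi := (if a i < 0 then fτ τ else fun t => 2 * F2τ τ t) with hHi
          have hux : u x = u (Cyl (P i) z) := by rw [← hk, c.sol.per]
          have hle : fτ τ (u x) ≤ Hi (u x) := by
            rw [hHi]; split_ifs with hi
            · exact le_rfl
            · have := near_le c hB hl2 hγ (lt_of_le_of_ne (not_lt.1 hi) (c.ne i).symm) hz
              exact (hF _ (γ0_exp hτ (hux ▸ this))).2
          rcases le_total z.1 A with h | h
          · rw [(hχ i).one _ (h.trans (hs0 i)), (hζ i).one _ (by linarith [ht0 i])]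
            linarith
          · have hu := hFar x (hfar A hAρ h)
            have hf := hf0 x hu
            have h2f := (hK _ hu).1
            rcases le_total z.1 (A + M1) with h' | h'
            · rw [(hζ i).one _ (h'.trans (ht0 i))]
              have : 0 ≤ (1 - χ i z.1)^2 * fτ' τ (u x) := mul_nonneg (sq_nonneg _) (by linarith)
              linarith
            · rw [(hχ i).zero _ ((hs1 i).trans h')]
              have : 0 ≤ ζ i z.1 ^ 2 * Hi (u x) := mul_nonneg (sq_nonneg _) (hf.trans hle)
              linarith)
    rw [hmass, ← hn, ← hσe] at key
    have := mul_lt_mul_of_pos_right hπ hσ0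
    linarith
  · have hσe : σ = -∑ i, a i := abs_of_neg hc
    have key := glue c hst hχ hs1' hζ ht1 (e := 0) le_rfl hχη (G := fun t => -fτ 1 t) (C := 2 * C) (η' := η)
      (H := fun i => F2τ 1) (fun i => (F_smooth hτ).continuous) (fun i t => by
        have := (hbd t).2
        rw [abs_mul, abs_two] at this
        linarith [abs_nonneg (F2τ 1 t)]) (f_cont hτ).neg (fun t => by rw [abs_neg]; exact (hbd t).1) hζF
      (fun x hx => by
        rw [zero_mul, zero_add]
        rcases et_split c.sep hx with ⟨hF1, h0⟩ | ⟨i, z, hz, ⟨k, hk⟩, hfar, hv⟩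
        · have hu := hFar x (hF1.mono (exp_pos _).le hAρ')
          rw [Finset.sum_eq_zero fun i _ => by rw [h0 _ _ _ _ (hζ i).sq (ht1 i) i, zero_mul]]
          linarith [hf0 x hu]
        · rw [(hval x i z hv).2]
          have hle := abs_f_le_F_one (u x)
          rcases le_total z.1 A with h | h
          · rw [(hζ i).one _ (by linarith [ht0 i])]
            linarith [neg_abs_le (fτ 1 (u x))]
          · have hf := hf0 x (hFar x (hfar A hAρ h))
            have : 0 ≤ ζ i z.1 ^ 2 * F2τ 1 (u x) := mul_nonneg (sq_nonneg _) ((abs_nonneg _).trans hle)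
            linarith)
    rw [integral_neg, mul_neg, hmass, ← hn] at key
    have := mul_lt_mul_of_pos_right hπ hσ0
    have h3 : 0 ≤ n * n * η := by positivity
    rw [hσe] at this hησ
    linarith
variable {p : E2} {a' S s0 s1 A : ℝ} {χ χ' : ℝ → ℝ}

lemma cont_slice {H : E2 → ℝ} {s : ℝ} (h : ∀ z : E2, z.1 < S → ContinuousAt H z) (hs : s < S) : Continuous fun θ => H (s, θ) :=
  continuous_iff_continuousAt.2 fun θ => ContinuousAt.comp (f := fun θ : ℝ => ((s, θ) : E2)) (h (s, θ) hs) (by fun_prop)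

lemma Loc.flux_le (hτ : 0 < τ) (hl : 0 ≤ lam) (hL : Loc τ lam u p a' S) (hχ : Cut χ χ' s0 s1) (hS : s1 < S) (hd : ∀ s, χ' s ≤ 0)
    (hA : A ≤ s0) (hneg : ∀ z : E2, A ≤ z.1 → z.1 ≤ s1 → u (Cyl p z) ≤ 0) {C : ℝ} (hC : ∀ t, |fτ τ t| ≤ C) {s : ℝ} (h0 : A ≤ s) (h1 : s ≤ s0) :
    4 * π * a' - ∫ z in strip, χ z.1 * (lam * (exp (2*z.1) * fτ τ (u (Cyl p z)))) ≤ cavg (D1 (u ∘ Cyl p)) s := by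
  have lt := hχ.lt
  have sm : ∀ z : E2, z.1 < S → SmAt (u ∘ Cyl p) z := fun z hz => hL.U_sm hz
  have smD : ∀ z : E2, z.1 < S → SmAt (D1 (u ∘ Cyl p)) z := fun z hz => (sm z hz).D1
  have der : ∀ t < S, HasDerivAt (cavg (D1 (u ∘ Cyl p))) (cavg (lapp (u ∘ Cyl p)) t) t := fun t ht => by
    rw [cavg_lapp sm ht (tper_cyl u p)]; exact cavg_deriv smD ht
  have anti : AntitoneOn (cavg (D1 (u ∘ Cyl p))) (Icc A s1) := by
    refine antitoneOn_of_deriv_nonpos (convex_Icc _ _) (fun t ht => (der t (ht.2.trans_lt hS)).continuousAt.continuousWithinAt)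
      (fun t ht => (der t ((interior_subset ht).2.trans_lt hS)).differentiableAt.differentiableWithinAt) fun t ht => ?_
    have ht := interior_subset ht
    have htS := ht.2.trans_lt hS
    rw [(der t htS).deriv]
    refine (cavg_mono (K := fun _ => 0) (cont_slice (fun z hz => (sm z hz).lapp.cont) htS) continuous_const fun θ => ?_).trans
      (by rw [cavg_const, mul_zero])
    rw [hL.U_pde htS]
    have := f_sign_neg hτ (hneg (t, θ) ht.1 ht.2)
    have : 0 ≤ lam * exp (2*t) * fτ τ ((u ∘ Cyl p) (t, θ)) := by simp only [Function.comp]; positivity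
    linarith
  refine le_trans ?_ (anti ⟨h0, by linarith⟩ ⟨hA, lt.le⟩ h1)
  have i1 := hL.intG hχ.smooth.continuous hχ.zero (fun s => by rw [abs_of_nonneg (hχ.nonneg s)]; exact hχ.le_one s) hS (f_cont hτ) hC
  have i2 : IntegrableOn (fun z => χ' z.1 * D1 (u ∘ Cyl p) z) strip :=
    strip_int0 hχ.cont (fun s hs => hχ.d0 hs) (fun s hs => hχ.d1 hs) hS fun z hz => (smD z hz).cont
  have fl := (hL.flux hτ hχ hS).2
  have e : ∫ z in strip, (χ' z.1 * D1 (u ∘ Cyl p) z + χ z.1 * (-(lam * exp (2*z.1) * fτ τ (u (Cyl p z))))) =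
      (∫ z in strip, χ' z.1 * D1 (u ∘ Cyl p) z) - ∫ z in strip, χ z.1 * (lam * (exp (2*z.1) * fτ τ (u (Cyl p z)))) := by
    rw [← integral_sub i2 i1]; congr 1; ext z; ring
  rw [e] at fl
  have hsub : (Icc s0 s1 ×ˢ Ioo (-π) π : Set E2) ⊆ strip := prod_mono (subset_univ _) subset_rfl
  have hbox : ∫ z in strip, χ' z.1 * D1 (u ∘ Cyl p) z = ∫ z in box s0 s1, χ' z.1 * D1 (u ∘ Cyl p) z := by
    rw [setIntegral_eq_of_subset_of_forall_sdiff_eq_zero strip_meas hsub (fun z hz => ?_), setIntegral_congr_set (box_ae s0 s1)]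
    rcases le_total z.1 s0 with h | h
    · rw [hχ.d0 h, zero_mul]
    rcases le_total s1 z.1 with h' | h'
    · rw [hχ.d1 h', zero_mul]
    exact absurd ⟨⟨h, h'⟩, hz.1.2⟩ hz.2
  obtain ⟨f1, f2⟩ := box_fubini lt.le (ContinuousOn.integrableOn_compact (box_compact s0 s1) (f := fun z => χ' z.1 * D1 (u ∘ Cyl p) z) fun z hz =>
    ((hχ.cont.comp continuous_fst).continuousAt.mul (smD z ((box_mem.1 hz).1.2.trans_lt hS)).cont).continuousWithinAt)
  have hm : ∫ s in s0..s1, χ' s * cavg (D1 (u ∘ Cyl p)) s0 ≤ ∫ s in s0..s1, cavg (fun z => χ' z.1 * D1 (u ∘ Cyl p) z) s := by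
    refine intervalIntegral.integral_mono_on lt.le ((hχ.cont.mul_const _).intervalIntegrable _ _) f2 fun t ht => ?_
    have : cavg (fun z => χ' z.1 * D1 (u ∘ Cyl p) z) t = χ' t * cavg (D1 (u ∘ Cyl p)) t := by
      simp only [cavg]; rw [intervalIntegral.integral_const_mul]
    rw [this]
    exact mul_le_mul_of_nonpos_left (anti ⟨hA, lt.le⟩ ⟨hA.trans ht.1, ht.2⟩ ht.1) (hd t)
  have hone : ∫ s in s0..s1, χ' s = -1 := by
    rw [intervalIntegral.integral_eq_sub_of_hasDerivAt (fun t _ => hχ.deriv t) (hχ.cont.intervalIntegrable _ _), hχ.one _ le_rfl, hχ.zero _ le_rfl]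
    ring
  rw [intervalIntegral.integral_mul_const, hone] at hm
  rw [hbox, f1] at fl
  linarith

lemma Ctx.cavg_ub (c : Ctx P a τ ρ lam u) (hL : Loc τ lam u p a' S) (hS : s0 < S) (hs0 : s0 < log (1/2)) {g Cν : ℝ} (hg : 0 ≤ g)
    (hν : lam * ∫ x in QQ, mn (u x) ≤ Cν) (hneg : ∀ z : E2, A ≤ z.1 → z.1 ≤ s0 → u (Cyl p z) ≤ 0)
    (hG : ∀ s, A ≤ s → s ≤ s0 → -g ≤ cavg (D1 (u ∘ Cyl p)) s) {s : ℝ} (h0 : A ≤ s) (h1 : s ≤ s0 - 1) :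
    cavg (u ∘ Cyl p) s ≤ Cν - 2 * π * (1 + log lam + 2 * (s0 - 1)) + g * (s0 - s) := by
  have sm : ∀ z : E2, z.1 < S → SmAt (u ∘ Cyl p) z := fun z hz => hL.U_sm hz
  have ub : ∀ t, s ≤ t → t ≤ s0 → cavg (u ∘ Cyl p) s - g * (s0 - s) ≤ cavg (u ∘ Cyl p) t := by
    intro t hst hts
    have der : ∀ r < S, HasDerivAt (fun r => cavg (u ∘ Cyl p) r + g * r) (cavg (D1 (u ∘ Cyl p)) r + g * 1) r := fun r hr =>
      (cavg_deriv sm hr).add ((hasDerivAt_id r).const_mul g)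
    have mono : MonotoneOn (fun r => cavg (u ∘ Cyl p) r + g * r) (Icc A s0) := by
      refine monotoneOn_of_deriv_nonneg (convex_Icc _ _) (fun t ht => (der t (ht.2.trans_lt hS)).continuousAt.continuousWithinAt)
        (fun t ht => (der t ((interior_subset ht).2.trans_lt hS)).differentiableAt.differentiableWithinAt) fun t ht => ?_
      have ht := interior_subset ht
      rw [(der t (ht.2.trans_lt hS)).deriv]
      linarith [hG t ht.1 ht.2]
    have := mono ⟨h0, hst.trans hts⟩ ⟨h0.trans hst, hts⟩ hst
    have h3 := mul_le_mul_of_nonneg_left hts hg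
    simp only at this
    linarith
  obtain ⟨j1, j2⟩ := c.cyl_mn p (s0 := s0 - 1) hs0
  have lp := c.pos
  set k := 1 + log lam + 2 * (s0 - 1)
  have cU : ∀ z : E2, z.1 < S → ContinuousAt (fun z => k + (u ∘ Cyl p) z) z := fun z hz => continuousAt_const.add (sm z hz).cont
  have i1 : IntegrableOn (fun z => k + (u ∘ Cyl p) z) (box (s0-1) s0) :=
    ContinuousOn.integrableOn_compact (box_compact _ _) fun z hz => (cU z ((box_mem.1 hz).1.2.trans_lt hS)).continuousWithinAt
  obtain ⟨f1, f2⟩ := box_fubini (by linarith) i1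
  have b1 : ∫ z in box (s0-1) s0, (k + (u ∘ Cyl p) z) ≤ ∫ z in box (s0-1) s0, lam * (exp (2*z.1) * mn (u (Cyl p z))) := by
    refine setIntegral_mono_on i1 (j1.const_mul lam) (box_meas _ _) fun z hz => ?_
    have hz := (box_mem.1 hz).1
    rw [mn_of_le (hneg z (by linarith) hz.2)]
    have := add_one_le_exp (log lam + 2 * z.1 + u (Cyl p z))
    rw [exp_add, exp_add, exp_log lp] at this
    simp only [Function.comp, k]
    linarith
  rw [integral_const_mul] at b1
  have b2 := mul_le_mul_of_nonneg_left j2 lp.le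
  have b3 : ∫ t in (s0-1)..s0, (2 * π * k + (cavg (u ∘ Cyl p) s - g * (s0 - s))) ≤ ∫ t in (s0-1)..s0, cavg (fun z => k + (u ∘ Cyl p) z) t := by
    refine intervalIntegral.integral_mono_on (by linarith) (by simp) f2 fun t ht => ?_
    rw [cavg_add continuous_const (cont_slice (fun z hz => (sm z hz).cont) (ht.2.trans_lt hS)), cavg_const]
    linarith [ub t (h1.trans ht.1) ht.2]
  rw [intervalIntegral.integral_const, sub_sub_cancel, one_smul] at b3
  linarith

lemma Loc.sq_lb (hL : Loc τ lam u p a' S) (hS : A + 1 < S) {k V : ℝ} (hV : ∀ s, A ≤ s → s ≤ A + 1 → cavg (u ∘ Cyl p) s ≤ V) :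
    -2 * V + 2 * π * (2 * k - 1) ≤ ∫ z in box A (A+1), (u (Cyl p z) - k)^2 := by
  have sm : ∀ z : E2, z.1 < S → SmAt (u ∘ Cyl p) z := fun z hz => hL.U_sm hz
  have cU : ∀ z : E2, z.1 < S → ContinuousAt (fun z => -2 * (u ∘ Cyl p) z) z := fun z hz => (sm z hz).cont.const_mul _
  have i1 : IntegrableOn (fun z => -2 * (u ∘ Cyl p) z + (2*k-1)) (box A (A+1)) :=
    ContinuousOn.integrableOn_compact (box_compact _ _) fun z hz =>
      ((cU z ((box_mem.1 hz).1.2.trans_lt hS)).add continuousAt_const).continuousWithinAt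
  obtain ⟨f1, f2⟩ := box_fubini (by linarith) i1
  have b1 : ∫ z in box A (A+1), (-2 * (u ∘ Cyl p) z + (2*k-1)) ≤ ∫ z in box A (A+1), (u (Cyl p z) - k)^2 := by
    refine setIntegral_mono_on i1 (ContinuousOn.integrableOn_compact (box_compact _ _) fun z hz =>
      (((sm z ((box_mem.1 hz).1.2.trans_lt hS)).cont.sub continuousAt_const).pow 2).continuousWithinAt) (box_meas _ _) fun z hz => ?_
    simp only [Function.comp]
    linarith [sq_nonneg (u (Cyl p z) - k + 1)]
  have b3 : ∫ t in A..(A+1), (-2 * V + 2 * π * (2 * k - 1)) ≤ ∫ t in A..(A+1), cavg (fun z => -2 * (u ∘ Cyl p) z + (2*k-1)) t := by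
    refine intervalIntegral.integral_mono_on (by linarith) (by simp) f2 fun t ht => ?_
    rw [cavg_add (cont_slice cU (ht.2.trans_lt hS)) continuous_const, cavg_const, cavg_cmul]
    linarith [hV t ht.1 ht.2]
  rw [intervalIntegral.integral_const, add_sub_cancel_left, one_smul] at b3
  linarith

lemma exp_strip (t : ℝ) : IntegrableOn (fun z : E2 => exp (2*z.1)) (Iic t ×ˢ Ioo (-π) π) ∧
    ∫ z in (Iic t ×ˢ Ioo (-π) π : Set E2), exp (2*z.1) = π * exp (2*t) := by
  have e : (fun z : E2 => exp (2*z.1)) = fun z : E2 => (fun s => exp (2*s)) z.1 * (fun _ : ℝ => (1:ℝ)) z.2 := by ext z; simp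
  rw [e]
  constructor
  · rw [IntegrableOn, Measure.volume_eq_prod, ← Measure.prod_restrict]
    exact (integrableOn_exp_mul_Iic two_pos t).mul_prod (integrableOn_const (by simp))
  · rw [Measure.volume_eq_prod]
    refine (setIntegral_prod_mul (μ := volume) (ν := volume) (fun s : ℝ => exp (2*s)) (fun _ : ℝ => (1:ℝ)) (Iic t) (Ioo (-π) π)).trans ?_
    rw [integral_exp_mul_Iic two_pos]
    simp [pi_nonneg]; ring

lemma Ctx.core_ub (c : Ctx P a τ ρ lam u) (hL : Loc τ lam u p a' S) (hχ : Cut χ χ' s0 s1) (hS : s1 < S) (hAS : A + 1 < S) {J C M k : ℝ}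
    (hneg : ∀ z : E2, A ≤ z.1 → z.1 ≤ s1 → u (Cyl p z) ≤ 0) (hM : lam * exp (2*A) = M) (hC : ∀ t, |fτ τ t| ≤ C) (hk : k < 0) :
    -(∫ z in strip, χ z.1 * (lam * (exp (2*z.1) * fτ τ (u (Cyl p z))))) ≤
      C * (π * (M * exp (-(2*J)))) + C * M / k^2 * ∫ z in box (A-J) (A+1), (u (Cyl p z) - k)^2 := by
  have lp := c.pos
  have C0 : 0 ≤ C := (abs_nonneg _).trans (hC 0)
  have M0 : 0 < M := hM ▸ by positivity
  have hk2 : 0 < k^2 := by nlinarith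
  have ab : ∀ s, |χ s| ≤ 1 := fun s => by rw [abs_of_nonneg (hχ.nonneg s)]; exact hχ.le_one s
  have i1 := hL.intG hχ.smooth.continuous hχ.zero ab hS (f_cont c.hτ) hC
  obtain ⟨e1, e2⟩ := exp_strip (A - J)
  set T : Set E2 := Iic (A-J) ×ˢ Ioo (-π) π
  have hT : MeasurableSet T := measurableSet_Iic.prod measurableSet_Ioo
  have i3 : IntegrableOn (fun z => (u (Cyl p z) - k)^2) (box (A-J) (A+1)) :=
    ContinuousOn.integrableOn_compact (box_compact _ _) fun z hz =>
      (((hL.U_sm ((box_mem.1 hz).1.2.trans_lt hAS)).cont.sub continuousAt_const).pow 2).continuousWithinAt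
  have j2 : IntegrableOn (T.indicator fun z => C * lam * exp (2*z.1)) strip := ((integrable_indicator_iff hT).2 (e1.const_mul _)).integrableOn
  have j3 : IntegrableOn ((box (A-J) (A+1)).indicator fun z => C * M / k^2 * (u (Cyl p z) - k)^2) strip :=
    ((integrable_indicator_iff (box_meas _ _)).2 (i3.const_mul _)).integrableOn
  rw [← integral_neg]
  have hpt : ∀ z ∈ strip, -(χ z.1 * (lam * (exp (2*z.1) * fτ τ (u (Cyl p z))))) ≤
      T.indicator (fun z => C * lam * exp (2*z.1)) z + (box (A-J) (A+1)).indicator (fun z => C * M / k^2 * (u (Cyl p z) - k)^2) z := by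
    intro z hz
    have hz2 := hz.2
    have p1 : 0 ≤ T.indicator (fun z => C * lam * exp (2*z.1)) z := indicator_nonneg (fun z _ => by positivity) z
    have p2 : 0 ≤ (box (A-J) (A+1)).indicator (fun z => C * M / k^2 * (u (Cyl p z) - k)^2) z := indicator_nonneg (fun z _ => by positivity) z
    have χ0 := hχ.nonneg z.1
    have χ1 := hχ.le_one z.1
    have q0 : 0 ≤ lam * exp (2*z.1) := by positivity
    have q1 : -(χ z.1 * (lam * (exp (2*z.1) * fτ τ (u (Cyl p z))))) ≤ lam * exp (2*z.1) * C := by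
      calc _ ≤ |χ z.1 * (lam * (exp (2*z.1) * fτ τ (u (Cyl p z))))| := neg_le_abs _
        _ = |χ z.1| * (lam * exp (2*z.1) * |fτ τ (u (Cyl p z))|) := by
          rw [abs_mul, ← mul_assoc, abs_mul, abs_of_nonneg q0]
        _ ≤ 1 * (lam * exp (2*z.1) * C) := by gcongr; exacts [ab _, hC _]
        _ = _ := one_mul _
    rcases le_total z.1 (A - J) with h | h
    · rw [indicator_of_mem (show z ∈ T from ⟨h, hz2⟩)]; linarith
    rcases le_total (u (Cyl p z)) 0 with h' | h'
    · have := f_sign_neg c.hτ h'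
      have : 0 ≤ χ z.1 * (lam * (exp (2*z.1) * fτ τ (u (Cyl p z)))) := by positivity
      linarith
    rcases le_total z.1 A with h2 | h2
    · rw [indicator_of_mem (show z ∈ box (A-J) (A+1) from box_mem.2 ⟨⟨h, by linarith⟩, hz2.1.le, hz2.2.le⟩)]
      have q2 : lam * exp (2*z.1) ≤ M := hM ▸ mul_le_mul_of_nonneg_left (exp_le_exp.2 (by linarith)) lp.le
      have q3 : k^2 ≤ (u (Cyl p z) - k)^2 := by nlinarith
      have q4 : C * M ≤ C * M / k^2 * (u (Cyl p z) - k)^2 := by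
        rw [div_mul_eq_mul_div, le_div_iff₀ hk2]; exact mul_le_mul_of_nonneg_left q3 (by positivity)
      linarith [mul_le_mul_of_nonneg_right q2 C0]
    rcases le_total z.1 s1 with h3 | h3
    · have := hneg z h2 h3
      have h0 : u (Cyl p z) = 0 := le_antisymm this h'
      have := f_sign_neg c.hτ this
      have : 0 ≤ χ z.1 * (lam * (exp (2*z.1) * fτ τ (u (Cyl p z)))) := by positivity
      linarith
    · rw [hχ.zero _ h3, zero_mul]; linarith
  refine (setIntegral_mono_on i1.neg (j2.add j3) strip_meas hpt).trans ?_
  rw [integral_add' j2 j3, setIntegral_indicator hT, setIntegral_indicator (box_meas _ _), integral_const_mul, integral_const_mul,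
    inter_eq_self_of_subset_right (show T ⊆ strip from prod_mono (subset_univ _) subset_rfl), e2]
  have b1 := setIntegral_mono_set i3 (ae_of_all _ fun z => sq_nonneg _) (inter_subset_right (s := strip)).eventuallyLE
  have e3 : C * lam * (π * exp (2*(A-J))) = C * (π * (M * exp (-(2*J)))) := by
    rw [← hM, show 2*(A-J) = 2*A + -(2*J) by ring, exp_add]; ring
  rw [e3]
  exact add_le_add_right (mul_le_mul_of_nonneg_left b1 (by positivity)) _

set_option maxHeartbeats 1000000 in
lemma thmB3 (P : ι → E2) (a : ι → ℝ) (ρ : ℝ) (hτ : 0 < τ) {C1 : ℝ} (hC1 : 0 < C1)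
    (hc : ∑ i, a i < 0) (ha : ∀ i, -1 ≤ a i) : ∃ Λ : ℝ, ∀ lam u, Ctx P a τ ρ lam u → StabS τ lam u → Λ ≤ lam →
      ¬ lam * mu u (Ici (-1)) ≤ C1 := by
  obtain ⟨Cb, hCb, hb⟩ := numass P a τ ρ hτ
  set n : ℝ := (Fintype.card ι : ℝ) with hn
  have hn0 : 0 < n := by
    rw [hn, Nat.cast_pos, Fintype.card_pos_iff]
    by_contra h
    rw [not_nonempty_iff] at h
    simp at hc
  set κ0 : ℝ := (-∑ i, a i) / (2 * n) with hκ0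
  have κ0p : 0 < κ0 := div_pos (by linarith) (by linarith)
  have hκn : n * κ0 = (-∑ i, a i) / 2 := by rw [hκ0]; field_simp
  set κ := min κ0 (1/2) with hκ
  have κp : 0 < κ := lt_min κ0p (by norm_num)
  have κ1 : κ ≤ κ0 := min_le_left _ _
  have κ2 : κ ≤ 1/2 := min_le_right _ _
  obtain ⟨K, hK1, cK, hcK, hK⟩ := f_neg_inf hτ
  obtain ⟨M2, hM2, NC⟩ := noCore P a ρ hτ hC1 K
  obtain ⟨C, hC1', hC⟩ := f_bounds hτ
  have hbd : ∀ t, |fτ τ t| ≤ C := fun t => by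
    have h1 := mul_le_mul_of_nonneg_left (mn_le_one t) (by linarith : (0:ℝ) ≤ C)
    linarith [(hC t).1]
  have hπ := pi_gt_three
  have hπ0 := pi_pos
  obtain ⟨X, hX, hcut⟩ := cutJ
  obtain ⟨χ, χ', hχ, hd, -⟩ := hcut (log ρ - 1) 1 one_pos
  rw [sub_add_cancel] at hχ
  obtain ⟨J, hJ0, hJ⟩ : ∃ J : ℝ, 0 ≤ J ∧ C * (π * (M2 * exp (-(2*J)))) ≤ 2 * π * κ0 := by
    refine ⟨max 0 (log (C * M2 / (2 * κ0)) / 2), le_max_left _ _, ?_⟩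
    have : exp (-(2 * max 0 (log (C * M2 / (2 * κ0)) / 2))) ≤ (C * M2 / (2 * κ0))⁻¹ := by
      rw [← exp_log (show 0 < C * M2 / (2 * κ0) by positivity), ← exp_neg, exp_le_exp, log_exp]
      linarith [le_max_right 0 (log (C * M2 / (2 * κ0)) / 2)]
    calc _ ≤ C * (π * (M2 * (C * M2 / (2 * κ0))⁻¹)) := by gcongr
      _ = _ := by field_simp
  set Cν := Cb + C1
  set Q := Cbmo (∑ i, |a i|) (J + 1) with hQ
  have Q0 : 0 ≤ Q := Cbmo_nonneg (by linarith)
  set D := C * M2 * Q / (2 * π * κ0) with hD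
  have D0 : 0 ≤ D := by positivity
  set C' := Cν - 2 * π * (1 + 2 * (log ρ - 2)) + 4 * π * (1 - κ) * (log ρ - 1) - 2 * π * (1 - κ) * log M2 with hC'
  refine ⟨max (max M2 (exp ((Q + 2 * C' + 4 * π * (D + 1) + 2 * π + 1) / (4 * π * κ)))) (M2 * exp (-(2*(log ρ - 4)))),
    fun lam u c hst hl hB => ?_⟩
  have hp := c.sep.pos
  have hl1 := (le_max_left _ _).trans ((le_max_left _ _).trans hl)
  have hl2 := log_le_log (exp_pos _) ((le_max_right _ _).trans ((le_max_left _ _).trans hl))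
  rw [log_exp, div_le_iff₀ (by positivity)] at hl2
  have hA := sA_le hM2 ((le_max_right _ _).trans hl)
  have hν : lam * ∫ x in QQ, mn (u x) ≤ Cν := (hb lam u c).trans (by linarith)
  have hAM := sA_exp hM2 c.pos
  have hAe : 2 * sA M2 lam = log M2 - log lam := by rw [sA]; ring
  set A := sA M2 lam
  have hAρ : A ≤ log ρ := by linarith
  have hAρ' : exp A ≤ ρ := by rw [← exp_log hp]; exact exp_le_exp.2 hAρ
  have hFar : ∀ x, Far P (exp A) x → u x ≤ 0 := fun x hx => by
    linarith [NC lam u c hst hB hl1 x (exp A) (exp_pos _) (by linarith [c.sep.small]) hAM.ge hx]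
  have hl4 := log_lt4 c.sep
  have hlh := logρ_lt c.sep
  -- some index with much negative mass
  obtain ⟨i, hi⟩ : ∃ i, 4 * π * κ0 < -∫ z in strip, χ z.1 ^ 2 * (lam * (exp (2*z.1) * fτ τ (u (Cyl (P i) z)))) := by
    by_contra! hcon
    have key := glue c hst (fun _ : ι => hχ) (fun _ => le_rfl) (fun _ => hχ) (fun _ => le_rfl) (e := 0) le_rfl (fun _ => le_rfl)
      (H := fun _ t => -fτ τ t) (G := fun t => -fτ τ t) (C := C) (η' := 4 * π * κ0) (fun _ => (f_cont hτ).neg)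
      (fun _ t => by rw [abs_neg]; exact hbd t) (f_cont hτ).neg (fun t => by rw [abs_neg]; exact hbd t)
      (fun i => by
        refine le_trans (le_of_eq ?_) (hcon i)
        rw [← integral_neg]; congr 1; ext z; ring)
      (fun x hx => by
        rw [zero_mul, zero_add]
        rcases et_split c.sep hx with ⟨hF1, h0⟩ | ⟨i, z, hz, ⟨k, hk⟩, hfar, hv⟩
        · have hu := hFar x (hF1.mono (exp_pos _).le hAρ')
          rw [Finset.sum_eq_zero fun i _ => by rw [h0 _ _ _ _ hχ.sq le_rfl i, zero_mul]]
          linarith [f_sign_neg hτ hu]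
        · rw [Finset.sum_eq_single i (fun j _ hj => by rw [(hv _ _ _ _ hχ.sq le_rfl).2 j hj, zero_mul]) (by simp),
            (hv _ _ _ _ hχ.sq le_rfl).1]
          rcases le_total z.1 A with h | h
          · rw [hχ.one _ (by linarith)]; linarith
          · have hf := f_sign_neg hτ (hFar x (hfar A hAρ h))
            have h1 := mul_le_mul_of_nonneg_right (hχ.sq.le_one z.1) hf
            linarith)
    rw [integral_neg, mul_neg, c.sol.mass hτ c.sep, ← hn, zero_mul, zero_add,
      show n * (4 * π * κ0) = 4 * π * (n * κ0) by ring, hκn] at key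
    have := mul_pos hπ0 (neg_pos.2 hc)
    linarith
  have hL := c.sol.loc c.sep i
  have hnear : ∀ z : E2, z.1 ≤ log ρ → nsq (Cyl (P i) z - P i) ≤ ρ^2 := fun z hz => by
    rw [nsq_cyl, ← exp_two_log hp]; exact exp_le_exp.2 (by linarith)
  have hneg : ∀ z : E2, A ≤ z.1 → z.1 ≤ log ρ → u (Cyl (P i) z) ≤ 0 := fun z h1 h2 =>
    hFar _ (Far.of_near c.sep (exp_pos _).le hAρ' (by rw [exp_sq, nsq_cyl]; exact exp_le_exp.2 (by linarith)) (hnear z h2))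
  have hψd : ∀ s, 2 * χ s * χ' s ≤ 0 := fun s => mul_nonpos_of_nonneg_of_nonpos (by linarith [hχ.nonneg s]) (hd s)
  have hG : ∀ s, A ≤ s → s ≤ log ρ - 1 → -(4 * π * (1 - κ)) ≤ cavg (D1 (u ∘ Cyl (P i))) s := fun s h0 h1 => by
    have := hL.flux_le hτ c.pos.le hχ.sq hl4 hψd (by linarith) hneg hbd h0 h1
    have h2 := mul_le_mul_of_nonneg_left (ha i) hπ0.le
    have h3 := mul_le_mul_of_nonneg_left κ1 hπ0.le
    linarith
  have hV : ∀ s, A ≤ s → s ≤ A + 1 → cavg (u ∘ Cyl (P i)) s ≤ C' - 2 * π * κ * log lam := fun s h0 h1 => by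
    have g0 : 0 ≤ 4 * π * (1 - κ) := mul_nonneg (by linarith) (by linarith)
    have h2 := c.cavg_ub hL (by linarith) (by linarith) g0 hν (fun z h1 h2 => hneg z h1 (by linarith)) hG h0 (by linarith)
    have h3 := mul_le_mul_of_nonneg_left h0 g0
    have h4 : 4 * π * (1 - κ) * A = 2 * π * (1 - κ) * (log M2 - log lam) := by rw [← hAe]; ring
    rw [hC']
    linarith
  set k := ravg (u ∘ Cyl (P i)) (A - J, -π) (A + 1, π)
  have hbmo : ∫ z in box (A-J) (A+1), (u (Cyl (P i) z) - k)^2 ≤ Q := by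
    have := c.bmo (q := P i) (s0 := A - J) (s1 := A + 1) (by linarith) (by linarith) (fun z hz hm => Cyl_ne _ _ (c.sep.near
      ((hnear z (by linarith [(box_mem.1 hz).1.2])).trans_lt (by nlinarith)) hm))
    rwa [show A + 1 - (A - J) = J + 1 by ring] at this
  have hk : -(D + 1) ≤ k := by
    by_contra! hk
    have h1 := c.core_ub hL hχ.sq hl4 (by linarith) hneg (by rw [← exp_sq]; exact hAM) hbd (k := k) (M := M2) (J := J) (by linarith)
    have hk2 : D + 1 ≤ k^2 := by nlinarith
    have h2 : C * M2 / k^2 * ∫ z in box (A-J) (A+1), (u (Cyl (P i) z) - k)^2 ≤ C * M2 / (D + 1) * Q := by gcongr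
    have h3 : C * M2 / (D + 1) * Q ≤ 2 * π * κ0 := by
      rw [div_mul_eq_mul_div, div_le_iff₀ (by positivity)]
      have : D * (2 * π * κ0) = C * M2 * Q := by rw [hD]; field_simp
      have := mul_pos hπ0 κ0p
      linarith
    linarith
  have h5 := hL.sq_lb (k := k) (by linarith) hV
  have h6 := setIntegral_mono_set (μ := volume) (ContinuousOn.integrableOn_compact (box_compact (A-J) (A+1)) (f := fun z => (u (Cyl (P i) z) - k)^2) fun z hz =>
      (((hL.U_sm (z := z) (by linarith [(box_mem.1 hz).1.2])).cont.sub continuousAt_const).pow 2).continuousWithinAt)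
      (ae_of_all _ fun z => sq_nonneg _) (show box A (A+1) ⊆ box (A-J) (A+1) from fun z hz => by
        have := box_mem.1 hz
        exact box_mem.2 ⟨⟨by linarith, by linarith⟩, this.2⟩).eventuallyLE
  have h7 := mul_le_mul_of_nonneg_left hk hπ0.le
  linarith

lemma half_bd (P : ι → E2) (a : ι → ℝ) (ρ : ℝ) (hτ : 0 < τ)
    (hc : 0 < ∑ i, a i ∨ (∑ i, a i < 0 ∧ (τ = 1 ∨ ∀ i, -1 ≤ a i))) :
    ∃ C : ℝ, 0 < C ∧ ∃ Λ : ℝ, ∀ lam u, Ctx P a τ ρ lam u → StabS τ lam u → Λ ≤ lam →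
      lam * mu u (Iic (-5)) ≤ C := by
  obtain ⟨C, hC, h⟩ := tri P a τ ρ hτ
  have key : ∃ Λ : ℝ, ∀ lam u, Ctx P a τ ρ lam u → StabS τ lam u → Λ ≤ lam →
      ¬ lam * mu u (Ici (-1)) ≤ C := by
    rcases hc with h1 | ⟨h1, h2 | h2⟩
    · exact thmB12 P a ρ hτ hC (Or.inl h1)
    · exact thmB12 P a ρ hτ hC (Or.inr ⟨h2, h1⟩)
    · exact thmB3 P a ρ hτ hC h1 h2
  obtain ⟨Λ, hΛ⟩ := key
  exact ⟨C, hC, Λ, fun lam u c s hl => (h lam u c).resolve_left (hΛ lam u c s hl)⟩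

lemma abs_thm (hsep : Sepa P ρ) (hτ : 0 < τ) (hS : ∑ i, a i ≠ 0)
    (h2 : τ = 1 ∨ ((0 < ∑ i, a i → ∀ i, a i ≤ 1) ∧ (∑ i, a i < 0 → ∀ i, -1 ≤ a i)))
    {γ : ℝ} (hγ : 0 < γ) {q : E2} (hq : q ∉ Zs P) :
    ∃ Λ : ℝ, ∀ lam u, Ctx P a τ ρ lam u → StabS τ lam u → Λ ≤ lam → |u q| ≤ γ := by
  have hτ3 : 0 < τ^3 := pow_pos hτ 3
  have hsn : ∑ i, -a i = -∑ i, a i := Finset.sum_neg_distrib a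
  obtain ⟨C, hC, Λ1, h1⟩ := half_bd P a ρ hτ (by
    rcases lt_or_gt_of_ne hS with h | h
    · exact Or.inr ⟨h, h2.imp id fun h' => h'.2 h⟩
    · exact Or.inl h)
  obtain ⟨C', hC', Λ2, h2⟩ := half_bd P (fun i => -a i) ρ (inv_pos.2 hτ) (by
    rw [hsn]
    rcases lt_or_gt_of_ne hS with h | h
    · exact Or.inl (by linarith)
    · refine Or.inr ⟨by linarith, h2.imp (fun h' => by rw [h']; simp) fun h' i => ?_⟩
      have := h'.1 h i
      linarith)
  obtain ⟨r, hr, hr2, hball⟩ : ∃ r : ℝ, 0 < r ∧ r ≤ 1/2 ∧ ∀ x, nsq (x - q) < r^2 → x ∉ Zs P := by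
    obtain ⟨e, he, hb⟩ := Metric.isOpen_iff.1 hsep.isOpen q hq
    refine ⟨min e (1/2), by positivity, min_le_right _ _, fun x hx => hb ?_⟩
    have hm : 0 < min e (1/2) := by positivity
    have l1 : (x - q).1^2 < (min e (1/2))^2 := by
      have := sq_nonneg (x-q).2
      simp only [nsq] at hx; linarith
    have l2 : (x - q).2^2 < (min e (1/2))^2 := by
      have := sq_nonneg (x-q).1
      simp only [nsq] at hx; linarith
    rw [mem_ball, Prod.dist_eq, max_lt_iff, Real.dist_eq, Real.dist_eq]
    exact ⟨(abs_lt_of_sq_lt_sq l1 hm.le).trans_le (min_le_left _ _),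
      (abs_lt_of_sq_lt_sq l2 hm.le).trans_le (min_le_left _ _)⟩
  obtain ⟨Λ3, h3⟩ := caseA P a τ ρ hτ (C1 := C' * τ^3) (by positivity) hγ hr hr2
  obtain ⟨Λ4, h4⟩ := caseA P (fun i => -a i) τ⁻¹ ρ (inv_pos.2 hτ) (C1 := C * (τ^3)⁻¹) (by positivity) hγ hr hr2
  have nz : ∀ b : ι → ℝ, ∀ x, nsq (x - q) < r^2 → NotZ2 P b x :=
    fun b x hx i k h => absurd ⟨i, k, h⟩ (hball x hx)
  refine ⟨max (max Λ1 (Λ2 * τ^3)) (max (max Λ3 (Λ4 * τ^3)) (τ^3)), fun lam u c s hl => ?_⟩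
  simp only [max_le_iff] at hl
  obtain ⟨⟨l1, l2⟩, ⟨l3, l4⟩, l5⟩ := hl
  have c' := c.neg l5
  have s' := s.neg hτ
  have tr : ∀ {L : ℝ}, L * τ^3 ≤ lam → L ≤ lam * (τ^3)⁻¹ := fun h => by
    rw [← div_eq_mul_inv, le_div_iff₀ hτ3]; exact h
  have m1 := h1 lam u c s l1
  have m2 := h2 _ _ c' s' (tr l2)
  have e1 := mu_neg (u := u) 5
  have e2 := mu_neg (u := fun x => -u x) 5
  simp only [neg_neg] at e2
  rw [← e2] at m2
  have m3 : lam * mu u (Ici 5) ≤ C' * τ^3 := by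
    have := mul_le_mul_of_nonneg_right m2 hτ3.le
    calc lam * mu u (Ici 5) = lam * (τ^3)⁻¹ * mu u (Ici 5) * τ^3 := by field_simp
      _ ≤ _ := this
  have m4 : lam * (τ^3)⁻¹ * mu (fun x => -u x) (Ici 5) ≤ C * (τ^3)⁻¹ := by
    rw [e1]
    have := mul_le_mul_of_nonneg_right m1 (inv_pos.2 hτ3).le
    linarith
  have b1 := h3 lam u c l3 m3 q (nz _) hq
  have b2 := h4 _ _ c' (tr l4) m4 q (nz _) hq
  rw [abs_le]
  constructor <;> linarith
end

open Classical in
/-- removes the removable singularities -/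
def fill (w : E2 → ℝ) (x : E2) : ℝ :=
  if h : ∃ c, Tendsto w (𝓝[≠] x) (𝓝 c) then h.choose else w x

lemma fill_eq {w : E2 → ℝ} {x : E2} {c : ℝ} (h : Tendsto w (𝓝[≠] x) (𝓝 c)) : fill w x = c := by
  have h' : ∃ c, Tendsto w (𝓝[≠] x) (𝓝 c) := ⟨c, h⟩
  rw [fill, dif_pos h']
  exact tendsto_nhds_unique h'.choose_spec h

lemma fill_cont {w : E2 → ℝ} {x : E2} (h : ContinuousAt w x) : fill w x = w x :=
  fill_eq (h.tendsto.mono_left nhdsWithin_le_nhds)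

lemma shift_ne (x v : E2) : Tendsto (fun y => y - v) (𝓝[≠] (x + v)) (𝓝[≠] x) := by
  refine tendsto_nhdsWithin_iff.2 ⟨?_, ?_⟩
  · have : Tendsto (fun y : E2 => y - v) (𝓝 (x + v)) (𝓝 (x + v - v)) :=
      (continuous_id.sub continuous_const).continuousAt.tendsto
    rw [add_sub_cancel_right] at this
    exact this.mono_left nhdsWithin_le_nhds
  · filter_upwards [self_mem_nhdsWithin] with y hy h
    exact hy (by rw [mem_singleton_iff] at h ⊢; rw [← h]; simp)

lemma per_sub {w : E2 → ℝ} (hp : Per w) (y : E2) (k : ℤ × ℤ) : w (y - lat k) = w y := by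
  rw [← hp (y - lat k) k]; simp

lemma fill_per {w : E2 → ℝ} (hp : Per w) : Per (fill w) := by
  have key : ∀ x k c, Tendsto w (𝓝[≠] x) (𝓝 c) → Tendsto w (𝓝[≠] (x + lat k)) (𝓝 c) := by
    intro x k c h
    have := h.comp (shift_ne x (lat k))
    refine this.congr fun y => per_sub hp y k
  intro x k
  by_cases h : ∃ c, Tendsto w (𝓝[≠] x) (𝓝 c)
  · obtain ⟨c, hc⟩ := h
    rw [fill_eq hc, fill_eq (key x k c hc)]
  · have h' : ¬ ∃ c, Tendsto w (𝓝[≠] (x + lat k)) (𝓝 c) := by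
      rintro ⟨c, hc⟩
      have := key _ (-k) c hc
      rw [lat_neg, add_neg_cancel_right] at this
      exact h ⟨c, this⟩
    rw [fill, dif_neg h', fill, dif_neg h, hp]

lemma fill_punct {w g : E2 → ℝ} {x : E2} (h : ∀ᶠ y in 𝓝[≠] x, w y = g y)
    (hg : ∀ᶠ y in 𝓝[≠] x, ContinuousAt g y) : ∀ᶠ y in 𝓝[≠] x, fill w y = g y := by
  filter_upwards [eventually_eventually_nhdsWithin.2 h, hg, h, self_mem_nhdsWithin] with y h1 h2 h3 h4
  rw [IsOpen.nhdsWithin_eq isOpen_compl_singleton h4] at h1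
  rw [fill_cont (h2.congr (h1.mono fun z hz => hz.symm)), h3]

lemma fill_rem {w v : E2 → ℝ} {x : E2} (h : ∀ᶠ y in 𝓝[≠] x, w y = v y) (hv : SmAt v x) :
    fill w =ᶠ[𝓝 x] v := by
  have h1 := fill_punct h ((hv.ev.mono fun y hy => hy.cont).filter_mono nhdsWithin_le_nhds)
  have h2 : fill w x = v x :=
    fill_eq ((hv.cont.tendsto.mono_left nhdsWithin_le_nhds).congr' (h.mono fun y hy => hy.symm))
  rw [eventually_nhdsWithin_iff] at h1
  filter_upwards [h1] with y hy
  by_cases e : y = x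
  · rw [e, h2]
  · exact hy e

lemma SmAt.shift {v : E2 → ℝ} {p c : E2} (h : SmAt v p) : SmAt (fun y => v (y - c)) (p + c) := by
  have ht : Tendsto (fun y : E2 => y - c) (𝓝 (p + c)) (𝓝 p) := by
    have : Tendsto (fun y : E2 => y - c) (𝓝 (p + c)) (𝓝 (p + c - c)) :=
      (continuous_id.sub continuous_const).continuousAt.tendsto
    rwa [add_sub_cancel_right] at this
  filter_upwards [ht.eventually h] with y hy
  exact ContDiffAt.comp y hy (contDiff_id.sub contDiff_const).contDiffAt

lemma Sol.fill {κ : Type} [Fintype κ] {Q : κ → E2} {b : κ → ℝ} {τ lam : ℝ} {w : E2 → ℝ} (hτ : 0 < τ)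
    (h : Sol Q b τ lam w) :
    Sol (fun i : {i // b i ≠ 0} => Q i.1) (fun i => b i.1) τ lam (fill w) := by
  have hsm : ∀ x ∉ Zs (fun i : {i // b i ≠ 0} => Q i.1), SmAt (_root_.fill w) x := by
    intro x hx
    by_cases hx' : x ∈ Zs Q
    · obtain ⟨i, k, rfl⟩ := hx'
      have hb : b i = 0 := by
        by_contra hb
        exact hx ⟨⟨i, hb⟩, k, rfl⟩
      obtain ⟨v, hv, he⟩ := h.sing i
      have e := (shift_ne (Q i) (lat k)).eventually he
      have := hv.shift (c := lat k)
      refine this.congr (fill_rem ?_ this)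
      filter_upwards [e] with y hy
      rw [← per_sub h.per y k, hy, hb]; ring
    · have := h.sm x hx'
      exact this.congr (fill_rem (Eventually.of_forall fun y => rfl) this)
  have heq : ∀ x ∉ Zs Q, _root_.fill w =ᶠ[𝓝 x] w := fun x hx =>
    fill_rem (Eventually.of_forall fun y => rfl) (h.sm x hx)
  refine ⟨fill_per h.per, hsm, ?_, ?_⟩
  · intro x hx
    have hc : ContinuousAt (fun y => lapp (_root_.fill w) y + lam * fτ τ (_root_.fill w y)) x :=
      (hsm x hx).lapp.cont.add (continuousAt_const.mul
        ((f_smooth hτ).continuous.continuousAt.comp (hsm x hx).cont))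
    have hz : ∀ y ∉ Zs Q, lapp (_root_.fill w) y + lam * fτ τ (_root_.fill w y) = 0 := by
      intro y hy
      have e := heq y hy
      rw [lapp_congr e, e.self_of_nhds, h.pde y hy]; ring
    have hd : Dense (Zs Q)ᶜ := Zs_countable.dense_compl ℝ
    by_contra hne
    have hne' : lapp (_root_.fill w) x + lam * fτ τ (_root_.fill w x) ≠ 0 := fun h0 => hne (by linarith)
    obtain ⟨y, hy, hy'⟩ := mem_closure_iff_nhds.1 (hd x) _ (hc.eventually_ne hne')
    exact hy (hz y hy')
  · rintro ⟨i, hi⟩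
    obtain ⟨v, hv, he⟩ := h.sing i
    refine ⟨v, hv, ?_⟩
    have h1 : ∀ᶠ y in 𝓝[≠] (Q i), SmAt v y := hv.ev.filter_mono nhdsWithin_le_nhds
    refine fill_punct he ?_
    filter_upwards [h1, self_mem_nhdsWithin] with y h2 h3
    have hn : nsq (y - Q i) ≠ 0 := (nsq_pos (sub_ne_zero.2 h3)).ne'
    have hc : ContinuousAt (fun y => nsq (y - Q i)) y :=
      (nsq_cont.comp (continuous_id.sub continuous_const)).continuousAt
    exact (continuousAt_const.mul (hc.log hn)).add h2.cont

lemma fill_eq_off {κ : Type} {Q : κ → E2} {b : κ → ℝ} {τ lam : ℝ} {w : E2 → ℝ}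
    (h : Sol Q b τ lam w) {x : E2} (hx : x ∉ Zs Q) : fill w x = w x := fill_cont (h.sm x hx).cont

lemma StabS.fill {κ : Type} [Fintype κ] {Q : κ → E2} {b : κ → ℝ} {τ lam : ℝ} {w : E2 → ℝ}
    (h : Sol Q b τ lam w) (hs : StabS τ lam w) : StabS τ lam (fill w) := by
  intro φ h1 h2
  have := hs φ h1 h2
  have e : ∫ x in QQ, (gsq φ x - lam * fτ' τ (_root_.fill w x) * φ x ^ 2)
      = ∫ x in QQ, (gsq φ x - lam * fτ' τ (w x) * φ x ^ 2) := by
    refine integral_congr_ae (ae_restrict_of_ae ?_)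
    filter_upwards [Zs_ae (P := Q)] with x hx
    rw [fill_eq_off h hx]
  rw [e]; exact this

/-- coordinates on the Euclidean plane -/
def TP : E2 ≃L[ℝ] Pl :=
  (ContinuousLinearEquiv.finTwoArrow ℝ ℝ).symm.trans (EuclideanSpace.equiv (Fin 2) ℝ).symm

lemma TP_0 (x : E2) : TP x 0 = x.1 := rfl
lemma TP_1 (x : E2) : TP x 1 = x.2 := rfl

lemma TP_e0 : TP (1, 0) = EuclideanSpace.single 0 (1:ℝ) := by
  ext i; fin_cases i <;> simp [TP_0, TP_1]
lemma TP_e1 : TP (0, 1) = EuclideanSpace.single 1 (1:ℝ) := by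
  ext i; fin_cases i <;> simp [TP_0, TP_1]

lemma TP_lat (k : ℤ × ℤ) : TP (lat k) ∈ unitLattice := by
  refine ⟨k.1, k.2, ?_⟩
  ext i; fin_cases i <;> simp [TP_0, TP_1, lat]

lemma lat_of {v : Pl} (h : v ∈ unitLattice) : ∃ k, v = TP (lat k) := by
  obtain ⟨a, b, rfl⟩ := h
  refine ⟨(a, b), ?_⟩
  ext i; fin_cases i <;> simp [TP_0, TP_1, lat]

lemma TP_log (x : E2) : 2 * Real.log ‖TP x‖ = log (nsq x) := by
  have : nsq x = ‖TP x‖ ^ 2 := by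
    rw [EuclideanSpace.norm_sq_eq, Fin.sum_univ_two, TP_0, TP_1, nsq]; simp
  rw [this, Real.log_pow]; norm_num

lemma TP_mp : MeasurePreserving (TP : E2 → Pl) volume volume :=
  (PiLp.volume_preserving_toLp (Fin 2)).comp ((volume_preserving_finTwoArrow ℝ).symm _)

lemma lineDeriv_TP (g : Pl → ℝ) (x v : E2) : lineDeriv ℝ g (TP x) (TP v) = lineDeriv ℝ (g ∘ TP) x v := by
  unfold lineDeriv
  congr 1; ext t
  simp

lemma pd0_TP {g : Pl → ℝ} {x : E2} (h : DifferentiableAt ℝ (g ∘ TP) x) : pd g 0 (TP x) = D1 (g ∘ TP) x := by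
  rw [pd, ← TP_e0, lineDeriv_TP, h.lineDeriv_eq_fderiv]; rfl
lemma pd1_TP {g : Pl → ℝ} {x : E2} (h : DifferentiableAt ℝ (g ∘ TP) x) : pd g 1 (TP x) = D2 (g ∘ TP) x := by
  rw [pd, ← TP_e1, lineDeriv_TP, h.lineDeriv_eq_fderiv]; rfl

lemma lap_TP {g : Pl → ℝ} {x : E2} (h : SmAt (g ∘ TP) x) : lap g (TP x) = lapp (g ∘ TP) x := by
  have e0 : (pd g 0) ∘ TP =ᶠ[𝓝 x] D1 (g ∘ TP) := h.ev.mono fun y hy => pd0_TP hy.diff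
  have e1 : (pd g 1) ∘ TP =ᶠ[𝓝 x] D2 (g ∘ TP) := h.ev.mono fun y hy => pd1_TP hy.diff
  rw [lap, pd0_TP (h.D1.diff.congr_of_eventuallyEq e0), pd1_TP (h.D2.diff.congr_of_eventuallyEq e1),
    D1_congr e0, D2_congr e1, lapp]

lemma Per.of_Pl {g : Pl → ℝ} (h : Periodic2 g) : Per (g ∘ TP) := by
  intro x k
  simp only [Function.comp, map_add]
  exact h _ _ (TP_lat k)

lemma fund_pre : (TP : E2 → Pl) ⁻¹' fund =ᵐ[volume] QQ := by
  have : (TP : E2 → Pl) ⁻¹' fund = Ico (0:ℝ) 1 ×ˢ Ico (0:ℝ) 1 := rfl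
  rw [this, QQ, cell]
  simp only [Prod.fst_zero, Prod.snd_zero, zero_add]
  exact Measure.set_prod_ae_eq (Ico_ae_eq_Icc.trans Ioc_ae_eq_Icc.symm) (Ico_ae_eq_Icc.trans Ioc_ae_eq_Icc.symm)

lemma fund_int (G : Pl → ℝ) : ∫ x in fund, G x = ∫ x in QQ, G (TP x) := by
  rw [← TP_mp.setIntegral_preimage_emb TP.toHomeomorph.measurableEmbedding G fund]
  exact setIntegral_congr_set fund_pre

lemma StabS.of_Pl {τ ε : ℝ} {u : Pl → ℝ} (h : Stable τ ε u) : StabS τ (ε^2)⁻¹ (u ∘ TP) := by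
  intro φ h1 h2
  have hc : (φ ∘ TP.symm) ∘ TP = φ := by ext x; simp
  have := h (φ ∘ TP.symm) (h1.comp TP.symm.contDiff) (by
    intro x v hv
    obtain ⟨k, rfl⟩ := lat_of hv
    simp [h2 _ k])
  rw [QuadForm, fund_int] at this
  convert this using 3 with x
  have hd : DifferentiableAt ℝ ((φ ∘ TP.symm) ∘ TP) x := by
    rw [hc]; exact h1.contDiffAt.differentiableAt (by simp)
  rw [gradSq, pd0_TP hd, pd1_TP hd, hc, gsq]
  simp

namespace VortexData
variable (V : VortexData)
/-- all vortex points, in coordinates -/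
def Q (i : Fin V.d₁ ⊕ Fin V.d₂) : E2 := TP.symm (Sum.elim V.p₁ V.p₂ i)
/-- signed multiplicities -/
def b (i : Fin V.d₁ ⊕ Fin V.d₂) : ℝ := Sum.elim V.m₁ (fun j => -V.m₂ j) i
end VortexData

lemma mem_Zs_Q (V : VortexData) (x : E2) : x ∈ Zs V.Q ↔ TP x ∈ V.Z := by
  have key : ∀ i k, x = V.Q i + lat k ↔ TP x = Sum.elim V.p₁ V.p₂ i + TP (lat k) := by
    intro i k
    rw [← TP.injective.eq_iff, map_add, VortexData.Q, TP.apply_symm_apply]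
  constructor
  · rintro ⟨i | j, k, h⟩
    · exact Or.inl ⟨i, _, TP_lat k, (key _ _).1 h⟩
    · exact Or.inr ⟨j, _, TP_lat k, (key _ _).1 h⟩
  · rintro (⟨j, v, hv, h⟩ | ⟨j, v, hv, h⟩)
    · obtain ⟨k, rfl⟩ := lat_of hv
      exact ⟨Sum.inl j, k, (key _ _).2 h⟩
    · obtain ⟨k, rfl⟩ := lat_of hv
      exact ⟨Sum.inr j, k, (key _ _).2 h⟩

lemma Q_distinct (V : VortexData) (i j) (k : ℤ × ℤ) (h : V.Q i = V.Q j + lat k) : i = j := by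
  by_contra hne
  refine V.distinct i j hne _ (TP_lat k) ?_
  have := congrArg TP h
  simpa [VortexData.Q] using this

lemma LogSing.of_Pl {u : Pl → ℝ} {p : Pl} {a : ℝ} (h : LogSing u p a) :
    ∃ v : E2 → ℝ, SmAt v (TP.symm p) ∧
      ∀ᶠ x in 𝓝[≠] (TP.symm p), (u ∘ TP) x = a * log (nsq (x - TP.symm p)) + v x := by
  obtain ⟨r, hr, v, hv, he⟩ := h
  have hO : IsOpen ((TP : E2 → Pl) ⁻¹' ball p r) := isOpen_ball.preimage TP.continuous
  have hm : TP.symm p ∈ (TP : E2 → Pl) ⁻¹' ball p r := by simp [hr]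
  refine ⟨v ∘ TP, SmAt.of_on (hv.comp TP.contDiff.contDiffOn (mapsTo_preimage _ _)) hO hm, ?_⟩
  filter_upwards [nhdsWithin_le_nhds (hO.mem_nhds hm), self_mem_nhdsWithin] with x h1 h2
  have h3 : TP x ≠ p := fun h => h2 (by rw [mem_singleton_iff, ← h]; simp)
  have := he _ h1 h3
  have e : TP x - p = TP (x - TP.symm p) := by simp
  rw [Function.comp_apply, this, e, ← TP_log]
  simp only [Function.comp_apply]; ring

lemma Sol.of_Pl {V : VortexData} {τ ε : ℝ} {u : Pl → ℝ} (h : IsSolution V τ ε u)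
    (ho : IsOpen (Zs V.Q)ᶜ) : Sol V.Q V.b τ (ε^2)⁻¹ (u ∘ TP) := by
  have hsm : ∀ x ∉ Zs V.Q, SmAt (u ∘ TP) x := fun x hx =>
    SmAt.of_on (h.smooth.comp TP.contDiff.contDiffOn (fun y (hy : y ∈ (Zs V.Q)ᶜ) => fun hy' => hy ((mem_Zs_Q V y).2 hy'))) ho hx
  refine ⟨Per.of_Pl h.periodic, hsm, ?_, ?_⟩
  · intro x hx
    have := h.pde (TP x) fun hh => hx ((mem_Zs_Q V x).2 hh)
    rw [lap_TP (hsm x hx)] at this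
    simp only [Function.comp_apply]
    linarith
  · rintro (i | j)
    · exact (h.sing₁ i).of_Pl
    · exact (h.sing₂ j).of_Pl

lemma main_thm
    (V : VortexData) (τ : ℝ) (hτ : 0 < τ)
    (hH1 : V.N1 ≠ V.N2)
    (hH2 : τ = 1 ∨ ((V.N1 > V.N2 → ∀ j, V.m₁ j ∈ Icc (0:ℝ) 1) ∧
                    (V.N2 > V.N1 → ∀ j, V.m₂ j ∈ Icc (0:ℝ) 1)))
    (ε : ℕ → ℝ) (hε : ∀ n, 0 < ε n) (hε0 : Tendsto ε atTop (nhds 0))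
    (u : ℕ → Pl → ℝ) (hu : ∀ n, IsSolution V τ (ε n) (u n))
    (hstab : ∀ n, Stable τ (ε n) (u n)) (x : Pl) (hx : x ∉ V.Z) :
    Tendsto (fun n => u n x) atTop (nhds 0) := by
  classical
  obtain ⟨ρ0, hρ0⟩ := sep_exists V.Q (Q_distinct V)
  obtain ⟨ρ, hρ⟩ := sep_exists (fun i : {i // V.b i ≠ 0} => V.Q i.1)
    (fun i j k h => Subtype.ext (Q_distinct V _ _ k h))
  have hsum : ∑ i : {i // V.b i ≠ 0}, V.b i.1 = V.N1 - V.N2 := by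
    have h1 : ∑ i : {i // V.b i ≠ 0}, V.b i.1 = ∑ i, V.b i := by
      rw [← Finset.sum_subtype (Finset.univ.filter fun i => V.b i ≠ 0) (by simp) V.b]
      exact Finset.sum_filter_ne_zero _
    rw [h1, Fintype.sum_sum_type]
    simp only [VortexData.b, Sum.elim_inl, Sum.elim_inr, Finset.sum_neg_distrib]
    rw [VortexData.N1, VortexData.N2]; ring
  set q := TP.symm x with hq
  have hqx : TP q = x := by simp [hq]
  have hqZ : q ∉ Zs V.Q := fun h => hx (by rw [← hqx]; exact (mem_Zs_Q V q).1 h)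
  have hqZ' : q ∉ Zs (fun i : {i // V.b i ≠ 0} => V.Q i.1) := by
    rintro ⟨i, k, h⟩
    exact hqZ ⟨i.1, k, h⟩
  have hlam : Tendsto (fun n => ((ε n)^2)⁻¹) atTop atTop := by
    refine Tendsto.inv_tendsto_nhdsGT_zero (tendsto_nhdsWithin_iff.2 ⟨?_, ?_⟩)
    · simpa using hε0.pow 2
    · exact Eventually.of_forall fun n => pow_pos (hε n) 2
  rw [Metric.tendsto_nhds]
  intro γ hγ
  obtain ⟨Λ, hΛ⟩ := abs_thm (a := fun i : {i // V.b i ≠ 0} => V.b i.1) hρ hτ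
    (by rw [hsum]; exact sub_ne_zero.2 hH1)
    (by
      rw [hsum]
      refine hH2.imp id fun h => ⟨fun h0 i => ?_, fun h0 i => ?_⟩
      · obtain ⟨i | j, hi⟩ := i
        · exact (h.1 (by linarith) i).2
        · have := V.m₂_nonneg j
          change -V.m₂ j ≤ 1
          linarith
      · obtain ⟨i | j, hi⟩ := i
        · have := V.m₁_nonneg i
          change -1 ≤ V.m₁ i
          linarith
        · have := (h.2 (by linarith) j).2
          change -1 ≤ -V.m₂ j
          linarith)
    (half_pos hγ) hqZ'
  filter_upwards [hlam.eventually_ge_atTop Λ, hlam.eventually_ge_atTop 1] with n h1 h2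
  have s := Sol.of_Pl (hu n) hρ0.isOpen
  have st := (StabS.of_Pl (hstab n)).fill s
  have := hΛ _ _ ⟨hτ, s.fill hτ, hρ, fun i => i.2, h2⟩ st h1
  rw [fill_eq_off s hqZ, Function.comp_apply, hqx] at this
  rw [Real.dist_eq, sub_zero]
  linarith

/-- Under (H1) `N₁ ≠ N₂` and (H2) (`τ = 1`, or all multiplicities on the
dominant side lie in `[0,1]`), any sequence of stable solutions of `(E_ε)` with `ε → 0`
converges to `0` a.e. in `Ω ∖ Z`. -/
theorem stable_implies_topological
    (V : VortexData) (τ : ℝ) (hτ : 0 < τ)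
    (hH1 : V.N1 ≠ V.N2)
    (hH2 : τ = 1 ∨ ((V.N1 > V.N2 → ∀ j, V.m₁ j ∈ Icc (0:ℝ) 1) ∧
                    (V.N2 > V.N1 → ∀ j, V.m₂ j ∈ Icc (0:ℝ) 1)))
    (ε : ℕ → ℝ) (hε : ∀ n, 0 < ε n) (hε0 : Tendsto ε atTop (nhds 0))
    (u : ℕ → Pl → ℝ) (hu : ∀ n, IsSolution V τ (ε n) (u n))
    (hstab : ∀ n, Stable τ (ε n) (u n)) :
    ∀ᵐ x : Pl, x ∈ fund \ V.Z → Tendsto (fun n => u n x) atTop (nhds 0) := by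
  exact ae_of_all _ fun x hx => main_thm V τ hτ hH1 hH2 ε hε hε0 u hu hstab x hx.2
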